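/- Fix b₀ > 0, θ₀ = arctan b₀, and α, δ, δ₀ ∈ (0, 1). Let Q = {y ∈ ℝ³ : y₁ > 0, y₃ > b₀y₁} and let f ∈ H^{(1−δ,2−δ₀)}_{4,α}(Q) be 2π-periodic in y₂. Then the boundary value problem: Δv = f in Q; the normal derivative of v vanishes on both faces {y₃ = b₀y₁, y₁ > 0} and {y₁ = 0, y₃ > 0}; v(y₁, y₂ + 2π, y₃) = v(y₁, y₂, y₃); v(y) → 0 as y → (0,0,0) within Q̄; and ∇v(y) → 0 as √(y₁² + y₃²) → ∞, has exactly one solution v belonging to H^{(−1−δ,−δ₀)}_{6,α}(Q). -/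

import Mathlib

noncomputable section

open Real Set Filter MeasureTheory Topology

/-- Points of `ℝ³` (Euclidean). -/
abbrev V3 : Type := EuclideanSpace ℝ (Fin 3)

/-- `r_x = √(x₁² + x₃²)`, the distance of `x` to the `x₂`-axis. -/
def rx (x : V3) : ℝ := Real.sqrt (x 0 ^ 2 + x 2 ^ 2)

/-- The edge `{x₁ = x₃ = 0}` (the `x₂`-axis). -/
def edge : Set V3 := {x : V3 | x 0 = 0 ∧ x 2 = 0}

/-- The infinite wedge `Q = {y₁ > 0, y₃ > b₀y₁}`. -/
def wedgeQ (b₀ : ℝ) : Set V3 := {y : V3 | 0 < y 0 ∧ b₀ * y 0 < y 2}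

/-- The truncated wedge `Q_L = Q ∩ {r < L}`. -/
def wedgeQL (b₀ L : ℝ) : Set V3 := {y ∈ wedgeQ b₀ | rx y < L}

/-- `Q̄ ∖ edge`, the natural regularity set for functions on the wedge. -/
def SQ (b₀ : ℝ) : Set V3 := closure (wedgeQ b₀) \ edge

/-- `Q̄_L ∖ edge`. -/
def SL (b₀ L : ℝ) : Set V3 := closure (wedgeQL b₀ L) \ edge

/-- Partial derivative within `S` in the `i`-th coordinate direction. -/
def pdW (S : Set V3) (i : Fin 3) (u : V3 → ℝ) (x : V3) : ℝ :=
  fderivWithin ℝ u S x (EuclideanSpace.single i 1)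

/-- Laplacian of `u` at `x` (derivatives taken within `S`). -/
def lapW (S : Set V3) (u : V3 → ℝ) (x : V3) : ℝ :=
  ∑ i : Fin 3, pdW S i (pdW S i u) x

/-- `2π`-periodicity in `y₂`, on the set `D`. -/
def Per2On (D : Set V3) (u : V3 → ℝ) : Prop :=
  ∀ y ∈ D, u (y + EuclideanSpace.single 1 (2 * Real.pi)) = u y

/-- All weighted sup quantities entering `Σ_{j≤m}[u]^{(k,l)}_{j,0;D}` are `≤ M`
(derivatives taken within `S`). -/
def wsupLE (S : Set V3) (m : ℕ) (k l : ℝ) (D : Set V3) (u : V3 → ℝ) (M : ℝ) : Prop :=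
  (∀ j : ℕ, j ≤ m → ∀ x ∈ D, 0 < rx x → rx x < 1 →
      rx x ^ max (k + j) 0 * ‖iteratedFDerivWithin ℝ j u S x‖ ≤ M) ∧
  (∀ j : ℕ, j ≤ m → ∀ x ∈ D, 1 < rx x →
      rx x ^ (l + j) * ‖iteratedFDerivWithin ℝ j u S x‖ ≤ M)

/-- All quantities entering the weighted Hölder norm `‖u‖^{(k,l)}_{m,α;D}` are `≤ M`
(derivatives taken within `S`). -/
def wnormLE (S : Set V3) (m : ℕ) (α k l : ℝ) (D : Set V3) (u : V3 → ℝ) (M : ℝ) : Prop :=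
  wsupLE S m k l D u M ∧
  (∀ x ∈ D, ∀ y ∈ D, 0 < min (rx x) (rx y) → min (rx x) (rx y) < 1 →
      min (rx x) (rx y) ^ max (k + m + α) 0 *
        ‖iteratedFDerivWithin ℝ m u S x - iteratedFDerivWithin ℝ m u S y‖ ≤
        M * ‖x - y‖ ^ α) ∧
  (∀ x ∈ D, ∀ y ∈ D, 1 < min (rx x) (rx y) →
      min (rx x) (rx y) ^ (l + m + α) *
        ‖iteratedFDerivWithin ℝ m u S x - iteratedFDerivWithin ℝ m u S y‖ ≤
        M * ‖x - y‖ ^ α)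

/-- Membership in the weighted Hölder space `H^{(k,l)}_{m,α}(D)`. -/
def memH (S : Set V3) (m : ℕ) (α k l : ℝ) (D : Set V3) (u : V3 → ℝ) : Prop :=
  ContDiffOn ℝ m u S ∧ ∃ M : ℝ, 0 ≤ M ∧ wnormLE S m α k l D u M

/-- `v` solves the problem (4.3) in the full wedge `Q`: `Δv = f` in `Q`, vanishing normal
derivatives on both faces, `2π`-periodicity in `y₂`, `v → 0` at the edge point `(0,0,0)`,
and `∇v → 0` as `√(y₁² + y₃²) → ∞`. -/
def IsWedgeSolution (b₀ : ℝ) (f v : V3 → ℝ) : Prop :=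
  (∀ y ∈ wedgeQ b₀, lapW (SQ b₀) v y = f y) ∧
  (∀ y ∈ SQ b₀, y 2 = b₀ * y 0 →
      b₀ * pdW (SQ b₀) 0 v y - pdW (SQ b₀) 2 v y = 0) ∧
  (∀ y ∈ SQ b₀, y 0 = 0 → pdW (SQ b₀) 0 v y = 0) ∧
  Per2On (closure (wedgeQ b₀)) v ∧
  Tendsto v (𝓝[SQ b₀] (0 : V3)) (𝓝 0) ∧
  (∀ ε : ℝ, 0 < ε → ∃ R : ℝ, ∀ y ∈ wedgeQ b₀, R < rx y →
      ‖fderivWithin ℝ v (SQ b₀) y‖ < ε)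

section
open scoped ContDiff
open Metric
set_option linter.all false

section
section KerSec
variable {F : Type*} [NormedAddCommGroup F] [NormedSpace ℝ F]

/-- Smooth kernels supported in the closed unit ball. -/
structure Ker (k : V3 → F) : Prop where
  smooth : ContDiff ℝ ∞ k
  supp : ∀ ξ : V3, 1 < ‖ξ‖ → k ξ = 0

lemma Ker.cont {k : V3 → F} (hk : Ker k) : Continuous k := hk.smooth.continuous

lemma Ker.fderiv {k : V3 → F} (hk : Ker k) : Ker (fderiv ℝ k) := by
  refine ⟨hk.smooth.fderiv_right (by simp), fun ξ hξ => ?_⟩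
  have h : k =ᶠ[𝓝 ξ] fun _ => 0 := by
    filter_upwards [(isOpen_lt continuous_const continuous_norm).mem_nhds hξ] with y hy
    exact hk.supp y hy
  rw [h.fderiv_eq]; simp

lemma Ker.compactSupp {k : V3 → F} (hk : Ker k) : HasCompactSupport k :=
  HasCompactSupport.intro (isCompact_closedBall (0:V3) 1) (fun x hx => hk.supp x (by simpa using hx))

/-- mollification with kernel `k` at scale `s`. -/
def Mol (k : V3 → F) (s : ℝ) (f : V3 → ℝ) (x : V3) : F := ∫ ξ, f (x - s • ξ) • k ξ

lemma mol_integrable {k : V3 → F} (hk : Ker k) {f : V3 → ℝ} (hf : Continuous f) (s : ℝ) (x : V3) :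
    Integrable (fun ξ => f (x - s • ξ) • k ξ) := by
  apply Continuous.integrable_of_hasCompactSupport
  · have := hk.cont; fun_prop
  · exact hk.compactSupp.smul_left

lemma mol_eq_setIntegral {k : V3 → F} (hk : Ker k) (f : V3 → ℝ) (s : ℝ) (x : V3) :
    Mol k s f x = ∫ ξ in closedBall (0:V3) 1, f (x - s • ξ) • k ξ := by
  rw [Mol, setIntegral_eq_integral_of_forall_compl_eq_zero]
  intro ξ hξ
  rw [hk.supp ξ (by simpa using hξ), smul_zero]

lemma mol_continuous {k : V3 → F} (hk : Ker k) {f : V3 → ℝ} (hf : Continuous f) :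
    Continuous (fun p : ℝ × V3 => Mol k p.1 f p.2) := by
  simp_rw [mol_eq_setIntegral hk]
  refine continuous_parametric_integral_of_continuous (f := fun (p : ℝ × V3) ξ => f (p.2 - p.1 • ξ) • k ξ) ?_ (isCompact_closedBall _ _)
  have := hk.cont
  unfold Function.uncurry
  fun_prop

/-- bound -/
lemma mol_norm_le {k : V3 → F} (hk : Ker k) {f : V3 → ℝ} {s : ℝ} (hs : 0 ≤ s) {x : V3} {K : ℝ}
    (hK : ∀ y, dist y x ≤ s → |f y| ≤ K) : ‖Mol k s f x‖ ≤ K * ∫ ξ, ‖k ξ‖ := by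
  unfold Mol
  rw [← integral_const_mul]
  refine norm_integral_le_of_norm_le ((hk.cont.norm.integrable_of_hasCompactSupport hk.compactSupp.norm).const_mul K) ?_
  refine Eventually.of_forall fun ξ => ?_
  rw [norm_smul]
  by_cases h : 1 < ‖ξ‖
  · rw [hk.supp ξ h]; simp
  · have : |f (x - s • ξ)| ≤ K := hK _ (by
      rw [dist_eq_norm]; simp [norm_smul, abs_of_nonneg hs]; nlinarith [norm_nonneg ξ])
    gcongr
    simpa using this

lemma mol_congr {k : V3 → F} (hk : Ker k) {f g : V3 → ℝ} {s : ℝ} (hs : 0 ≤ s) {x : V3}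
    (h : ∀ y, dist y x ≤ s → f y = g y) : Mol k s f x = Mol k s g x := by
  unfold Mol
  congr 1; ext1 ξ
  by_cases h1 : 1 < ‖ξ‖
  · rw [hk.supp ξ h1]; simp
  · rw [h]
    rw [dist_eq_norm]; simp [norm_smul, abs_of_nonneg hs]; nlinarith [norm_nonneg ξ]

lemma mol_lin {k : V3 → F} (hk : Ker k) {f g : V3 → ℝ} (hf : Continuous f) (hg : Continuous g) (a b s : ℝ) (x : V3) :
    Mol k s (fun y => a * f y + b * g y) x = a • Mol k s f x + b • Mol k s g x := by
  unfold Mol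
  rw [← integral_smul, ← integral_smul, ← integral_add]
  · congr 1; ext1 ξ; simp only [add_smul, mul_smul]
  · exact (mol_integrable hk hf s x).smul a
  · exact (mol_integrable hk hg s x).smul b

lemma mol_hasFDerivAt {k : V3 → F} (hk : Ker k) {f : V3 → ℝ} (hf : Continuous f) {s : ℝ} (hs : 0 < s) (x : V3) :
    HasFDerivAt (Mol k s f) (s⁻¹ • Mol (fderiv ℝ k) s f x) x := by
  set L : F →L[ℝ] ℝ →L[ℝ] F := (ContinuousLinearMap.lsmul ℝ ℝ).flip with hL
  set ks : V3 → F := fun y => k (s⁻¹ • y) with hks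
  have hks1 : ContDiff ℝ 1 ks := (hk.smooth.of_le (by norm_cast)).comp (by fun_prop)
  have hcs : HasCompactSupport ks := by
    refine HasCompactSupport.intro (isCompact_closedBall (0:V3) s) (fun y hy => hk.supp _ ?_)
    simp only [mem_closedBall_zero_iff, not_le] at hy
    rw [norm_smul, norm_inv, norm_of_nonneg hs.le, inv_mul_eq_div, one_lt_div hs]; exact hy
  have key := hcs.hasFDerivAt_convolution_left (μ := volume) L hks1 (hf.locallyIntegrable) x
  have e1 : ∀ {G : Type _} [NormedAddCommGroup G] [NormedSpace ℝ G] (g : V3 → G) (y : V3),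
      (∫ t, f (y - t) • g (s⁻¹ • t)) = s ^ 3 • Mol g s f y := by
    intro G _ _ g y
    have := Measure.integral_comp_inv_smul_of_nonneg (volume : Measure V3) (fun ξ => f (y - s • ξ) • g ξ) hs.le
    simp only [finrank_euclideanSpace, Fintype.card_fin] at this
    unfold Mol
    rw [← this]
    congr 1; ext1 t
    rw [smul_smul, mul_inv_cancel₀ hs.ne', one_smul]
  have e2 : (MeasureTheory.convolution ks f L volume) = fun y => s ^ 3 • Mol k s f y := by
    ext1 y
    rw [← e1 k y]
    rfl
  have hfd : ∀ t, fderiv ℝ ks t = s⁻¹ • fderiv ℝ k (s⁻¹ • t) := by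
    intro t
    rw [hks]
    rw [fderiv_comp_smul]
  have e3 : (MeasureTheory.convolution (fderiv ℝ ks) f (L.precompL V3) volume) x = s ^ 3 • (s⁻¹ • Mol (fderiv ℝ k) s f x) := by
    rw [smul_comm, ← e1 (fderiv ℝ k) x, ← integral_smul]
    unfold convolution
    congr 1; ext1 t
    rw [hfd]
    ext v
    simp [hL, smul_smul, ContinuousLinearMap.precompL_apply]
  rw [e2, e3] at key
  have := key.const_smul (s^3)⁻¹
  rw [smul_smul, inv_mul_cancel₀ (pow_ne_zero 3 hs.ne'), one_smul] at this
  simpa [smul_smul, inv_mul_cancel₀ (pow_ne_zero 3 hs.ne'), Pi.smul_def] using this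

lemma ker_int_fderiv {k : V3 → F} (hk : Ker k) : ∫ ξ, fderiv ℝ k ξ = 0 := by
  have h := mol_hasFDerivAt hk (f := fun _ => (1:ℝ)) continuous_const one_pos 0
  have h2 : HasFDerivAt (Mol k 1 (fun _ => (1:ℝ))) (0 : V3 →L[ℝ] F) 0 := by
    have : Mol k 1 (fun _ => (1:ℝ)) = fun _ => ∫ ξ, k ξ := by
      ext1 x; simp [Mol]
    rw [this]; exact hasFDerivAt_const _ _
  have := h.unique h2
  simpa [Mol] using this

lemma mol_holder {k : V3 → F} (hk : Ker k) (h0 : ∫ ξ, k ξ = 0) {f : V3 → ℝ} (hf : Continuous f) {s : ℝ} (hs : 0 ≤ s)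
    {x : V3} {H α : ℝ} (hα : 0 ≤ α) (hH : ∀ y, dist y x ≤ s → |f y - f x| ≤ H * dist y x ^ α) (hH0 : 0 ≤ H) :
    ‖Mol k s f x‖ ≤ (H * s ^ α) * ∫ ξ, ‖k ξ‖ := by
  have e : Mol k s f x = Mol k s (fun y => f y - f x) x := by
    unfold Mol
    simp_rw [sub_smul]
    have h1 : Integrable (fun ξ => f x • k ξ) := (hk.cont.integrable_of_hasCompactSupport hk.compactSupp).smul (f x)
    rw [integral_sub (mol_integrable hk hf s x) h1, integral_smul, h0]
    simp
  rw [e]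
  refine mol_norm_le hk hs fun y hy => (hH y hy).trans ?_
  gcongr
end KerSec
end

section
/-- basic bump -/
def eta (x : V3) : ℝ := Real.smoothTransition (1 - ‖x‖ ^ 2)
def phi (x : V3) : ℝ := 2 * deriv Real.smoothTransition (1 - ‖x‖ ^ 2)

lemma ker_eta : Ker eta := by
  constructor
  · unfold eta
    exact Real.smoothTransition.contDiff.comp (contDiff_const.sub (contDiff_norm_sq ℝ))
  · intro ξ h
    exact Real.smoothTransition.zero_of_nonpos (by nlinarith)

lemma ker_phi : Ker phi := by
  constructor
  · unfold phi
    have h : ContDiff ℝ ∞ (deriv Real.smoothTransition) := by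
      have := Real.smoothTransition.contDiff (n := ⊤)
      exact this.iterate_deriv 1
    exact contDiff_const.mul (h.comp (contDiff_const.sub (contDiff_norm_sq ℝ)))
  · intro ξ h
    have : Real.smoothTransition =ᶠ[𝓝 (1 - ‖ξ‖^2)] fun _ => 0 := by
      have : 1 - ‖ξ‖^2 < 0 := by nlinarith
      filter_upwards [Iio_mem_nhds this] with y hy
      exact Real.smoothTransition.zero_of_nonpos hy.le
    unfold phi
    rw [this.deriv_eq]; simp

lemma eta_hasFDerivAt (x : V3) : HasFDerivAt eta (-(phi x) • innerSL ℝ x) x := by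
  have h1 : HasDerivAt Real.smoothTransition (deriv Real.smoothTransition (1 - ‖x‖^2)) (1 - ‖x‖^2) :=
    ((Real.smoothTransition.contDiff (n := 1)).differentiable (by simp) _).hasDerivAt
  have h2 : HasFDerivAt (fun y : V3 => 1 - ‖y‖^2) (-(2 • innerSL ℝ x)) x :=
    (hasStrictFDerivAt_norm_sq x).hasFDerivAt.const_sub 1
  have := h1.comp_hasFDerivAt x h2
  refine this.congr_fderiv ?_
  ext v; simp [phi]; ring

lemma phi_nonneg (x : V3) : 0 ≤ phi x :=
  mul_nonneg zero_le_two (Real.smoothTransition.monotone.deriv_nonneg)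

def c0 : ℝ := ∫ ξ, phi ξ

lemma c0_pos : 0 < c0 := by
  have hne : ∃ x, phi x ≠ 0 := by
    by_contra! h
    have h0 : ∀ x, HasFDerivAt eta (0 : V3 →L[ℝ] ℝ) x := fun x => by
      have := eta_hasFDerivAt x
      rw [h x] at this; simpa using this
    have := is_const_of_fderiv_eq_zero (𝕜 := ℝ) (f := eta) (fun x => (h0 x).differentiableAt) (fun x => (h0 x).fderiv)
      0 (EuclideanSpace.single 0 1)
    simp [eta] at this
  obtain ⟨x, hx⟩ := hne
  exact ker_phi.cont.integral_pos_of_hasCompactSupport_nonneg_nonzero ker_phi.compactSupp phi_nonneg hx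

/-- the standard basis -/
abbrev ee (i : Fin 3) : V3 := EuclideanSpace.single i 1

/-- Laplacian -/
def lapl (w : V3 → ℝ) (x : V3) : ℝ := ∑ i : Fin 3, fderiv ℝ (fun y => fderiv ℝ w y (ee i)) x (ee i)

lemma v3_sum (ξ : V3) : ξ = ∑ i, ξ i • ee i := by
  ext j; fin_cases j <;> simp [Fin.sum_univ_three, ee]

lemma pd_cont {w : V3 → ℝ} (hw : ContDiff ℝ 2 w) (i : Fin 3) : ContDiff ℝ 1 (fun y => fderiv ℝ w y (ee i)) :=
  (hw.fderiv_right (m := 1) (by norm_num)).clm_apply contDiff_const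

lemma lapl_cont {w : V3 → ℝ} (hw : ContDiff ℝ 2 w) : Continuous (lapl w) := by
  unfold lapl
  refine continuous_finsetSum _ fun i _ => ?_
  exact ((pd_cont hw i).continuous_fderiv (by simp)).clm_apply continuous_const

lemma mol_ibp {w : V3 → ℝ} (hw : ContDiff ℝ 2 w) (x : V3) (s : ℝ) :
    ∫ ξ, (-(fderiv ℝ w (x - s • ξ) ξ)) * phi ξ = s * Mol eta s (lapl w) x := by
  have hfd : Continuous (fderiv ℝ w) := hw.continuous_fderiv (by simp)
  have hfe : ∀ i ξ, fderiv ℝ eta ξ (ee i) = - phi ξ * ξ i := by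
    intro i ξ; rw [(eta_hasFDerivAt ξ).fderiv]; simp [ee, EuclideanSpace.inner_single_right]
  have hpe := fun i => pd_cont hw i
  have hg : ∀ i ξ, HasFDerivAt (fun ξ : V3 => fderiv ℝ w (x - s • ξ) (ee i))
      ((fderiv ℝ (fun y => fderiv ℝ w y (ee i)) (x - s • ξ)).comp (-(s • ContinuousLinearMap.id ℝ V3))) ξ := by
    intro i ξ
    have h1 : HasFDerivAt (fun ξ : V3 => x - s • ξ) (-(s • ContinuousLinearMap.id ℝ V3)) ξ :=
      ((hasFDerivAt_id ξ).const_smul s).const_sub x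
    exact (((hpe i).differentiable (by simp)) _).hasFDerivAt.comp ξ h1
  have hpc : Continuous phi := ker_phi.cont
  have hec : Continuous eta := ker_eta.cont
  have hecs := ker_eta.compactSupp
  have hec' : Continuous (fderiv ℝ eta) := ker_eta.fderiv.cont
  have hecs' := ker_eta.fderiv.compactSupp
  have c1 : ∀ i, Continuous (fun ξ : V3 => fderiv ℝ w (x - s • ξ) (ee i)) := fun i => by fun_prop
  have c2 : ∀ i, Continuous (fun ξ : V3 => fderiv ℝ (fun y => fderiv ℝ w y (ee i)) (x - s • ξ) (ee i)) := fun i => by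
    have := (hpe i).continuous_fderiv (by simp)
    fun_prop
  have hs' : ∀ i, HasCompactSupport (fun ξ => fderiv ℝ eta ξ (ee i)) := fun i =>
    hecs'.comp_left (g := fun L : V3 →L[ℝ] ℝ => L (ee i)) (by simp)
  have I1 : ∀ i, Integrable (fun ξ : V3 => fderiv ℝ w (x - s • ξ) (ee i) * fderiv ℝ eta ξ (ee i)) := fun i => by
    apply Continuous.integrable_of_hasCompactSupport
    · have := c1 i; fun_prop
    · exact (hs' i).mul_left
  have I2 : ∀ i, Integrable (fun ξ : V3 => fderiv ℝ (fun y => fderiv ℝ w y (ee i)) (x - s • ξ) (ee i) * eta ξ) := fun i => by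
    apply Continuous.integrable_of_hasCompactSupport
    · have := c2 i; fun_prop
    · exact hecs.mul_left
  have ib : ∀ i, ∫ ξ, fderiv ℝ w (x - s • ξ) (ee i) * fderiv ℝ eta ξ (ee i)
      = s * ∫ ξ, fderiv ℝ (fun y => fderiv ℝ w y (ee i)) (x - s • ξ) (ee i) * eta ξ := by
    intro i
    have e : ∀ ξ, fderiv ℝ (fun ξ : V3 => fderiv ℝ w (x - s • ξ) (ee i)) ξ (ee i)
      = -(s * fderiv ℝ (fun y => fderiv ℝ w y (ee i)) (x - s • ξ) (ee i)) := by
      intro ξ; rw [(hg i ξ).fderiv]; simp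
    rw [integral_mul_fderiv_eq_neg_fderiv_mul_of_integrable]
    · simp_rw [e]
      rw [← integral_neg, ← integral_const_mul]
      congr 1; ext1 ξ; ring
    · simp_rw [e]
      refine ((I2 i).const_mul (-s)).congr (Eventually.of_forall fun ξ => ?_)
      simp only; ring
    · exact I1 i
    · apply Continuous.integrable_of_hasCompactSupport
      · have := c1 i; fun_prop
      · exact hecs.mul_left
    · intro ξ _; exact (hg i ξ).differentiableAt
    · intro ξ _; exact (eta_hasFDerivAt ξ).differentiableAt
  have L : ∀ ξ, (-(fderiv ℝ w (x - s • ξ) ξ)) * phi ξ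
     = ∑ i, fderiv ℝ w (x - s • ξ) (ee i) * fderiv ℝ eta ξ (ee i) := by
    intro ξ
    have : fderiv ℝ w (x - s • ξ) ξ = ∑ i, ξ i * fderiv ℝ w (x - s • ξ) (ee i) := by
      have := congrArg (fderiv ℝ w (x - s • ξ)) (v3_sum ξ)
      rw [this, map_sum]; simp
    rw [this, ← Finset.sum_neg_distrib, Finset.sum_mul]
    refine Finset.sum_congr rfl fun i _ => ?_
    rw [hfe]; ring
  simp_rw [L]
  rw [integral_finsetSum _ (fun i _ => I1 i)]
  simp_rw [ib]
  rw [← Finset.mul_sum, ← integral_finsetSum _ (fun i _ => I2 i)]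
  congr 1
  unfold Mol lapl
  congr 1; ext1 ξ
  rw [Finset.sum_smul]
  simp

lemma mol_ident {w : V3 → ℝ} (hw : ContDiff ℝ 2 w) (x : V3) (R : ℝ) :
    Mol phi R w x - c0 * w x = ∫ s in (0:ℝ)..R, s * Mol eta s (lapl w) x := by
  have hfd : Continuous (fderiv ℝ w) := hw.continuous_fderiv (by simp)
  have hwc := hw.continuous
  have hpc : Continuous phi := ker_phi.cont
  have hd : ∀ s, HasDerivAt (fun s => Mol phi s w x) (s * Mol eta s (lapl w) x) s := by
    intro s
    rw [← mol_ibp hw]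
    -- bound on a compact set
    obtain ⟨B, hB⟩ := ((isCompact_closedBall s 1).prod (isCompact_closedBall (0:V3) 1)).exists_bound_of_continuousOn
      (f := fun p : ℝ × V3 => (-(fderiv ℝ w (x - p.1 • p.2) p.2)) * phi p.2) (by fun_prop)
    simp_rw [mol_eq_setIntegral ker_phi]
    rw [← setIntegral_eq_integral_of_forall_compl_eq_zero (s := closedBall (0:V3) 1)
      (fun ξ hξ => by rw [ker_phi.supp ξ (by simpa using hξ), mul_zero])]
    refine (hasDerivAt_integral_of_dominated_loc_of_deriv_le (s := closedBall s 1) (bound := fun _ => B)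
      (F' := fun s ξ => (-(fderiv ℝ w (x - s • ξ) ξ)) * phi ξ)
      (closedBall_mem_nhds s one_pos) (Eventually.of_forall fun t => ?_) ?_ ?_ ?_ ?_ ?_).2
    · exact Continuous.aestronglyMeasurable (by fun_prop)
    · exact (Continuous.continuousOn (by fun_prop)).integrableOn_compact (isCompact_closedBall _ _)
    · exact Continuous.aestronglyMeasurable (by fun_prop)
    · filter_upwards [ae_restrict_mem isClosed_closedBall.measurableSet] with ξ hξ t ht
      exact hB (t, ξ) ⟨ht, hξ⟩
    · exact continuous_const.continuousOn.integrableOn_compact (isCompact_closedBall _ _)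
    · refine Eventually.of_forall fun ξ t _ => ?_
      have h1 : HasDerivAt (fun t : ℝ => x - t • ξ) (-ξ) t := by
        have := ((hasDerivAt_id t).smul_const ξ).const_sub x
        simpa using this
      have h2 := ((hw.differentiable (by simp)) (x - t • ξ)).hasFDerivAt.comp_hasDerivAt t h1
      have := h2.mul_const (phi ξ)
      simpa [smul_eq_mul] using this
  have hc : Continuous (fun s => s * Mol eta s (lapl w) x) := by
    have := (mol_continuous ker_eta (lapl_cont hw)).comp (f := fun s : ℝ => (s, x)) (by fun_prop)
    exact continuous_id.mul this
  rw [intervalIntegral.integral_eq_sub_of_hasDerivAt (fun s _ => hd s) (hc.intervalIntegrable _ _)]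
  congr 1
  simp [Mol, c0, integral_const_mul, mul_comm]
end

section
def dfct (s : ℝ) (x : V3) (w f : V3 → ℝ) : ℝ :=
  Mol phi s w x - c0 * w x - ∫ σ in (0:ℝ)..s, σ * Mol eta σ f x

def Weak (x0 : V3) (ρ : ℝ) (w f : V3 → ℝ) : Prop :=
  Continuous w ∧ Continuous f ∧ ∀ x s, 0 < s → dist x x0 + s < ρ → dfct s x w f = 0

lemma moleta_cont {f : V3 → ℝ} (hf : Continuous f) (x : V3) : Continuous fun σ : ℝ => σ * Mol eta σ f x :=
  continuous_id.mul ((mol_continuous ker_eta hf).comp (f := fun s : ℝ => (s, x)) (by fun_prop))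

lemma dfct_lin {w w' f f' : V3 → ℝ} (hw : Continuous w) (hw' : Continuous w') (hf : Continuous f) (hf' : Continuous f')
    (a b s : ℝ) (x : V3) : dfct s x (fun y => a * w y + b * w' y) (fun y => a * f y + b * f' y)
      = a * dfct s x w f + b * dfct s x w' f' := by
  unfold dfct
  simp_rw [mol_lin ker_phi hw hw', mol_lin ker_eta hf hf']
  have e : ∀ σ : ℝ, σ * (a • Mol eta σ f x + b • Mol eta σ f' x) = a * (σ * Mol eta σ f x) + b * (σ * Mol eta σ f' x) := by
    intro σ; simp only [smul_eq_mul]; ring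
  simp_rw [e]
  rw [intervalIntegral.integral_add (((moleta_cont hf x).intervalIntegrable _ _).const_mul a) (((moleta_cont hf' x).intervalIntegrable _ _).const_mul b)]
  simp only [intervalIntegral.integral_const_mul, smul_eq_mul]; ring

lemma dfct_congr {w w' f f' : V3 → ℝ} {s : ℝ} (hs : 0 ≤ s) {x : V3}
    (h : ∀ y, dist y x ≤ s → w y = w' y ∧ f y = f' y) : dfct s x w f = dfct s x w' f' := by
  unfold dfct
  rw [mol_congr ker_phi hs (fun y hy => (h y hy).1), (h x (by simpa using hs)).1]
  congr 1
  refine intervalIntegral.integral_congr fun σ hσ => ?_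
  rw [uIcc_of_le hs] at hσ
  change σ * Mol eta σ f x = σ * Mol eta σ f' x
  rw [mol_congr ker_eta hσ.1 (fun y hy => (h y (hy.trans hσ.2)).2)]

lemma dfct_le {w f : V3 → ℝ} {s : ℝ} (hs : 0 ≤ s) {x : V3} {K : ℝ}
    (h : ∀ y, dist y x ≤ s → |w y| ≤ K ∧ |f y| ≤ K) :
    |dfct s x w f| ≤ K * ((∫ ξ, ‖phi ξ‖) + c0 + s * (∫ ξ, ‖eta ξ‖) * s) := by
  have h1 := mol_norm_le ker_phi hs (fun y hy => (h y hy).1)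
  have h2 : |c0 * w x| ≤ K * c0 := by
    rw [abs_mul, abs_of_pos c0_pos, mul_comm]; have := (h x (by simpa using hs)).1
    gcongr; exact c0_pos.le
  have h3 : ‖∫ σ in (0:ℝ)..s, σ * Mol eta σ f x‖ ≤ (s * (K * ∫ ξ, ‖eta ξ‖)) * |s - 0| := by
    refine intervalIntegral.norm_integral_le_of_norm_le_const fun σ hσ => ?_
    rw [uIoc_of_le hs] at hσ
    have h4 := mol_norm_le ker_eta hσ.1.le (fun y hy => (h y (hy.trans hσ.2)).2)
    rw [norm_mul, norm_of_nonneg hσ.1.le]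
    exact mul_le_mul hσ.2 h4 (norm_nonneg _) hs
  rw [sub_zero, abs_of_nonneg hs] at h3
  rw [norm_eq_abs] at h1 h3
  unfold dfct
  calc _ ≤ |Mol phi s w x - c0 * w x| + |∫ σ in (0:ℝ)..s, σ * Mol eta σ f x| := abs_sub _ _
    _ ≤ |Mol phi s w x| + |c0 * w x| + |∫ σ in (0:ℝ)..s, σ * Mol eta σ f x| := by gcongr; exact abs_sub _ _
    _ ≤ _ := by linarith

/-- limits -/
lemma dfct_zero_of_limit {w f : V3 → ℝ} (hw : Continuous w) (hf : Continuous f) {s : ℝ} (hs : 0 ≤ s) {x : V3}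
    (h : ∀ ε > 0, ∃ w' f', Continuous w' ∧ Continuous f' ∧ dfct s x w' f' = 0 ∧
      ∀ y, dist y x ≤ s → |w y - w' y| ≤ ε ∧ |f y - f' y| ≤ ε) : dfct s x w f = 0 := by
  set C := (∫ ξ, ‖phi ξ‖) + c0 + s * (∫ ξ, ‖eta ξ‖) * s
  have hC : 0 ≤ C := by
    have := c0_pos
    have h1 : 0 ≤ ∫ ξ, ‖phi ξ‖ := integral_nonneg fun _ => norm_nonneg _
    have h2 : 0 ≤ ∫ ξ, ‖eta ξ‖ := integral_nonneg fun _ => norm_nonneg _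
    positivity
  by_contra hne
  have hp : 0 < |dfct s x w f| := abs_pos.2 hne
  obtain ⟨w', f', hw', hf', h0, hy⟩ := h (|dfct s x w f| / (2 * (C + 1))) (by positivity)
  have e := dfct_lin hw hw' hf hf' 1 (-1) s x
  have b := dfct_le (w := fun y => 1 * w y + -1 * w' y) (f := fun y => 1 * f y + -1 * f' y) hs (fun y h => by
    have := hy y h
    constructor
    · convert this.1 using 2; ring
    · convert this.2 using 2; ring)
  rw [e, h0] at b
  simp only [one_mul, mul_zero, add_zero] at b
  have : |dfct s x w f| / (2 * (C + 1)) * C < |dfct s x w f| := by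
    rw [div_mul_eq_mul_div, div_lt_iff₀ (by positivity)]; nlinarith
  exact absurd b (not_le.2 this)

lemma exists_cutoff (x0 : V3) {r ρ : ℝ} (hr : r < ρ) (hρ : 0 < ρ) : ∃ χ : V3 → ℝ, ContDiff ℝ ∞ χ ∧ (∀ y, dist y x0 ≤ r → χ y = 1) ∧
    tsupport χ ⊆ ball x0 ρ := by
  set r' := max r (ρ/2)
  have hr' : r' < ρ := max_lt hr (by linarith)
  have h0 : 0 < r' := lt_max_of_lt_right (by linarith)
  let b : ContDiffBump x0 := ⟨r', (r' + ρ)/2, h0, by linarith⟩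
  refine ⟨b, b.contDiff, fun y hy => b.one_of_mem_closedBall (by
    rw [mem_closedBall]; exact hy.trans (le_max_left r (ρ/2))), ?_⟩
  rw [b.tsupport_eq]
  refine closedBall_subset_ball ?_
  change (r' + ρ)/2 < ρ; linarith

lemma exists_ext {g : V3 → ℝ} {x0 : V3} {r ρ : ℝ} (hr : r < ρ) (hρ : 0 < ρ) (hg : ContinuousOn g (ball x0 ρ)) :
    ∃ g' : V3 → ℝ, Continuous g' ∧ ∀ y, dist y x0 ≤ r → g' y = g y := by
  obtain ⟨χ, h1, h2, h3⟩ := exists_cutoff x0 hr hρ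
  refine ⟨fun y => χ y * g y, ?_, fun y hy => by simp [h2 y hy]⟩
  refine ContinuousOn.continuous_of_tsupport_subset (h1.continuous.continuousOn.mul hg) isOpen_ball ?_
  exact (tsupport_mul_subset_left).trans h3

lemma contDiff_cutoff_mul {n : WithTop ℕ∞} {w χ : V3 → ℝ} {U : Set V3} (hU : IsOpen U) (hw : ContDiffOn ℝ n w U) (hχ : ContDiff ℝ n χ)
    (hs : tsupport χ ⊆ U) : ContDiff ℝ n (fun y => χ y * w y) := by
  rw [contDiff_iff_contDiffAt]
  intro y
  by_cases hy : y ∈ tsupport χ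
  · exact hχ.contDiffAt.mul (hw.contDiffAt (hU.mem_nhds (hs hy)))
  · have : (fun y => χ y * w y) =ᶠ[𝓝 y] fun _ => 0 := by
      filter_upwards [(isClosed_tsupport χ).isOpen_compl.mem_nhds hy] with z hz
      rw [image_eq_zero_of_notMem_tsupport hz, zero_mul]
    exact contDiffAt_const.congr_of_eventuallyEq this

lemma lapl_congr {w w' : V3 → ℝ} {x : V3} (h : w =ᶠ[𝓝 x] w') : lapl w x = lapl w' x := by
  unfold lapl
  refine Finset.sum_congr rfl fun i _ => ?_
  have : (fun y => fderiv ℝ w y (ee i)) =ᶠ[𝓝 x] (fun y => fderiv ℝ w' y (ee i)) := by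
    filter_upwards [h.fderiv (𝕜 := ℝ)] with y hy; rw [hy]
  rw [this.fderiv_eq]

lemma weak_of_C2 {w f : V3 → ℝ} {x0 : V3} {ρ : ℝ} (hw : ContDiffOn ℝ 2 w (ball x0 ρ)) (hwc : Continuous w)
    (hfc : Continuous f) (h : ∀ y ∈ ball x0 ρ, lapl w y = f y) : Weak x0 ρ w f := by
  refine ⟨hwc, hfc, fun x s hs hxs => ?_⟩
  have hsub : ball x (ρ - dist x x0) ⊆ ball x0 ρ := ball_subset_ball' (by linarith)
  set r := (s + (ρ - dist x x0)) / 2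
  obtain ⟨χ, h1, h2, h3⟩ := exists_cutoff x (r := r) (ρ := ρ - dist x x0) (by simp only [r]; linarith) (by linarith)
  have hc := contDiff_cutoff_mul isOpen_ball (hw.mono hsub) (h1.of_le (by norm_cast)) h3
  have key := mol_ident hc x s
  have : dfct s x w f = dfct s x (fun y => χ y * w y) (lapl fun y => χ y * w y) := by
    refine dfct_congr hs.le fun y hy => ⟨by rw [h2 y (by simp only [r]; linarith), one_mul], ?_⟩
    rw [← h y (hsub (by simp; linarith))]
    refine lapl_congr ?_
    have : y ∈ ball x r := by simp only [mem_ball, r]; linarith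
    filter_upwards [isOpen_ball.mem_nhds this] with z hz
    rw [h2 z (le_of_lt hz), one_mul]
  rw [this]; unfold dfct; linarith

lemma weak_deriv {w f g k : V3 → ℝ} {x0 τ : V3} {ρ : ℝ} (hW : Weak x0 ρ w f) (hg : Continuous g) (hk : Continuous k)
    (h1 : ∀ y ∈ ball x0 ρ, HasDerivAt (fun h : ℝ => w (y + h • τ)) (g y) 0)
    (h2 : ∀ y ∈ ball x0 ρ, HasDerivAt (fun h : ℝ => f (y + h • τ)) (k y) 0) : Weak x0 ρ g k := by
  obtain ⟨hw, hf, hW⟩ := hW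
  refine ⟨hg, hk, fun x s hs hxs => ?_⟩
  refine dfct_zero_of_limit hg hk hs.le fun ε hε => ?_
  -- uniform difference-quotient estimate
  have DQ : ∀ {u p : V3 → ℝ}, Continuous p → (∀ y ∈ ball x0 ρ, HasDerivAt (fun h : ℝ => u (y + h • τ)) (p y) 0) →
      ∃ h0 > 0, ∀ h : ℝ, 0 < h → h < h0 → ∀ y, dist y x ≤ s → |p y - (h⁻¹ * u (y + h • τ) + (-h⁻¹) * u y)| ≤ ε := by
    intro u p hp hu
    have huc := (isCompact_closedBall x (s+‖τ‖)).uniformContinuousOn_of_continuous hp.continuousOn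
    rw [uniformContinuousOn_iff] at huc
    obtain ⟨d, hd, hunif⟩ := huc ε hε
    set gap := ρ - dist x x0 - s
    have hgap : 0 < gap := by simp only [gap]; linarith
    refine ⟨min 1 (min d gap / (‖τ‖ + 1)), by positivity, fun h hh hh0 y hy => ?_⟩
    have hh1 : h < 1 := hh0.trans_le (min_le_left _ _)
    have hτ : h * ‖τ‖ < min d gap := by
      have := hh0.trans_le (min_le_right _ _)
      rw [lt_div_iff₀ (by positivity)] at this; nlinarith
    have hb : ∀ t ∈ Icc (0:ℝ) h, y + t • τ ∈ ball x0 ρ := by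
      intro t ht
      have : dist (y + t • τ) y ≤ h * ‖τ‖ := by
        rw [dist_eq_norm]; simp only [add_sub_cancel_left, norm_smul, norm_of_nonneg ht.1]; gcongr; exact ht.2
      have h5 := hτ.trans_le (min_le_right _ _)
      have := dist_triangle4 (y + t • τ) y x x0
      simp only [mem_ball, gap] at *; linarith
    have hder : ∀ t ∈ Icc (0:ℝ) h, HasDerivAt (fun t : ℝ => u (y + t • τ) - t * p y) (p (y + t • τ) - p y) t := by
      intro t ht
      have h3 := hu _ (hb t ht)
      have h4 : HasDerivAt (fun t' : ℝ => u (y + t' • τ)) (p (y + t • τ)) t := by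
        have h5 : HasDerivAt (fun t' : ℝ => t' - t) 1 t := (hasDerivAt_id t).sub_const t
        have h6 := HasDerivAt.comp (h₂ := fun h : ℝ => u (y + t • τ + h • τ)) (h := fun t' : ℝ => t' - t) t (by simpa using h3) h5
        simp only [mul_one] at h6
        refine h6.congr_of_eventuallyEq (Eventually.of_forall fun t' => ?_)
        simp only [Function.comp]
        congr 1; rw [sub_smul]; abel
      have := h4.sub ((hasDerivAt_id t).mul_const (p y))
      rw [one_mul] at this
      exact this
    have mv := Convex.norm_image_sub_le_of_norm_hasDerivWithin_le (f := fun t : ℝ => u (y + t • τ) - t * p y)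
      (C := ε) (s := Icc 0 h) (x := 0) (y := h) (fun t ht => (hder t ht).hasDerivWithinAt) (fun t ht => by
        have hd1 : dist (y + t • τ) y ≤ h * ‖τ‖ := by
          rw [dist_eq_norm]; simp only [add_sub_cancel_left, norm_smul, norm_of_nonneg ht.1]; gcongr; exact ht.2
        have hd2 : h * ‖τ‖ ≤ ‖τ‖ := by nlinarith [norm_nonneg τ]
        have := hunif (y + t • τ) (by
          have := dist_triangle (y + t • τ) y x
          simp only [mem_closedBall]; linarith) y (by simp only [mem_closedBall]; linarith [norm_nonneg τ]) (by
            have := hτ.trans_le (min_le_left _ _); linarith)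
        rw [Real.dist_eq] at this; exact this.le) (convex_Icc _ _) (by simp [hh.le]) (by simp [hh.le])
    simp only [zero_smul, add_zero, zero_mul, sub_zero, norm_eq_abs, abs_of_pos hh] at mv
    have : p y - (h⁻¹ * u (y + h • τ) + (-h⁻¹) * u y) = - (h⁻¹ * (u (y + h • τ) - h * p y - u y)) := by
      field_simp; ring
    rw [this, abs_neg, abs_mul, abs_of_pos (inv_pos.2 hh), inv_mul_le_iff₀ hh]; linarith
  obtain ⟨a, ha, hA⟩ := DQ hg h1
  obtain ⟨b, hb, hB⟩ := DQ hk h2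
  set gap := ρ - dist x x0 - s
  have hgap : 0 < gap := by simp only [gap]; linarith
  set h := min (min a b) (gap / (‖τ‖ + 1)) / 2
  have hh : 0 < h := by positivity
  have hm : 0 < min (min a b) (gap / (‖τ‖ + 1)) := by positivity
  have hlt : h < min (min a b) (gap / (‖τ‖ + 1)) := by simp only [h]; linarith
  have hha : h < a := hlt.trans_le ((min_le_left _ _).trans (min_le_left _ _))
  have hhb : h < b := hlt.trans_le ((min_le_left _ _).trans (min_le_right _ _))
  have hτ : h * ‖τ‖ < gap := by
    have := hlt.trans_le (min_le_right _ _)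
    rw [lt_div_iff₀ (by positivity)] at this; nlinarith
  refine ⟨fun y => h⁻¹ * w (y + h • τ) + (-h⁻¹) * w y, fun y => h⁻¹ * f (y + h • τ) + (-h⁻¹) * f y, by fun_prop, by fun_prop, ?_,
    fun y hy => ⟨hA h hh hha y hy, hB h hh hhb y hy⟩⟩
  rw [dfct_lin (by fun_prop) hw (by fun_prop) hf, hW x s hs hxs]
  have tr : dfct s x (fun y => w (y + h • τ)) (fun y => f (y + h • τ)) = dfct s (x + h • τ) w f := by
    have : ∀ (k : V3 → ℝ) (σ : ℝ) (u : V3 → ℝ), Mol k σ (fun y => u (y + h • τ)) x = Mol k σ u (x + h • τ) := by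
      intro k σ u; unfold Mol; congr 1; ext1 ξ; beta_reduce; rw [sub_add_eq_add_sub]
    unfold dfct; simp_rw [this]
  rw [tr, hW _ s hs]
  · simp
  · have : dist (x + h • τ) x = h * ‖τ‖ := by rw [dist_eq_norm]; simp [norm_smul, hh.le]
    have := dist_triangle (x + h • τ) x x0
    simp only [gap] at hτ; linarith

lemma lapl_of_weak {w f : V3 → ℝ} {x0 : V3} {ρ : ℝ} (hW : Weak x0 ρ w f) (hw : ContDiffOn ℝ 2 w (ball x0 ρ)) :
    ∀ x ∈ ball x0 ρ, lapl w x = f x := by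
  intro x hx
  obtain ⟨hwc, hf, hW⟩ := hW
  have hx' : dist x x0 < ρ := hx
  set r := (ρ - dist x x0)/2
  have hr : 0 < r := by simp only [r]; linarith
  have hsub : ball x (ρ - dist x x0) ⊆ ball x0 ρ := ball_subset_ball' (by linarith)
  obtain ⟨χ, h1, h2, h3⟩ := exists_cutoff x (r := r) (ρ := ρ - dist x x0) (by simp only [r]; linarith) (by linarith)
  have hc := contDiff_cutoff_mul isOpen_ball (hw.mono hsub) (h1.of_le (by norm_cast)) h3
  set w' := fun y => χ y * w y
  have hww : w' =ᶠ[𝓝 x] w := by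
    filter_upwards [ball_mem_nhds x hr] with z hz
    simp only [w']; rw [h2 z (le_of_lt hz), one_mul]
  rw [← lapl_congr hww]
  set g := fun y => 1 * f y + -1 * lapl w' y with hg
  have hgc : Continuous g := by have := lapl_cont hc; fun_prop
  have I0 : ∀ s, 0 < s → s < r → ∫ σ in (0:ℝ)..s, σ * Mol eta σ g x = 0 := by
    intro s hs hsr
    have e1 := hW x s hs (by simp only [r] at hsr; linarith)
    have e2 : dfct s x w' (lapl w') = 0 := by have := mol_ident hc x s; unfold dfct; linarith
    have e3 : dfct s x (fun y => 1 * w y + -1 * w' y) g = 0 := by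
      rw [hg, dfct_lin hwc hc.continuous hf (lapl_cont hc), e1, e2]; simp
    have e4 : dfct s x (fun y => 1 * w y + -1 * w' y) g = dfct s x (fun _ => 0) g := by
      refine dfct_congr hs.le fun y hy => ⟨?_, rfl⟩
      simp only [w']; rw [h2 y (by linarith)]; ring
    rw [e4] at e3
    unfold dfct at e3
    simpa [Mol] using e3
  have hcont := moleta_cont hgc x
  have I1 : ∀ s, 0 < s → s < r → Mol eta s g x = 0 := by
    intro s hs hsr
    have hd : HasDerivAt (fun s => ∫ σ in (0:ℝ)..s, σ * Mol eta σ g x) (s * Mol eta s g x) s :=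
      intervalIntegral.integral_hasDerivAt_right (hcont.intervalIntegrable _ _) (hcont.stronglyMeasurableAtFilter _ _) hcont.continuousAt
    have hz : HasDerivAt (fun s => ∫ σ in (0:ℝ)..s, σ * Mol eta σ g x) 0 s := by
      refine (hasDerivAt_const s (0:ℝ)).congr_of_eventuallyEq ?_
      filter_upwards [Ioo_mem_nhds hs hsr] with t ht
      exact I0 t ht.1 ht.2
    have := hd.unique hz
    rcases mul_eq_zero.1 this with h | h
    · exact absurd h hs.ne'
    · exact h
  have I2 : Mol eta 0 g x = 0 := by
    have hcc : Continuous fun s : ℝ => Mol eta s g x := (mol_continuous ker_eta hgc).comp (f := fun s : ℝ => (s, x)) (by fun_prop)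
    have ht : Tendsto (fun s : ℝ => Mol eta s g x) (𝓝[>] 0) (𝓝 (Mol eta 0 g x)) := (hcc.tendsto 0).mono_left nhdsWithin_le_nhds
    have ht2 : Tendsto (fun s : ℝ => Mol eta s g x) (𝓝[>] 0) (𝓝 0) := by
      refine tendsto_const_nhds.congr' ?_
      filter_upwards [Ioo_mem_nhdsGT hr] with t ht
      exact (I1 t ht.1 ht.2).symm
    exact tendsto_nhds_unique ht ht2
  have hpos : 0 < ∫ ξ, eta ξ :=
    ker_eta.cont.integral_pos_of_hasCompactSupport_nonneg_nonzero ker_eta.compactSupp (fun _ => Real.smoothTransition.nonneg _)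
      (x := 0) (by simp [eta])
  simp only [Mol, zero_smul, sub_zero, integral_const_mul, smul_eq_mul] at I2
  rcases mul_eq_zero.1 I2 with h | h
  · simp only [hg] at h; linarith
  · exact absurd h hpos.ne'
end

section
section HBsec
variable {F : Type*} [NormedAddCommGroup F] [NormedSpace ℝ F]

structure HB (m : ℕ) (α : ℝ) (S : Set V3) (u : V3 → F) (K : ℝ) : Prop where
  cd : ContDiffOn ℝ m u S
  bd : ∀ j ≤ m, ∀ x ∈ S, ‖iteratedFDerivWithin ℝ j u S x‖ ≤ K
  ho : ∀ x ∈ S, ∀ y ∈ S, ‖iteratedFDerivWithin ℝ m u S x - iteratedFDerivWithin ℝ m u S y‖ ≤ K * dist x y ^ α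

lemma HB.norm_le {m : ℕ} {α K : ℝ} {S : Set V3} {u : V3 → F} (h : HB m α S u K) {x : V3} (hx : x ∈ S) : ‖u x‖ ≤ K := by
  simpa using h.bd 0 (Nat.zero_le _) x hx

lemma hb_zero_iff {α K : ℝ} (hα : 0 < α) {S : Set V3} {u : V3 → F} :
    HB 0 α S u K ↔ (∀ x ∈ S, ‖u x‖ ≤ K) ∧ ∀ x ∈ S, ∀ y ∈ S, ‖u x - u y‖ ≤ K * dist x y ^ α := by
  have e : ∀ x y, ‖iteratedFDerivWithin ℝ 0 u S x - iteratedFDerivWithin ℝ 0 u S y‖ = ‖u x - u y‖ := by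
    intro x y
    rw [iteratedFDerivWithin_zero_eq_comp]
    simp only [Function.comp, ← map_sub, LinearIsometryEquiv.norm_map]
  constructor
  · intro h
    exact ⟨fun x hx => h.norm_le hx, fun x hx y hy => by rw [← e]; exact h.ho x hx y hy⟩
  · rintro ⟨h1, h2⟩
    refine ⟨?_, fun j hj x hx => ?_, fun x hx y hy => by rw [e]; exact h2 x hx y hy⟩
    · simp only [CharP.cast_eq_zero, contDiffOn_zero]
      intro x hx
      rw [ContinuousWithinAt, tendsto_iff_norm_sub_tendsto_zero]
      have hlim : Tendsto (fun y => K * dist y x ^ α) (𝓝[S] x) (𝓝 0) := by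
        have : Continuous fun y : V3 => K * dist y x ^ α :=
          continuous_const.mul ((continuous_id.dist continuous_const).rpow_const (fun _ => Or.inr hα.le))
        have h := this.tendsto x
        simp only [dist_self, Real.zero_rpow hα.ne', mul_zero] at h
        exact h.mono_left nhdsWithin_le_nhds
      refine squeeze_zero' (Eventually.of_forall fun _ => norm_nonneg _) ?_ hlim
      filter_upwards [self_mem_nhdsWithin] with y hy using h2 y hy x hx
    · obtain rfl : j = 0 := by omega
      simpa using h1 x hx

lemma HB.mono {m : ℕ} {α K K' : ℝ} {S : Set V3} {u : V3 → F} (h : HB m α S u K) (hK : K ≤ K') : HB m α S u K' :=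
  ⟨h.cd, fun j hj x hx => (h.bd j hj x hx).trans hK, fun x hx y hy => (h.ho x hx y hy).trans (by gcongr)⟩

lemma iter_succ_diff {S : Set V3} (hS : UniqueDiffOn ℝ S) {u : V3 → F} {m : ℕ} {x y : V3} (hx : x ∈ S) (hy : y ∈ S) :
    ‖iteratedFDerivWithin ℝ (m+1) u S x - iteratedFDerivWithin ℝ (m+1) u S y‖ =
    ‖iteratedFDerivWithin ℝ m (fderivWithin ℝ u S) S x - iteratedFDerivWithin ℝ m (fderivWithin ℝ u S) S y‖ := by
  rw [iteratedFDerivWithin_succ_eq_comp_right hS hx, iteratedFDerivWithin_succ_eq_comp_right hS hy]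
  simp only [Function.comp, ← dist_eq_norm]
  exact (continuousMultilinearCurryRightEquiv' ℝ m V3 F).symm.dist_map _ _

lemma HB.succ {m : ℕ} {α K : ℝ} {S : Set V3} (hS : UniqueDiffOn ℝ S) {u : V3 → F} (hd : DifferentiableOn ℝ u S)
    (hb : ∀ x ∈ S, ‖u x‖ ≤ K) (h : HB m α S (fderivWithin ℝ u S) K) : HB (m+1) α S u K := by
  refine ⟨?_, fun j hj x hx => ?_, fun x hx y hy => ?_⟩
  · push_cast
    exact (contDiffOn_succ_iff_fderivWithin hS).2 ⟨hd, by simp, h.cd⟩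
  · cases j with
    | zero => simpa using hb x hx
    | succ j => rw [← norm_iteratedFDerivWithin_fderivWithin hS hx]; exact h.bd j (by omega) x hx
  · rw [iter_succ_diff hS hx hy]; exact h.ho x hx y hy

lemma HB.grad {m : ℕ} {α K : ℝ} {S : Set V3} (hS : UniqueDiffOn ℝ S) {u : V3 → F}
    (h : HB (m+1) α S u K) : HB m α S (fderivWithin ℝ u S) K := by
  refine ⟨?_, fun j hj x hx => ?_, fun x hx y hy => ?_⟩
  · have := h.cd
    push_cast at this
    exact ((contDiffOn_succ_iff_fderivWithin hS).1 this).2.2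
  · rw [norm_iteratedFDerivWithin_fderivWithin hS hx]; exact h.bd (j+1) (by omega) x hx
  · rw [← iter_succ_diff hS hx hy]; exact h.ho x hx y hy

lemma HB.congr {m : ℕ} {α K : ℝ} {S : Set V3} {u v : V3 → F} (h : HB m α S u K) (e : EqOn v u S) : HB m α S v K := by
  refine ⟨h.cd.congr e, fun j hj x hx => ?_, fun x hx y hy => ?_⟩
  · rw [iteratedFDerivWithin_congr e hx]; exact h.bd j hj x hx
  · rw [iteratedFDerivWithin_congr e hx, iteratedFDerivWithin_congr e hy]; exact h.ho x hx y hy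

end HBsec

section sing
variable {F : Type*} [NormedAddCommGroup F] [NormedSpace ℝ F]

/-- Hölder hypothesis on ball -/
structure HolB (x0 : V3) (α K : ℝ) (f : V3 → ℝ) : Prop where
  c : Continuous f
  b : ∀ y ∈ ball x0 2, |f y| ≤ K
  h : ∀ y ∈ ball x0 2, ∀ z ∈ ball x0 2, |f y - f z| ≤ K * dist y z ^ α

lemma HolB.K0 {x0 : V3} {α K : ℝ} {f : V3 → ℝ} (h : HolB x0 α K f) : 0 ≤ K :=
  (abs_nonneg _).trans (h.b x0 (by simp))

lemma HolB.mol {x0 : V3} {α K : ℝ} (hα : 0 < α) {f : V3 → ℝ} (h : HolB x0 α K f) {k : V3 → F} (hk : Ker k) (h0 : ∫ ξ, k ξ = 0)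
    {x : V3} (hx : x ∈ ball x0 1) {s : ℝ} (hs : 0 < s) (hs1 : s ≤ 1) :
    ‖Mol k s f x‖ ≤ K * (∫ ξ, ‖k ξ‖) * s ^ α := by
  have := mol_holder hk h0 h.c hs.le (x := x) hα.le (H := K) (fun y hy => h.h y (by
    have := dist_triangle y x x0; simp only [mem_ball] at *; linarith) x (ball_subset_ball (by norm_num) hx)) h.K0
  linarith

lemma mol_cont_s {k : V3 → F} (hk : Ker k) {f : V3 → ℝ} (hf : Continuous f) (x : V3) : Continuous fun s : ℝ => Mol k s f x :=
  (mol_continuous hk hf).comp (f := fun s : ℝ => (s, x)) (by fun_prop)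

lemma rpow_int {α : ℝ} (hα : 0 < α) (a b : ℝ) : IntervalIntegrable (fun s : ℝ => s ^ (α - 1)) volume a b :=
  intervalIntegral.intervalIntegrable_rpow' (by linarith)

lemma inv_smul_bound {α : ℝ} {s A : ℝ} (hs : 0 < s) {v : F} (h : ‖v‖ ≤ A * s ^ α) : ‖s⁻¹ • v‖ ≤ A * s ^ (α - 1) := by
  rw [norm_smul, norm_of_nonneg (inv_nonneg.2 hs.le), Real.rpow_sub_one hs.ne']
  rw [inv_mul_le_iff₀ hs]; field_simp; exact h

lemma sing_hasFDerivAt {x0 : V3} {α K : ℝ} (hα : 0 < α) {f : V3 → ℝ} (h : HolB x0 α K f) {k : V3 → F} (hk : Ker k)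
    {g : ℝ → ℝ} (hg : Continuous g) (hg1 : ∀ s ∈ Ioc (0:ℝ) 1, |g s| ≤ 1) {x : V3} (hx : x ∈ ball x0 1) :
    HasFDerivAt (fun x => ∫ s in (0:ℝ)..1, g s • Mol k s f x) (∫ s in (0:ℝ)..1, g s • (s⁻¹ • Mol (fderiv ℝ k) s f x)) x := by
  have hu : uIoc (0:ℝ) 1 = Ioc 0 1 := uIoc_of_le zero_le_one
  refine intervalIntegral.hasFDerivAt_integral_of_dominated_of_fderiv_le (s := ball x0 1) (F := fun x s => g s • Mol k s f x)
    (F' := fun x s => g s • (s⁻¹ • Mol (fderiv ℝ k) s f x))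
    (bound := fun s => (K * (∫ ξ, ‖fderiv ℝ k ξ‖)) * s ^ (α - 1)) (isOpen_ball.mem_nhds hx) ?_ ?_ ?_ ?_ ?_ ?_
  · exact Eventually.of_forall fun y => ((hg.smul (mol_cont_s hk h.c y)).aestronglyMeasurable)
  · exact (hg.smul (mol_cont_s hk h.c x)).intervalIntegrable _ _
  · exact (hg.aestronglyMeasurable).smul (measurable_inv.aestronglyMeasurable.smul (mol_cont_s hk.fderiv h.c x).aestronglyMeasurable)
  · refine Eventually.of_forall fun s hs y hy => ?_
    rw [hu] at hs
    have := inv_smul_bound hs.1 (h.mol hα hk.fderiv (ker_int_fderiv hk) hy hs.1 hs.2)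
    rw [norm_smul]
    calc _ ≤ 1 * ‖s⁻¹ • Mol (fderiv ℝ k) s f y‖ := by gcongr; exact hg1 s hs
      _ ≤ _ := by rw [one_mul]; exact this
  · exact (rpow_int hα 0 1).const_mul _
  · refine Eventually.of_forall fun s hs y hy => ?_
    rw [hu] at hs
    exact (mol_hasFDerivAt hk h.c hs.1 y).const_smul (g s)

lemma sing_intble {x0 : V3} {α K : ℝ} (hα : 0 < α) {f : V3 → ℝ} (h : HolB x0 α K f) {k : V3 → F} (hk : Ker k) (h0 : ∫ ξ, k ξ = 0)
    {x : V3} (hx : x ∈ ball x0 1) : IntervalIntegrable (fun s => s⁻¹ • Mol k s f x) volume 0 1 := by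
  refine ((rpow_int hα 0 1).const_mul (K * (∫ ξ, ‖k ξ‖))).mono_fun' (measurable_inv.aestronglyMeasurable.smul (mol_cont_s hk h.c x).aestronglyMeasurable) ?_
  filter_upwards [ae_restrict_mem measurableSet_uIoc] with s hs
  rw [uIoc_of_le zero_le_one] at hs
  exact inv_smul_bound hs.1 (h.mol hα hk h0 hx hs.1 hs.2)

lemma sing_bound {x0 : V3} {α K : ℝ} (hα : 0 < α) {f : V3 → ℝ} (h : HolB x0 α K f) {k : V3 → F} (hk : Ker k) (h0 : ∫ ξ, k ξ = 0)
    {x : V3} (hx : x ∈ ball x0 1) {d : ℝ} (hd : 0 ≤ d) (hd1 : d ≤ 1) :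
    ‖∫ s in (0:ℝ)..d, s⁻¹ • Mol k s f x‖ ≤ (K * (∫ ξ, ‖k ξ‖)) * (d ^ α / α) := by
  have := intervalIntegral.norm_integral_le_of_norm_le (f := fun s => s⁻¹ • Mol k s f x) (g := fun s => (K * (∫ ξ, ‖k ξ‖)) * s ^ (α - 1)) hd
    (Eventually.of_forall fun s hs => inv_smul_bound hs.1 (h.mol hα hk h0 hx hs.1 (hs.2.trans hd1))) ((rpow_int hα 0 d).const_mul _)
  refine this.trans_eq ?_
  rw [intervalIntegral.integral_const_mul, integral_rpow (Or.inl (by linarith))]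
  simp [Real.zero_rpow hα.ne']

lemma sing_holder {x0 : V3} {α K : ℝ} (hα : 0 < α) (hα1 : α < 1) {f : V3 → ℝ} (h : HolB x0 α K f) {k : V3 → F} (hk : Ker k) (h0 : ∫ ξ, k ξ = 0)
    {x y : V3} (hx : x ∈ ball x0 1) (hy : y ∈ ball x0 1) :
    ‖(∫ s in (0:ℝ)..1, s⁻¹ • Mol k s f x) - ∫ s in (0:ℝ)..1, s⁻¹ • Mol k s f y‖ ≤
      K * (2 * (∫ ξ, ‖k ξ‖) / α + (∫ ξ, ‖fderiv ℝ k ξ‖) / (1 - α)) * dist x y ^ α := by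
  have hK := h.K0
  set A := ∫ ξ, ‖k ξ‖
  set B := ∫ ξ, ‖fderiv ℝ k ξ‖
  have hA : 0 ≤ A := integral_nonneg fun _ => norm_nonneg _
  have hB : 0 ≤ B := integral_nonneg fun _ => norm_nonneg _
  have h1α : 0 < 1 - α := by linarith
  set d := dist x y
  have hd0 : 0 ≤ d := dist_nonneg
  rcases hd0.eq_or_lt with hd | hd
  · have : x = y := dist_eq_zero.1 hd.symm
    rw [this]; simp; positivity
  rcases le_or_gt 1 d with hd1 | hd1
  · have b1 := sing_bound hα h hk h0 hx zero_le_one le_rfl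
    have b2 := sing_bound hα h hk h0 hy zero_le_one le_rfl
    rw [Real.one_rpow] at b1 b2
    have hda : 1 ≤ d ^ α := Real.one_le_rpow hd1 hα.le
    calc _ ≤ (K * A) * (1/α) + (K * A) * (1/α) := (norm_sub_le _ _).trans (add_le_add b1 b2)
      _ = K * (2 * A / α) * 1 := by ring
      _ ≤ _ := by gcongr; exact le_add_of_nonneg_right (by positivity)
  · have ix := sing_intble hα h hk h0 hx
    have iy := sing_intble hα h hk h0 hy
    have sub1 : uIcc 0 d ⊆ uIcc (0:ℝ) 1 := by
      rw [uIcc_of_le hd0, uIcc_of_le zero_le_one]; exact Icc_subset_Icc_right hd1.le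
    have sub2 : uIcc d 1 ⊆ uIcc (0:ℝ) 1 := by
      rw [uIcc_of_le hd1.le, uIcc_of_le zero_le_one]; exact Icc_subset_Icc_left hd0
    rw [← intervalIntegral.integral_add_adjacent_intervals (ix.mono_set sub1) (ix.mono_set sub2),
      ← intervalIntegral.integral_add_adjacent_intervals (iy.mono_set sub1) (iy.mono_set sub2)]
    rw [add_sub_add_comm, ← intervalIntegral.integral_sub (ix.mono_set sub2) (iy.mono_set sub2)]
    have b1 := sing_bound hα h hk h0 hx hd0 hd1.le
    have b2 := sing_bound hα h hk h0 hy hd0 hd1.le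
    have ri : IntervalIntegrable (fun s : ℝ => K * B * d * s ^ (α - 2)) volume d 1 := by
      refine IntervalIntegrable.const_mul ?_ _
      exact intervalIntegral.intervalIntegrable_rpow (Or.inr (by rw [uIcc_of_le hd1.le]; simp [hd]))
    have b3 := intervalIntegral.norm_integral_le_of_norm_le (f := fun s => s⁻¹ • Mol k s f x - s⁻¹ • Mol k s f y)
      (g := fun s => K * B * d * s ^ (α - 2)) hd1.le (Eventually.of_forall fun s hs => by
        have hs0 : 0 < s := hd.trans hs.1
        have mv := (convex_ball x0 1).norm_image_sub_le_of_norm_hasFDerivWithin_le (f := Mol k s f) (x := y) (y := x) (C := K * B * s ^ (α - 1))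
          (fun z hz => (mol_hasFDerivAt hk h.c hs0 z).hasFDerivWithinAt) (fun z hz => inv_smul_bound hs0 (h.mol hα hk.fderiv (ker_int_fderiv hk) hz hs0 hs.2)) hy hx
        rw [← smul_sub, norm_smul, norm_of_nonneg (inv_nonneg.2 hs0.le), inv_mul_le_iff₀ hs0]
        refine mv.trans_eq ?_
        have e1 : s ^ (α - 1) = s * s ^ (α - 2) := by
          have : α - 1 = (α - 2) + 1 := by ring
          rw [this, Real.rpow_add_one hs0.ne']; ring
        rw [e1, ← dist_eq_norm]; ring) ri
    have b4 : ∫ s in d..1, K * B * d * s ^ (α - 2) ≤ K * B / (1 - α) * d ^ α := by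
      rw [intervalIntegral.integral_const_mul, integral_rpow (Or.inr ⟨by linarith, by rw [uIcc_of_le hd1.le]; simp [hd]⟩)]
      have e1 : α - 2 + 1 = α - 1 := by ring
      rw [e1, Real.one_rpow]
      have e2 : d ^ α = d * d ^ (α - 1) := by
        have : α = (α - 1) + 1 := by ring
        conv_lhs => rw [this, Real.rpow_add_one hd.ne']
        ring
      have e3 : (1 - d ^ (α - 1)) / (α - 1) = (d ^ (α - 1) - 1) / (1 - α) := by
        rw [← neg_div_neg_eq]; congr 1 <;> ring
      rw [e2, e3]
      calc _ = K * B / (1 - α) * (d * (d ^ (α - 1) - 1)) := by ring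
        _ ≤ _ := by gcongr; linarith
    calc _ ≤ (K * A * (d ^ α / α) + K * A * (d ^ α / α)) + K * B / (1 - α) * d ^ α :=
        (norm_add_le _ _).trans (add_le_add ((norm_sub_le _ _).trans (add_le_add b1 b2)) (b3.trans b4))
      _ = _ := by ring
end sing

lemma int_norm_nonneg {F : Type*} [NormedAddCommGroup F] (k : V3 → F) : 0 ≤ ∫ ξ, ‖k ξ‖ :=
  integral_nonneg fun _ => norm_nonneg _

lemma schauder_gen {F : Type*} [NormedAddCommGroup F] [NormedSpace ℝ F] {α : ℝ} (hα : 0 < α) (hα1 : α < 1) {k q : V3 → F} (hk : Ker k) (hq : Ker q) :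
    ∃ C : ℝ, 0 ≤ C ∧ ∀ (x0 : V3) (w f : V3 → ℝ) (K : ℝ), Continuous w →
    (∀ y ∈ ball x0 2, |w y| ≤ K) → HolB x0 α K f →
    HB 1 α (ball x0 1) (fun x => Mol q 1 w x - ∫ s in (0:ℝ)..1, Mol k s f x) (C * K) := by
  have k2 := hk.fderiv
  have p2 := hq.fderiv
  have p3 := p2.fderiv
  have h1α : 0 < 1 - α := by linarith
  obtain ⟨A1, hA1e⟩ : ∃ A, A = ∫ ξ, ‖k ξ‖ := ⟨_, rfl⟩
  obtain ⟨A2, hA2e⟩ : ∃ A, A = ∫ ξ, ‖fderiv ℝ k ξ‖ := ⟨_, rfl⟩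
  obtain ⟨A3, hA3e⟩ : ∃ A, A = ∫ ξ, ‖fderiv ℝ (fderiv ℝ k) ξ‖ := ⟨_, rfl⟩
  obtain ⟨P1, hP1e⟩ : ∃ A, A = ∫ ξ, ‖q ξ‖ := ⟨_, rfl⟩
  obtain ⟨P2, hP2e⟩ : ∃ A, A = ∫ ξ, ‖fderiv ℝ q ξ‖ := ⟨_, rfl⟩
  obtain ⟨P3, hP3e⟩ : ∃ A, A = ∫ ξ, ‖fderiv ℝ (fderiv ℝ q) ξ‖ := ⟨_, rfl⟩
  have hA1 : 0 ≤ A1 := hA1e ▸ int_norm_nonneg _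
  have hA2 : 0 ≤ A2 := hA2e ▸ int_norm_nonneg _
  have hA3 : 0 ≤ A3 := by rw [hA3e]; exact integral_nonneg fun ξ => ContinuousLinearMap.opNorm_nonneg _
  have hP1 : 0 ≤ P1 := hP1e ▸ int_norm_nonneg _
  have hP2 : 0 ≤ P2 := hP2e ▸ int_norm_nonneg _
  have hP3 : 0 ≤ P3 := by rw [hP3e]; exact integral_nonneg fun ξ => ContinuousLinearMap.opNorm_nonneg _
  obtain ⟨H, hH⟩ : ∃ H, H = (2 * P3 + 2 * A2 / α + A3 / (1 - α)) := ⟨_, rfl⟩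
  obtain ⟨H1, hH1⟩ : ∃ H, H = (P1 + A1) := ⟨_, rfl⟩
  obtain ⟨H2, hH2⟩ : ∃ H, H = (P2 + A2 / α) := ⟨_, rfl⟩
  have hH0 : 0 ≤ H := by rw [hH]; positivity
  have hH10 : 0 ≤ H1 := by rw [hH1]; positivity
  have hH20 : 0 ≤ H2 := by rw [hH2]; positivity
  refine ⟨H + H1 + H2, by linarith, fun x0 w f K hwc hwK hf => ?_⟩
  have hK := hf.K0
  set S := ball x0 1
  have hSo : IsOpen S := isOpen_ball
  have hS := hSo.uniqueDiffOn (𝕜 := ℝ)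
  have hball : ∀ x ∈ S, ∀ y, dist y x ≤ 1 → y ∈ ball x0 2 := fun x hx y hy => by
    have := dist_triangle y x x0; simp only [S, mem_ball] at *; linarith
  set W1 : V3 → F := fun x => Mol q 1 w x - ∫ s in (0:ℝ)..1, Mol k s f x with hW1
  set W2 : V3 → (V3 →L[ℝ] F) := fun x => Mol (fderiv ℝ q) 1 w x - ∫ s in (0:ℝ)..1, s⁻¹ • Mol (fderiv ℝ k) s f x with hW2
  have d2 : ∀ x ∈ S, HasFDerivAt W1 (W2 x) x := by
    intro x hx
    have a1 := mol_hasFDerivAt hq hwc one_pos x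
    have a2 := sing_hasFDerivAt hα hf hk (g := fun s => 1) continuous_const (fun s hs => by simp) hx
    simp only [inv_one, one_smul] at a1 a2
    exact a1.sub a2
  have mbq : ∀ x ∈ S, ‖Mol q 1 w x‖ ≤ K * P1 := fun x hx => by
    rw [hP1e]; exact mol_norm_le hq zero_le_one (fun y hy => hwK y (hball x hx y hy))
  have mbq2 : ∀ x ∈ S, ‖Mol (fderiv ℝ q) 1 w x‖ ≤ K * P2 := fun x hx => by
    rw [hP2e]; exact mol_norm_le p2 zero_le_one (fun y hy => hwK y (hball x hx y hy))
  have mbq3 : ∀ x ∈ S, ‖Mol (fderiv ℝ (fderiv ℝ q)) 1 w x‖ ≤ K * P3 := fun x hx => by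
    rw [hP3e]; exact mol_norm_le p3 zero_le_one (fun y hy => hwK y (hball x hx y hy))
  have n1 : ∀ x ∈ S, ‖W1 x‖ ≤ H1 * K := by
    intro x hx
    have b1 := mbq x hx
    have b2 : ‖∫ s in (0:ℝ)..1, Mol k s f x‖ ≤ (K * A1) * |1 - 0| := by
      refine intervalIntegral.norm_integral_le_of_norm_le_const fun s hs => ?_
      rw [uIoc_of_le zero_le_one] at hs
      rw [hA1e]
      exact mol_norm_le hk hs.1.le (fun y hy => hf.b y (hball x hx y (hy.trans hs.2)))
    refine (norm_sub_le _ _).trans ((add_le_add b1 b2).trans_eq ?_)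
    rw [hH1]; simp; ring
  have n2 : ∀ x ∈ S, ‖W2 x‖ ≤ H2 * K := by
    intro x hx
    have b1 := mbq2 x hx
    have b2 := sing_bound hα hf k2 (ker_int_fderiv hk) hx zero_le_one le_rfl
    rw [← hA2e] at b2
    refine (norm_sub_le _ _).trans ((add_le_add b1 b2).trans_eq ?_)
    rw [hH2]; simp; ring
  have n3 : ∀ x ∈ S, ∀ y ∈ S, ‖W2 x - W2 y‖ ≤ (H * K) * dist x y ^ α := by
    intro x hx y hy
    have b2 := sing_holder hα hα1 hf k2 (ker_int_fderiv hk) hx hy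
    rw [← hA2e, ← hA3e] at b2
    have b1 : ‖Mol (fderiv ℝ q) 1 w x - Mol (fderiv ℝ q) 1 w y‖ ≤ (K * P3) * ‖x - y‖ :=
      (convex_ball x0 1).norm_image_sub_le_of_norm_hasFDerivWithin_le
        (fun z hz => (mol_hasFDerivAt p2 hwc one_pos z).hasFDerivWithinAt) (fun z hz => by simpa using mbq3 z hz) hy hx
    have hd : ‖x - y‖ ≤ 2 * dist x y ^ α := by
      rw [← dist_eq_norm]
      have hd2 : dist x y ≤ 2 := by
        have := dist_triangle_right x y x0; simp only [S, mem_ball] at *; linarith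
      rcases (dist_nonneg (x := x) (y := y)).eq_or_lt with h0 | h0
      · rw [← h0]; positivity
      · have e : dist x y = dist x y ^ (1 - α) * dist x y ^ α := by
          rw [← rpow_add h0]; simp
        calc dist x y = dist x y ^ (1 - α) * dist x y ^ α := e
          _ ≤ 2 ^ (1 - α) * dist x y ^ α := by gcongr
          _ ≤ 2 ^ (1:ℝ) * dist x y ^ α := by gcongr <;> linarith
          _ = _ := by simp
    simp only [hW2]
    rw [sub_sub_sub_comm]
    refine (norm_sub_le _ _).trans ?_
    calc _ ≤ (K * P3) * (2 * dist x y ^ α) + K * (2 * A2 / α + A3 / (1 - α)) * dist x y ^ α := add_le_add (b1.trans (by gcongr)) b2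
      _ = _ := by rw [hH]; ring
  have hCK : ∀ T, T ≤ H + H1 + H2 → T * K ≤ (H + H1 + H2) * K := fun T hT => by gcongr
  have f2 : EqOn (fderivWithin ℝ W1 S) W2 S := fun x hx => (d2 x hx).hasFDerivWithinAt.fderivWithin (hS x hx)
  refine HB.succ hS (fun x hx => (d2 x hx).differentiableAt.differentiableWithinAt) (fun x hx => ?_) (HB.congr ?_ f2)
  · exact (n1 x hx).trans (hCK _ (by linarith))
  rw [hb_zero_iff hα]
  refine ⟨fun x hx => (n2 x hx).trans (hCK _ (by linarith)), fun x hx y hy => (n3 x hx y hy).trans ?_⟩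
  gcongr; linarith

lemma HB.const_smul {F : Type*} [NormedAddCommGroup F] [NormedSpace ℝ F] {m : ℕ} {α K : ℝ} {S : Set V3} (hS : UniqueDiffOn ℝ S) {u : V3 → F}
    (h : HB m α S u K) (c : ℝ) : HB m α S (fun x => c • u x) (|c| * K) := by
  have e : ∀ j ≤ m, ∀ x ∈ S, iteratedFDerivWithin ℝ j (fun x => c • u x) S x = c • iteratedFDerivWithin ℝ j u S x := fun j hj x hx =>
    iteratedFDerivWithin_const_smul_apply ((h.cd x hx).of_le (by exact_mod_cast hj)) hS hx
  refine ⟨h.cd.const_smul c, fun j hj x hx => ?_, fun x hx y hy => ?_⟩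
  · rw [e j hj x hx, norm_smul, norm_eq_abs]; gcongr; exact h.bd j hj x hx
  · rw [e m le_rfl x hx, e m le_rfl y hy, ← smul_sub, norm_smul, norm_eq_abs, mul_assoc]; gcongr; exact h.ho x hx y hy

lemma schauder0 {α : ℝ} (hα : 0 < α) (hα1 : α < 1) : ∃ C : ℝ, 1 ≤ C ∧ ∀ (x0 : V3) (w f : V3 → ℝ) (K : ℝ), Weak x0 2 w f →
    (∀ y ∈ ball x0 2, |w y| ≤ K) → HolB x0 α K f → HB 2 α (ball x0 1) w (C * K) := by
  obtain ⟨C, hC0, hC⟩ := schauder_gen hα hα1 ker_eta.fderiv ker_phi.fderiv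
  have hc0 := c0_pos
  refine ⟨1 + c0⁻¹ * C, by have : 0 ≤ c0⁻¹ * C := by positivity
                           linarith, fun x0 w f K hW hwK hf => ?_⟩
  have hK := hf.K0
  obtain ⟨hwc, hfc, hW⟩ := hW
  have hS := isOpen_ball (x := x0) (ε := 1).uniqueDiffOn (𝕜 := ℝ)
  have hB := (hC x0 w f K hwc hwK hf).const_smul hS c0⁻¹
  set S := ball x0 1
  have rep : ∀ x ∈ S, w x = c0⁻¹ * (Mol phi 1 w x - ∫ s in (0:ℝ)..1, s * Mol eta s f x) := by
    intro x hx
    have := hW x 1 one_pos (by simp only [S, mem_ball] at hx; linarith)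
    unfold dfct at this
    field_simp; linarith
  have d1 : ∀ x ∈ S, HasFDerivAt w (c0⁻¹ • (Mol (fderiv ℝ phi) 1 w x - ∫ s in (0:ℝ)..1, Mol (fderiv ℝ eta) s f x)) x := by
    intro x hx
    have a1 := mol_hasFDerivAt ker_phi hwc one_pos x
    have a2 := sing_hasFDerivAt hα hf ker_eta (g := fun s => s) continuous_id (fun s hs => by rw [abs_of_pos hs.1]; exact hs.2) hx
    have a3 : (∫ s in (0:ℝ)..1, s • (s⁻¹ • Mol (fderiv ℝ eta) s f x)) = ∫ s in (0:ℝ)..1, Mol (fderiv ℝ eta) s f x := by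
      refine intervalIntegral.integral_congr_ae (Eventually.of_forall fun s hs => ?_)
      rw [uIoc_of_le zero_le_one] at hs
      rw [smul_smul, mul_inv_cancel₀ hs.1.ne', one_smul]
    rw [a3] at a2
    simp only [inv_one, one_smul] at a1
    have := (a1.sub a2).const_smul c0⁻¹
    refine this.congr_of_eventuallyEq ?_
    filter_upwards [isOpen_ball.mem_nhds hx] with y hy
    rw [rep y hy]; rfl
  refine HB.succ hS (fun x hx => (d1 x hx).differentiableAt.differentiableWithinAt) (fun x hx => ?_) (HB.congr (hB.mono ?_)
    (fun x hx => (d1 x hx).hasFDerivWithinAt.fderivWithin (hS x hx)))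
  · refine (hwK x (ball_subset_ball (by norm_num) hx)).trans ?_
    have : 0 ≤ c0⁻¹ * C * K := by positivity
    linarith
  · rw [abs_of_pos (inv_pos.2 hc0)]; linarith
end

section
section HBalg
variable {F G : Type*} [NormedAddCommGroup F] [NormedSpace ℝ F] [NormedAddCommGroup G] [NormedSpace ℝ G]

lemma HB.add {m : ℕ} {α K K' : ℝ} {S : Set V3} (hS : UniqueDiffOn ℝ S) {u v : V3 → F}
    (h : HB m α S u K) (h' : HB m α S v K') : HB m α S (fun x => u x + v x) (K + K') := by
  have e : ∀ j ≤ m, ∀ x ∈ S, iteratedFDerivWithin ℝ j (fun x => u x + v x) S x = iteratedFDerivWithin ℝ j u S x + iteratedFDerivWithin ℝ j v S x := fun j hj x hx =>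
    iteratedFDerivWithin_add_apply' ((h.cd x hx).of_le (by exact_mod_cast hj)) ((h'.cd x hx).of_le (by exact_mod_cast hj)) hS hx
  refine ⟨h.cd.add h'.cd, fun j hj x hx => ?_, fun x hx y hy => ?_⟩
  · rw [e j hj x hx]; exact (norm_add_le _ _).trans (add_le_add (h.bd j hj x hx) (h'.bd j hj x hx))
  · rw [e m le_rfl x hx, e m le_rfl y hy, add_sub_add_comm, add_mul]
    exact (norm_add_le _ _).trans (add_le_add (h.ho x hx y hy) (h'.ho x hx y hy))

lemma HB.clm {m : ℕ} {α K : ℝ} {S : Set V3} (hS : UniqueDiffOn ℝ S) {u : V3 → F} (L : F →L[ℝ] G)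
    (h : HB m α S u K) : HB m α S (fun x => L (u x)) (‖L‖ * K) := by
  have e : ∀ j ≤ m, ∀ x ∈ S, iteratedFDerivWithin ℝ j (fun x => L (u x)) S x = L.compContinuousMultilinearMap (iteratedFDerivWithin ℝ j u S x) := fun j hj x hx =>
    L.iteratedFDerivWithin_comp_left (h.cd x hx) hS hx (by exact_mod_cast hj)
  refine ⟨L.contDiff.comp_contDiffOn h.cd, fun j hj x hx => ?_, fun x hx y hy => ?_⟩
  · rw [e j hj x hx]
    refine (L.norm_compContinuousMultilinearMap_le _).trans ?_
    gcongr; exact h.bd j hj x hx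
  · have e2 : ∀ A B : V3 [×m]→L[ℝ] F, L.compContinuousMultilinearMap A - L.compContinuousMultilinearMap B = L.compContinuousMultilinearMap (A - B) := by
      intro A B; ext v; simp
    rw [e m le_rfl x hx, e m le_rfl y hy, e2, mul_assoc]
    refine (L.norm_compContinuousMultilinearMap_le _).trans ?_
    gcongr; exact h.ho x hx y hy

lemma HB.subset {m : ℕ} {α K : ℝ} {S T : Set V3} (hS : UniqueDiffOn ℝ S) (hT : UniqueDiffOn ℝ T) (hTS : T ⊆ S) {u : V3 → F}
    (h : HB m α S u K) : HB m α T u K := by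
  have e : ∀ j ≤ m, ∀ x ∈ T, iteratedFDerivWithin ℝ j u T x = iteratedFDerivWithin ℝ j u S x := fun j hj x hx =>
    iteratedFDerivWithin_subset hTS hT hS (h.cd.of_le (by exact_mod_cast hj)) hx
  refine ⟨h.cd.mono hTS, fun j hj x hx => ?_, fun x hx y hy => ?_⟩
  · rw [e j hj x hx]; exact h.bd j hj x (hTS hx)
  · rw [e _ le_rfl x hx, e _ le_rfl y hy]; exact h.ho x (hTS hx) y (hTS hy)

lemma le_holder {d D α : ℝ} (hα : 0 < α) (hα1 : α < 1) (hd : 0 ≤ d) (hD : d ≤ D) (h1 : 1 ≤ D) : d ≤ D * d ^ α := by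
  rcases hd.eq_or_lt with h0 | h0
  · rw [← h0, Real.zero_rpow hα.ne']; simp
  · have e : d = d ^ (1 - α) * d ^ α := by rw [← rpow_add h0]; simp
    calc d = d ^ (1 - α) * d ^ α := e
      _ ≤ D ^ (1 - α) * d ^ α := by gcongr
      _ ≤ D ^ (1:ℝ) * d ^ α := by gcongr <;> linarith
      _ = _ := by simp

lemma HB.holder0 {m : ℕ} {α K D : ℝ} (hα : 0 < α) (hα1 : α < 1) {S : Set V3} (hS : UniqueDiffOn ℝ S) (hc : Convex ℝ S) (hK : 0 ≤ K) (hD1 : 1 ≤ D)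
    (hD : ∀ x ∈ S, ∀ y ∈ S, dist x y ≤ D) {u : V3 → F} (h : HB m α S u K) :
    ∀ x ∈ S, ∀ y ∈ S, ‖u x - u y‖ ≤ (D * K) * dist x y ^ α := by
  intro x hx y hy
  rcases m with _ | m
  · refine (((hb_zero_iff hα).1 h).2 x hx y hy).trans ?_
    gcongr; nlinarith
  · have hd : DifferentiableOn ℝ u S := h.cd.differentiableOn (by simp)
    have hb : ∀ z ∈ S, ‖fderivWithin ℝ u S z‖ ≤ K := fun z hz => (HB.grad hS h).norm_le hz
    have := hc.norm_image_sub_le_of_norm_hasFDerivWithin_le (fun z hz => (hd z hz).hasFDerivWithinAt) hb hy hx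
    refine this.trans ?_
    rw [← dist_eq_norm]
    have := le_holder hα hα1 dist_nonneg (hD x hx y hy) hD1
    nlinarith

end HBalg

lemma proj_norm (i : Fin 3) : ‖(EuclideanSpace.proj i : V3 →L[ℝ] ℝ)‖ ≤ 1 := by
  refine ContinuousLinearMap.opNorm_le_bound _ zero_le_one fun x => ?_
  simpa using EuclideanSpace.norm_eq x ▸ (by
    rw [Real.le_sqrt (by positivity) (by positivity)]
    exact Finset.single_le_sum (f := fun i => ‖x i‖^2) (fun _ _ => by positivity) (Finset.mem_univ i))

lemma clm_eq_sum (L : V3 →L[ℝ] ℝ) : L = ∑ i : Fin 3, L (ee i) • (EuclideanSpace.proj i : V3 →L[ℝ] ℝ) := by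
  ext x
  conv_lhs => rw [v3_sum x]
  simp [mul_comm]

lemma ee_norm (i : Fin 3) : ‖(ee i : V3)‖ = 1 := by simp [ee]

lemma HB.pd {m : ℕ} {α K : ℝ} (hK : 0 ≤ K) {S : Set V3} (hS : UniqueDiffOn ℝ S) {u : V3 → ℝ} (h : HB (m+1) α S u K) (i : Fin 3) :
    HB m α S (fun x => fderivWithin ℝ u S x (ee i)) K := by
  have h2 := (HB.grad hS h).clm hS (ContinuousLinearMap.apply ℝ ℝ (ee i))
  refine HB.mono (K := _) h2 ?_
  have : ‖ContinuousLinearMap.apply ℝ ℝ (ee i : V3)‖ ≤ 1 := by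
    refine ContinuousLinearMap.opNorm_le_bound _ zero_le_one fun L => ?_
    simpa [ee_norm] using L.le_opNorm (ee i)
  nlinarith

lemma HB.of_pd {m : ℕ} {α K : ℝ} (hK : 0 ≤ K) {S : Set V3} (hS : UniqueDiffOn ℝ S) {u : V3 → ℝ} (hd : DifferentiableOn ℝ u S)
    (hb : ∀ x ∈ S, ‖u x‖ ≤ K) (h : ∀ i, HB m α S (fun x => fderivWithin ℝ u S x (ee i)) K) : HB (m+1) α S u (3 * K) := by
  refine HB.succ hS hd (fun x hx => (hb x hx).trans (by linarith)) ?_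
  have hi : ∀ i, HB m α S (fun x => fderivWithin ℝ u S x (ee i) • (EuclideanSpace.proj i : V3 →L[ℝ] ℝ)) K := fun i => by
    have h2 := (h i).clm hS ((ContinuousLinearMap.id ℝ ℝ).smulRight (EuclideanSpace.proj i : V3 →L[ℝ] ℝ))
    refine HB.mono (K := _) h2 ?_
    have : ‖(ContinuousLinearMap.id ℝ ℝ).smulRight (EuclideanSpace.proj i : V3 →L[ℝ] ℝ)‖ ≤ 1 := by
      rw [ContinuousLinearMap.norm_smulRight_apply]
      have := proj_norm i
      simpa using this
    nlinarith
  have h3 := ((hi 0).add hS (hi 1)).add hS (hi 2)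
  refine HB.mono (K := K + K + K) (HB.congr h3 fun x hx => ?_) (by linarith)
  conv_lhs => rw [clm_eq_sum (fderivWithin ℝ u S x)]
  rw [Fin.sum_univ_three]

end

section
/-- reflection-folding about the plane `x₂ = κ` -/
def fold (κ : ℝ) (x : V3) : V3 := x + (|x 2 - κ| - (x 2 - κ)) • ee 2

def Hf (κ : ℝ) : Set V3 := {x : V3 | κ ≤ x 2}

lemma fold_cont (κ : ℝ) : Continuous (fold κ) := by unfold fold; fun_prop

lemma fold_two (κ : ℝ) (x : V3) : fold κ x 2 = κ + |x 2 - κ| := by simp [fold, ee]; ring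
lemma fold_zero (κ : ℝ) (x : V3) : fold κ x 0 = x 0 := by simp [fold, ee]
lemma fold_one (κ : ℝ) (x : V3) : fold κ x 1 = x 1 := by simp [fold, ee]

lemma fold_mem (κ : ℝ) (x : V3) : fold κ x ∈ Hf κ := by
  simp only [Hf, mem_setOf_eq, fold_two]; have := abs_nonneg (x 2 - κ); linarith

lemma fold_eq {κ : ℝ} {x : V3} (h : x ∈ Hf κ) : fold κ x = x := by
  simp only [Hf, mem_setOf_eq] at h
  rw [fold, abs_of_nonneg (by linarith)]; simp

lemma norm_sq3 (x : V3) : ‖x‖ ^ 2 = x 0 ^ 2 + x 1 ^ 2 + x 2 ^ 2 := by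
  rw [EuclideanSpace.norm_eq, Real.sq_sqrt (by positivity), Fin.sum_univ_three]; simp

lemma fold_norm {κ : ℝ} (hκ : κ ≤ 0) (x : V3) : ‖fold κ x‖ ≤ ‖x‖ := by
  rw [← sq_le_sq₀ (norm_nonneg _) (norm_nonneg _), norm_sq3, norm_sq3, fold_two, fold_one, fold_zero]
  rcases abs_cases (x 2 - κ) with ⟨h, h'⟩ | ⟨h, h'⟩ <;> rw [h] <;> nlinarith

lemma fold_dist (κ : ℝ) (x y : V3) : dist (fold κ x) (fold κ y) ≤ dist x y := by
  rw [dist_eq_norm, dist_eq_norm, ← sq_le_sq₀ (norm_nonneg _) (norm_nonneg _), norm_sq3, norm_sq3]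
  simp only [PiLp.sub_apply, fold_two, fold_one, fold_zero]
  have : (|x 2 - κ| - |y 2 - κ|) ^ 2 ≤ (x 2 - y 2) ^ 2 := by
    have := abs_abs_sub_abs_le_abs_sub (x 2 - κ) (y 2 - κ)
    rw [sub_sub_sub_cancel_right] at this
    exact sq_le_sq.2 this
  have e : κ + |x 2 - κ| - (κ + |y 2 - κ|) = |x 2 - κ| - |y 2 - κ| := by ring
  rw [e]; linarith

lemma fold_add (κ : ℝ) (x : V3) {τ : V3} (hτ : τ 2 = 0) (h : ℝ) : fold κ (x + h • τ) = fold κ x + h • τ := by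
  simp only [fold, PiLp.add_apply, PiLp.smul_apply, hτ, smul_zero, add_zero]; abel

lemma hf_convex (κ : ℝ) : Convex ℝ (Hf κ) := by
  have : Hf κ = (EuclideanSpace.proj (2 : Fin 3) : V3 →L[ℝ] ℝ) ⁻¹' (Ici κ) := by ext x; simp [Hf]
  rw [this]; exact (convex_Ici κ).linear_preimage _

lemma hfb_convex (κ R : ℝ) : Convex ℝ (Hf κ ∩ ball 0 R) := (hf_convex κ).inter (convex_ball _ _)

lemma hfb_unique {κ R : ℝ} (hκ : κ ≤ 0) (hR : 0 < R) : UniqueDiffOn ℝ (Hf κ ∩ ball 0 R) := by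
  refine uniqueDiffOn_convex (hfb_convex κ R) ?_
  have ho : IsOpen ({x : V3 | κ < x 2} ∩ ball 0 R) :=
    (isOpen_lt (by fun_prop) (by fun_prop)).inter isOpen_ball
  refine ⟨(R/2) • ee 2, mem_interior.2 ⟨_, ?_, ho, ?_, ?_⟩⟩
  · exact inter_subset_inter_left _ fun x (hx : κ < x 2) => show κ ≤ x 2 from le_of_lt hx
  · simp [ee]; linarith
  · simp [norm_smul, ee_norm, abs_of_pos hR]; linarith

lemma pd_lapl_comm {w : V3 → ℝ} {U : Set V3} (hU : IsOpen U) (hw : ContDiffOn ℝ 2 w U) {x : V3} (hx : x ∈ U) (i j : Fin 3) :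
    fderiv ℝ (fun y => fderiv ℝ w y (ee i)) x (ee j) = fderiv ℝ (fun y => fderiv ℝ w y (ee j)) x (ee i) := by
  have hc : ContDiffAt ℝ 2 w x := hw.contDiffAt (hU.mem_nhds hx)
  have hd : DifferentiableAt ℝ (fderiv ℝ w) x := (hc.fderiv_right (m := 1) (by norm_num)).differentiableAt (by norm_num)
  have e : ∀ v : V3, fderiv ℝ (fun y => fderiv ℝ w y v) x = (fderiv ℝ (fderiv ℝ w) x).flip v := fun v => by
    rw [fderiv_clm_apply hd (by fun_prop)]; simp
  rw [e, e]
  simp only [ContinuousLinearMap.flip_apply]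
  exact (hc.isSymmSndFDerivAt (by simp)).eq _ _

def Rm (m : ℕ) : ℝ := 3 * m + 2

lemma claim {α : ℝ} (hα : 0 < α) (hα1 : α < 1) (m : ℕ) : ∃ C : ℝ, 1 ≤ C ∧ ∀ (κ : ℝ), κ ≤ 0 → ∀ (w f : V3 → ℝ) (K : ℝ),
    Weak 0 (Rm m) w f → (∀ y ∈ ball 0 (Rm m), |w y| ≤ K) → (∀ y ∈ ball 0 (Rm m), f (fold κ y) = f y) →
    HB m α (Hf κ ∩ ball 0 (Rm m)) f K → HB (m+2) α (Hf κ ∩ ball 0 1) w (C * K) := by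
  obtain ⟨C0, hC0, hS0⟩ := schauder0 hα hα1
  induction m with
  | zero =>
    refine ⟨C0, hC0, fun κ hκ w f K hW hw hf hb => ?_⟩
    have e2 : Rm 0 = 2 := by simp [Rm]
    rw [e2] at hW hw hf hb
    have hmem : ∀ y ∈ ball (0:V3) 2, fold κ y ∈ Hf κ ∩ ball 0 2 := fun y hy => ⟨fold_mem κ y, by
      simp only [mem_ball_zero_iff] at hy ⊢; exact (fold_norm hκ y).trans_lt hy⟩
    have hb0 := (hb_zero_iff hα).1 hb
    have K0 : 0 ≤ K := (abs_nonneg _).trans (hw 0 (by simp))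
    have := hS0 0 w f K hW hw ⟨hW.2.1, fun y hy => by rw [← hf y hy]; exact hb0.1 _ (hmem y hy), fun y hy z hz => by
      rw [← hf y hy, ← hf z hz]
      refine (hb0.2 _ (hmem y hy) _ (hmem z hz)).trans ?_
      gcongr; exact fold_dist κ y z⟩
    exact this.subset isOpen_ball.uniqueDiffOn (hfb_unique hκ one_pos) inter_subset_right
  | succ m ih =>
    obtain ⟨C1, hC1, ih⟩ := ih
    obtain ⟨D, hDe⟩ : ∃ D, D = 2 * Rm (m+1) := ⟨_, rfl⟩
    have hR : Rm (m+1) = Rm m + 3 := by simp [Rm]; ring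
    have hRm : 2 ≤ Rm m := by simp [Rm]
    have hD1 : 1 ≤ D := by rw [hDe, hR]; linarith
    -- constant for C² bound
    set C2 := C0 * D with hC2
    have hC2D : D ≤ C2 := by nlinarith
    have hC21 : 1 ≤ C2 := by linarith
    set C3 := C1 * C2 with hC3
    have hC3' : 1 ≤ C3 := by nlinarith
    refine ⟨3 * (3 * (3 * (3 * C3))), by linarith, fun κ hκ w f K hW hw hf hb => ?_⟩
    have K0 : 0 ≤ K := (abs_nonneg _).trans (hw 0 (by simp; linarith))
    set S := Hf κ ∩ ball (0:V3) (Rm (m+1)) with hSdef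
    have hSu : UniqueDiffOn ℝ S := hfb_unique hκ (by linarith)
    have hSc : Convex ℝ S := hfb_convex κ _
    have hSD : ∀ x ∈ S, ∀ y ∈ S, dist x y ≤ D := fun x hx y hy => by
      have h1 := hx.2; have h2 := hy.2
      have := dist_triangle_right x y 0
      rw [mem_ball] at h1 h2; linarith
    have hmem : ∀ y ∈ ball (0:V3) (Rm (m+1)), fold κ y ∈ S := fun y hy => ⟨fold_mem κ y, by
      simp only [mem_ball_zero_iff] at hy ⊢; exact (fold_norm hκ y).trans_lt hy⟩
    have hfH := hb.holder0 hα hα1 hSu hSc K0 hD1 hSD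
    -- C2 on big ball
    have hC2b : ∀ x0 ∈ ball (0:V3) (Rm m + 1), HB 2 α (ball x0 1) w (C2 * K) := by
      intro x0 hx0
      have hin : ball x0 2 ⊆ ball 0 (Rm (m+1)) := by
        apply ball_subset_ball'
        rw [mem_ball] at hx0; linarith
      have := hS0 x0 w f (D * K) ⟨hW.1, hW.2.1, fun x s hs hx => hW.2.2 x s hs (by
        have := dist_triangle x x0 0; rw [mem_ball] at hx0; linarith)⟩ (fun y hy => (hw y (hin hy)).trans (by nlinarith))
        ⟨hW.2.1, fun y hy => by rw [← hf y (hin hy)]; exact (hb.norm_le (hmem y (hin hy))).trans (by nlinarith), fun y hy z hz => by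
          rw [← hf y (hin hy), ← hf z (hin hz)]
          refine (hfH _ (hmem y (hin hy)) _ (hmem z (hin hz))).trans ?_
          gcongr; exact fold_dist κ y z⟩
      rwa [← mul_assoc] at this
    set B := ball (0:V3) (Rm m + 1) with hB
    have hBo : IsOpen B := isOpen_ball
    have hwC2 : ContDiffOn ℝ 2 w B := fun x hx =>
      ((hC2b x hx).cd.contDiffAt (ball_mem_nhds x one_pos)).contDiffWithinAt
    have hgb : ∀ x ∈ B, ‖fderiv ℝ w x‖ ≤ C2 * K := fun x hx => by
      have := (HB.grad isOpen_ball.uniqueDiffOn (hC2b x hx)).norm_le (mem_ball_self one_pos)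
      rwa [fderivWithin_of_isOpen isOpen_ball (mem_ball_self one_pos)] at this
    set T := Hf κ ∩ ball (0:V3) 1 with hT
    have hTu : UniqueDiffOn ℝ T := hfb_unique hκ one_pos
    have hTB : T ⊆ B := fun x hx => ball_subset_ball (by linarith) hx.2
    have hTS : T ⊆ S := inter_subset_inter_right _ (ball_subset_ball (by linarith))
    have hfg : ContDiffOn ℝ 1 (fderiv ℝ w) B := hwC2.fderiv_of_isOpen hBo (by norm_num)
    have hpd : ∀ i, ContDiffOn ℝ 1 (fun y => fderiv ℝ w y (ee i)) B := fun i => hfg.clm_apply contDiffOn_const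
    have hBS : B ⊆ ball (0:V3) (Rm (m+1)) := ball_subset_ball (by linarith)
    -- tangential derivatives
    have tang : ∀ i : Fin 3, (ee i : V3) 2 = 0 → HB (m+2) α T (fun y => fderiv ℝ w y (ee i)) (C3 * K) := by
      intro i hi
      have hfcont : ContinuousOn (fun y => fderivWithin ℝ f S (fold κ y) (ee i)) B := by
        have h1 : ContinuousOn (fun y => fderivWithin ℝ f S y (ee i)) S := (hb.pd K0 hSu i).cd.continuousOn
        exact h1.comp (fold_cont κ).continuousOn (fun y hy => hmem y (hBS hy))
      obtain ⟨g, hg, hge⟩ := exists_ext (r := Rm m + 1/2) (ρ := Rm m + 1) (by linarith) (by linarith) (hpd i).continuousOn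
      obtain ⟨k, hk, hke⟩ := exists_ext (r := Rm m + 1/2) (ρ := Rm m + 1) (by linarith) (by linarith) hfcont
      have hsub : ∀ y ∈ ball (0:V3) (Rm m), dist y 0 ≤ Rm m + 1/2 := fun y hy => by
        rw [mem_ball] at hy; linarith
      have hsubB : ∀ y ∈ ball (0:V3) (Rm m), y ∈ B := fun y hy => ball_subset_ball (by linarith) hy
      have hWm : Weak 0 (Rm m) w f := ⟨hW.1, hW.2.1, fun x s hs hx => hW.2.2 x s hs (by linarith)⟩
      have hW' : Weak 0 (Rm m) g k := by
        refine weak_deriv (τ := ee i) hWm hg hk (fun y hy => ?_) (fun y hy => ?_)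
        · rw [hge y (hsub y hy)]
          have h1 : HasFDerivAt w (fderiv ℝ w y) y :=
            ((hwC2.contDiffAt (hBo.mem_nhds (hsubB y hy))).differentiableAt (by norm_num)).hasFDerivAt
          have h2 : HasDerivAt (fun h : ℝ => y + h • (ee i : V3)) (ee i) 0 := by
            simpa using ((hasDerivAt_id (0:ℝ)).smul_const (ee i : V3)).const_add y
          have h1' : HasFDerivAt w (fderiv ℝ w y) (y + (0:ℝ) • ee i) := by simpa using h1
          exact h1'.comp_hasDerivAt (0:ℝ) h2
        · rw [hke y (hsub y hy)]
          have hyB := hBS (hsubB y hy)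
          have hd : HasFDerivWithinAt f (fderivWithin ℝ f S (fold κ y)) S (fold κ y) :=
            ((hb.cd.differentiableOn (by simp)) _ (hmem y hyB)).hasFDerivWithinAt
          have h2 : HasDerivAt (fun h : ℝ => fold κ y + h • (ee i : V3)) (ee i) 0 := by
            simpa using ((hasDerivAt_id (0:ℝ)).smul_const (ee i : V3)).const_add (fold κ y)
          have hev : ∀ᶠ h : ℝ in 𝓝 0, y + h • (ee i : V3) ∈ ball (0:V3) (Rm (m+1)) := by
            have hc : Continuous fun h : ℝ => y + h • (ee i : V3) := by fun_prop
            apply hc.continuousAt.eventually_mem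
            simpa using isOpen_ball.mem_nhds hyB
          have h2' : HasDerivWithinAt (fun h : ℝ => fold κ y + h • (ee i : V3)) (ee i) {h | y + h • (ee i : V3) ∈ ball (0:V3) (Rm (m+1))} 0 := h2.hasDerivWithinAt
          have hd' : HasFDerivWithinAt f (fderivWithin ℝ f S (fold κ y)) S (fold κ y + (0:ℝ) • ee i) := by simpa using hd
          have h3 := hd'.comp_hasDerivWithinAt (0:ℝ) h2' (fun h hh => by
            rw [← fold_add κ y hi]; exact hmem _ hh)
          have h4 := h3.hasDerivAt hev
          refine h4.congr_of_eventuallyEq ?_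
          filter_upwards [hev] with h hh
          simp only [Function.comp]
          rw [← fold_add κ y hi, hf _ hh]
      have hKK : K ≤ C2 * K := by nlinarith
      have hHBk : HB m α (Hf κ ∩ ball 0 (Rm m)) k (C2 * K) := by
        have h1 := (hb.pd K0 hSu i).mono hKK
        have h2 := h1.subset hSu (hfb_unique hκ (R := Rm m) (by linarith)) (inter_subset_inter_right _ (ball_subset_ball (by linarith)))
        refine h2.congr fun y hy => ?_
        rw [hke y (hsub y hy.2), fold_eq hy.1]
      have := ih κ hκ g k (C2 * K) hW' (fun y hy => by
        rw [hge y (hsub y hy)]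
        refine (((fderiv ℝ w y).le_opNorm _).trans ?_)
        rw [ee_norm, mul_one]; exact hgb y (hsubB y hy)) (fun y hy => by
        rw [hke y (hsub y hy), hke _ (by simp only [dist_zero_right]; have := hsub y hy; have := fold_norm hκ y; rw [dist_zero_right] at *; linarith), fold_eq (fold_mem κ y)]) hHBk
      rw [hC3, mul_assoc]
      refine this.congr fun y hy => ?_
      rw [hge y (by have := hy.2; rw [mem_ball] at this; linarith)]
    have hC3K : C2 * K ≤ C3 * K := by gcongr; nlinarith
    have hKC3 : K ≤ C3 * K := by nlinarith
    have C3K0 : 0 ≤ C3 * K := by linarith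
    have h0 := tang 0 (by simp [ee])
    have h1 := tang 1 (by simp [ee])
    have hwin : ∀ i, ∀ x ∈ T, fderivWithin ℝ (fun y => fderiv ℝ w y (ee i)) T x = fderiv ℝ (fun y => fderiv ℝ w y (ee i)) x := fun i x hx =>
      (((hpd i).contDiffAt (hBo.mem_nhds (hTB hx))).differentiableAt (by norm_num)).fderivWithin (hTu x hx)
    have hw1 : ∀ x ∈ T, fderivWithin ℝ w T x = fderiv ℝ w x := fun x hx =>
      ((hwC2.contDiffAt (hBo.mem_nhds (hTB hx))).differentiableAt (by norm_num)).fderivWithin (hTu x hx)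
    have hb1 : ∀ i, ∀ x ∈ T, ‖fderiv ℝ w x (ee i)‖ ≤ C3 * K := fun i x hx => by
      refine (((fderiv ℝ w x).le_opNorm _).trans ?_)
      rw [ee_norm, mul_one]; exact (hgb x (hTB hx)).trans hC3K
    have h2 : HB (m+2) α T (fun y => fderiv ℝ w y (ee 2)) (3 * (3 * (3 * C3 * K))) := by
      refine HB.of_pd (by nlinarith) hTu (fun x hx => (((hpd 2).contDiffAt (hBo.mem_nhds (hTB hx))).differentiableAt (by norm_num)).differentiableWithinAt)
        (fun x hx => (hb1 2 x hx).trans (by nlinarith)) fun i => ?_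
      have c0 : HB (m+1) α T (fun x => fderivWithin ℝ (fun y => fderiv ℝ w y (ee 0)) T x (ee 2)) (C3 * K) := h0.pd C3K0 hTu 2
      have c1 : HB (m+1) α T (fun x => fderivWithin ℝ (fun y => fderiv ℝ w y (ee 1)) T x (ee 2)) (C3 * K) := h1.pd C3K0 hTu 2
      fin_cases i
      · refine HB.mono (K := C3 * K) (HB.congr c0 fun x hx => ?_) (by nlinarith)
        simp only [Fin.zero_eta, Fin.mk_one, Fin.reduceFinMk]
        rw [hwin 2 x hx, hwin 0 x hx]
        exact pd_lapl_comm hBo hwC2 (hTB hx) _ _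
      · refine HB.mono (K := C3 * K) (HB.congr c1 fun x hx => ?_) (by nlinarith)
        simp only [Fin.zero_eta, Fin.mk_one, Fin.reduceFinMk]
        rw [hwin 2 x hx, hwin 1 x hx]
        exact pd_lapl_comm hBo hwC2 (hTB hx) _ _
      · have d0 := (h0.pd C3K0 hTu 0).const_smul hTu (-1)
        have d1 := (h1.pd C3K0 hTu 1).const_smul hTu (-1)
        have df := hb.subset hSu hTu hTS
        have := (df.add hTu d0).add hTu d1
        refine HB.mono (K := _) (HB.congr this fun x hx => ?_) (K' := 3 * (3 * C3 * K)) (by simp; nlinarith)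
        simp only [Fin.zero_eta, Fin.mk_one, Fin.reduceFinMk]
        rw [hwin 2 x hx, hwin 0 x hx, hwin 1 x hx]
        have hl := lapl_of_weak (ρ := Rm m + 1) ⟨hW.1, hW.2.1, fun x s hs hx => hW.2.2 x s hs (by linarith)⟩ hwC2 x (hTB hx)
        rw [lapl, Fin.sum_univ_three] at hl
        rw [← hl]; simp only [smul_eq_mul]; ring
    have hfin : HB (m+2+1) α T w (3 * (3 * (3 * (3 * C3 * K)))) := by
      refine HB.of_pd (by nlinarith) hTu (fun x hx => (((hwC2).contDiffAt (hBo.mem_nhds (hTB hx))).differentiableAt (by norm_num)).differentiableWithinAt)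
        (fun x hx => (hw x (hBS (hTB hx))).trans (by nlinarith)) fun i => ?_
      refine HB.congr (u := fun y => fderiv ℝ w y (ee i)) ?_ (fun x hx => by simp only [hw1 x hx])
      fin_cases i
      · exact h0.mono (by nlinarith)
      · exact h1.mono (by nlinarith)
      · exact h2
    exact hfin.mono (by nlinarith)
end

section
open scoped Pointwise

def sim (p : V3) (R : ℝ) (U : V3 ≃ₗᵢ[ℝ] V3) (x : V3) : V3 := p + R • U x

lemma sim_cont (p : V3) (R : ℝ) (U : V3 ≃ₗᵢ[ℝ] V3) : Continuous (sim p R U) := by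
  have := U.continuous; unfold sim; fun_prop

lemma sim_dist {p : V3} {R : ℝ} (hR : 0 < R) {U : V3 ≃ₗᵢ[ℝ] V3} (x y : V3) : dist (sim p R U x) (sim p R U y) = R * dist x y := by
  simp only [sim, dist_add_left, dist_smul₀, U.dist_map, norm_eq_abs, abs_of_pos hR]

lemma sim_zero (p : V3) (R : ℝ) (U : V3 ≃ₗᵢ[ℝ] V3) : sim p R U 0 = p := by simp [sim]

lemma sim_dist0 {p : V3} {R : ℝ} (hR : 0 < R) {U : V3 ≃ₗᵢ[ℝ] V3} (x : V3) : dist (sim p R U x) p = R * dist x 0 := by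
  rw [← sim_dist hR (U := U) (p := p), sim_zero]

def simL (R : ℝ) (hR : 0 < R) (U : V3 ≃ₗᵢ[ℝ] V3) : V3 ≃L[ℝ] V3 :=
  U.toContinuousLinearEquiv.trans (ContinuousLinearEquiv.smulLeft (Units.mk0 R hR.ne'))

lemma simL_apply {R : ℝ} (hR : 0 < R) (U : V3 ≃ₗᵢ[ℝ] V3) (x : V3) : simL R hR U x = R • U x := rfl

lemma mol_sim {k : V3 → ℝ} (hk : ∀ (U : V3 ≃ₗᵢ[ℝ] V3) ξ, k (U ξ) = k ξ) (p : V3) (R s : ℝ) (U : V3 ≃ₗᵢ[ℝ] V3) (w : V3 → ℝ) (x : V3) :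
    Mol k s (fun y => w (sim p R U y)) x = Mol k (R * s) w (sim p R U x) := by
  unfold Mol
  rw [← U.measurePreserving.integral_comp U.toHomeomorph.measurableEmbedding (fun ξ => w (sim p R U x - (R * s) • ξ) • k ξ)]
  congr 1; ext ξ
  rw [hk]
  congr 2
  simp only [sim, map_sub, map_smul, smul_sub, mul_smul, add_sub_assoc]

lemma phi_iso (U : V3 ≃ₗᵢ[ℝ] V3) (ξ : V3) : phi (U ξ) = phi ξ := by simp [phi]
lemma eta_iso (U : V3 ≃ₗᵢ[ℝ] V3) (ξ : V3) : eta (U ξ) = eta ξ := by simp [eta]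

lemma weak_sim {p : V3} {R ρ : ℝ} (hR : 0 < R) (U : V3 ≃ₗᵢ[ℝ] V3) {w f : V3 → ℝ} (h : Weak p (R * ρ) w f) :
    Weak 0 ρ (fun y => w (sim p R U y)) (fun y => R ^ 2 * f (sim p R U y)) := by
  refine ⟨h.1.comp (sim_cont p R U), (h.2.1.comp (sim_cont p R U)).const_smul (R^2), fun x s hs hx => ?_⟩
  have := h.2.2 (sim p R U x) (R * s) (by positivity) (by rw [sim_dist0 hR]; nlinarith)
  unfold dfct at *
  rw [mol_sim phi_iso]
  refine Eq.trans ?_ this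
  congr 1
  have e : ∀ σ : ℝ, σ * Mol eta σ (fun y => R ^ 2 * f (sim p R U y)) x = R * ((R * σ) * Mol eta (R * σ) f (sim p R U x)) := fun σ => by
    have : Mol eta σ (fun y => R ^ 2 * f (sim p R U y)) x = R ^ 2 * Mol eta σ (fun y => f (sim p R U y)) x := by
      unfold Mol; rw [← integral_const_mul]; congr 1; ext ξ; simp only [smul_eq_mul]; ring
    rw [this, mol_sim eta_iso]; ring
  simp_rw [e]
  rw [intervalIntegral.integral_const_mul, intervalIntegral.mul_integral_comp_mul_left (f := fun σ => σ * Mol eta σ f (sim p R U x))]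
  rw [mul_zero]

lemma simL_norm {R : ℝ} (hR : 0 < R) (U : V3 ≃ₗᵢ[ℝ] V3) : ‖(simL R hR U : V3 →L[ℝ] V3)‖ ≤ R := by
  refine ContinuousLinearMap.opNorm_le_bound _ hR.le fun x => ?_
  show ‖R • U x‖ ≤ _
  rw [norm_smul, U.norm_map, norm_eq_abs, abs_of_pos hR]

lemma simL_symm_norm {R : ℝ} (hR : 0 < R) (U : V3 ≃ₗᵢ[ℝ] V3) : ‖((simL R hR U).symm : V3 →L[ℝ] V3)‖ ≤ R⁻¹ := by
  refine ContinuousLinearMap.opNorm_le_bound _ (by positivity) fun x => ?_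
  obtain ⟨y, rfl⟩ := (simL R hR U).surjective x
  simp only [ContinuousLinearEquiv.coe_coe, ContinuousLinearEquiv.symm_apply_apply]
  rw [simL_apply, norm_smul, U.norm_map, norm_eq_abs, abs_of_pos hR]; field_simp; exact le_rfl

lemma simL_comp {R : ℝ} (hR : 0 < R) (U : V3 ≃ₗᵢ[ℝ] V3) {j : ℕ} (T : V3 [×j]→L[ℝ] ℝ) :
    ‖T.compContinuousLinearMap (fun _ => (simL R hR U : V3 →L[ℝ] V3))‖ = R ^ j * ‖T‖ := by
  set g := simL R hR U
  have up : ∀ (L : V3 →L[ℝ] V3) (c : ℝ), ‖L‖ ≤ c → ∀ T : V3 [×j]→L[ℝ] ℝ, ‖T.compContinuousLinearMap (fun _ => L)‖ ≤ c ^ j * ‖T‖ := by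
    intro L c hL T
    refine (T.norm_compContinuousLinearMap_le _).trans ?_
    rw [mul_comm, Finset.prod_const, Finset.card_univ, Fintype.card_fin]
    gcongr
  apply le_antisymm (up _ _ (simL_norm hR U) T)
  have h2 := up _ _ (simL_symm_norm hR U) (T.compContinuousLinearMap (fun _ => (g : V3 →L[ℝ] V3)))
  have e : (T.compContinuousLinearMap (fun _ => (g : V3 →L[ℝ] V3))).compContinuousLinearMap (fun _ => (g.symm : V3 →L[ℝ] V3)) = T := by
    ext v; simp
  change ‖(T.compContinuousLinearMap (fun _ => (g : V3 →L[ℝ] V3))).compContinuousLinearMap (fun _ => (g.symm : V3 →L[ℝ] V3))‖ ≤ _ at h2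
  rw [e] at h2
  calc R ^ j * ‖T‖ ≤ R ^ j * (R⁻¹ ^ j * ‖T.compContinuousLinearMap fun x => (g : V3 →L[ℝ] V3)‖) := by gcongr
    _ = _ := by rw [← mul_assoc, ← mul_pow, mul_inv_cancel₀ hR.ne', one_pow, one_mul]

lemma uniqueDiffOn_sim {p : V3} {R : ℝ} (hR : 0 < R) (U : V3 ≃ₗᵢ[ℝ] V3) {S : Set V3} (hS : UniqueDiffOn ℝ S) : UniqueDiffOn ℝ ((-p) +ᵥ S) := by
  intro x hx
  obtain ⟨y, hy, rfl⟩ := hx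
  have := (hasFDerivAt_id (𝕜 := ℝ) y).const_add (-p)
  have h2 := (hS y hy).mono_nhds (t := S) le_rfl
  have := HasFDerivWithinAt.uniqueDiffWithinAt (f := fun x => -p + x) this.hasFDerivWithinAt (hS y hy) (by simpa using Function.surjective_id.denseRange)
  exact this

lemma iter_sim {p : V3} {R : ℝ} (hR : 0 < R) (U : V3 ≃ₗᵢ[ℝ] V3) {S : Set V3} (hS : UniqueDiffOn ℝ S) (w : V3 → ℝ) {x : V3} (hx : sim p R U x ∈ S) (j : ℕ) :
    iteratedFDerivWithin ℝ j (fun y => w (sim p R U y)) (sim p R U ⁻¹' S) x =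
      (iteratedFDerivWithin ℝ j w S (sim p R U x)).compContinuousLinearMap (fun _ => (simL R hR U : V3 →L[ℝ] V3)) := by
  have e1 : sim p R U ⁻¹' S = (simL R hR U) ⁻¹' ((-p) +ᵥ S) := by
    ext y; rw [mem_preimage, mem_preimage, mem_vadd_set_iff_neg_vadd_mem]; simp [sim, simL_apply]
  have := ContinuousLinearEquiv.iteratedFDerivWithin_comp_right (simL R hR U) (fun z => w (p + z)) (uniqueDiffOn_sim hR U (p := p) hS) (x := x)
    (by have h : x ∈ sim p R U ⁻¹' S := hx
        rw [e1] at h; exact h) j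
  rw [iteratedFDerivWithin_comp_add_left, vadd_vadd, add_neg_cancel, zero_vadd] at this
  rw [e1]
  exact this

lemma contDiffOn_sim {p : V3} {R : ℝ} (hR : 0 < R) (U : V3 ≃ₗᵢ[ℝ] V3) {S : Set V3} {w : V3 → ℝ} {n : WithTop ℕ∞} :
    ContDiffOn ℝ n (fun y => w (sim p R U y)) (sim p R U ⁻¹' S) ↔ ContDiffOn ℝ n w S := by
  constructor
  · intro h
    have hc : ContDiff ℝ n (fun y : V3 => (simL R hR U).symm (y - p)) := (simL R hR U).symm.contDiff.comp (by fun_prop)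
    have h1 : ∀ y, sim p R U ((simL R hR U).symm (y - p)) = y := fun y => by
      have : R • U ((simL R hR U).symm (y - p)) = y - p := (simL R hR U).apply_symm_apply (y - p)
      rw [sim, this, add_sub_cancel]
    have := h.comp hc.contDiffOn (s := S) (fun y hy => by rw [mem_preimage, h1]; exact hy)
    refine this.congr fun y hy => by simp only [Function.comp, h1]
  · intro h
    have hc : ContDiff ℝ n (sim p R U) := contDiff_const.add ((simL R hR U).contDiff)
    exact h.comp hc.contDiffOn (mapsTo_preimage _ _)

lemma local_est {α : ℝ} (hα : 0 < α) (hα1 : α < 1) : ∃ C : ℝ, 1 ≤ C ∧ ∀ (p : V3) (R : ℝ) (hR : 0 < R) (U : V3 ≃ₗᵢ[ℝ] V3) (κ : ℝ) (hκ : κ ≤ 0)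
    (S : Set V3) (hS : UniqueDiffOn ℝ S) (hSA : ∀ x ∈ ball (0:V3) 14, sim p R U x ∈ S ↔ κ ≤ x 2) (w f : V3 → ℝ) (K : ℝ),
    Weak p (R * 14) w f → (∀ y ∈ ball p (R * 14), |w y| ≤ K) →
    (∀ x ∈ ball (0:V3) 14, f (sim p R U (fold κ x)) = f (sim p R U x)) →
    ContDiffOn ℝ 4 f (S ∩ ball p (R * 14)) →
    (∀ j ≤ 4, ∀ y ∈ S ∩ ball p (R * 14), R ^ (j + 2) * ‖iteratedFDerivWithin ℝ j f S y‖ ≤ K) →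
    (∀ y ∈ S ∩ ball p (R * 14), ∀ z ∈ S ∩ ball p (R * 14),
      R ^ 6 * R ^ α * ‖iteratedFDerivWithin ℝ 4 f S y - iteratedFDerivWithin ℝ 4 f S z‖ ≤ K * dist y z ^ α) →
    ContDiffOn ℝ 6 w (S ∩ ball p R) ∧
    (∀ j ≤ 6, ∀ y ∈ S ∩ ball p R, R ^ j * ‖iteratedFDerivWithin ℝ j w S y‖ ≤ C * K) ∧
    (∀ y ∈ S ∩ ball p R, ∀ z ∈ S ∩ ball p R,
      R ^ 6 * R ^ α * ‖iteratedFDerivWithin ℝ 6 w S y - iteratedFDerivWithin ℝ 6 w S z‖ ≤ C * K * dist y z ^ α) ∧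
    ContDiffOn ℝ 2 w (ball p R) := by
  obtain ⟨C, hC1, hC⟩ := claim hα hα1 4
  obtain ⟨C0, hC0, hS0⟩ := schauder0 hα hα1
  have eR : Rm 4 = 14 := by norm_num [Rm]
  rw [eR] at hC
  refine ⟨C, hC1, fun p R hR U κ hκ S hS hSA w f K hW hw hfe hf4 hfb hfh => ?_⟩
  have K0 : 0 ≤ K := (abs_nonneg _).trans (hw p (by simp [hR]))
  have hBl : ∀ ρ, ∀ x, sim p R U x ∈ ball p (R * ρ) ↔ x ∈ ball (0:V3) ρ := fun ρ x => by
    rw [mem_ball, mem_ball, sim_dist0 hR]; exact mul_lt_mul_iff_right₀ hR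
  have pre : ∀ ρ ≤ 14, sim p R U ⁻¹' (S ∩ ball p (R * ρ)) = Hf κ ∩ ball 0 ρ := by
    intro ρ hρ; ext x
    rw [mem_preimage, mem_inter_iff, mem_inter_iff, hBl]
    constructor
    · rintro ⟨h1, h2⟩; exact ⟨(hSA x (ball_subset_ball hρ h2)).1 h1, h2⟩
    · rintro ⟨h1, h2⟩; exact ⟨(hSA x (ball_subset_ball hρ h2)).2 h1, h2⟩
  have hSb : ∀ ρ, UniqueDiffOn ℝ (S ∩ ball p (R * ρ)) := fun ρ => hS.inter isOpen_ball
  have iter : ∀ (u : V3 → ℝ) (j : ℕ) ρ, ρ ≤ 14 → ∀ x ∈ Hf κ ∩ ball 0 ρ, iteratedFDerivWithin ℝ j (fun y => u (sim p R U y)) (Hf κ ∩ ball 0 ρ) x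
      = (iteratedFDerivWithin ℝ j u S (sim p R U x)).compContinuousLinearMap (fun _ => (simL R hR U : V3 →L[ℝ] V3)) := by
    intro u j ρ hρ x hx
    rw [← pre ρ hρ] at hx ⊢
    rw [iter_sim hR U (hSb ρ) u hx, iteratedFDerivWithin_inter_open isOpen_ball hx.2]
  have csub : ∀ {j : ℕ} (T T' : V3 [×j]→L[ℝ] ℝ), ‖T.compContinuousLinearMap (fun _ => (simL R hR U : V3 →L[ℝ] V3)) - T'.compContinuousLinearMap (fun _ => (simL R hR U : V3 →L[ℝ] V3))‖ = R ^ j * ‖T - T'‖ := by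
    intro j T T'
    rw [← simL_comp hR U]; congr 1
  have hdst : ∀ x y, dist (sim p R U x) (sim p R U y) ^ α = R ^ α * dist x y ^ α := fun x y => by
    rw [sim_dist hR, Real.mul_rpow hR.le dist_nonneg]
  have hHf : HB 4 α (Hf κ ∩ ball 0 14) (fun y => f (sim p R U y)) ((R^2)⁻¹ * K) := by
    refine ⟨?_, fun j hj x hx => ?_, fun x hx y hy => ?_⟩
    · rw [← pre 14 le_rfl]; exact (contDiffOn_sim hR U).2 hf4
    · rw [iter f j 14 le_rfl x hx, simL_comp]
      rw [← pre 14 le_rfl] at hx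
      have := hfb j hj _ hx
      rw [inv_mul_eq_div, le_div_iff₀ (by positivity)]
      calc _ = _ := by ring
        _ ≤ _ := this
    · rw [iter f 4 14 le_rfl x hx, iter f 4 14 le_rfl y hy, csub]
      rw [← pre 14 le_rfl] at hx hy
      have := hfh _ hx _ hy
      rw [hdst] at this
      rw [inv_mul_eq_div, div_mul_eq_mul_div, le_div_iff₀ (by positivity)]
      have hRa : 0 < R ^ α := by positivity
      refine le_of_mul_le_mul_left (a := R ^ α) ?_ hRa
      calc _ = _ := by ring
        _ ≤ _ := this
        _ = _ := by ring
  have hHf2 := hHf.const_smul (hfb_unique hκ (by norm_num)) (R^2)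
  rw [abs_of_pos (by positivity), ← mul_assoc, mul_inv_cancel₀ (by positivity), one_mul] at hHf2
  have key := hC κ hκ _ _ K (weak_sim hR U hW) (fun y hy => hw _ ((hBl 14 y).2 hy)) (fun y hy => by simp only [hfe y hy]) hHf2
  have surj : ∀ y ∈ S ∩ ball p R, ∃ x ∈ Hf κ ∩ ball 0 1, sim p R U x = y := by
    intro y hy
    have h1 : sim p R U ((simL R hR U).symm (y - p)) = y := by
      have : R • U ((simL R hR U).symm (y - p)) = y - p := (simL R hR U).apply_symm_apply (y - p)
      rw [sim, this, add_sub_cancel]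
    refine ⟨_, ?_, h1⟩
    rw [← pre 1 (by norm_num), mem_preimage, h1, mul_one]; exact hy
  refine ⟨?_, fun j hj y hy => ?_, fun y hy z hz => ?_, ?_⟩
  · have := key.cd
    rw [← pre 1 (by norm_num), contDiffOn_sim hR U, mul_one] at this
    exact_mod_cast this
  · obtain ⟨x, hx, rfl⟩ := surj y hy
    have := key.bd j hj x hx
    rwa [iter w j 1 (by norm_num) x hx, simL_comp] at this
  · obtain ⟨x, hx, rfl⟩ := surj y hy
    obtain ⟨x', hx', rfl⟩ := surj z hz
    have := key.ho x hx x' hx'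
    rw [iter w _ 1 (by norm_num) x hx, iter w _ 1 (by norm_num) x' hx', csub] at this
    rw [hdst]
    have hRa : 0 < R ^ α := by positivity
    calc _ = R ^ α * (R ^ (4+2) * ‖iteratedFDerivWithin ℝ 6 w S (sim p R U x) - iteratedFDerivWithin ℝ 6 w S (sim p R U x')‖) := by ring
      _ ≤ R ^ α * (C * K * dist x x' ^ α) := by gcongr
      _ = _ := by ring
  · have hfH := hHf2.holder0 hα hα1 (hfb_unique hκ (by norm_num)) (hfb_convex κ _) K0 (D := 28) (by norm_num) (fun x hx y hy => by
      have h1 := hx.2; have h2 := hy.2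
      have := dist_triangle_right x y 0
      rw [mem_ball] at h1 h2; linarith)
    have hmem : ∀ y ∈ ball (0:V3) 14, fold κ y ∈ Hf κ ∩ ball 0 14 := fun y hy => ⟨fold_mem κ y, by
      simp only [mem_ball_zero_iff] at hy ⊢; exact (fold_norm hκ y).trans_lt hy⟩
    have hin : ball (0:V3) 2 ⊆ ball 0 14 := ball_subset_ball (by norm_num)
    have hW14 := weak_sim hR U hW
    have h2 := hS0 0 _ _ (28 * K) ⟨hW14.1, hW14.2.1, fun x s hs hx => hW14.2.2 x s hs (by linarith)⟩
      (fun y hy => (hw _ ((hBl 14 y).2 (hin hy))).trans (by linarith)) ⟨hW14.2.1, fun y hy => by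
        have := hHf2.norm_le (hmem y (hin hy))
        simp only [Pi.smul_apply, smul_eq_mul, hfe y (hin hy)] at this
        exact this.trans (by linarith), fun y hy z hz => by
        have h := hfH _ (hmem y (hin hy)) _ (hmem z (hin hz))
        simp only [Pi.smul_apply, smul_eq_mul, hfe y (hin hy), hfe z (hin hz)] at h
        refine h.trans ?_
        gcongr; exact fold_dist κ y z⟩
    have h3 := h2.cd
    have e : sim p R U ⁻¹' (ball p R) = ball 0 1 := by
      ext x; have := hBl 1 x; rw [mul_one] at this; exact this
    rw [← e, contDiffOn_sim hR U] at h3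
    exact_mod_cast h3
end

section
/-- coefficients of the (normalised) modified Bessel series -/
def bco (κ ν : ℝ) : ℕ → ℝ
  | 0 => 1
  | (k+1) => κ / (4 * (k+1) * (ν + (k+1))) * bco κ ν k

lemma bco_nonneg {κ ν : ℝ} (hκ : 0 ≤ κ) (hν : 0 < ν) (k : ℕ) : 0 ≤ bco κ ν k := by
  induction k with
  | zero => simp [bco]
  | succ k ih => rw [bco]; positivity

lemma bco_le {κ ν : ℝ} (hκ : 0 ≤ κ) (hν : 0 < ν) (k : ℕ) : bco κ ν k ≤ κ ^ k / k.factorial := by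
  induction k with
  | zero => simp [bco]
  | succ k ih =>
    rw [bco, pow_succ, Nat.factorial_succ]
    push_cast
    have h1 : κ / (4 * (k+1) * (ν + (k+1))) ≤ κ / (k+1) := by
      apply div_le_div_of_nonneg_left hκ (by positivity)
      have : (0:ℝ) ≤ k := by positivity
      nlinarith
    calc _ ≤ κ / (k+1) * (κ ^ k / k.factorial) := mul_le_mul h1 ih (bco_nonneg hκ hν k) (by positivity)
      _ = _ := by field_simp

/-- `bel κ ν j t = Σ_k a_k (ν+2k)^j e^{(ν+2k)t}` -/
def bel (κ ν : ℝ) (j : ℕ) (t : ℝ) : ℝ := ∑' k : ℕ, bco κ ν k * (ν + 2 * k) ^ j * exp ((ν + 2 * k) * t)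

lemma bel_summ {κ ν : ℝ} (hκ : 0 ≤ κ) (hν : 0 < ν) (j : ℕ) (T : ℝ) : Summable fun k : ℕ => bco κ ν k * (ν + 2 * k) ^ j * exp ((ν + 2 * k) * T) := by
  -- (ν+2k)^j ≤ j! e^{ν+2k}
  have hs : Summable fun k : ℕ => (j.factorial * exp (ν * (1 + T))) * ((κ * exp (2 * (1+T))) ^ k / k.factorial) :=
    (Real.summable_pow_div_factorial _).mul_left _
  refine Summable.of_nonneg_of_le (fun k => ?_) (fun k => ?_) hs
  · have := bco_nonneg hκ hν k; positivity
  · have h1 := bco_le hκ hν k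
    have h2 : (ν + 2 * k) ^ j ≤ j.factorial * exp (ν + 2 * k) := by
      have := Real.pow_div_factorial_le_exp (ν + 2 * k) (by positivity) j
      rw [div_le_iff₀ (by positivity)] at this
      linarith
    calc _ ≤ (κ ^ k / k.factorial) * (j.factorial * exp (ν + 2 * k)) * exp ((ν + 2 * k) * T) := by
          gcongr
      _ = _ := by
          have e1 : exp ((ν + 2 * k)) * exp ((ν + 2 * k) * T) = exp (ν * (1 + T)) * exp (2 * (1 + T)) ^ k := by
            rw [← Real.exp_nat_mul, ← Real.exp_add, ← Real.exp_add]; congr 1; ring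
          calc _ = (κ ^ k / k.factorial) * j.factorial * (exp ((ν + 2 * k)) * exp ((ν + 2 * k) * T)) := by ring
            _ = _ := by rw [e1, mul_pow]; ring

lemma bel_deriv {κ ν : ℝ} (hκ : 0 ≤ κ) (hν : 0 < ν) (j : ℕ) (t : ℝ) : HasDerivAt (bel κ ν j) (bel κ ν (j+1) t) t := by
  refine hasDerivAt_tsum_of_isPreconnected (bel_summ hκ hν (j+1) (t+1)) (isOpen_Iio (a := t+1)) (isPreconnected_Iio)
    (g' := fun k y => bco κ ν k * (ν + 2 * k) ^ (j+1) * exp ((ν + 2 * k) * y))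
    (fun k y hy => ?_) (fun k y hy => ?_) (y₀ := t) (by simp) (bel_summ hκ hν j t) (by simp)
  · have := ((((hasDerivAt_id y).const_mul (ν + 2 * k)).exp).const_mul (bco κ ν k * (ν + 2 * k) ^ j))
    refine this.congr_deriv ?_
    simp only [id]; ring
  · have hb := bco_nonneg hκ hν k
    rw [norm_eq_abs, abs_of_nonneg (by positivity)]
    gcongr; exact le_of_lt hy

lemma bel_ode {κ ν : ℝ} (hκ : 0 ≤ κ) (hν : 0 < ν) (t : ℝ) : bel κ ν 2 t = (ν ^ 2 + κ * exp (2 * t)) * bel κ ν 0 t := by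
  have hs2 := bel_summ hκ hν 2 t
  have hs0 := bel_summ hκ hν 0 t
  have e : ∀ k : ℕ, bco κ ν k * (ν + 2 * k) ^ 2 * exp ((ν + 2 * k) * t) - ν ^ 2 * (bco κ ν k * (ν + 2 * k) ^ 0 * exp ((ν + 2 * k) * t)) =
     bco κ ν k * (4 * k * (ν + k)) * exp ((ν + 2 * k) * t) := fun k => by ring
  have hs := hs2.sub (hs0.mul_left (ν^2))
  have key : bel κ ν 2 t - ν ^ 2 * bel κ ν 0 t = κ * exp (2 * t) * bel κ ν 0 t := by
    unfold bel
    rw [← tsum_mul_left, ← hs2.tsum_sub (hs0.mul_left _), ← tsum_mul_left]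
    simp_rw [e] at hs ⊢
    rw [hs.tsum_eq_zero_add]
    simp only [Nat.cast_zero, mul_zero, zero_mul, zero_add]
    congr 1; ext k
    rw [bco]; push_cast
    have : exp ((ν + 2 * (k+1)) * t) = exp (2 * t) * exp ((ν + 2 * k) * t) := by rw [← Real.exp_add]; congr 1; ring
    rw [this]
    have h1 : (ν + (k + 1)) ≠ 0 := by positivity
    field_simp
  linarith

lemma bel_growth {κ ν : ℝ} (hκ : 0 ≤ κ) (hν : 0 < ν) {t s : ℝ} (h : t ≤ s) : bel κ ν 0 t * exp (ν * (s - t)) ≤ bel κ ν 0 s := by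
  unfold bel
  rw [← tsum_mul_right]
  refine ((bel_summ hκ hν 0 t).mul_right _).tsum_le_tsum (fun k => ?_) (bel_summ hκ hν 0 s)
  have := bco_nonneg hκ hν k
  simp only [pow_zero, mul_one]
  rw [mul_assoc, ← Real.exp_add]
  gcongr
  have : (0:ℝ) ≤ k := by positivity
  nlinarith

lemma bel_pos {κ ν : ℝ} (hκ : 0 ≤ κ) (hν : 0 < ν) (t : ℝ) : exp (ν * t) ≤ bel κ ν 0 t := by
  have := (bel_summ hκ hν 0 t).le_tsum 0 (fun k _ => by have := bco_nonneg hκ hν k; positivity)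
  simpa [bco, bel] using this

lemma bel_cont {κ ν : ℝ} (hκ : 0 ≤ κ) (hν : 0 < ν) (j : ℕ) : Continuous (bel κ ν j) :=
  continuous_iff_continuousAt.2 fun t => (bel_deriv hκ hν j t).continuousAt
end

section
lemma ode_exists {κ ν : ℝ} (hκ : 0 ≤ κ) (hν : 0 < ν) {c : ℝ → ℝ} (hc : Continuous c) {T : ℝ} (hT : 0 < T)
    (hs : ∀ t, T < |t| → c t = 0) :
    ∃ y y' : ℝ → ℝ, (∀ t, HasDerivAt y (y' t) t) ∧ (∀ t, HasDerivAt y' ((ν ^ 2 + κ * exp (2 * t)) * y t + c t) t) ∧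
      ∃ C : ℝ, ∀ t, |y t| ≤ C * exp (-(ν * |t|)) := by
  set I := bel κ ν 0 with hI
  have Ic : Continuous I := bel_cont hκ hν 0
  have Ipos : ∀ t, 0 < I t := fun t => lt_of_lt_of_le (exp_pos _) (bel_pos hκ hν t)
  set p : ℝ → ℝ := fun t => ∫ s in (-T)..t, I s * c s with hp
  have pd : ∀ t, HasDerivAt p (I t * c t) t := fun t =>
    intervalIntegral.integral_hasDerivAt_right ((Ic.mul hc).intervalIntegrable _ _)
      ((Ic.mul hc).stronglyMeasurableAtFilter _ _) (Ic.mul hc).continuousAt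
  have pc : Continuous p := continuous_iff_continuousAt.2 fun t => (pd t).continuousAt
  have p0 : ∀ t, t ≤ -T → p t = 0 := by
    intro t ht
    simp only [hp]
    rw [intervalIntegral.integral_symm, neg_eq_zero]
    rw [← intervalIntegral.integral_zero (a := t) (b := -T) (μ := volume)]
    apply intervalIntegral.integral_congr
    intro s hs'
    rw [uIcc_of_le ht] at hs'
    have hcz : ∀ s ∈ Ioo t (-T), c s = 0 := fun s h => hs s (by rw [abs_of_neg (by linarith [h.2])]; linarith [h.2])
    rcases eq_or_lt_of_le hs'.2 with e | e
    · have : c s = 0 := by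
        have hcl : c ⁻¹' {0} = c ⁻¹' {0} := rfl
        have hclosed : IsClosed (c ⁻¹' {0}) := isClosed_singleton.preimage hc
        have : Iio (-T) ⊆ c ⁻¹' {0} := fun x hx => hs x (by rw [abs_of_neg (by linarith [mem_Iio.1 hx])]; linarith [mem_Iio.1 hx])
        have h2 := hclosed.closure_subset_iff.2 this
        rw [closure_Iio] at h2
        exact h2 (by simp [e])
      simp [this]
    · have : c s = 0 := hs s (by rw [abs_of_neg (by linarith)]; linarith)
      simp [this]
  have p1 : ∀ t, T ≤ t → p t = p T := by
    intro t ht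
    have : ∫ s in T..t, I s * c s = 0 := by
      rw [← intervalIntegral.integral_zero (a := T) (b := t) (μ := volume)]
      apply intervalIntegral.integral_congr_ae
      refine Eventually.of_forall fun s hs' => ?_
      rw [uIoc_of_le ht] at hs'
      rw [hs s (by rw [abs_of_pos (by linarith [hs'.1])]; exact hs'.1), mul_zero]
    simp only [hp]
    have hh : Continuous fun s => I s * c s := Ic.mul hc
    rw [← intervalIntegral.integral_add_adjacent_intervals (hh.intervalIntegrable (-T) T) (hh.intervalIntegrable T t), this, add_zero]
  obtain ⟨P0, hP0⟩ := isCompact_Icc.exists_bound_of_continuousOn (s := Icc (-T) T) pc.continuousOn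
  have pb : ∀ t, |p t| ≤ P0 := by
    intro t
    rcases le_total t (-T) with h | h
    · rw [p0 t h, abs_zero]; exact (norm_nonneg _).trans (hP0 0 ⟨by linarith, hT.le⟩)
    · rcases le_total t T with h' | h'
      · exact hP0 t ⟨h, h'⟩
      · rw [p1 t h']; exact hP0 T ⟨by linarith, le_rfl⟩
  have P0nn : 0 ≤ P0 := (abs_nonneg _).trans (pb 0)
  set g : ℝ → ℝ := fun s => (I s)⁻¹ * (I s)⁻¹ * p s with hg
  have gc : Continuous g := ((Ic.inv₀ fun s => (Ipos s).ne').mul (Ic.inv₀ fun s => (Ipos s).ne')).mul pc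
  have gb : ∀ t s, t ≤ s → I t * |g s| ≤ P0 * exp (ν * t) * exp ((-(2 * ν)) * s) := by
    intro t s h
    have h1 := bel_growth hκ hν h
    have h2 := bel_pos hκ hν s
    have h3 : I t * (I s)⁻¹ ≤ exp (-(ν * (s - t))) := by
      rw [← div_eq_mul_inv, div_le_iff₀ (Ipos s)]
      calc I t = exp (-(ν * (s - t))) * (I t * exp (ν * (s - t))) := by
            rw [mul_comm, mul_assoc, ← Real.exp_add]; simp
        _ ≤ _ := by gcongr
    have h4 : (I s)⁻¹ ≤ exp (-(ν * s)) := by rw [Real.exp_neg]; exact inv_anti₀ (exp_pos _) h2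
    have h5 : 0 < (I s)⁻¹ := inv_pos.2 (Ipos s)
    calc I t * |g s| = (I t * (I s)⁻¹) * (I s)⁻¹ * |p s| := by
          simp only [hg, abs_mul, abs_of_pos h5]; ring
      _ ≤ exp (-(ν * (s - t))) * exp (-(ν * s)) * P0 := by
          have := Ipos t
          gcongr; exact pb s
      _ = _ := by
          rw [mul_comm, mul_assoc, ← Real.exp_add, ← Real.exp_add]; congr 2; ring
  have hν2 : -(2 * ν) < 0 := by linarith
  have gint : ∀ t, IntegrableOn g (Ioi t) := by
    intro t
    refine Integrable.mono' ((integrableOn_exp_mul_Ioi hν2 t).const_mul ((I t)⁻¹ * (P0 * exp (ν * t)))) gc.aestronglyMeasurable ?_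
    refine (ae_restrict_mem measurableSet_Ioi).mono fun s hs' => ?_
    rw [norm_eq_abs, mul_assoc, ← div_eq_inv_mul, le_div_iff₀ (Ipos t), mul_comm]
    exact gb t s (le_of_lt hs')
  set u : ℝ → ℝ := fun t => (∫ s in (0:ℝ)..t, g s) - ∫ s in Ioi 0, g s with hu
  have ud : ∀ t, HasDerivAt u (g t) t := fun t =>
    (intervalIntegral.integral_hasDerivAt_right (gc.intervalIntegrable _ _)
      (gc.stronglyMeasurableAtFilter _ _) gc.continuousAt).sub_const _
  have ue : ∀ t, u t = - ∫ s in Ioi t, g s := by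
    intro t
    have := intervalIntegral.integral_interval_add_Ioi (gint 0) (gint t)
    simp only [hu]; linarith
  have yb : ∀ t, I t * |u t| ≤ P0 / (2 * ν) * exp (-(ν * t)) := by
    intro t
    rw [ue, abs_neg]
    calc I t * |∫ s in Ioi t, g s| = ‖∫ s in Ioi t, I t * g s‖ := by
          rw [integral_const_mul, norm_mul, norm_eq_abs, norm_eq_abs, abs_of_pos (Ipos t)]
      _ ≤ ∫ s in Ioi t, P0 * exp (ν * t) * exp ((-(2 * ν)) * s) := by
          refine norm_integral_le_of_norm_le ((integrableOn_exp_mul_Ioi hν2 t).const_mul _) ?_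
          refine (ae_restrict_mem measurableSet_Ioi).mono fun s hs' => ?_
          rw [norm_mul, norm_eq_abs, norm_eq_abs, abs_of_pos (Ipos t)]
          exact gb t s (le_of_lt hs')
      _ = _ := by
          rw [integral_const_mul, integral_exp_mul_Ioi hν2]
          have : exp (-(ν * t)) = exp (ν * t) * exp (-(2 * ν) * t) := by rw [← Real.exp_add]; congr 1; ring
          rw [this]; field_simp
  have ub : ∀ t, t ≤ 0 → |u t| ≤ P0 / (2 * ν) * exp (2 * ν * T) := by
    have base : ∀ t, -T ≤ t → t ≤ 0 → |u t| ≤ P0 / (2 * ν) * exp (2 * ν * T) := by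
      intro t h h'
      have h1 := yb t
      have h2 := bel_pos hκ hν t
      have h3 : exp (ν * t) * |u t| ≤ P0 / (2 * ν) * exp (-(ν * t)) := (mul_le_mul_of_nonneg_right h2 (abs_nonneg _)).trans h1
      have h4 : |u t| ≤ P0 / (2 * ν) * exp (-(ν * t)) * exp (-(ν * t)) := by
        calc |u t| = exp (ν * t) * |u t| * exp (-(ν * t)) := by
              rw [mul_comm (exp _), mul_assoc, ← Real.exp_add]; simp
          _ ≤ _ := by gcongr
      refine h4.trans ?_
      rw [mul_assoc, ← Real.exp_add]
      gcongr
      nlinarith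
    intro t h
    rcases le_total (-T) t with h' | h'
    · exact base t h' h
    · have : u t = u (-T) := by
        simp only [hu]
        have e : ∫ s in t..(-T), g s = 0 := by
          rw [← intervalIntegral.integral_zero (a := t) (b := -T) (μ := volume)]
          apply intervalIntegral.integral_congr
          intro s hs'
          rw [uIcc_of_le h'] at hs'
          simp [hg, p0 s hs'.2]
        have := intervalIntegral.integral_add_adjacent_intervals (gc.intervalIntegrable (μ := volume) 0 t) (gc.intervalIntegrable t (-T))
        linarith
      rw [this]; exact base _ le_rfl (by linarith)
  refine ⟨fun t => I t * u t, fun t => bel κ ν 1 t * u t + (I t)⁻¹ * p t, fun t => ?_, fun t => ?_, ?_⟩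
  · refine ((bel_deriv hκ hν 0 t).mul (ud t)).congr_deriv ?_
    have := (Ipos t).ne'
    simp only [hg]
    change bel κ ν 1 t * u t + I t * ((I t)⁻¹ * (I t)⁻¹ * p t) = _
    field_simp
  · refine (((bel_deriv hκ hν 1 t).mul (ud t)).add (((bel_deriv hκ hν 0 t).inv (Ipos t).ne').mul (pd t))).congr_deriv ?_
    rw [bel_ode hκ hν]
    have := (Ipos t).ne'
    simp only [hg]
    simp only [← hI]
    simp only [Pi.inv_apply]
    field_simp
    ring
  · refine ⟨P0 / (2 * ν) + I 0 * (P0 / (2 * ν) * exp (2 * ν * T)), fun t => ?_⟩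
    rw [abs_mul, abs_of_pos (Ipos t)]
    have i0 := Ipos 0
    rcases le_total t 0 with h | h
    · rw [abs_of_nonpos h]
      have h1 := bel_growth hκ hν h
      have h2 : I t ≤ I 0 * exp (-(ν * -t)) := by
        calc I t = I t * exp (ν * (0 - t)) * exp (-(ν * -t)) := by rw [mul_assoc, ← Real.exp_add]; simp
          _ ≤ _ := by gcongr
      calc I t * |u t| ≤ (I 0 * exp (-(ν * -t))) * (P0 / (2 * ν) * exp (2 * ν * T)) := by
            gcongr; exact ub t h
        _ = (0 + I 0 * (P0 / (2 * ν) * exp (2 * ν * T))) * exp (-(ν * -t)) := by ring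
        _ ≤ _ := by gcongr; positivity
    · rw [abs_of_nonneg h]
      refine (yb t).trans ?_
      gcongr
      have : 0 ≤ I 0 * (P0 / (2 * ν) * exp (2 * ν * T)) := by positivity
      linarith
end

section
lemma second_nonpos {φ φ' : ℝ → ℝ} {x c : ℝ} (h : ∀ t, HasDerivAt φ (φ' t) t) (h' : HasDerivAt φ' c x)
    (hm : ∀ t, φ t ≤ φ x) : φ' x = 0 ∧ c ≤ 0 := by
  have hloc : IsLocalMax φ x := Eventually.of_forall hm
  have e1 : deriv φ = φ' := funext fun t => (h t).deriv
  have z : φ' x = 0 := by rw [← e1]; exact hloc.deriv_eq_zero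
  refine ⟨z, ?_⟩
  by_contra hc
  push Not at hc
  have hmin : IsLocalMin φ x := isLocalMin_of_deriv_deriv_pos (by rw [e1, h'.deriv]; exact hc) (by rw [e1]; exact z) (h x).continuousAt
  have hcst : φ =ᶠ[𝓝 x] fun _ => φ x := by
    filter_upwards [hmin, hloc] with t h1 h2 using le_antisymm h2 h1
  have h1 : φ' =ᶠ[𝓝 x] fun _ => (0:ℝ) := by
    filter_upwards [hcst.eventuallyEq_nhds] with t ht
    rw [← (h t).deriv, ht.deriv_eq]; simp
  have h2 := h1.deriv_eq
  rw [h'.deriv] at h2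
  simp at h2
  linarith

/-- two dimensional maximum principle -/
lemma max2d_up {ι : Type} (s : Finset ι) {m : ι → ℤ} {β : ι → ℝ} {Y Y' c : ι → ℝ → ℝ} {ν a K : ℝ} (ha : |a| < ν)
    (h1 : ∀ i ∈ s, ∀ t, HasDerivAt (Y i) (Y' i t) t)
    (h2 : ∀ i ∈ s, ∀ t, HasDerivAt (Y' i) ((ν ^ 2 + (m i : ℝ) ^ 2 * exp (2 * t)) * Y i t + c i t) t)
    (h3 : ∀ i ∈ s, ∃ C, ∀ t, |Y i t| ≤ C * exp (-(ν * |t|))) (hK : 0 ≤ K)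
    (hΨ : ∀ t z, |∑ i ∈ s, c i t * cos (m i * z + β i)| ≤ K * exp (a * t)) (t z : ℝ) :
    ∑ i ∈ s, Y i t * cos (m i * z + β i) ≤ K / (ν ^ 2 - a ^ 2) * exp (a * t) := by
  have hν : 0 < ν := (abs_nonneg a).trans_lt ha
  have hden : 0 < ν ^ 2 - a ^ 2 := by
    have := sq_lt_sq' (by linarith [abs_nonneg a]) ha
    rw [sq_abs] at this; linarith
  set g : ℝ → ℝ → ℝ := fun t z => exp (-(a * t)) * ∑ i ∈ s, Y i t * cos (m i * z + β i) with hg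
  suffices H : g t z ≤ K / (ν ^ 2 - a ^ 2) by
    calc _ = g t z * exp (a * t) := by simp only [hg]; rw [mul_comm, ← mul_assoc, ← Real.exp_add]; simp
      _ ≤ _ := by gcongr
  by_contra hcon
  push Not at hcon
  have Qnn : 0 ≤ K / (ν ^ 2 - a ^ 2) := by positivity
  -- decay
  choose! C hC using h3
  have dec : ∀ t z, |g t z| ≤ (∑ i ∈ s, |C i|) * exp (-((ν - |a|) * |t|)) := by
    intro t z
    simp only [hg]
    rw [abs_mul, abs_of_pos (exp_pos _)]
    calc _ ≤ exp (-(a * t)) * ∑ i ∈ s, |C i| * exp (-(ν * |t|)) := by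
          gcongr
          refine (Finset.abs_sum_le_sum_abs _ _).trans (Finset.sum_le_sum fun i hi => ?_)
          rw [abs_mul]
          calc _ ≤ |Y i t| * 1 := by gcongr; exact abs_cos_le_one _
            _ ≤ C i * exp (-(ν * |t|)) := by rw [mul_one]; exact hC i hi t
            _ ≤ _ := by gcongr; exact le_abs_self _
      _ = (∑ i ∈ s, |C i|) * (exp (-(a * t)) * exp (-(ν * |t|))) := by rw [← Finset.sum_mul]; ring
      _ ≤ _ := by
          rw [← Real.exp_add]
          gcongr
          have : -(a * t) ≤ |a| * |t| := by rw [← abs_mul]; exact neg_le_abs _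
          nlinarith
  have tz : Tendsto (fun t : ℝ => (∑ i ∈ s, |C i|) * exp (-((ν - |a|) * |t|))) (cocompact ℝ) (𝓝 0) := by
    have : Tendsto (fun t : ℝ => exp (-((ν - |a|) * |t|))) (cocompact ℝ) (𝓝 0) := by
      refine tendsto_exp_neg_atTop_nhds_zero.comp ?_
      refine Tendsto.const_mul_atTop (by linarith) ?_
      exact tendsto_norm_cocompact_atTop (E := ℝ)
    simpa using this.const_mul (∑ i ∈ s, |C i|)
  have hpos : 0 < g t z := Qnn.trans_lt hcon
  have ev := tz.eventually (gt_mem_nhds hpos)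
  rw [← cobounded_eq_cocompact] at ev
  obtain ⟨R, hR⟩ := (hasBasis_cobounded_norm (E := ℝ)).eventually_iff.1 ev
  have hR := hR.2
  -- compactness
  have gcont : Continuous fun p : ℝ × ℝ => g p.1 p.2 := by
    simp only [hg]
    refine (by fun_prop : Continuous fun p : ℝ × ℝ => exp (-(a * p.1))).mul (continuous_finsetSum _ fun i hi => ?_)
    have : Continuous (Y i) := continuous_iff_continuousAt.2 fun t => (h1 i hi t).continuousAt
    exact (this.comp continuous_fst).mul (by fun_prop)
  have gper : ∀ t z, ∀ k : ℤ, g t (z - k * (2 * π)) = g t z := by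
    intro t z k
    simp only [hg]
    congr 1
    refine Finset.sum_congr rfl fun i _ => ?_
    congr 1
    have : (m i : ℝ) * (z - k * (2 * π)) + β i = (m i * z + β i) - ((m i * k : ℤ) : ℝ) * (2 * π) := by push_cast; ring
    rw [this, Real.cos_sub_int_mul_two_pi]
  set B := max |R| |t| with hB
  obtain ⟨q, hq, hmax⟩ := (isCompact_Icc.prod isCompact_Icc : IsCompact (Icc (-B) B ×ˢ Icc (0:ℝ) (2 * π))).exists_isMaxOn
    ⟨(0,0), by constructor <;> constructor <;> simp [hB, pi_pos.le] ⟩ gcont.continuousOn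
  have red : ∀ z, ∃ z' ∈ Icc (0:ℝ) (2 * π), ∀ t, g t z' = g t z := by
    intro z
    refine ⟨z - ⌊z / (2 * π)⌋ * (2 * π), ⟨?_, ?_⟩, fun t => gper t z _⟩
    · have := Int.floor_le (z / (2 * π)); rw [le_div_iff₀ (by positivity)] at this; linarith
    · have := Int.lt_floor_add_one (z / (2 * π)); rw [div_lt_iff₀ (by positivity)] at this; linarith
  have gq : g t z ≤ g q.1 q.2 := by
    obtain ⟨z', hz', e⟩ := red z
    rw [← e t]
    exact hmax (a := (t, z')) ⟨⟨by linarith [neg_abs_le t, le_max_right |R| |t|], (le_abs_self t).trans (le_max_right _ _)⟩, hz'⟩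
  have gmax : ∀ t' z', g t' z' ≤ g q.1 q.2 := by
    intro t' z'
    rcases le_total |t'| B with h | h
    · obtain ⟨z'', hz', e⟩ := red z'
      rw [← e t']
      exact hmax (a := (t', z'')) ⟨abs_le.1 h, hz'⟩
    · have : R ≤ ‖t'‖ := (le_abs_self R).trans ((le_max_left _ _).trans h)
      have := hR this
      exact (le_abs_self _).trans ((dec t' z').trans (this.le.trans gq))
  -- derivatives
  set A := ∑ i ∈ s, Y i q.1 * cos (m i * q.2 + β i) with hA
  set A1 := ∑ i ∈ s, Y' i q.1 * cos (m i * q.2 + β i) with hA1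
  set A2 := ∑ i ∈ s, ((ν ^ 2 + (m i : ℝ) ^ 2 * exp (2 * q.1)) * Y i q.1 + c i q.1) * cos (m i * q.2 + β i) with hA2
  set Az := ∑ i ∈ s, Y i q.1 * (-((m i : ℝ) ^ 2 * cos (m i * q.2 + β i))) with hAz
  have dE : ∀ t, HasDerivAt (fun t => exp (-(a * t))) (-a * exp (-(a * t))) t := fun t => by
    refine ((hasDerivAt_id t).const_mul a).neg.exp.congr_deriv ?_
    simp only [id, mul_one, Pi.neg_apply]; ring
  have dS : ∀ t, HasDerivAt (fun t => ∑ i ∈ s, Y i t * cos (m i * q.2 + β i)) (∑ i ∈ s, Y' i t * cos (m i * q.2 + β i)) t := fun t =>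
    HasDerivAt.fun_sum fun i hi => (h1 i hi t).mul_const _
  have dS' : ∀ t, HasDerivAt (fun t => ∑ i ∈ s, Y' i t * cos (m i * q.2 + β i)) (∑ i ∈ s, ((ν ^ 2 + (m i : ℝ) ^ 2 * exp (2 * t)) * Y i t + c i t) * cos (m i * q.2 + β i)) t := fun t =>
    HasDerivAt.fun_sum fun i hi => (h2 i hi t).mul_const _
  have st := second_nonpos (φ := fun t => g t q.2) (x := q.1) (fun t => (dE t).mul (dS t))
    (((dE q.1).const_mul (-a)).mul (dS q.1) |>.add ((dE q.1).mul (dS' q.1))) (fun t => gmax t q.2)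
  have dz : ∀ z, HasDerivAt (fun z => g q.1 z) (exp (-(a * q.1)) * ∑ i ∈ s, Y i q.1 * (-sin (m i * z + β i) * m i)) z := fun z => by
    refine (HasDerivAt.fun_sum fun i hi => HasDerivAt.const_mul (Y i q.1) (HasDerivAt.cos ?_)).const_mul _
    simpa using ((hasDerivAt_id z).const_mul (m i : ℝ)).add_const (β i)
  have dz' : HasDerivAt (fun z => exp (-(a * q.1)) * ∑ i ∈ s, Y i q.1 * (-sin (m i * z + β i) * m i)) (exp (-(a * q.1)) * Az) q.2 := by
    refine (HasDerivAt.fun_sum fun i hi => ?_).const_mul _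
    have h0 : HasDerivAt (fun z : ℝ => (m i : ℝ) * z + β i) (m i) q.2 := by
      simpa using ((hasDerivAt_id q.2).const_mul (m i : ℝ)).add_const (β i)
    refine ((h0.sin.neg.mul_const (m i : ℝ)).const_mul (Y i q.1)).congr_deriv ?_
    ring
  have sz := second_nonpos (φ := fun z => g q.1 z) (x := q.2) dz dz' (fun z => gmax q.1 z)
  set E := exp (-(a * q.1)) with hE
  have Epos : 0 < E := exp_pos _
  obtain ⟨st1, st2⟩ := st
  have sz2 := sz.2
  simp only [← hA, ← hA1, ← hA2, ← hE] at st1 st2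
  have eq : A2 + exp (2 * q.1) * Az = ν ^ 2 * A + ∑ i ∈ s, c i q.1 * cos (m i * q.2 + β i) := by
    simp only [hA2, hA, hAz, Finset.mul_sum, ← Finset.sum_add_distrib]
    refine Finset.sum_congr rfl fun i _ => by ring
  have hp := (abs_le.1 (hΨ q.1 q.2)).1
  have hEE : E * (K * exp (a * q.1)) = K := by
    rw [mul_left_comm, hE, ← Real.exp_add]; simp
  have gqA : g q.1 q.2 = E * A := rfl
  have h5 : E * A2 ≤ a ^ 2 * (E * A) := by
    have e1 : E * A1 = a * (E * A) := by linarith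
    have e2 : a * (E * A1) = a * (a * (E * A)) := by rw [e1]
    have e3 : -a * (-a * E) * A + -a * E * A1 + (-a * E * A1 + E * A2) = a * (a * (E * A)) - 2 * (a * (E * A1)) + E * A2 := by ring
    rw [e3, e2] at st2
    linarith
  have h6 : exp (2 * q.1) * (E * Az) ≤ 0 := mul_nonpos_of_nonneg_of_nonpos (exp_pos _).le sz2
  have h7 : ν ^ 2 * (E * A) + E * (∑ i ∈ s, c i q.1 * cos (m i * q.2 + β i)) ≤ a ^ 2 * (E * A) := by
    have : ν ^ 2 * (E * A) + E * (∑ i ∈ s, c i q.1 * cos (m i * q.2 + β i)) = E * (A2 + exp (2 * q.1) * Az) := by rw [eq]; ring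
    rw [this]; nlinarith
  have h8 : -K ≤ E * (∑ i ∈ s, c i q.1 * cos (m i * q.2 + β i)) := by
    rw [← hEE]; nlinarith
  have h9 : E * A ≤ K / (ν ^ 2 - a ^ 2) := by rw [le_div_iff₀ hden]; nlinarith
  linarith

lemma max2d {ι : Type} (s : Finset ι) {m : ι → ℤ} {β : ι → ℝ} {Y Y' c : ι → ℝ → ℝ} {ν a K : ℝ} (ha : |a| < ν)
    (h1 : ∀ i ∈ s, ∀ t, HasDerivAt (Y i) (Y' i t) t)
    (h2 : ∀ i ∈ s, ∀ t, HasDerivAt (Y' i) ((ν ^ 2 + (m i : ℝ) ^ 2 * exp (2 * t)) * Y i t + c i t) t)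
    (h3 : ∀ i ∈ s, ∃ C, ∀ t, |Y i t| ≤ C * exp (-(ν * |t|))) (hK : 0 ≤ K)
    (hΨ : ∀ t z, |∑ i ∈ s, c i t * cos (m i * z + β i)| ≤ K * exp (a * t)) (t z : ℝ) :
    |∑ i ∈ s, Y i t * cos (m i * z + β i)| ≤ K / (ν ^ 2 - a ^ 2) * exp (a * t) := by
  refine abs_le.2 ⟨?_, max2d_up s ha h1 h2 h3 hK hΨ t z⟩
  have := max2d_up s (Y := fun i t => - Y i t) (Y' := fun i t => - Y' i t) (c := fun i t => - c i t) (m := m) (β := β) ha (fun i hi t => (h1 i hi t).neg)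
    (fun i hi t => (h2 i hi t).neg.congr_deriv (by ring)) (fun i hi => by simpa using h3 i hi) hK
    (fun t z => by simpa using hΨ t z) t z
  simp only [neg_mul, Finset.sum_neg_distrib] at this
  linarith
end

section
/-- data of a finite trigonometric sum -/
structure TD : Type 1 where
  ι : Type
  fin : Fintype ι
  n : ι → ℤ
  m : ι → ℤ
  β : ι → ℝ
  c : ι → ℝ → ℝ
  cc : ∀ i, Continuous (c i)

attribute [instance] TD.fin

def TD.F (D : TD) (μ θ₀ t θ z : ℝ) : ℝ :=
  ∑ i, D.c i t * cos (μ * D.n i * (θ - θ₀)) * cos (D.m i * z + D.β i)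

/-- folding of the angle -/
def tri (μ θ₀ θ : ℝ) : ℝ := θ₀ + μ⁻¹ * arccos (cos (μ * (θ - θ₀)))

lemma tri_cont (μ θ₀ : ℝ) : Continuous (tri μ θ₀) := by
  unfold tri; fun_prop

lemma tri_mem {μ θ₀ : ℝ} (hμ : 0 < μ) (θ : ℝ) : tri μ θ₀ θ ∈ Icc θ₀ (θ₀ + π / μ) := by
  unfold tri
  have h1 := arccos_nonneg (cos (μ * (θ - θ₀)))
  have h2 := arccos_le_pi (cos (μ * (θ - θ₀)))
  constructor
  · have : 0 ≤ μ⁻¹ * arccos (cos (μ * (θ - θ₀))) := by positivity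
    linarith
  · rw [div_eq_inv_mul]; gcongr

lemma tri_eq {μ θ₀ θ : ℝ} (hμ : 0 < μ) (h : θ ∈ Icc θ₀ (θ₀ + π / μ)) : tri μ θ₀ θ = θ := by
  unfold tri
  rw [arccos_cos]
  · field_simp; ring
  · have := h.1; apply mul_nonneg hμ.le; linarith
  · have := h.2; rw [mul_comm, ← le_div_iff₀ hμ]; linarith

lemma cos_tri {μ : ℝ} (hμ : 0 < μ) (θ₀ θ : ℝ) (n : ℤ) : cos (μ * n * (tri μ θ₀ θ - θ₀)) = cos (μ * n * (θ - θ₀)) := by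
  have e1 : μ * n * (tri μ θ₀ θ - θ₀) = n * arccos (cos (μ * (θ - θ₀))) := by unfold tri; field_simp; ring
  have e2 : μ * n * (θ - θ₀) = n * (μ * (θ - θ₀)) := by ring
  rw [e1, e2, ← Polynomial.Chebyshev.T_real_cos, ← Polynomial.Chebyshev.T_real_cos, cos_arccos (neg_one_le_cos _) (cos_le_one _)]

lemma TD.F_tri (D : TD) {μ : ℝ} (hμ : 0 < μ) (θ₀ t θ z : ℝ) : D.F μ θ₀ t (tri μ θ₀ θ) z = D.F μ θ₀ t θ z := by
  unfold TD.F; simp_rw [cos_tri hμ]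

lemma cos_int_per (m : ℤ) (z β : ℝ) : cos (m * (z + 2 * π) + β) = cos (m * z + β) := by
  have : (m : ℝ) * (z + 2 * π) + β = (m * z + β) + (m : ℝ) * (2 * π) := by push_cast; ring
  rw [this, Real.cos_add_int_mul_two_pi]

lemma TD.F_cont (D : TD) (μ θ₀ : ℝ) : Continuous fun p : ℝ × ℝ × ℝ => D.F μ θ₀ p.1 p.2.1 p.2.2 := by
  unfold TD.F
  refine continuous_finsetSum _ fun i _ => ?_
  have := D.cc i
  fun_prop

def TD.add (D D' : TD) : TD where
  ι := D.ι ⊕ D'.ι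
  fin := inferInstance
  n := Sum.elim D.n D'.n
  m := Sum.elim D.m D'.m
  β := Sum.elim D.β D'.β
  c := Sum.elim D.c D'.c
  cc := by rintro (i | i); exacts [D.cc i, D'.cc i]

lemma TD.F_add (D D' : TD) (μ θ₀ t θ z : ℝ) : (D.add D').F μ θ₀ t θ z = D.F μ θ₀ t θ z + D'.F μ θ₀ t θ z :=
  Fintype.sum_sum_type _

def sgn (b : Bool) : ℤ := if b then 1 else -1

def TD.mul (D D' : TD) : TD where
  ι := (D.ι × D'.ι) × (Bool × Bool)
  fin := inferInstance
  n := fun i => D.n i.1.1 + sgn i.2.1 * D'.n i.1.2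
  m := fun i => D.m i.1.1 + sgn i.2.2 * D'.m i.1.2
  β := fun i => D.β i.1.1 + sgn i.2.2 * D'.β i.1.2
  c := fun i t => D.c i.1.1 t * D'.c i.1.2 t / 4
  cc := fun i => ((D.cc _).mul (D'.cc _)).div_const _

lemma TD.F_mul (D D' : TD) (μ θ₀ t θ z : ℝ) : (D.mul D').F μ θ₀ t θ z = D.F μ θ₀ t θ z * D'.F μ θ₀ t θ z := by
  unfold TD.F
  rw [Finset.sum_mul_sum]
  change ∑ i : (D.ι × D'.ι) × (Bool × Bool), _ = _
  rw [Fintype.sum_prod_type, Fintype.sum_prod_type]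
  refine Finset.sum_congr rfl fun i _ => Finset.sum_congr rfl fun j _ => ?_
  rw [Fintype.sum_prod_type]
  simp only [Fintype.sum_bool, TD.mul, sgn]
  simp only [if_true, Bool.false_eq_true, if_false]
  push_cast
  have e1 : ∀ A B : ℝ, cos A * cos B = (cos (A + B) + cos (A - B)) / 2 := fun A B => by rw [cos_add, cos_sub]; ring
  have f1 : μ * (D.n i + 1 * D'.n j) * (θ - θ₀) = μ * D.n i * (θ - θ₀) + μ * D'.n j * (θ - θ₀) := by ring
  have f2 : μ * (D.n i + -1 * D'.n j) * (θ - θ₀) = μ * D.n i * (θ - θ₀) - μ * D'.n j * (θ - θ₀) := by ring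
  have f3 : (D.m i + 1 * D'.m j : ℝ) * z + (D.β i + 1 * D'.β j) = (D.m i * z + D.β i) + (D'.m j * z + D'.β j) := by ring
  have f4 : (D.m i + -1 * D'.m j : ℝ) * z + (D.β i + -1 * D'.β j) = (D.m i * z + D.β i) - (D'.m j * z + D'.β j) := by ring
  rw [f1, f2, f3, f4]
  calc _ = D.c i t * D'.c j t * ((cos (μ * D.n i * (θ - θ₀) + μ * D'.n j * (θ - θ₀)) + cos (μ * D.n i * (θ - θ₀) - μ * D'.n j * (θ - θ₀))) / 2) *
        ((cos ((D.m i * z + D.β i) + (D'.m j * z + D'.β j)) + cos ((D.m i * z + D.β i) - (D'.m j * z + D'.β j))) / 2) := by ring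
    _ = _ := by rw [← e1, ← e1]; ring

def TD.single (n m : ℤ) (β : ℝ) (c : ℝ → ℝ) (hc : Continuous c) : TD where
  ι := Unit
  fin := inferInstance
  n := fun _ => n
  m := fun _ => m
  β := fun _ => β
  c := fun _ => c
  cc := fun _ => hc

lemma TD.F_single (n m : ℤ) (β : ℝ) (c : ℝ → ℝ) (hc : Continuous c) (μ θ₀ t θ z : ℝ) :
    (TD.single n m β c hc).F μ θ₀ t θ z = c t * cos (μ * n * (θ - θ₀)) * cos (m * z + β) := by
  unfold TD.F TD.single; simp

/-- multiply by a function of `t` -/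
def TD.cut (D : TD) (χ : ℝ → ℝ) (hχ : Continuous χ) : TD where
  ι := D.ι
  fin := D.fin
  n := D.n
  m := D.m
  β := D.β
  c := fun i t => χ t * D.c i t
  cc := fun i => hχ.mul (D.cc i)

lemma TD.F_cut (D : TD) (χ : ℝ → ℝ) (hχ : Continuous χ) (μ θ₀ t θ z : ℝ) :
    (D.cut χ hχ).F μ θ₀ t θ z = χ t * D.F μ θ₀ t θ z := by
  unfold TD.F TD.cut
  rw [Finset.mul_sum]
  exact Finset.sum_congr rfl fun i _ => by ring

abbrev SWX (L θ₀ μ : ℝ) : Type := Icc (-L) L × (Icc θ₀ (θ₀ + π / μ) × AddCircle (2 * π))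

/-- density of trigonometric sums -/
lemma trig_dense {μ : ℝ} (hμ : 0 < μ) (θ₀ : ℝ) {F : ℝ → ℝ → ℝ → ℝ} (hF : Continuous fun p : ℝ × ℝ × ℝ => F p.1 p.2.1 p.2.2)
    (hper : ∀ t θ z, F t θ (z + 2 * π) = F t θ z) (htri : ∀ t θ z, F t (tri μ θ₀ θ) z = F t θ z)
    (L : ℝ) {ε : ℝ} (hε : 0 < ε) : ∃ D : TD, ∀ t θ z, |t| ≤ L → |D.F μ θ₀ t θ z - F t θ z| < ε := by
  haveI : Fact (0 < 2 * π) := ⟨by positivity⟩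
  let q : Icc (-L) L × (Icc θ₀ (θ₀ + π / μ) × ℝ) → SWX L θ₀ μ := Prod.map id (Prod.map id (QuotientAddGroup.mk))
  have hq : IsOpenQuotientMap q := IsOpenQuotientMap.id.prodMap (IsOpenQuotientMap.id.prodMap QuotientAddGroup.isOpenQuotientMap_mk)
  have hp : ∀ t θ, Function.Periodic (F t θ) (2 * π) := fun t θ z => hper t θ z
  let Fh : C(SWX L θ₀ μ, ℝ) := ⟨fun x => (hp x.1 x.2.1).lift x.2.2, by
    rw [← hq.continuous_comp_iff]
    exact hF.comp (by fun_prop : Continuous fun x : Icc (-L) L × (Icc θ₀ (θ₀ + π / μ) × ℝ) => ((x.1 : ℝ), (x.2.1 : ℝ), x.2.2))⟩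
  let g1 : C(SWX L θ₀ μ, ℝ) := ⟨fun x => x.1, by fun_prop⟩
  let g2 : C(SWX L θ₀ μ, ℝ) := ⟨fun x => cos (μ * (x.2.1 - θ₀)), by fun_prop⟩
  let g3 : C(SWX L θ₀ μ, ℝ) := ⟨fun x => Real.Angle.cos x.2.2, Real.Angle.continuous_cos.comp (by fun_prop : Continuous fun x : SWX L θ₀ μ => x.2.2)⟩
  let g4 : C(SWX L θ₀ μ, ℝ) := ⟨fun x => Real.Angle.sin x.2.2, Real.Angle.continuous_sin.comp (by fun_prop : Continuous fun x : SWX L θ₀ μ => x.2.2)⟩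
  let A := Algebra.adjoin ℝ ({g1, g2, g3, g4} : Set C(SWX L θ₀ μ, ℝ))
  have hA : A.SeparatesPoints := by
    rintro ⟨t, θ, z⟩ ⟨t', θ', z'⟩ hne
    by_cases h1 : t = t'
    · by_cases h2 : θ = θ'
      · have h3 : z ≠ z' := by rintro rfl; exact hne (by rw [h1, h2])
        obtain ⟨a, rfl⟩ := QuotientAddGroup.mk_surjective z
        obtain ⟨b, rfl⟩ := QuotientAddGroup.mk_surjective z'
        by_cases h4 : cos a = cos b
        · refine ⟨g4, ⟨g4, Algebra.subset_adjoin (by simp), rfl⟩, fun h5 => h3 (Real.Angle.cos_sin_inj h4 h5)⟩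
        · exact ⟨g3, ⟨g3, Algebra.subset_adjoin (by simp), rfl⟩, h4⟩
      · refine ⟨g2, ⟨g2, Algebra.subset_adjoin (by simp), rfl⟩, fun h5 => h2 ?_⟩
        have hm : ∀ θ : Icc θ₀ (θ₀ + π / μ), μ * (θ - θ₀) ∈ Icc 0 π := fun θ => by
          have := θ.2
          refine ⟨mul_nonneg hμ.le (by linarith [this.1]), ?_⟩
          rw [mul_comm, ← le_div_iff₀ hμ]; linarith [this.2]
        have := injOn_cos (hm θ) (hm θ') h5
        have := mul_left_cancel₀ hμ.ne' this
        exact Subtype.ext (by linarith)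
    · exact ⟨g1, ⟨g1, Algebra.subset_adjoin (by simp), rfl⟩, fun h => h1 (Subtype.ext h)⟩
  obtain ⟨g, hg⟩ := ContinuousMap.exists_mem_subalgebra_near_continuousMap_of_separatesPoints A hA Fh ε hε
  have rep : ∀ g ∈ A, ∃ D : TD, ∀ (t : Icc (-L) L) (θ : Icc θ₀ (θ₀ + π / μ)) (z : ℝ), g (t, θ, (z : AddCircle (2 * π))) = D.F μ θ₀ t θ z := by
    intro g hg
    induction hg using Algebra.adjoin_induction with
    | mem x hx =>
      rcases hx with rfl | rfl | rfl | rfl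
      · refine ⟨TD.single 0 0 0 id continuous_id, fun t θ z => ?_⟩
        rw [TD.F_single]; simp [g1]
      · refine ⟨TD.single 1 0 0 (fun _ => 1) continuous_const, fun t θ z => ?_⟩
        rw [TD.F_single]; simp [g2]
      · refine ⟨TD.single 0 1 0 (fun _ => 1) continuous_const, fun t θ z => ?_⟩
        rw [TD.F_single]; simp [g3]; exact Real.Angle.cos_coe z
      · refine ⟨TD.single 0 1 (-(π/2)) (fun _ => 1) continuous_const, fun t θ z => ?_⟩
        rw [TD.F_single]; simp [g4, ← sub_eq_add_neg, cos_sub_pi_div_two]; exact Real.Angle.sin_coe z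
    | algebraMap r =>
      refine ⟨TD.single 0 0 0 (fun _ => r) continuous_const, fun t θ z => ?_⟩
      rw [TD.F_single]; simp
    | add x y _ _ hx hy =>
      obtain ⟨D, hD⟩ := hx
      obtain ⟨D', hD'⟩ := hy
      exact ⟨D.add D', fun t θ z => by rw [TD.F_add, ← hD, ← hD']; rfl⟩
    | mul x y _ _ hx hy =>
      obtain ⟨D, hD⟩ := hx
      obtain ⟨D', hD'⟩ := hy
      exact ⟨D.mul D', fun t θ z => by rw [TD.F_mul, ← hD, ← hD']; rfl⟩
  obtain ⟨D, hD⟩ := rep g g.2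
  refine ⟨D, fun t θ z ht => ?_⟩
  rw [← D.F_tri hμ, ← htri]
  have h1 := (ContinuousMap.norm_coe_le_norm ((g : C(SWX L θ₀ μ, ℝ)) - Fh) (⟨t, abs_le.1 ht⟩, ⟨tri μ θ₀ θ, tri_mem hμ θ⟩, (z : AddCircle (2 * π)))).trans_lt hg
  have h2 := hD ⟨t, abs_le.1 ht⟩ ⟨tri μ θ₀ θ, tri_mem hμ θ⟩ z
  rw [← h2]
  exact h1

def chi (N : ℕ) (t : ℝ) : ℝ := max 0 (min 1 (N + 1 - |t|))

lemma chi_cont (N : ℕ) : Continuous (chi N) := by unfold chi; fun_prop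
lemma chi_nn (N : ℕ) (t : ℝ) : 0 ≤ chi N t := le_max_left _ _
lemma chi_le (N : ℕ) (t : ℝ) : chi N t ≤ 1 := by unfold chi; simp
lemma chi_one {N : ℕ} {t : ℝ} (h : |t| ≤ N) : chi N t = 1 := by
  unfold chi; rw [min_eq_left (by linarith)]; simp
lemma chi_zero {N : ℕ} {t : ℝ} (h : N + 1 < |t|) : chi N t = 0 := by
  unfold chi; rw [max_eq_left]; exact (min_le_right _ _).trans (by linarith)

/-- cut-off approximants -/
lemma trig_approx {μ : ℝ} (hμ : 0 < μ) (θ₀ : ℝ) {F : ℝ → ℝ → ℝ → ℝ} (hF : Continuous fun p : ℝ × ℝ × ℝ => F p.1 p.2.1 p.2.2)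
    (hper : ∀ t θ z, F t θ (z + 2 * π) = F t θ z) (htri : ∀ t θ z, F t (tri μ θ₀ θ) z = F t θ z)
    {w : ℝ → ℝ} (hw : Continuous w) (hw0 : ∀ t, 0 < w t) (N : ℕ) :
    ∃ D : TD, (∀ i t, (N + 2 : ℝ) < |t| → D.c i t = 0) ∧ ∀ t θ z, |D.F μ θ₀ t θ z - chi N t * F t θ z| ≤ w t / (N + 1) := by
  obtain ⟨t0, ht0, hmin⟩ := (isCompact_Icc (a := -((N:ℝ)+2)) (b := N+2)).exists_isMinOn ⟨0, by constructor <;> [linarith [Nat.cast_nonneg (α := ℝ) N]; positivity]⟩ hw.continuousOn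
  obtain ⟨D, hD⟩ := trig_dense hμ θ₀ hF hper htri (N + 2) (ε := w t0 / (N + 1)) (by have := hw0 t0; positivity)
  refine ⟨D.cut (chi N) (chi_cont N), fun i t h => ?_, fun t θ z => ?_⟩
  · simp [TD.cut, chi_zero (by linarith : (N:ℝ) + 1 < |t|)]
  · rw [TD.F_cut, ← mul_sub, abs_mul, abs_of_nonneg (chi_nn N t)]
    have := hw0 t
    rcases le_or_gt |t| (N + 2) with h | h
    · calc _ ≤ 1 * (w t0 / (N + 1)) := by gcongr; exact chi_le N t; exact (hD t θ z h).le
        _ ≤ _ := by rw [one_mul]; gcongr; exact hmin (abs_le.1 h)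
    · rw [chi_zero (by linarith), zero_mul]; positivity
end

section
lemma min_exp_le {a1 a a2 : ℝ} (h1 : a < a1) (h2 : a2 < a) (t : ℝ) :
    min (exp (a1 * t)) (exp (a2 * t)) ≤ exp (a * t) * exp (-(min (a1 - a) (a - a2) * |t|)) := by
  rw [← Real.exp_add]
  rcases le_total 0 t with h | h
  · refine (min_le_right _ _).trans (exp_le_exp.2 ?_)
    rw [abs_of_nonneg h]
    nlinarith [min_le_right (a1 - a) (a - a2)]
  · refine (min_le_left _ _).trans (exp_le_exp.2 ?_)
    rw [abs_of_nonpos h]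
    nlinarith [min_le_left (a1 - a) (a - a2)]

lemma approx_seq {μ : ℝ} (hμ : 0 < μ) (θ₀ : ℝ) {F : ℝ → ℝ → ℝ → ℝ} (hF : Continuous fun p : ℝ × ℝ × ℝ => F p.1 p.2.1 p.2.2)
    (hper : ∀ t θ z, F t θ (z + 2 * π) = F t θ z) (htri : ∀ t θ z, F t (tri μ θ₀ θ) z = F t θ z)
    {a1 a a2 K : ℝ} (h1 : a < a1) (h2 : a2 < a) (hK : 0 ≤ K)
    (hFK : ∀ t θ z, |F t θ z| ≤ K * min (exp (a1 * t)) (exp (a2 * t))) :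
    ∃ (D : ℕ → TD) (ε : ℕ → ℝ), Tendsto ε atTop (𝓝 0) ∧
      (∀ (N : ℕ) i t, (N + 2 : ℝ) < |t| → (D N).c i t = 0) ∧
      (∀ N t θ z, |(D N).F μ θ₀ t θ z| ≤ (K + 1) * min (exp (a1 * t)) (exp (a2 * t))) ∧
      (∀ N t θ z, |(D N).F μ θ₀ t θ z - F t θ z| ≤ ε N * exp (a * t)) := by
  set w : ℝ → ℝ := fun t => min (exp (a1 * t)) (exp (a2 * t)) with hw
  have wc : Continuous w := by simp only [hw]; fun_prop
  have w0 : ∀ t, 0 < w t := fun t => lt_min (exp_pos _) (exp_pos _)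
  set γ := min (a1 - a) (a - a2) with hγ
  have γpos : 0 < γ := lt_min (by linarith) (by linarith)
  choose D hD1 hD2 using fun N => trig_approx hμ θ₀ hF hper htri wc w0 N
  refine ⟨D, fun N => K * exp (-(γ * N)) + 1 / ((N : ℝ) + 1), ?_, hD1, fun N t θ z => ?_, fun N t θ z => ?_⟩
  · have t1 : Tendsto (fun N : ℕ => exp (-(γ * N))) atTop (𝓝 0) :=
      tendsto_exp_neg_atTop_nhds_zero.comp (tendsto_natCast_atTop_atTop.const_mul_atTop γpos)
    have := (t1.const_mul K).add (tendsto_one_div_add_atTop_nhds_zero_nat (𝕜 := ℝ))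
    simpa using this
  · have e1 := hD2 N t θ z
    have e2 := hFK t θ z
    have w' := w0 t
    have e3 : |chi N t * F t θ z| ≤ K * w t := by
      rw [abs_mul, abs_of_nonneg (chi_nn N t)]
      calc _ ≤ 1 * |F t θ z| := by gcongr; exact chi_le N t
        _ ≤ _ := by rw [one_mul]; exact e2
    have e4 : w t / (N + 1) ≤ w t := div_le_self w'.le (by linarith [Nat.cast_nonneg (α := ℝ) N])
    calc _ = |((D N).F μ θ₀ t θ z - chi N t * F t θ z) + chi N t * F t θ z| := by congr 1; ring
      _ ≤ _ := abs_add_le _ _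
      _ ≤ _ := by linarith
  · have e1 := hD2 N t θ z
    have e2 := hFK t θ z
    have w' := w0 t
    have e3 : |chi N t * F t θ z - F t θ z| ≤ K * exp (-(γ * N)) * exp (a * t) := by
      rcases le_or_gt |t| N with h | h
      · rw [chi_one h]; simp; positivity
      · have : chi N t * F t θ z - F t θ z = -((1 - chi N t) * F t θ z) := by ring
        rw [this, abs_neg, abs_mul, abs_of_nonneg (by linarith [chi_le N t])]
        calc _ ≤ 1 * |F t θ z| := by gcongr; linarith [chi_nn N t]
          _ ≤ K * (exp (a * t) * exp (-(γ * |t|))) := by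
              rw [one_mul]; exact e2.trans (mul_le_mul_of_nonneg_left (min_exp_le h1 h2 t) hK)
          _ ≤ K * (exp (a * t) * exp (-(γ * N))) := by gcongr
          _ = _ := by ring
    have e5 : w t ≤ exp (a * t) := (min_exp_le h1 h2 t).trans (by
      refine mul_le_of_le_one_right (exp_pos _).le (Real.exp_le_one_iff.2 ?_)
      have : 0 ≤ min (a1 - a) (a - a2) * |t| := by positivity
      linarith)
    calc _ = |((D N).F μ θ₀ t θ z - chi N t * F t θ z) + (chi N t * F t θ z - F t θ z)| := by congr 1; ring
      _ ≤ _ := abs_add_le _ _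
      _ ≤ exp (a * t) / (N + 1) + K * exp (-(γ * N)) * exp (a * t) := add_le_add (e1.trans (by gcongr)) e3
      _ = _ := by ring

lemma int_cos_int (n : ℤ) : ∫ x in (0:ℝ)..π, cos (n * x) = if n = 0 then π else 0 := by
  split_ifs with h
  · simp [h]
  · have : (n : ℝ) ≠ 0 := by exact_mod_cast h
    rw [intervalIntegral.integral_comp_mul_left (fun x => cos x) this, integral_cos]
    simp [sin_int_mul_pi]

lemma orth (n : ℤ) {k : ℕ} (hk : k ≠ 0) : ∫ x in (0:ℝ)..π, cos (n * x) * cos (k * x) = if n.natAbs = k then π / 2 else 0 := by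
  have e : ∀ x : ℝ, cos (n * x) * cos (k * x) = 2⁻¹ * (cos ((n + k : ℤ) * x) + cos ((n - k : ℤ) * x)) := fun x => by
    push_cast; rw [add_mul, sub_mul, cos_add, cos_sub]; ring
  simp_rw [e]
  rw [intervalIntegral.integral_const_mul, intervalIntegral.integral_add (by apply Continuous.intervalIntegrable; fun_prop) (by apply Continuous.intervalIntegrable; fun_prop), int_cos_int, int_cos_int]
  by_cases h : n.natAbs = k
  · rw [if_pos h]
    by_cases h1 : n + k = 0
    · rw [if_pos h1, if_neg (by omega)]; ring
    · rw [if_neg h1, if_pos (by omega)]; ring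
  · rw [if_neg h, if_neg (by omega), if_neg (by omega)]; ring

/-- solution data -/
structure SD : Type 1 where
  ι : Type
  fin : Fintype ι
  n : ι → ℤ
  m : ι → ℤ
  β : ι → ℝ
  Y : ι → ℝ → ℝ
  Y1 : ι → ℝ → ℝ
  Y2 : ι → ℝ → ℝ
  h1 : ∀ i t, HasDerivAt (Y i) (Y1 i t) t
  h2 : ∀ i t, HasDerivAt (Y1 i) (Y2 i t) t
  h3 : ∀ i, Continuous (Y2 i)

attribute [instance] SD.fin

def SD.V (S : SD) (μ θ₀ t θ z : ℝ) : ℝ :=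
  ∑ i, S.Y i t * cos (μ * S.n i * (θ - θ₀)) * cos (S.m i * z + S.β i)

def SD.c (S : SD) (μ : ℝ) (i : S.ι) (t : ℝ) : ℝ := S.Y2 i t - ((μ * S.n i) ^ 2 + (S.m i : ℝ) ^ 2 * exp (2 * t)) * S.Y i t

def SD.G (S : SD) (μ θ₀ t θ z : ℝ) : ℝ :=
  ∑ i, S.c μ i t * cos (μ * S.n i * (θ - θ₀)) * cos (S.m i * z + S.β i)

def SD.sub (S S' : SD) : SD where
  ι := S.ι ⊕ S'.ι
  fin := inferInstance
  n := Sum.elim S.n S'.n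
  m := Sum.elim S.m S'.m
  β := Sum.elim S.β S'.β
  Y := Sum.elim S.Y (fun i t => -S'.Y i t)
  Y1 := Sum.elim S.Y1 (fun i t => -S'.Y1 i t)
  Y2 := Sum.elim S.Y2 (fun i t => -S'.Y2 i t)
  h1 := by rintro (i | i) t; exacts [S.h1 i t, (S'.h1 i t).neg]
  h2 := by rintro (i | i) t; exacts [S.h2 i t, (S'.h2 i t).neg]
  h3 := by rintro (i | i); exacts [S.h3 i, (S'.h3 i).neg]

lemma SD.V_sub (S S' : SD) (μ θ₀ t θ z : ℝ) : (S.sub S').V μ θ₀ t θ z = S.V μ θ₀ t θ z - S'.V μ θ₀ t θ z := by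
  unfold SD.V
  refine (Fintype.sum_sum_type _).trans ?_
  simp [SD.sub, Finset.sum_neg_distrib, sub_eq_add_neg]

lemma SD.G_sub (S S' : SD) (μ θ₀ t θ z : ℝ) : (S.sub S').G μ θ₀ t θ z = S.G μ θ₀ t θ z - S'.G μ θ₀ t θ z := by
  unfold SD.G SD.c
  refine (Fintype.sum_sum_type _).trans ?_
  simp only [SD.sub, Sum.elim_inl, Sum.elim_inr, sub_eq_add_neg, ← Finset.sum_neg_distrib]
  congr 1
  exact Finset.sum_congr rfl fun i _ => by ring

lemma SD.contY (S : SD) (i : S.ι) : Continuous (S.Y i) := continuous_iff_continuousAt.2 fun t => (S.h1 i t).continuousAt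

lemma SD.V_cont (S : SD) (μ θ₀ : ℝ) : Continuous fun p : ℝ × ℝ × ℝ => S.V μ θ₀ p.1 p.2.1 p.2.2 := by
  unfold SD.V
  refine continuous_finsetSum _ fun i _ => ?_
  have := S.contY i
  fun_prop

lemma SD.G_cont (S : SD) (μ θ₀ : ℝ) : Continuous fun p : ℝ × ℝ × ℝ => S.G μ θ₀ p.1 p.2.1 p.2.2 := by
  unfold SD.G SD.c
  refine continuous_finsetSum _ fun i _ => ?_
  have := S.contY i
  have := S.h3 i
  fun_prop

lemma SD.V_tri (S : SD) {μ : ℝ} (hμ : 0 < μ) (θ₀ t θ z : ℝ) : S.V μ θ₀ t (tri μ θ₀ θ) z = S.V μ θ₀ t θ z := by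
  unfold SD.V; simp_rw [cos_tri hμ]

lemma SD.V_per (S : SD) (μ θ₀ t θ z : ℝ) : S.V μ θ₀ t θ (z + 2 * π) = S.V μ θ₀ t θ z := by
  unfold SD.V; simp_rw [cos_int_per]

def SD.Dec (S : SD) (μ : ℝ) : Prop := ∀ i, (S.n i = 0 → ∀ t, S.Y i t = 0) ∧ ∃ C, ∀ t, |S.Y i t| ≤ C * exp (-(μ * (S.n i).natAbs * |t|))

lemma SD.Dec_sub {S S' : SD} {μ : ℝ} (h : S.Dec μ) (h' : S'.Dec μ) : (S.sub S').Dec μ := by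
  rintro (i | i)
  · exact h i
  · refine ⟨fun e t => ?_, ?_⟩
    · have := (h' i).1 e t; change -S'.Y i t = 0; rw [this, neg_zero]
    · obtain ⟨C, hC⟩ := (h' i).2
      exact ⟨C, fun t => by change |-S'.Y i t| ≤ _; rw [abs_neg]; exact hC t⟩

def CC (μ : ℝ) : ℝ := 2 / (μ ^ 2 - 4) * ∑' k : ℕ, 1 / (k : ℝ) ^ 2

lemma SD.comp (S : SD) {μ : ℝ} (hμ : 0 < μ) (θ₀ t z : ℝ) {k : ℕ} (hk : k ≠ 0) :
    ∫ x in (0:ℝ)..π, S.G μ θ₀ t (θ₀ + x / μ) z * cos (k * x) =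
      π / 2 * ∑ i ∈ Finset.univ.filter (fun i => (S.n i).natAbs = k), S.c μ i t * cos (S.m i * z + S.β i) := by
  have e : ∀ x : ℝ, S.G μ θ₀ t (θ₀ + x / μ) z * cos (k * x) = ∑ i, (S.c μ i t * cos (S.m i * z + S.β i)) * (cos (S.n i * x) * cos (k * x)) := fun x => by
    unfold SD.G
    rw [Finset.sum_mul]
    refine Finset.sum_congr rfl fun i _ => ?_
    have : μ * S.n i * (θ₀ + x / μ - θ₀) = S.n i * x := by field_simp; ring
    rw [this]; ring
  simp_rw [e]
  rw [intervalIntegral.integral_finsetSum (fun i _ => by apply Continuous.intervalIntegrable; fun_prop)]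
  simp_rw [intervalIntegral.integral_const_mul, orth _ hk]
  rw [Finset.sum_filter, Finset.mul_sum]
  refine Finset.sum_congr rfl fun i _ => ?_
  split_ifs <;> ring

lemma SD.bound (S : SD) {μ θ₀ a K : ℝ} (hμ : 2 < μ) (ha : |a| < 2) (hK : 0 ≤ K) (hd : S.Dec μ)
    (hG : ∀ t θ z, |S.G μ θ₀ t θ z| ≤ K * exp (a * t)) (t θ z : ℝ) :
    |S.V μ θ₀ t θ z| ≤ CC μ * K * exp (a * t) := by
  have hμ0 : 0 < μ := by linarith
  have hμ4 : 0 < μ ^ 2 - 4 := by nlinarith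
  have key : ∀ k : ℕ, k ≠ 0 → |∑ i ∈ Finset.univ.filter (fun i => (S.n i).natAbs = k), S.Y i t * cos (S.m i * z + S.β i)| ≤
      (2 * K * exp (a * t)) / (μ ^ 2 - 4) * (1 / (k : ℝ) ^ 2) := by
    intro k hk
    have hk1 : (1:ℝ) ≤ k := by exact_mod_cast Nat.one_le_iff_ne_zero.2 hk
    have hak : |a| < μ * k := by nlinarith
    have en : ∀ i ∈ Finset.univ.filter (fun i => (S.n i).natAbs = k), (μ * (S.n i : ℝ)) ^ 2 = (μ * k) ^ 2 := fun i hi => by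
      have : (S.n i).natAbs = k := (Finset.mem_filter.1 hi).2
      rw [mul_pow, mul_pow, ← this, Nat.cast_natAbs, Int.cast_abs, sq_abs]
    have := max2d (Finset.univ.filter (fun i => (S.n i).natAbs = k)) (m := S.m) (β := S.β) (Y := S.Y) (Y' := S.Y1) (c := S.c μ) (ν := μ * k) (a := a) (K := 2 * K)
      hak (fun i _ t => S.h1 i t) (fun i hi t => (S.h2 i t).congr_deriv (by unfold SD.c; rw [en i hi]; ring))
      (fun i hi => by have := (hd i).2; rwa [(Finset.mem_filter.1 hi).2] at this) (by positivity) (fun t z => by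
        have h1 := S.comp hμ0 θ₀ t z hk
        have h2 : ‖∫ x in (0:ℝ)..π, S.G μ θ₀ t (θ₀ + x / μ) z * cos (k * x)‖ ≤ (K * exp (a * t)) * |π - 0| := by
          refine intervalIntegral.norm_integral_le_of_norm_le_const fun x _ => ?_
          rw [norm_mul, norm_eq_abs, norm_eq_abs]
          calc _ ≤ |S.G μ θ₀ t (θ₀ + x / μ) z| * 1 := by gcongr; exact abs_cos_le_one _
            _ ≤ _ := by rw [mul_one]; exact hG _ _ _
        rw [h1, sub_zero, abs_of_pos pi_pos, norm_mul, norm_eq_abs, norm_eq_abs, abs_of_pos (by positivity : 0 < π / 2)] at h2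
        have : 0 < π := pi_pos
        nlinarith) t z
    refine this.trans ?_
    have h4 : (μ ^ 2 - 4) * (k:ℝ) ^ 2 ≤ (μ * k) ^ 2 - a ^ 2 := by
      have : a ^ 2 ≤ 4 := by rw [← sq_abs]; nlinarith [abs_nonneg a]
      nlinarith
    calc _ ≤ 2 * K / ((μ ^ 2 - 4) * (k:ℝ) ^ 2) * exp (a * t) := by gcongr
      _ = _ := by field_simp
  have split : S.V μ θ₀ t θ z = ∑ k ∈ Finset.univ.image (fun i => (S.n i).natAbs), cos (μ * k * (θ - θ₀)) *
      ∑ i ∈ Finset.univ.filter (fun i => (S.n i).natAbs = k), S.Y i t * cos (S.m i * z + S.β i) := by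
    unfold SD.V
    rw [← Finset.sum_fiberwise_of_maps_to (s := Finset.univ) (t := Finset.univ.image (fun i => (S.n i).natAbs)) (g := fun i => (S.n i).natAbs) (fun i _ => Finset.mem_image_of_mem _ (Finset.mem_univ i))]
    refine Finset.sum_congr rfl fun k _ => ?_
    rw [Finset.mul_sum]
    refine Finset.sum_congr rfl fun i hi => ?_
    have hi : (S.n i).natAbs = k := (Finset.mem_filter.1 hi).2
    have : cos (μ * S.n i * (θ - θ₀)) = cos (μ * k * (θ - θ₀)) := by
      rw [← hi]
      rcases Int.natAbs_eq (S.n i) with h | h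
      · have : (S.n i : ℝ) = ((S.n i).natAbs : ℝ) := by
          have h' := congrArg (Int.cast : ℤ → ℝ) h
          simpa using h'
        rw [← this]
      · have : (S.n i : ℝ) = -((S.n i).natAbs : ℝ) := by
          have h' := congrArg (Int.cast : ℤ → ℝ) h
          simpa using h'
        rw [this, ← cos_neg]; congr 1; ring
    rw [this]; ring
  rw [split]
  have hsum : Summable fun k : ℕ => 1 / (k : ℝ) ^ 2 := Real.summable_one_div_nat_pow.2 (by norm_num)
  calc _ ≤ ∑ k ∈ Finset.univ.image (fun i => (S.n i).natAbs), (2 * K * exp (a * t)) / (μ ^ 2 - 4) * (1 / (k : ℝ) ^ 2) := by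
        refine (Finset.abs_sum_le_sum_abs _ _).trans (Finset.sum_le_sum fun k _ => ?_)
        rw [abs_mul]
        by_cases hk : k = 0
        · have : ∑ i ∈ Finset.univ.filter (fun i => (S.n i).natAbs = k), S.Y i t * cos (S.m i * z + S.β i) = 0 := by
            refine Finset.sum_eq_zero fun i hi => ?_
            have hi : (S.n i).natAbs = k := (Finset.mem_filter.1 hi).2
            rw [(hd i).1 (by omega), zero_mul]
          rw [this]; simp; positivity
        · calc _ ≤ 1 * |∑ i ∈ Finset.univ.filter (fun i => (S.n i).natAbs = k), S.Y i t * cos (S.m i * z + S.β i)| := by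
                gcongr; exact abs_cos_le_one _
            _ ≤ _ := by rw [one_mul]; exact key k hk
    _ = (2 * K * exp (a * t)) / (μ ^ 2 - 4) * ∑ k ∈ Finset.univ.image (fun i => (S.n i).natAbs), (1 / (k : ℝ) ^ 2) := by rw [Finset.mul_sum]
    _ ≤ (2 * K * exp (a * t)) / (μ ^ 2 - 4) * ∑' k : ℕ, 1 / (k : ℝ) ^ 2 := by
        gcongr; exact hsum.sum_le_tsum _ (fun _ _ => by positivity)
    _ = _ := by unfold CC; ring
end

section
def Approx (μ θ₀ : ℝ) (V F : ℝ → ℝ → ℝ → ℝ) : Prop := ∀ ε > 0, ∀ L : ℝ, ∃ S : SD, ∀ t θ z, |t| ≤ L →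
  |S.V μ θ₀ t θ z - V t θ z| ≤ ε ∧ |S.G μ θ₀ t θ z - F t θ z| ≤ ε

def SD.zero : SD where
  ι := Empty
  fin := inferInstance
  n := fun _ => 0
  m := fun _ => 0
  β := fun _ => 0
  Y := fun _ _ => 0
  Y1 := fun _ _ => 0
  Y2 := fun _ _ => 0
  h1 := fun i => i.elim
  h2 := fun i => i.elim
  h3 := fun i => i.elim

lemma Approx.add {μ θ₀ : ℝ} {V F V' F' : ℝ → ℝ → ℝ → ℝ} (h : Approx μ θ₀ V F) (h' : Approx μ θ₀ V' F') :
    Approx μ θ₀ (fun t θ z => V t θ z + V' t θ z) (fun t θ z => F t θ z + F' t θ z) := by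
  intro ε hε L
  obtain ⟨S, hS⟩ := h (ε/2) (by positivity) L
  obtain ⟨S', hS'⟩ := h' (ε/2) (by positivity) L
  refine ⟨S.sub (SD.zero.sub S'), fun t θ z ht => ?_⟩
  have e1 : SD.zero.V μ θ₀ t θ z = 0 := Fintype.sum_empty (ι := Empty) _
  have e2 : SD.zero.G μ θ₀ t θ z = 0 := Fintype.sum_empty (ι := Empty) _
  rw [SD.V_sub, SD.V_sub, SD.G_sub, SD.G_sub, e1, e2]
  have a := hS t θ z ht
  have b := hS' t θ z ht
  simp only [abs_le] at a b ⊢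
  constructor <;> constructor <;> linarith [a.1.1, a.1.2, a.2.1, a.2.2, b.1.1, b.1.2, b.2.1, b.2.2]

lemma cont_of_loc {W : ℝ → ℝ → ℝ → ℝ} (h : ∀ ε > 0, ∀ L : ℝ, ∃ g : ℝ → ℝ → ℝ → ℝ, Continuous (fun p : ℝ × ℝ × ℝ => g p.1 p.2.1 p.2.2) ∧
    ∀ t θ z, |t| ≤ L → |g t θ z - W t θ z| ≤ ε) : Continuous fun p : ℝ × ℝ × ℝ => W p.1 p.2.1 p.2.2 := by
  refine continuous_of_locally_uniform_approx_of_continuousAt fun x u hu => ?_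
  obtain ⟨ε, hε, hu⟩ := mem_uniformity_dist.1 hu
  obtain ⟨g, hg, hb⟩ := h (ε/2) (by positivity) (|x.1| + 1)
  refine ⟨{p | |p.1| < |x.1| + 1}, ?_, fun p => g p.1 p.2.1 p.2.2, hg.continuousAt, fun y hy => hu ?_⟩
  · refine IsOpen.mem_nhds (isOpen_lt (by fun_prop) (by fun_prop)) ?_
    simp
  · rw [dist_comm, Real.dist_eq]
    exact (hb y.1 y.2.1 y.2.2 (le_of_lt hy)).trans_lt (by linarith)

lemma Approx.contV {μ θ₀ : ℝ} {V F : ℝ → ℝ → ℝ → ℝ} (h : Approx μ θ₀ V F) : Continuous fun p : ℝ × ℝ × ℝ => V p.1 p.2.1 p.2.2 :=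
  cont_of_loc fun ε hε L => by
    obtain ⟨S, hS⟩ := h ε hε L
    exact ⟨_, S.V_cont μ θ₀, fun t θ z ht => (hS t θ z ht).1⟩

lemma Approx.contF {μ θ₀ : ℝ} {V F : ℝ → ℝ → ℝ → ℝ} (h : Approx μ θ₀ V F) : Continuous fun p : ℝ × ℝ × ℝ => F p.1 p.2.1 p.2.2 :=
  cont_of_loc fun ε hε L => by
    obtain ⟨S, hS⟩ := h ε hε L
    exact ⟨_, S.G_cont μ θ₀, fun t θ z ht => (hS t θ z ht).2⟩

lemma eq_of_close {a b : ℝ} (h : ∀ ε > 0, ∃ c, |c - a| ≤ ε ∧ |c - b| ≤ ε) : a = b := by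
  refine eq_of_forall_dist_le fun ε hε => ?_
  obtain ⟨c, h1, h2⟩ := h (ε/2) (by positivity)
  rw [Real.dist_eq]
  rw [abs_le] at *
  constructor <;> linarith [h1.1, h1.2, h2.1, h2.2]

lemma Approx.tri {μ θ₀ : ℝ} (hμ : 0 < μ) {V F : ℝ → ℝ → ℝ → ℝ} (h : Approx μ θ₀ V F) (t θ z : ℝ) : V t (tri μ θ₀ θ) z = V t θ z :=
  eq_of_close fun ε hε => by
    obtain ⟨S, hS⟩ := h ε hε |t|
    exact ⟨_, (hS t (_root_.tri μ θ₀ θ) z le_rfl).1, by rw [S.V_tri hμ]; exact (hS t θ z le_rfl).1⟩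

lemma Approx.per {μ θ₀ : ℝ} {V F : ℝ → ℝ → ℝ → ℝ} (h : Approx μ θ₀ V F) (t θ z : ℝ) : V t θ (z + 2 * π) = V t θ z :=
  eq_of_close fun ε hε => by
    obtain ⟨S, hS⟩ := h ε hε |t|
    exact ⟨_, (hS t θ (z + 2 * π) le_rfl).1, by rw [S.V_per]; exact (hS t θ z le_rfl).1⟩

def TD.mean (D : TD) (t z : ℝ) : ℝ := ∑ i, if D.n i = 0 then D.c i t * cos (D.m i * z + D.β i) else 0

lemma TD.mean_eq (D : TD) {μ : ℝ} (hμ : 0 < μ) (θ₀ t z : ℝ) :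
    ∫ x in (0:ℝ)..π, D.F μ θ₀ t (θ₀ + x / μ) z = π * D.mean t z := by
  have e : ∀ x : ℝ, D.F μ θ₀ t (θ₀ + x / μ) z = ∑ i, (D.c i t * cos (D.m i * z + D.β i)) * cos (D.n i * x) := fun x => by
    unfold TD.F
    refine Finset.sum_congr rfl fun i _ => ?_
    have : μ * D.n i * (θ₀ + x / μ - θ₀) = D.n i * x := by field_simp; ring
    rw [this]; ring
  simp_rw [e]
  rw [intervalIntegral.integral_finsetSum (fun i _ => by apply Continuous.intervalIntegrable; fun_prop)]
  simp_rw [intervalIntegral.integral_const_mul, int_cos_int]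
  unfold TD.mean
  rw [Finset.mul_sum]
  refine Finset.sum_congr rfl fun i _ => ?_
  split_ifs <;> ring

lemma TD.mean_close (D : TD) {μ : ℝ} (hμ : 0 < μ) (θ₀ t z : ℝ) {F : ℝ → ℝ} {A ε : ℝ} (hF : Continuous F) (hA : ∫ x in (0:ℝ)..π, F (θ₀ + x / μ) = π * A)
    (h : ∀ θ, |D.F μ θ₀ t θ z - F θ| ≤ ε) : |D.mean t z - A| ≤ ε := by
  have h1 : ‖∫ x in (0:ℝ)..π, (D.F μ θ₀ t (θ₀ + x / μ) z - F (θ₀ + x / μ))‖ ≤ ε * |π - 0| :=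
    intervalIntegral.norm_integral_le_of_norm_le_const fun x _ => h _
  have c1 : Continuous fun x => D.F μ θ₀ t (θ₀ + x / μ) z :=
    (D.F_cont μ θ₀).comp (by fun_prop : Continuous fun x : ℝ => (t, θ₀ + x / μ, z))
  have c2 : Continuous fun x => F (θ₀ + x / μ) := hF.comp (by fun_prop)
  rw [intervalIntegral.integral_sub (c1.intervalIntegrable _ _) (c2.intervalIntegrable _ _), D.mean_eq hμ, hA, ← mul_sub, sub_zero, norm_mul,
    norm_eq_abs, norm_eq_abs, abs_of_pos pi_pos, mul_comm] at h1
  exact le_of_mul_le_mul_right h1 pi_pos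

lemma TD.exists_SD (D : TD) {μ T : ℝ} (hμ : 0 < μ) (θ₀ : ℝ) (hT : 0 < T) (hs : ∀ i t, T < |t| → D.c i t = 0) :
    ∃ S : SD, S.Dec μ ∧ ∀ t θ z, S.G μ θ₀ t θ z = D.F μ θ₀ t θ z - D.mean t z := by
  have : ∀ i, ∃ y y' : ℝ → ℝ, (∀ t, HasDerivAt y (y' t) t) ∧ (∀ t, HasDerivAt y' (((μ * D.n i) ^ 2 + (D.m i : ℝ) ^ 2 * exp (2 * t)) * y t + if D.n i = 0 then 0 else D.c i t) t) ∧
      (D.n i = 0 → ∀ t, y t = 0) ∧ ∃ C : ℝ, ∀ t, |y t| ≤ C * exp (-(μ * (D.n i).natAbs * |t|)) := by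
    intro i
    by_cases h : D.n i = 0
    · refine ⟨fun _ => 0, fun _ => 0, fun t => hasDerivAt_const _ _, fun t => ?_, fun _ _ => rfl, 0, fun t => by simp⟩
      simpa [h] using hasDerivAt_const t (0:ℝ)
    · have hn : 0 < μ * ((D.n i).natAbs : ℝ) := by
        have : 0 < (D.n i).natAbs := Int.natAbs_pos.2 h
        positivity
      obtain ⟨y, y', h1, h2, h3⟩ := ode_exists (κ := (D.m i : ℝ) ^ 2) (sq_nonneg _) hn (D.cc i) hT (hs i)
      refine ⟨y, y', h1, fun t => ?_, fun h' => absurd h' h, h3⟩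
      refine (h2 t).congr_deriv ?_
      have : (μ * ((D.n i).natAbs : ℝ)) ^ 2 = (μ * D.n i) ^ 2 := by
        rw [mul_pow, mul_pow, Nat.cast_natAbs, Int.cast_abs, sq_abs]
      rw [this, if_neg h]
  choose Y Y1 h1 h2 h3 h4 using this
  refine ⟨{ ι := D.ι, fin := D.fin, n := D.n, m := D.m, β := D.β, Y := Y, Y1 := Y1, Y2 := fun i t => _, h1 := h1, h2 := h2, h3 := fun i => ?_ }, fun i => ⟨h3 i, h4 i⟩, fun t θ z => ?_⟩
  · have := D.cc i
    have : Continuous (Y i) := continuous_iff_continuousAt.2 fun t => (h1 i t).continuousAt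
    split_ifs <;> fun_prop
  · unfold SD.G SD.c TD.F TD.mean
    dsimp only
    rw [← Finset.sum_sub_distrib]
    refine Finset.sum_congr rfl fun i _ => ?_
    split_ifs with h
    · simp [h]
    · ring

/-- solution of the problem with vanishing angular mean -/
lemma solve_ne {μ : ℝ} (hμ : 2 < μ) (θ₀ : ℝ) {F : ℝ → ℝ → ℝ → ℝ} (hF : Continuous fun p : ℝ × ℝ × ℝ => F p.1 p.2.1 p.2.2)
    (hper : ∀ t θ z, F t θ (z + 2 * π) = F t θ z) (htri : ∀ t θ z, F t (tri μ θ₀ θ) z = F t θ z)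
    (hmean : ∀ t z, ∫ x in (0:ℝ)..π, F t (θ₀ + x / μ) z = 0)
    {a1 a2 K : ℝ} (h1 : 1 < a1) (h1' : a1 < 2) (h2 : a2 < 1) (h2' : 0 < a2) (hK : 0 ≤ K)
    (hFK : ∀ t θ z, |F t θ z| ≤ K * min (exp (a1 * t)) (exp (a2 * t))) :
    ∃ V : ℝ → ℝ → ℝ → ℝ, Approx μ θ₀ V F ∧ ∃ C ≥ 0, ∀ t θ z, |V t θ z| ≤ C * min (exp (a1 * t)) (exp (a2 * t)) := by
  have hμ0 : 0 < μ := by linarith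
  have CCn : 0 ≤ CC μ := by
    unfold CC
    have : 0 ≤ 2 / (μ ^ 2 - 4) := div_nonneg (by norm_num) (by nlinarith)
    exact mul_nonneg this (tsum_nonneg fun k => by positivity)
  obtain ⟨D, ε, hε, hsup, hb, hc⟩ := approx_seq hμ0 θ₀ hF hper htri h1 h2 hK hFK
  choose S hdec hSG using fun N : ℕ => (D N).exists_SD hμ0 θ₀ (T := N + 2) (by positivity) (hsup N)
  have Fc : ∀ t z, Continuous fun θ => F t θ z := fun t z => hF.comp (by fun_prop : Continuous fun θ : ℝ => (t, θ, z))
  have m1 : ∀ N t z, |(D N).mean t z| ≤ ε N * exp (1 * t) := fun N t z => by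
    simpa using (D N).mean_close hμ0 θ₀ t z (A := 0) (Fc t z) (by simpa using hmean t z) fun θ => hc N t θ z
  have m2 : ∀ N t z, |(D N).mean t z| ≤ (K + 1) * min (exp (a1 * t)) (exp (a2 * t)) := fun N t z => by
    simpa using (D N).mean_close hμ0 θ₀ t z (F := fun _ => 0) (A := 0) continuous_const (by simp) fun θ => by simpa using hb N t θ z
  have g1 : ∀ N t θ z, |(S N).G μ θ₀ t θ z - F t θ z| ≤ 2 * ε N * exp (1 * t) := fun N t θ z => by
    have a := hc N t θ z
    have b := m1 N t z
    rw [hSG]; rw [abs_le] at *; constructor <;> linarith [a.1, a.2, b.1, b.2]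
  have g2 : ∀ N t θ z, |(S N).G μ θ₀ t θ z| ≤ 2 * (K + 1) * min (exp (a1 * t)) (exp (a2 * t)) := fun N t θ z => by
    have a := hb N t θ z
    have b := m2 N t z
    rw [hSG]; rw [abs_le] at *; constructor <;> linarith [a.1, a.2, b.1, b.2]
  have v2 : ∀ N t θ z, |(S N).V μ θ₀ t θ z| ≤ (CC μ * (2 * (K + 1))) * min (exp (a1 * t)) (exp (a2 * t)) := fun N t θ z => by
    rw [mul_min_of_nonneg _ _ (by positivity)]
    refine le_min ?_ ?_
    · refine SD.bound _ hμ (by rw [abs_lt]; constructor <;> linarith) (by positivity) (hdec N) (fun t θ z => (g2 N t θ z).trans ?_) t θ z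
      exact mul_le_mul_of_nonneg_left (min_le_left _ _) (by positivity)
    · refine SD.bound _ hμ (by rw [abs_lt]; constructor <;> linarith) (by positivity) (hdec N) (fun t θ z => (g2 N t θ z).trans ?_) t θ z
      exact mul_le_mul_of_nonneg_left (min_le_right _ _) (by positivity)
  have v1 : ∀ N M t θ z, |(S N).V μ θ₀ t θ z - (S M).V μ θ₀ t θ z| ≤ CC μ * (2 * |ε N| + 2 * |ε M|) * exp (1 * t) := fun N M t θ z => by
    rw [← SD.V_sub]
    refine SD.bound _ hμ (by rw [abs_lt]; constructor <;> linarith) (by positivity) (SD.Dec_sub (hdec N) (hdec M)) (fun t θ z => ?_) t θ z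
    rw [SD.G_sub]
    have a := g1 N t θ z
    have b := g1 M t θ z
    have c := mul_le_mul_of_nonneg_right (le_abs_self (ε N)) (exp_pos (1 * t)).le
    have d := mul_le_mul_of_nonneg_right (le_abs_self (ε M)) (exp_pos (1 * t)).le
    rw [abs_le] at *; constructor <;> linarith [a.1, a.2, b.1, b.2]
  have εa : Tendsto (fun N => |ε N|) atTop (𝓝 0) := by simpa using hε.abs
  have cau : ∀ t θ z, ∃ v, Tendsto (fun N => (S N).V μ θ₀ t θ z) atTop (𝓝 v) := fun t θ z => by
    refine cauchySeq_tendsto_of_complete (Metric.cauchySeq_iff'.2 fun e he => ?_)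
    have : Tendsto (fun N => CC μ * (2 * |ε N| + 2 * |ε N|) * exp (1 * t)) atTop (𝓝 0) := by
      simpa using (((εa.const_mul 2).add (εa.const_mul 2)).const_mul (CC μ)).mul_const (exp (1 * t))
    have : Tendsto (fun N => CC μ * (2 * |ε N|) * exp (1 * t)) atTop (𝓝 0) := by
      simpa using ((εa.const_mul 2).const_mul (CC μ)).mul_const (exp (1 * t))
    obtain ⟨N, hN⟩ := eventually_atTop.1 (this.eventually (gt_mem_nhds (half_pos he)))
    refine ⟨N, fun n hn => ?_⟩
    rw [Real.dist_eq]
    refine (v1 n N t θ z).trans_lt ?_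
    have := hN n hn
    have := hN N le_rfl
    linarith
  choose V hV using cau
  refine ⟨V, fun e he L => ?_, CC μ * (2 * (K + 1)), by positivity, fun t θ z => le_of_tendsto (hV t θ z).abs (Eventually.of_forall fun N => v2 N t θ z)⟩
  have q1 : Tendsto (fun N => CC μ * (2 * |ε N|) * exp (1 * L)) atTop (𝓝 0) := by
    simpa using ((εa.const_mul 2).const_mul (CC μ)).mul_const (exp (1 * L))
  have q2 : Tendsto (fun N => (2 * |ε N|) * exp (1 * L)) atTop (𝓝 0) := by
    simpa using (εa.const_mul 2).mul_const (exp (1 * L))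
  obtain ⟨N, hN1, hN2⟩ := ((q1.eventually (gt_mem_nhds he)).and (q2.eventually (gt_mem_nhds he))).exists
  refine ⟨S N, fun t θ z ht => ?_⟩
  have hexp : exp (1 * t) ≤ exp (1 * L) := exp_le_exp.2 (by linarith [le_abs_self t])
  constructor
  · have h3 : Tendsto (fun M => CC μ * (2 * |ε N| + 2 * |ε M|) * exp (1 * t)) atTop (𝓝 (CC μ * (2 * |ε N| + 2 * 0) * exp (1 * t))) :=
      (((εa.const_mul 2).const_add _).const_mul (CC μ)).mul_const _
    have := le_of_tendsto_of_tendsto' ((hV t θ z).const_sub ((S N).V μ θ₀ t θ z)).abs h3 fun M => v1 N M t θ z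
    rw [mul_zero, add_zero] at this
    exact this.trans ((mul_le_mul_of_nonneg_left hexp (by positivity)).trans hN1.le)
  · refine (g1 N t θ z).trans (le_trans ?_ hN2.le)
    refine (mul_le_mul_of_nonneg_right (mul_le_mul_of_nonneg_left (le_abs_self _) (by norm_num)) (exp_pos _).le).trans ?_
    exact mul_le_mul_of_nonneg_left hexp (by positivity)
end

section
lemma mode0 (m : ℤ) {c : ℝ → ℝ} (hc : Continuous c) {T : ℝ} (hT : 0 < T) (hs : ∀ t, T < |t| → c t = 0) :
    ∃ P P' v : ℝ → ℝ, (∀ t, HasDerivAt P (P' t) t) ∧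
      (∀ t, HasDerivAt P' ((1 ^ 2 + (m:ℝ) ^ 2 * exp (2 * t)) * P t + c t) t) ∧
      (∃ C, ∀ t, |P t| ≤ C * exp (-(1 * |t|))) ∧ (∀ t, HasDerivAt v (exp t * P t) t) ∧
      ∀ t, HasDerivAt (fun t => exp t * P t) ((m:ℝ) ^ 2 * exp (2 * t) * v t + exp (2 * t) * ∫ s in T..t, exp (-s) * c s) t := by
  obtain ⟨P, P', h1, h2, C, h3⟩ := ode_exists (κ := (m:ℝ) ^ 2) (sq_nonneg _) one_pos hc hT hs
  have Pc : Continuous P := continuous_iff_continuousAt.2 fun t => (h1 t).continuousAt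
  set g : ℝ → ℝ := fun t => ∫ s in T..t, exp (-s) * c s with hg
  have hgd : ∀ t, HasDerivAt g (exp (-t) * c t) t := fun t => by
    have hh : Continuous fun s => exp (-s) * c s := by fun_prop
    exact intervalIntegral.integral_hasDerivAt_right (hh.intervalIntegrable _ _) (hh.stronglyMeasurableAtFilter _ _) hh.continuousAt
  have e1 : ∀ t, exp (-t) * exp t = 1 := fun t => by rw [← exp_add]; simp
  have e2 : ∀ t, exp (2 * t) = exp t * exp t := fun t => by rw [← exp_add]; ring_nf
  have E1 : ∀ t, HasDerivAt (fun t => exp t * P t) (exp t * (P' t + P t)) t := fun t =>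
    ((Real.hasDerivAt_exp t).mul (h1 t)).congr_deriv (by ring)
  have en : ∀ t : ℝ, HasDerivAt (fun t => exp (-t)) (-exp (-t)) t := fun t => by
    simpa using (hasDerivAt_neg t).exp
  set q : ℝ → ℝ := fun t => exp (-t) * (P' t + P t) - g t with hq
  have hqd : ∀ t, HasDerivAt q ((m:ℝ) ^ 2 * (exp t * P t)) t := fun t => by
    refine (((en t).mul ((h2 t).add (h1 t))).sub (hgd t)).congr_deriv ?_
    have := e1 t
    rw [e2 t]
    simp only [Pi.add_apply]
    linear_combination (m:ℝ) ^ 2 * exp t * P t * this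
  by_cases hm : m = 0
  · have hk : ∀ t, q t = q T := fun t => is_const_of_deriv_eq_zero (fun s => (hqd s).differentiableAt) (fun s => by rw [(hqd s).deriv, hm]; simp) t T
    have gT : ∀ t, T ≤ t → g t = 0 := fun t ht => by
      refine (intervalIntegral.integral_congr (g := fun _ => 0) fun s hs' => ?_).trans (by simp)
      rw [uIcc_of_le ht] at hs'
      rcases eq_or_lt_of_le hs'.1 with h | h
      · have : c T = 0 := by
          have hcl : IsClosed {t | c t = 0} := isClosed_eq hc continuous_const
          refine hcl.closure_subset_iff.2 (fun x (hx : x ∈ Ioi T) => hs x (lt_of_lt_of_le hx (le_abs_self x))) ?_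
          rw [closure_Ioi]; exact self_mem_Ici
        simp only [← h, this, mul_zero]
      · simp only [hs s (h.trans_le (le_abs_self s)), mul_zero]
    have q0 : q T = 0 := by
      -- exp t * P t - k/2 exp (2t) constant on t ≥ T
      have hco : ∀ t, T ≤ t → exp t * P t - q T / 2 * exp (2 * t) = exp T * P T - q T / 2 * exp (2 * T) := fun t ht => by
        have hd : ∀ s, HasDerivAt (fun t => exp t * P t - q T / 2 * exp (2 * t)) (exp (2 * s) * g s) s := fun s => by
          have : HasDerivAt (fun t : ℝ => exp (2 * t)) (exp (2 * s) * 2) s := by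
            simpa using ((hasDerivAt_id s).const_mul 2).exp
          refine ((E1 s).sub (this.const_mul (q T / 2))).congr_deriv ?_
          have h4 := hk s
          simp only [hq] at h4 ⊢
          have h5 := e1 s
          rw [e2 s]
          linear_combination exp s * exp s * h4 - exp s * (P' s + P s) * h5
        refine constant_of_has_deriv_right_zero (b := t) (a := T) (f := fun t => exp t * P t - q T / 2 * exp (2 * t)) (fun s _ => (hd s).continuousAt.continuousWithinAt) (fun s hs' => ?_) t ⟨ht, le_rfl⟩
        have := (hd s).hasDerivWithinAt (s := Ici s)
        rwa [gT s hs'.1, mul_zero] at this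
      by_contra hne
      have hb : ∀ t, T ≤ t → |q T| / 2 * exp (2 * t) ≤ C + |exp T * P T - q T / 2 * exp (2 * T)| := fun t ht => by
        have a1 := hco t ht
        have a2 : |exp t * P t| ≤ C := by
          rw [abs_mul, abs_of_pos (exp_pos t)]
          have := mul_le_mul_of_nonneg_left (h3 t) (exp_pos t).le
          rw [abs_of_pos (hT.trans_le ht), one_mul] at this
          refine this.trans (le_of_eq ?_)
          linear_combination C * e1 t
        have a3 : |q T| / 2 * exp (2 * t) = |q T / 2 * exp (2 * t)| := by
          rw [abs_mul, abs_div, abs_of_pos (exp_pos (2 * t)), abs_of_pos (two_pos : (0:ℝ) < 2)]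
        have a4 : q T / 2 * exp (2 * t) = exp t * P t - (exp T * P T - q T / 2 * exp (2 * T)) := by linarith
        rw [a3, a4]
        exact (abs_sub _ _).trans (by linarith)
      have hpos : 0 < |q T| / 2 := by positivity
      have : Tendsto (fun t : ℝ => |q T| / 2 * exp (2 * t)) atTop atTop :=
        Tendsto.const_mul_atTop hpos (tendsto_exp_atTop.comp (tendsto_id.const_mul_atTop two_pos))
      obtain ⟨t, h5, h6⟩ := ((this.eventually_gt_atTop (C + |exp T * P T - q T / 2 * exp (2 * T)|)).and (eventually_ge_atTop T)).exists
      exact absurd (hb t h6) (not_le.2 h5)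
    have hh : Continuous fun s => exp s * P s := by fun_prop
    refine ⟨P, P', fun t => ∫ s in (0:ℝ)..t, exp s * P s, h1, h2, ⟨C, h3⟩, fun t => intervalIntegral.integral_hasDerivAt_right (hh.intervalIntegrable _ _) (hh.stronglyMeasurableAtFilter _ _) hh.continuousAt, fun t => (E1 t).congr_deriv ?_⟩
    have h4 := hk t
    rw [q0] at h4
    simp only [hq] at h4
    have h5 := e1 t
    rw [hm, e2 t]
    simp only [Int.cast_zero]
    show _ = 0 ^ 2 * (exp t * exp t) * _ + exp t * exp t * g t
    linear_combination exp t * exp t * h4 - exp t * (P' t + P t) * h5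
  · have hm' : (m:ℝ) ^ 2 ≠ 0 := by have : (m:ℝ) ≠ 0 := by exact_mod_cast hm
                                   positivity
    refine ⟨P, P', fun t => q t / (m:ℝ) ^ 2, h1, h2, ⟨C, h3⟩, fun t => ((hqd t).div_const _).congr_deriv (by field_simp), fun t => (E1 t).congr_deriv ?_⟩
    rw [e2 t]
    show _ = (m:ℝ) ^ 2 * (exp t * exp t) * (q t / (m:ℝ) ^ 2) + exp t * exp t * g t
    have : (m:ℝ) ^ 2 * (exp t * exp t) * (q t / (m:ℝ) ^ 2) = exp t * exp t * q t := by field_simp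
    rw [this]
    simp only [hq]
    have h5 := e1 t
    linear_combination - exp t * (P' t + P t) * h5

def SD.V1 (S : SD) (t z : ℝ) : ℝ := ∑ i, S.Y1 i t * cos (S.m i * z + S.β i)

def SD.N0 (S : SD) : Prop := ∀ i, S.n i = 0

lemma SD.N0_V {S : SD} (h : S.N0) (μ θ₀ t θ z : ℝ) : S.V μ θ₀ t θ z = ∑ i, S.Y i t * cos (S.m i * z + S.β i) :=
  Finset.sum_congr rfl fun i _ => by simp [h i]

lemma SD.N0_G {S : SD} (h : S.N0) (μ θ₀ t θ z : ℝ) : S.G μ θ₀ t θ z = ∑ i, (S.Y2 i t - (S.m i : ℝ) ^ 2 * exp (2 * t) * S.Y i t) * cos (S.m i * z + S.β i) :=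
  Finset.sum_congr rfl fun i _ => by simp [h i, SD.c]

lemma SD.N0_sub {S S' : SD} (h : S.N0) (h' : S'.N0) : (S.sub S').N0 := by
  rintro (i | i); exacts [h i, h' i]

lemma SD.V1_sub (S S' : SD) (t z : ℝ) : (S.sub S').V1 t z = S.V1 t z - S'.V1 t z := by
  unfold SD.V1 SD.sub
  rw [Fintype.sum_sum_type, sub_eq_add_neg, ← Finset.sum_neg_distrib]
  congr 1
  exact Finset.sum_congr rfl fun i _ => by simp

lemma SD.dV {S : SD} (h : S.N0) (μ θ₀ t θ z : ℝ) : HasDerivAt (fun t => S.V μ θ₀ t θ z) (S.V1 t z) t := by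
  simp only [SD.N0_V h]
  exact HasDerivAt.fun_sum fun i _ => (S.h1 i t).mul_const _

lemma SD.dV1 {S : SD} (t z : ℝ) : HasDerivAt (fun t => S.V1 t z) (∑ i, S.Y2 i t * cos (S.m i * z + S.β i)) t :=
  HasDerivAt.fun_sum fun i _ => (S.h2 i t).mul_const _

lemma kap (t0 : ℝ) : ∫ t in t0..t0 + 1, exp (2 * t) = (exp 2 - 1) / 2 * exp (2 * t0) := by
  have : ∀ t ∈ uIcc t0 (t0 + 1), HasDerivAt (fun t => exp (2 * t) / 2) (exp (2 * t)) t := fun t _ => by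
    have := (((hasDerivAt_id t).const_mul 2).exp).div_const 2
    simpa using this
  rw [intervalIntegral.integral_eq_sub_of_hasDerivAt this ((by fun_prop : Continuous fun t : ℝ => exp (2 * t)).intervalIntegrable _ _)]
  rw [mul_add, exp_add]; ring_nf

lemma kap_gt : 1 ≤ (exp 2 - 1) / 2 := by linarith [add_one_le_exp (2:ℝ)]

lemma SD.V_lip {S : SD} (h : S.N0) {μ θ₀ t0 A : ℝ} (hA : ∀ t z, |t - t0| ≤ 1 → |S.V1 t z| ≤ A) {t θ z : ℝ} (ht : |t - t0| ≤ 1) :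
    |S.V μ θ₀ t θ z - S.V μ θ₀ t0 θ z| ≤ A := by
  have A0 : 0 ≤ A := (abs_nonneg _).trans (hA t0 0 (by simp))
  have := (convex_Icc (t0 - 1) (t0 + 1)).norm_image_sub_le_of_norm_hasDerivWithin_le (f := fun t => S.V μ θ₀ t θ z) (f' := fun t => S.V1 t z) (C := A)
    (fun s _ => (SD.dV h μ θ₀ s θ z).hasDerivWithinAt) (fun s hs => hA s z (by rw [abs_le]; constructor <;> linarith [hs.1, hs.2])) (x := t0) (y := t) (by constructor <;> linarith)
    (by rw [abs_le] at ht; constructor <;> linarith [ht.1, ht.2])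
  rw [norm_eq_abs, norm_eq_abs] at this
  nlinarith

lemma SD.key {S : SD} (h : S.N0) {μ θ₀ θ t0 A : ℝ} (hA : ∀ t z, |t - t0| ≤ 1 → |S.V1 t z| ≤ A) (hG : ∀ t z, |t - t0| ≤ 1 → |S.G μ θ₀ t θ z| ≤ A) :
    ∃ B B1 B2 : ℝ → ℝ, (∀ z, HasDerivAt B (B1 z) z) ∧ (∀ z, HasDerivAt B1 (B2 z) z) ∧ (∀ z, |B2 z| ≤ 3 * A) ∧ (∀ z, B (z + 2 * π) = B z) ∧
      ∀ z, |B z - (exp 2 - 1) / 2 * exp (2 * t0) * S.V μ θ₀ t0 θ z| ≤ (exp 2 - 1) / 2 * exp (2 * t0) * A := by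
  have A0 : 0 ≤ A := (abs_nonneg _).trans (hA t0 0 (by simp))
  have Yc := fun i => S.contY i
  have Y2c := fun i => S.h3 i
  set b : S.ι → ℝ := fun i => ∫ t in t0..t0 + 1, exp (2 * t) * S.Y i t with hb
  refine ⟨fun z => ∑ i, b i * cos (S.m i * z + S.β i), fun z => ∑ i, b i * (- sin (S.m i * z + S.β i) * S.m i), fun z => ∑ i, b i * (- (cos (S.m i * z + S.β i) * S.m i) * S.m i), fun z => ?_, fun z => ?_, fun z => ?_, fun z => ?_, fun z => ?_⟩
  · refine HasDerivAt.fun_sum fun i _ => HasDerivAt.const_mul _ ?_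
    have := (((hasDerivAt_id z).const_mul (S.m i : ℝ)).add_const (S.β i)).cos
    simpa using this
  · refine HasDerivAt.fun_sum fun i _ => HasDerivAt.const_mul _ ?_
    have := ((((hasDerivAt_id z).const_mul (S.m i : ℝ)).add_const (S.β i)).sin.neg).mul_const (S.m i : ℝ)
    simpa using this
  · have e : ∑ i, b i * (- (cos (S.m i * z + S.β i) * S.m i) * S.m i) = (∫ t in t0..t0+1, S.G μ θ₀ t θ z) - (S.V1 (t0 + 1) z - S.V1 t0 z) := by
      rw [← intervalIntegral.integral_eq_sub_of_hasDerivAt (fun t _ => SD.dV1 t z) (Continuous.intervalIntegrable (by fun_prop) _ _), ← intervalIntegral.integral_sub]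
      · simp only [SD.N0_G h, ← Finset.sum_sub_distrib]
        rw [intervalIntegral.integral_finsetSum (fun i _ => by apply Continuous.intervalIntegrable; fun_prop)]
        refine Finset.sum_congr rfl fun i _ => ?_
        rw [hb]
        simp only
        rw [← intervalIntegral.integral_mul_const]
        exact intervalIntegral.integral_congr fun t _ => by ring
      · simp only [SD.N0_G h]
        apply Continuous.intervalIntegrable; fun_prop
      · apply Continuous.intervalIntegrable; fun_prop
    simp only
    rw [e]
    have i1 : ‖∫ t in t0..t0+1, S.G μ θ₀ t θ z‖ ≤ A * |t0 + 1 - t0| := intervalIntegral.norm_integral_le_of_norm_le_const fun t ht => by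
      rw [uIoc_of_le (by linarith)] at ht
      exact hG t z (by rw [abs_le]; constructor <;> linarith [ht.1, ht.2])
    simp only [add_sub_cancel_left, abs_one, mul_one, norm_eq_abs] at i1
    have i2 := hA (t0 + 1) z (by simp)
    have i3 := hA t0 z (by simp)
    rw [abs_le] at *
    constructor <;> linarith [i1.1, i1.2, i2.1, i2.2, i3.1, i3.2]
  · simp only [cos_int_per]
  · have e : ∑ i, b i * cos (S.m i * z + S.β i) - (exp 2 - 1) / 2 * exp (2 * t0) * S.V μ θ₀ t0 θ z = ∫ t in t0..t0+1, exp (2 * t) * (S.V μ θ₀ t θ z - S.V μ θ₀ t0 θ z) := by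
      simp only [mul_sub]
      have c1 : Continuous fun t => exp (2 * t) * S.V μ θ₀ t θ z := by simp only [SD.N0_V h]; fun_prop
      rw [intervalIntegral.integral_sub (c1.intervalIntegrable _ _) (by apply Continuous.intervalIntegrable; fun_prop), intervalIntegral.integral_mul_const, kap]
      congr 1
      simp only [SD.N0_V h, Finset.mul_sum]
      rw [intervalIntegral.integral_finsetSum (fun i _ => by apply Continuous.intervalIntegrable; fun_prop)]
      refine Finset.sum_congr rfl fun i _ => ?_
      rw [hb]
      simp only
      rw [← intervalIntegral.integral_mul_const]
      exact intervalIntegral.integral_congr fun t _ => by ring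
    simp only
    rw [e, ← kap, ← intervalIntegral.integral_mul_const]
    rw [← norm_eq_abs]
    refine intervalIntegral.norm_integral_le_of_norm_le (μ := volume) (g := fun t => exp (2 * t) * A) (by linarith) (Eventually.of_forall fun t ht => ?_) (by apply Continuous.intervalIntegrable; fun_prop)
    rw [norm_mul, norm_eq_abs, norm_eq_abs, abs_of_pos (exp_pos _)]
    exact mul_le_mul_of_nonneg_left (SD.V_lip h hA (by rw [abs_le]; constructor <;> linarith [ht.1, ht.2])) (exp_pos _).le

lemma taylor1 {B B1 B2 : ℝ → ℝ} {A : ℝ} (h1 : ∀ z, HasDerivAt B (B1 z) z) (h2 : ∀ z, HasDerivAt B1 (B2 z) z) (h3 : ∀ z, |B2 z| ≤ A) (z0 z : ℝ) :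
    |B z - B z0 - B1 z0 * (z - z0)| ≤ A * |z - z0| ^ 2 := by
  have A0 : 0 ≤ A := (abs_nonneg _).trans (h3 0)
  have b1 : ∀ w, |B1 w - B1 z0| ≤ A * |w - z0| := fun w =>
    convex_univ.norm_image_sub_le_of_norm_hasDerivWithin_le (f := B1) (f' := B2) (C := A) (fun s _ => (h2 s).hasDerivWithinAt) (fun s _ => h3 s) (mem_univ z0) (mem_univ w)
  have := (convex_uIcc z0 z).norm_image_sub_le_of_norm_hasDerivWithin_le (f := fun w => B w - B1 z0 * w) (f' := fun w => B1 w - B1 z0) (C := A * |z - z0|)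
    (fun s _ => (((h1 s).sub ((hasDerivAt_id s).const_mul (B1 z0))).congr_deriv (by ring)).hasDerivWithinAt) (fun s hs => (b1 s).trans ?_) left_mem_uIcc right_mem_uIcc
  · simp only [norm_eq_abs] at this
    have e : B z - B z0 - B1 z0 * (z - z0) = B z - B1 z0 * z - (B z0 - B1 z0 * z0) := by ring
    rw [e]; refine this.trans (le_of_eq (by ring))
  · refine mul_le_mul_of_nonneg_left ?_ A0
    exact abs_sub_left_of_mem_uIcc hs

lemma SD.aff {S : SD} (h : S.N0) {μ θ₀ θ t0 A : ℝ} (hA : ∀ t z, |t - t0| ≤ 1 → |S.V1 t z| ≤ A) (hG : ∀ t z, |t - t0| ≤ 1 → |S.G μ θ₀ t θ z| ≤ A)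
    {t z z0 : ℝ} (ht : |t - t0| ≤ 1) (hz : |z - z0| ≤ exp t0) :
    |S.V μ θ₀ t θ z - S.V μ θ₀ t0 θ z0 - (S.V μ θ₀ t0 θ (z0 + exp t0) - S.V μ θ₀ t0 θ z0) / exp t0 * (z - z0)| ≤ 11 * A := by
  have A0 : 0 ≤ A := (abs_nonneg _).trans (hA t0 0 (by simp))
  obtain ⟨B, B1, B2, h1, h2, h3, -, h5⟩ := SD.key h hA hG
  set κ := (exp 2 - 1) / 2 * exp (2 * t0) with hκ
  have e2 : exp (2 * t0) = exp t0 ^ 2 := by rw [← exp_nat_mul]; norm_num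
  have hκ1 : exp t0 ^ 2 ≤ κ := by rw [hκ, ← e2]; nlinarith [kap_gt, exp_pos (2 * t0)]
  have r0 := exp_pos t0
  have hκ0 : 0 < κ := lt_of_lt_of_le (by positivity) hκ1
  have main : ∀ w, |w - z0| ≤ exp t0 → |S.V μ θ₀ t0 θ w - S.V μ θ₀ t0 θ z0 - B1 z0 / κ * (w - z0)| ≤ 5 * A := fun w hw => by
    have a1 := taylor1 h1 h2 h3 z0 w
    have a2 : 3 * A * |w - z0| ^ 2 ≤ 3 * A * κ := mul_le_mul_of_nonneg_left ((pow_le_pow_left₀ (abs_nonneg _) hw 2).trans hκ1) (by positivity)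
    have a3 := h5 w
    have a4 := h5 z0
    have e : κ * (S.V μ θ₀ t0 θ w - S.V μ θ₀ t0 θ z0 - B1 z0 / κ * (w - z0)) = κ * S.V μ θ₀ t0 θ w - κ * S.V μ θ₀ t0 θ z0 - B1 z0 * (w - z0) := by field_simp
    have : κ * |S.V μ θ₀ t0 θ w - S.V μ θ₀ t0 θ z0 - B1 z0 / κ * (w - z0)| ≤ κ * (5 * A) := by
      rw [← abs_of_pos hκ0, ← abs_mul, abs_of_pos hκ0, e]
      replace a1 := a1.trans a2
      rw [abs_le] at a1 a3 a4 ⊢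
      constructor <;> linarith [a1.1, a1.2, a3.1, a3.2, a4.1, a4.2]
    exact le_of_mul_le_mul_left this hκ0
  have m1 := main z hz
  have m2 := main (z0 + exp t0) (by simp [abs_of_pos r0])
  have m3 := SD.V_lip h (μ := μ) (θ₀ := θ₀) (θ := θ) (z := z) hA ht
  set W := S.V μ θ₀ t0 θ (z0 + exp t0) - S.V μ θ₀ t0 θ z0 with hW
  have m4 : |(W - B1 z0 / κ * exp t0) * ((z - z0) / exp t0)| ≤ 5 * A * 1 := by
    rw [abs_mul]
    refine mul_le_mul ?_ ?_ (abs_nonneg _) (by positivity)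
    · simpa using m2
    · rw [abs_div, abs_of_pos r0, div_le_one r0]; exact hz
  have e : W / exp t0 * (z - z0) = (W - B1 z0 / κ * exp t0) * ((z - z0) / exp t0) + B1 z0 / κ * (z - z0) := by field_simp; ring
  rw [e]
  rw [abs_le] at m1 m3 m4 ⊢
  constructor <;> linarith [m1.1, m1.2, m3.1, m3.2, m4.1, m4.2]

lemma SD.osc {S : SD} (h : S.N0) {μ θ₀ θ A : ℝ} (hA : ∀ t z, |t - 0| ≤ 1 → |S.V1 t z| ≤ A) (hG : ∀ t z, |t - 0| ≤ 1 → |S.G μ θ₀ t θ z| ≤ A)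
    (z : ℝ) : |S.V μ θ₀ 0 θ z - S.V μ θ₀ 0 θ 0| ≤ 122 * A := by
  have A0 : 0 ≤ A := (abs_nonneg _).trans (hA 0 0 (by simp))
  obtain ⟨B, B1, B2, h1, h2, h3, h4, h5⟩ := SD.key h hA hG
  simp only [mul_zero, exp_zero, mul_one] at h5
  set κ := (exp 2 - 1) / 2 with hκ
  have hκ1 : 1 ≤ κ := kap_gt
  have hπ : π ^ 2 ≤ 10 := by nlinarith [pi_lt_d2, pi_pos]
  have hB : ∀ z, |B z - B 0| ≤ 120 * A := fun z => by
    obtain ⟨y, hy, hyz⟩ := Function.Periodic.exists_mem_Ico₀ (f := B) h4 (by positivity) z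
    rw [hyz]
    obtain ⟨ξ, hξ, hξ0⟩ := exists_hasDerivAt_eq_zero (f := B) (f' := B1) (a := 0) (b := 2 * π) (by positivity) (fun s _ => (h1 s).continuousAt.continuousWithinAt) (by have := h4 0; rw [zero_add] at this; exact this.symm) (fun s _ => h1 s)
    have b1 : ∀ w ∈ Icc 0 (2 * π), |B1 w| ≤ 3 * A * (2 * π) := fun w hw => by
      have := convex_univ.norm_image_sub_le_of_norm_hasDerivWithin_le (f := B1) (f' := B2) (C := 3 * A) (fun s _ => (h2 s).hasDerivWithinAt) (fun s _ => h3 s) (mem_univ ξ) (mem_univ w)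
      rw [hξ0, sub_zero] at this
      refine this.trans (mul_le_mul_of_nonneg_left ?_ (by positivity))
      rw [norm_eq_abs, abs_le]; constructor <;> linarith [hξ.1, hξ.2, hw.1, hw.2]
    have := (convex_Icc 0 (2 * π)).norm_image_sub_le_of_norm_hasDerivWithin_le (f := B) (f' := B1) (C := 3 * A * (2 * π)) (fun s _ => (h1 s).hasDerivWithinAt) b1 (x := 0) (y := y) ⟨le_rfl, by positivity⟩ ⟨hy.1, hy.2.le⟩
    refine this.trans ?_
    rw [norm_eq_abs, sub_zero, abs_of_nonneg hy.1]
    have : 3 * A * (2 * π) * y ≤ 3 * A * (2 * π) * (2 * π) := mul_le_mul_of_nonneg_left hy.2.le (by positivity)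
    nlinarith
  have a1 := hB z
  have a2 := h5 z
  have a3 := h5 0
  have : κ * |S.V μ θ₀ 0 θ z - S.V μ θ₀ 0 θ 0| ≤ κ * (122 * A) := by
    rw [← abs_of_pos (by linarith : 0 < κ), ← abs_mul, abs_of_pos (by linarith : 0 < κ), mul_sub]
    have : 120 * A ≤ κ * (120 * A) := by nlinarith
    rw [abs_le] at a1 a2 a3 ⊢
    constructor <;> linarith [a1.1, a1.2, a2.1, a2.2, a3.1, a3.2]
  exact le_of_mul_le_mul_left this (by linarith)

def SD.const (a : ℝ) : SD where
  ι := Unit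
  fin := inferInstance
  n := fun _ => 0
  m := fun _ => 0
  β := fun _ => 0
  Y := fun _ _ => a
  Y1 := fun _ _ => 0
  Y2 := fun _ _ => 0
  h1 := fun i t => hasDerivAt_const _ _
  h2 := fun i t => hasDerivAt_const _ _
  h3 := fun i => continuous_const

lemma SD.const_V (a μ θ₀ t θ z : ℝ) : (SD.const a).V μ θ₀ t θ z = a :=
  (Finset.sum_eq_single_of_mem (f := fun i : Unit => a * cos (μ * ((0:ℤ):ℝ) * (θ - θ₀)) * cos (((0:ℤ):ℝ) * z + 0)) () (Finset.mem_univ _) (by simp)).trans (by simp)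
lemma SD.const_G (a μ θ₀ t θ z : ℝ) : (SD.const a).G μ θ₀ t θ z = 0 := by simp [SD.const, SD.G, SD.c]
lemma SD.const_V1 (a t z : ℝ) : (SD.const a).V1 t z = 0 := by simp [SD.const, SD.V1]
lemma SD.const_N0 (a : ℝ) : (SD.const a).N0 := fun _ => rfl
end

section
lemma approx_limit {μ θ₀ : ℝ} (S : ℕ → SD) {F : ℝ → ℝ → ℝ → ℝ} {e : ℕ → ℝ} {M : ℝ → ℝ} (he0 : ∀ N, 0 ≤ e N) (he : Tendsto e atTop (𝓝 0))
    (h1 : ∀ L N N' t θ z, |t| ≤ L → |(S N).V μ θ₀ t θ z - (S N').V μ θ₀ t θ z| ≤ (e N + e N') * M L)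
    (h2 : ∀ L N t θ z, |t| ≤ L → |(S N).G μ θ₀ t θ z - F t θ z| ≤ e N * M L) :
    ∃ V, Approx μ θ₀ V F ∧ ∀ t θ z, Tendsto (fun N => (S N).V μ θ₀ t θ z) atTop (𝓝 (V t θ z)) := by
  have q : ∀ L, Tendsto (fun N => e N * M L) atTop (𝓝 0) := fun L => by simpa using he.mul_const (M L)
  have cau : ∀ t θ z, ∃ v, Tendsto (fun N => (S N).V μ θ₀ t θ z) atTop (𝓝 v) := fun t θ z => by
    refine cauchySeq_tendsto_of_complete (Metric.cauchySeq_iff'.2 fun ε hε => ?_)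
    obtain ⟨N, hN⟩ := eventually_atTop.1 ((q |t|).eventually (gt_mem_nhds (half_pos hε)))
    refine ⟨N, fun n hn => ?_⟩
    rw [Real.dist_eq]
    refine (h1 |t| n N t θ z le_rfl).trans_lt ?_
    have := hN n hn
    have := hN N le_rfl
    linarith
  choose V hV using cau
  refine ⟨V, fun ε hε L => ?_, hV⟩
  obtain ⟨N, hN⟩ := ((q L).eventually (gt_mem_nhds hε)).exists
  refine ⟨S N, fun t θ z ht => ⟨?_, (h2 L N t θ z ht).trans hN.le⟩⟩
  have h3 : Tendsto (fun N' => (e N + e N') * M L) atTop (𝓝 ((e N + 0) * M L)) := (he.const_add _).mul_const _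
  have := le_of_tendsto_of_tendsto' ((hV t θ z).const_sub ((S N).V μ θ₀ t θ z)).abs h3 fun N' => h1 L N N' t θ z ht
  rw [add_zero] at this
  exact this.trans hN.le

lemma cmp_le {g g' φ φ' : ℝ → ℝ} (hg : ∀ t, HasDerivAt g (g' t) t) (hφ : ∀ t, HasDerivAt φ (φ' t) t) (h : ∀ t, |g' t| ≤ φ' t) {s t : ℝ} (hst : s ≤ t) :
    |g t - g s| ≤ φ t - φ s := by
  have m1 : Monotone fun t => φ t - g t := monotone_of_deriv_nonneg (fun t => ((hφ t).sub (hg t)).differentiableAt) fun t => by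
    rw [((hφ t).fun_sub (hg t)).deriv]; linarith [(abs_le.1 (h t)).2]
  have m2 : Monotone fun t => φ t + g t := monotone_of_deriv_nonneg (fun t => ((hφ t).add (hg t)).differentiableAt) fun t => by
    rw [((hφ t).fun_add (hg t)).deriv]; linarith [(abs_le.1 (h t)).1]
  have a := m1 hst
  have b := m2 hst
  simp only at a b
  rw [abs_le]; constructor <;> linarith

structure SD.Mo (S : SD) (Pd c : S.ι → ℝ → ℝ) : Prop where
  n0 : S.N0
  a : ∀ i t, HasDerivAt (fun t => exp (-t) * S.Y1 i t) (Pd i t) t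
  b : ∀ i t, HasDerivAt (Pd i) ((1 ^ 2 + (S.m i : ℝ) ^ 2 * exp (2 * t)) * (exp (-t) * S.Y1 i t) + c i t) t
  d : ∀ i, ∃ C, ∀ t, |exp (-t) * S.Y1 i t| ≤ C * exp (-(1 * |t|))

lemma SD.Mo.sub {S S' : SD} {Pd c Pd' c'} (h : S.Mo Pd c) (h' : S'.Mo Pd' c') :
    (S.sub S').Mo (Sum.elim Pd (fun i t => - Pd' i t)) (Sum.elim c (fun i t => - c' i t)) where
  n0 := SD.N0_sub h.n0 h'.n0
  a := by
    rintro (i | i) t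
    · exact h.a i t
    · refine (h'.a i t).neg.congr_of_eventuallyEq (Eventually.of_forall fun t => ?_)
      simp [SD.sub]
  b := by
    rintro (i | i) t
    · exact h.b i t
    · refine (h'.b i t).neg.congr_deriv ?_
      simp [SD.sub]; ring
  d := by
    rintro (i | i)
    · exact h.d i
    · simpa [SD.sub] using h'.d i

lemma SD.Mo.bound {S : SD} {Pd c} (h : S.Mo Pd c) {a K : ℝ} (ha : |a| < 1) (hK : 0 ≤ K)
    (hc : ∀ t z, |∑ i, c i t * cos (S.m i * z + S.β i)| ≤ K * exp (a * t)) (t z : ℝ) :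
    |S.V1 t z| ≤ K / (1 - a ^ 2) * exp ((1 + a) * t) := by
  have := max2d Finset.univ ha (fun i _ => h.a i) (fun i _ => h.b i) (fun i _ => h.d i) hK hc t z
  rw [one_pow] at this
  have e : S.V1 t z = exp t * ∑ i, exp (-t) * S.Y1 i t * cos (S.m i * z + S.β i) := by
    rw [SD.V1, Finset.mul_sum]
    refine Finset.sum_congr rfl fun i _ => ?_
    rw [← mul_assoc, ← mul_assoc, ← exp_add]; simp
  rw [e, abs_mul, abs_of_pos (exp_pos t), add_mul, one_mul, exp_add]
  have := mul_le_mul_of_nonneg_left this (exp_pos t).le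
  linarith

lemma TD.exists_Mo (D : TD) {T : ℝ} (hT : 0 < T) (hs : ∀ i t, T < |t| → D.c i t = 0) :
    ∃ (S : SD) (Pd c : S.ι → ℝ → ℝ), S.Mo Pd c ∧ (∀ t z, ∑ i, c i t * cos (S.m i * z + S.β i) = D.mean t z) ∧
      ∀ μ θ₀ t θ z, S.G μ θ₀ t θ z = exp (2 * t) * ∫ s in T..t, exp (-s) * D.mean s z := by
  have cc : ∀ i, Continuous fun t => if D.n i = 0 then D.c i t else 0 := fun i => by
    have := D.cc i
    split_ifs <;> fun_prop
  choose P P' v h1 h2 h3 h4 h5 using fun i => mode0 (D.m i) (cc i) hT (fun t ht => by rw [hs i t ht, ite_self])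
  have Pc : ∀ i, Continuous (P i) := fun i => continuous_iff_continuousAt.2 fun t => (h1 i t).continuousAt
  have vc : ∀ i, Continuous (v i) := fun i => continuous_iff_continuousAt.2 fun t => (h4 i t).continuousAt
  have e : ∀ i, (fun t => exp (-t) * (exp t * P i t)) = P i := fun i => by
    ext t; rw [← mul_assoc, ← exp_add]; simp
  have hc3 : ∀ i, Continuous fun t => ((D.m i : ℝ) ^ 2 * exp (2 * t) * v i t + exp (2 * t) * ∫ s in T..t, exp (-s) * if D.n i = 0 then D.c i s else 0) := fun i => by
    have hh : Continuous fun s => exp (-s) * if D.n i = 0 then D.c i s else 0 := by have := cc i; fun_prop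
    have := intervalIntegral.continuous_primitive (μ := volume) (fun a b => hh.intervalIntegrable a b) T
    have := vc i
    fun_prop
  have n0 : SD.N0 { ι := D.ι, fin := D.fin, n := fun _ => 0, m := D.m, β := D.β, Y := v, Y1 := fun i t => exp t * P i t, Y2 := fun i t => _, h1 := h4, h2 := h5, h3 := hc3 } := fun _ => rfl
  refine ⟨_, P', fun i t => if D.n i = 0 then D.c i t else 0, ⟨n0, fun i t => ?_, fun i t => ?_, fun i => ?_⟩, fun t z => ?_, fun μ θ₀ t θ z => ?_⟩
  · dsimp only; rw [e]; exact h1 i t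
  · dsimp only
    rw [congrFun (e i) t]; exact h2 i t
  · obtain ⟨C, hC⟩ := h3 i
    exact ⟨C, fun t => by dsimp only; rw [congrFun (e i) t]; exact hC t⟩
  · unfold TD.mean
    exact Finset.sum_congr rfl fun i _ => by dsimp only; rw [ite_mul, zero_mul]
  · rw [SD.N0_G n0]
    dsimp only
    unfold TD.mean
    simp only [Finset.mul_sum]
    rw [intervalIntegral.integral_finsetSum, Finset.mul_sum]
    · refine Finset.sum_congr rfl fun i _ => ?_
      have : ∀ s, exp (-s) * (if D.n i = 0 then D.c i s * cos (D.m i * z + D.β i) else 0) = (exp (-s) * if D.n i = 0 then D.c i s else 0) * cos (D.m i * z + D.β i) := fun s => by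
        split_ifs <;> ring
      simp only [this]
      rw [intervalIntegral.integral_mul_const]
      ring
    · intro i _
      have := D.cc i
      apply Continuous.intervalIntegrable
      split_ifs <;> fun_prop

lemma exp_hd (a t : ℝ) : HasDerivAt (fun t => exp (a * t)) (a * exp (a * t)) t := by
  simpa [mul_comm] using ((hasDerivAt_id t).const_mul a).exp

/-- solution of the θ-independent problem -/
lemma solve_zero {μ : ℝ} (hμ : 0 < μ) (θ₀ : ℝ) {fb h : ℝ → ℝ → ℝ} {δ δ₀ K : ℝ} (hδ0 : 0 < δ) (hδ1 : δ < 1) (hδ₀0 : 0 < δ₀) (hδ₀1 : δ₀ < 1) (hK : 0 ≤ K)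
    (hd : ∀ t z, HasDerivAt (fun t => fb t z) (h t z) t) (hc : Continuous fun p : ℝ × ℝ => h p.1 p.2)
    (hper : ∀ t z, h t (z + 2 * π) = h t z)
    (b1 : ∀ t z, |fb t z| ≤ K * exp ((δ - 1) * t)) (b2 : ∀ t z, |fb t z| ≤ K * exp ((δ₀ - 2) * t))
    (b3 : ∀ t z, |h t z| ≤ K * exp ((δ - 1) * t)) (b4 : ∀ t z, |h t z| ≤ K * exp ((δ₀ - 2) * t)) :
    ∃ V : ℝ → ℝ → ℝ, Approx μ θ₀ (fun t θ z => V t z) (fun t θ z => exp (2 * t) * fb t z) ∧ ∃ C ≥ 0, (∀ t z, 0 ≤ t → |V t z| ≤ C * exp (δ₀ * t)) ∧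
      (∀ t z, t ≤ 0 → |V t z| ≤ C) ∧ ∀ t0 z0, t0 ≤ 0 → ∃ b, ∀ t z, |t - t0| ≤ 1 → |z - z0| ≤ exp t0 → |V t z - V t0 z0 - b * (z - z0)| ≤ C * exp ((1 + δ) * t0) := by
  have eab : ∀ a b : ℝ, ∀ t : ℝ, exp (a * t) * exp (b * t) = exp ((a + b) * t) := fun a b t => by rw [← exp_add]; ring_nf
  have e1t : ∀ t : ℝ, exp t = exp (1 * t) := fun t => by rw [one_mul]
  obtain ⟨D, ε, hε, hsup, hb, hcl⟩ := approx_seq hμ θ₀ (F := fun t θ z => exp t * h t z) (a1 := δ) (a := 0) (a2 := δ₀ - 1) (K := K)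
    (by have : Continuous fun p : ℝ × ℝ × ℝ => h p.1 p.2.2 := hc.comp (by fun_prop : Continuous fun p : ℝ × ℝ × ℝ => (p.1, p.2.2))
        fun_prop) (fun t θ z => by rw [hper]) (fun t θ z => rfl) hδ0 (by linarith) hK (fun t θ z => by
      rw [abs_mul, abs_of_pos (exp_pos t), mul_min_of_nonneg _ _ hK]
      refine le_min ?_ ?_
      · have := mul_le_mul_of_nonneg_left (b3 t z) (exp_pos t).le
        have e := eab 1 (δ - 1) t
        rw [← e1t, add_sub_cancel] at e
        rw [← e]; linarith
      · have := mul_le_mul_of_nonneg_left (b4 t z) (exp_pos t).le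
        have e := eab 1 (δ₀ - 2) t
        rw [← e1t, show 1 + (δ₀ - 2) = δ₀ - 1 by ring] at e
        rw [← e]; linarith)
  simp only [zero_mul, exp_zero, mul_one] at hcl
  have m1 : ∀ N t z, |(D N).mean t z - exp t * h t z| ≤ |ε N| := fun N t z =>
    ((D N).mean_close hμ θ₀ t z (F := fun _ => exp t * h t z) (A := exp t * h t z) continuous_const (by rw [intervalIntegral.integral_const, sub_zero, smul_eq_mul]) fun θ => hcl N t θ z).trans (le_abs_self _)
  have m2 : ∀ N t z, |(D N).mean t z| ≤ (K + 1) * min (exp (δ * t)) (exp ((δ₀ - 1) * t)) := fun N t z => by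
    simpa using (D N).mean_close hμ θ₀ t z (F := fun _ => 0) (A := 0) continuous_const (by simp) fun θ => by simpa using hb N t θ z
  choose S0 Pd c hMo hsum hG0 using fun N : ℕ => (D N).exists_Mo (T := N + 2) (by positivity) (hsup N)
  have mc : ∀ N z, Continuous fun s => (D N).mean s z := fun N z => by
    unfold TD.mean
    refine continuous_finsetSum _ fun i _ => ?_
    have := (D N).cc i
    split_ifs <;> fun_prop
  -- closeness of right-hand sides
  have g1 : ∀ N θ t z, |(S0 N).G μ θ₀ t θ z - exp (2 * t) * fb t z| ≤ |ε N| * exp t := fun N θ t z => by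
    set fN : ℝ → ℝ := fun t => ∫ s in (N + 2 : ℝ)..t, exp (-s) * (D N).mean s z with hfN
    have hfd : ∀ t, HasDerivAt fN (exp (-t) * (D N).mean t z) t := fun t => by
      have hh : Continuous fun s => exp (-s) * (D N).mean s z := by have := mc N z; fun_prop
      exact intervalIntegral.integral_hasDerivAt_right (hh.intervalIntegrable _ _) (hh.stronglyMeasurableAtFilter _ _) hh.continuousAt
    have hφ : ∀ t : ℝ, HasDerivAt (fun t => -(|ε N| * exp (-1 * t))) (|ε N| * exp (-1 * t)) t := fun t =>
      (((exp_hd (-1) t).const_mul |ε N|).neg).congr_deriv (by ring)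
    have cmp := fun s t hst => cmp_le (fun t => (hfd t).sub (hd t z)) hφ (s := s) (t := t) (fun t => by
      have := mul_le_mul_of_nonneg_left (m1 N t z) (exp_pos (-t)).le
      rw [← abs_of_pos (exp_pos (-t)), ← abs_mul, abs_of_pos (exp_pos (-t)), mul_sub, ← mul_assoc, ← exp_add] at this
      rw [neg_one_mul]
      simpa [mul_comm] using this) hst
    have l1 : Tendsto (fun t => fN t - fb t z) atTop (𝓝 (0 - 0)) := by
      refine Tendsto.sub ?_ ?_
      · refine tendsto_const_nhds.congr' ?_
        filter_upwards [eventually_ge_atTop (N + 2 : ℝ)] with t ht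
        refine (intervalIntegral.integral_zero_ae (Eventually.of_forall fun x hx => ?_)).symm
        rw [uIoc_of_le ht] at hx
        have : (D N).mean x z = 0 := by
          unfold TD.mean
          refine Finset.sum_eq_zero fun i _ => ?_
          rw [hsup N i x (hx.1.trans_le (le_abs_self x))]; simp
        rw [this, mul_zero]
      · refine squeeze_zero_norm (fun t => b1 t z) ?_
        have : Tendsto (fun t : ℝ => (δ - 1) * t) atTop atBot := tendsto_id.const_mul_atTop_of_neg (by linarith)
        simpa using (tendsto_exp_atBot.comp this).const_mul K
    have l2 : Tendsto (fun t : ℝ => -(|ε N| * exp (-1 * t))) atTop (𝓝 (-(|ε N| * 0))) := by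
      have : Tendsto (fun t : ℝ => (-1:ℝ) * t) atTop atBot := tendsto_id.const_mul_atTop_of_neg (by norm_num)
      exact ((tendsto_exp_atBot.comp this).const_mul _).neg
    have l3 : |0 - 0 - (fN t - fb t z)| ≤ -(|ε N| * 0) - -(|ε N| * exp (-1 * t)) :=
      le_of_tendsto_of_tendsto ((l1.sub_const _).abs) (l2.sub_const _) (by
        filter_upwards [eventually_ge_atTop t] with s hs using cmp t s hs)
    rw [hG0, ← mul_sub, abs_mul, abs_of_pos (exp_pos _), abs_sub_comm]
    have : |fb t z - fN t| ≤ |ε N| * exp (-1 * t) := by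
      have e : 0 - 0 - (fN t - fb t z) = fb t z - fN t := by ring
      rw [← e]; linarith
    have := mul_le_mul_of_nonneg_left this (exp_pos (2 * t)).le
    have e := eab 2 (-1) t
    rw [show (2:ℝ) + -1 = 1 by norm_num, one_mul] at e
    rw [← e]; linarith
  -- bounds on V1
  have v1 : ∀ N N' t z, |(S0 N).V1 t z - (S0 N').V1 t z| ≤ (|ε N| + |ε N'|) * exp t := fun N N' t z => by
    have := ((hMo N).sub (hMo N')).bound (a := 0) (K := |ε N| + |ε N'|) (by simp) (by positivity) (fun t z => by
      have e : ∑ i, (Sum.elim (c N) (fun i t => - c N' i t)) i t * cos (((S0 N).sub (S0 N')).m i * z + ((S0 N).sub (S0 N')).β i) = (D N).mean t z - (D N').mean t z := by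
        rw [← hsum N, ← hsum N', sub_eq_add_neg, ← Finset.sum_neg_distrib]
        refine (Fintype.sum_sum_type _).trans ?_
        congr 1
        exact Finset.sum_congr rfl fun i _ => by simp [SD.sub]
      refine (le_of_eq (congrArg abs e)).trans ?_
      have a := m1 N t z
      have b := m1 N' t z
      rw [zero_mul, exp_zero, mul_one]
      rw [abs_le] at *; constructor <;> linarith [a.1, a.2, b.1, b.2]) t z
    rw [SD.V1_sub] at this
    simpa using this
  have sq1 : 0 < 1 - δ ^ 2 := by nlinarith
  have sq2 : 0 < 1 - (δ₀ - 1) ^ 2 := by nlinarith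
  set C1 : ℝ := (K + 1) / (1 - δ ^ 2) + (K + 1) / (1 - (δ₀ - 1) ^ 2) with hC1
  have d1 : 0 ≤ (K + 1) / (1 - δ ^ 2) := by positivity
  have d2 : 0 ≤ (K + 1) / (1 - (δ₀ - 1) ^ 2) := by positivity
  have C10 : 0 ≤ C1 := by positivity
  have w1 : ∀ N t z, |(S0 N).V1 t z| ≤ C1 * exp ((1 + δ) * t) := fun N t z => by
    refine ((hMo N).bound (a := δ) (K := K + 1) (by rw [abs_lt]; constructor <;> linarith) (by positivity) (fun t z => by
      rw [hsum]; exact (m2 N t z).trans (mul_le_mul_of_nonneg_left (min_le_left _ _) (by positivity))) t z).trans ?_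
    exact mul_le_mul_of_nonneg_right (by linarith) (exp_pos _).le
  have w2 : ∀ N t z, |(S0 N).V1 t z| ≤ C1 * exp (δ₀ * t) := fun N t z => by
    have := ((hMo N).bound (a := δ₀ - 1) (K := K + 1) (by rw [abs_lt]; constructor <;> linarith) (by positivity) (fun t z => by
      rw [hsum]; exact (m2 N t z).trans (mul_le_mul_of_nonneg_left (min_le_right _ _) (by positivity))) t z)
    rw [add_sub_cancel] at this
    exact this.trans (mul_le_mul_of_nonneg_right (by linarith) (exp_pos _).le)
  -- normalisation
  set S : ℕ → SD := fun N => (S0 N).sub (SD.const ((S0 N).V μ θ₀ 0 θ₀ 0)) with hS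
  have SN : ∀ N, (S N).N0 := fun N => SD.N0_sub (hMo N).n0 (SD.const_N0 _)
  have SV1 : ∀ N t z, (S N).V1 t z = (S0 N).V1 t z := fun N t z => by rw [hS]; simp only; rw [SD.V1_sub, SD.const_V1, sub_zero]
  have SG : ∀ N t θ z, (S N).G μ θ₀ t θ z = (S0 N).G μ θ₀ t θ z := fun N t θ z => by rw [hS]; simp only; rw [SD.G_sub, SD.const_G, sub_zero]
  have Sθ : ∀ N t θ θ' z, (S N).V μ θ₀ t θ z = (S N).V μ θ₀ t θ' z := fun N t θ θ' z => by rw [SD.N0_V (SN N), SD.N0_V (SN N)]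
  have S00 : ∀ N θ, (S N).V μ θ₀ 0 θ 0 = 0 := fun N θ => by
    rw [Sθ N 0 θ θ₀, hS]; simp only; rw [SD.V_sub, SD.const_V, sub_self]
  clear_value S
  simp only [← SV1] at v1 w1 w2
  simp only [← SG] at g1
  have ea : Tendsto (fun N => |ε N|) atTop (𝓝 0) := by simpa using hε.abs
  have osc1 : ∀ N N' θ z, |(S N).V μ θ₀ 0 θ z - (S N').V μ θ₀ 0 θ z| ≤ 122 * ((|ε N| + |ε N'|) * exp 1) := fun N N' θ z => by
    have E : ∀ t : ℝ, |t - 0| ≤ 1 → (|ε N| + |ε N'|) * exp t ≤ (|ε N| + |ε N'|) * exp 1 := fun t ht =>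
      mul_le_mul_of_nonneg_left (exp_le_exp.2 (by rw [sub_zero, abs_le] at ht; exact ht.2)) (by positivity)
    have := SD.osc (SD.N0_sub (SN N) (SN N')) (μ := μ) (θ₀ := θ₀) (θ := θ) (A := (|ε N| + |ε N'|) * exp 1)
      (fun t z ht => by rw [SD.V1_sub]; exact (v1 N N' t z).trans (E t ht))
      (fun t z ht => by
        rw [SD.G_sub]
        refine le_trans ?_ (E t ht)
        have a := g1 N θ t z
        have b := g1 N' θ t z
        rw [abs_le] at *; constructor <;> linarith [a.1, a.2, b.1, b.2]) z
    rw [SD.V_sub, SD.V_sub, S00, S00] at this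
    simpa using this
  obtain ⟨V, hV, hlim⟩ := approx_limit (μ := μ) (θ₀ := θ₀) S (F := fun t θ z => exp (2 * t) * fb t z) (e := fun N => |ε N|) (M := fun L => 122 * exp 1 + 1 + exp L) (fun N => abs_nonneg _) ea
    (fun L N N' t θ z ht => by
      have hL : exp t ≤ exp L := exp_le_exp.2 ((le_abs_self t).trans ht)
      have o := osc1 N N' θ z
      have hg : ∀ t, HasDerivAt (fun t => (S N).V μ θ₀ t θ z - (S N').V μ θ₀ t θ z) ((S N).V1 t z - (S N').V1 t z) t := fun t =>
        (SD.dV (SN N) μ θ₀ t θ z).sub (SD.dV (SN N') μ θ₀ t θ z)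
      have hφ : ∀ t, HasDerivAt (fun t => (|ε N| + |ε N'|) * exp t) ((|ε N| + |ε N'|) * exp t) t := fun t => (Real.hasDerivAt_exp t).const_mul _
      have p0 : 0 ≤ |ε N| + |ε N'| := by positivity
      have k1 : |(S N).V μ θ₀ t θ z - (S N').V μ θ₀ t θ z - ((S N).V μ θ₀ 0 θ z - (S N').V μ θ₀ 0 θ z)| ≤ (|ε N| + |ε N'|) * (1 + exp L) := by
        rcases le_total 0 t with h0 | h0
        · have := cmp_le hg hφ (fun t => v1 N N' t z) h0
          refine this.trans ?_
          rw [exp_zero]; nlinarith [exp_pos L]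
        · have := cmp_le hg hφ (fun t => v1 N N' t z) h0
          rw [abs_sub_comm]
          refine this.trans ?_
          rw [exp_zero]; nlinarith [exp_pos L, exp_pos t, mul_nonneg p0 (exp_pos t).le, mul_nonneg p0 (exp_pos L).le]
      rw [abs_le] at o k1 ⊢
      constructor <;> linarith [o.1, o.2, k1.1, k1.2])
    (fun L N t θ z ht => by
      refine (g1 N θ t z).trans (mul_le_mul_of_nonneg_left ?_ (abs_nonneg _))
      have hL : exp t ≤ exp L := exp_le_exp.2 ((le_abs_self t).trans ht)
      have := exp_pos (1:ℝ)
      linarith)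
  have Vθ : ∀ t θ z, V t θ z = V t θ₀ z := fun t θ z => tendsto_nhds_unique (hlim t θ z) (by simp only [Sθ _ t θ θ₀ z]; exact hlim t θ₀ z)
  have hG' : ∀ N t z, |(S N).G μ θ₀ t θ₀ z| ≤ K * exp ((1 + δ) * t) + |ε N| * exp t := fun N t z => by
    have a := g1 N θ₀ t z
    have b : |exp (2 * t) * fb t z| ≤ K * exp ((1 + δ) * t) := by
      rw [abs_mul, abs_of_pos (exp_pos _)]
      have := mul_le_mul_of_nonneg_left (b1 t z) (exp_pos (2 * t)).le
      have e := eab 2 (δ - 1) t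
      rw [show 2 + (δ - 1) = 1 + δ by ring] at e
      rw [← e]; linarith
    rw [abs_le] at *; constructor <;> linarith [a.1, a.2, b.1, b.2]
  have nearexp : ∀ t t0 : ℝ, |t - t0| ≤ 1 → exp ((1 + δ) * t) ≤ exp 2 * exp ((1 + δ) * t0) := fun t t0 ht => by
    rw [← exp_add]
    refine exp_le_exp.2 ?_
    rw [abs_le] at ht; nlinarith [ht.1, ht.2]
  have nearexp1 : ∀ t t0 : ℝ, t0 ≤ 0 → |t - t0| ≤ 1 → exp t ≤ exp 1 := fun t t0 h0 ht => by
    refine exp_le_exp.2 ?_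
    rw [abs_le] at ht; linarith [ht.1, ht.2]
  have bA : ∀ N t0, t0 ≤ 0 → (∀ t z, |t - t0| ≤ 1 → |(S N).V1 t z| ≤ (C1 + K) * exp 2 * exp ((1 + δ) * t0) + |ε N| * exp 1) ∧
      (∀ t z, |t - t0| ≤ 1 → |(S N).G μ θ₀ t θ₀ z| ≤ (C1 + K) * exp 2 * exp ((1 + δ) * t0) + |ε N| * exp 1) := fun N t0 h0 => by
    have pp : 0 ≤ exp 2 * exp ((1 + δ) * t0) := by positivity
    constructor <;> intro t z ht
    · have a := w1 N t z
      have b := mul_le_mul_of_nonneg_left (nearexp t t0 ht) C10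
      have c : 0 ≤ |ε N| * exp 1 := by positivity
      have d := mul_nonneg hK pp
      linarith
    · have a := hG' N t z
      have b := mul_le_mul_of_nonneg_left (nearexp t t0 ht) hK
      have c := mul_le_mul_of_nonneg_left (nearexp1 t t0 h0 ht) (abs_nonneg (ε N))
      have d := mul_nonneg C10 pp
      linarith
  have C2b : ∀ z, |V 0 θ₀ z| ≤ 122 * ((C1 + K) * exp 2) := fun z => by
    have l : Tendsto (fun N => 122 * ((C1 + K) * exp 2 * exp ((1 + δ) * 0) + |ε N| * exp 1)) atTop (𝓝 (122 * ((C1 + K) * exp 2 * exp ((1 + δ) * 0) + 0 * exp 1))) :=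
      ((ea.mul_const _).const_add _).const_mul _
    have := le_of_tendsto_of_tendsto' ((hlim 0 θ₀ z).abs) l (fun N => by
      have := SD.osc (SN N) (bA N 0 le_rfl).1 (bA N 0 le_rfl).2 z
      rwa [S00, sub_zero] at this)
    simpa using this
  have Vlow : ∀ t z, t ≤ 0 → |V t θ₀ z - V 0 θ₀ z| ≤ C1 := fun t z ht => by
    refine le_of_tendsto (((hlim t θ₀ z).sub (hlim 0 θ₀ z)).abs) (Eventually.of_forall fun N => ?_)
    have hφ : ∀ t, HasDerivAt (fun t => C1 / (1 + δ) * exp ((1 + δ) * t)) (C1 * exp ((1 + δ) * t)) t := fun t =>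
      ((exp_hd (1 + δ) t).const_mul _).congr_deriv (by field_simp)
    have := cmp_le (fun t => SD.dV (SN N) μ θ₀ t θ₀ z) hφ (fun t => w1 N t z) ht
    rw [abs_sub_comm]
    refine this.trans ?_
    have : C1 / (1 + δ) ≤ C1 := div_le_self C10 (by linarith)
    have : 0 ≤ C1 / (1 + δ) * exp ((1 + δ) * t) := by positivity
    simp; linarith
  have Vhigh : ∀ t z, 0 ≤ t → |V t θ₀ z - V 0 θ₀ z| ≤ C1 / δ₀ * exp (δ₀ * t) := fun t z ht => by
    refine le_of_tendsto (((hlim t θ₀ z).sub (hlim 0 θ₀ z)).abs) (Eventually.of_forall fun N => ?_)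
    have hφ : ∀ t, HasDerivAt (fun t => C1 / δ₀ * exp (δ₀ * t)) (C1 * exp (δ₀ * t)) t := fun t =>
      ((exp_hd δ₀ t).const_mul _).congr_deriv (by field_simp)
    have := cmp_le (fun t => SD.dV (SN N) μ θ₀ t θ₀ z) hφ (fun t => w2 N t z) ht
    refine this.trans ?_
    have : 0 ≤ C1 / δ₀ * exp (δ₀ * 0) := by positivity
    linarith
  have p1 : 0 ≤ (C1 + K) * exp 2 := by positivity
  have p2 : 0 ≤ C1 / δ₀ := by positivity
  refine ⟨fun t z => V t θ₀ z, ?_, 122 * ((C1 + K) * exp 2) + C1 + C1 / δ₀, by positivity, fun t z ht => ?_, fun t z ht => ?_, fun t0 z0 ht0 => ⟨(V t0 θ₀ (z0 + exp t0) - V t0 θ₀ z0) / exp t0, fun t z ht hz => ?_⟩⟩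
  · have : (fun t (θ : ℝ) z => V t θ₀ z) = V := by ext t θ z; exact (Vθ t θ z).symm
    rw [this]; exact hV
  · have a := C2b z
    have b := Vhigh t z ht
    have c : 1 ≤ exp (δ₀ * t) := one_le_exp (by positivity)
    have : 122 * ((C1 + K) * exp 2) + C1 ≤ (122 * ((C1 + K) * exp 2) + C1) * exp (δ₀ * t) := by nlinarith
    rw [abs_le] at *; constructor <;> linarith [a.1, a.2, b.1, b.2]
  · have a := C2b z
    have b := Vlow t z ht
    rw [abs_le] at *; constructor <;> linarith [a.1, a.2, b.1, b.2]
  · have l : Tendsto (fun N => 11 * ((C1 + K) * exp 2 * exp ((1 + δ) * t0) + |ε N| * exp 1)) atTop (𝓝 (11 * ((C1 + K) * exp 2 * exp ((1 + δ) * t0) + 0 * exp 1))) :=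
      ((ea.mul_const _).const_add _).const_mul _
    have := le_of_tendsto_of_tendsto' ((((hlim t θ₀ z).sub (hlim t0 θ₀ z0)).sub ((((hlim t0 θ₀ (z0 + exp t0)).sub (hlim t0 θ₀ z0)).div_const (exp t0)).mul_const (z - z0))).abs) l (fun N =>
      SD.aff (SN N) (bA N t0 ht0).1 (bA N t0 ht0).2 ht hz)
    refine this.trans ?_
    have := exp_pos ((1 + δ) * t0)
    nlinarith [mul_nonneg p1 this.le, mul_nonneg p2 this.le, mul_nonneg C10 this.le]
end

section
theorem solve_all {μ : ℝ} (hμ : 2 < μ) (θ₀ : ℝ) {g g1 : ℝ → ℝ → ℝ → ℝ} {δ δ₀ K : ℝ} (hδ0 : 0 < δ) (hδ1 : δ < 1)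
    (hδ₀0 : 0 < δ₀) (hδ₀1 : δ₀ < 1) (hK : 0 ≤ K)
    (hd : ∀ t θ z, HasDerivAt (fun t => g t θ z) (g1 t θ z) t)
    (hg : Continuous fun p : ℝ × ℝ × ℝ => g p.1 p.2.1 p.2.2)
    (hg1 : Continuous fun p : ℝ × ℝ × ℝ => g1 p.1 p.2.1 p.2.2)
    (htri : ∀ t θ z, g t (tri μ θ₀ θ) z = g t θ z)
    (hper : ∀ t θ z, g t θ (z + 2 * π) = g t θ z)
    (hper1 : ∀ t θ z, g1 t θ (z + 2 * π) = g1 t θ z)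
    (b1 : ∀ t θ z, |g t θ z| ≤ K * exp ((δ - 1) * t)) (b2 : ∀ t θ z, |g t θ z| ≤ K * exp ((δ₀ - 2) * t))
    (b3 : ∀ t θ z, |g1 t θ z| ≤ K * exp ((δ - 1) * t)) (b4 : ∀ t θ z, |g1 t θ z| ≤ K * exp ((δ₀ - 2) * t)) :
    ∃ V : ℝ → ℝ → ℝ → ℝ, Approx μ θ₀ V (fun t θ z => exp (2 * t) * g t θ z) ∧ ∃ C ≥ 0,
      (∀ t θ z, 0 ≤ t → |V t θ z| ≤ C * exp (δ₀ * t)) ∧ (∀ t θ z, t ≤ 0 → |V t θ z| ≤ C) ∧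
      ∀ t0 z0, t0 ≤ 0 → ∃ a b, ∀ t θ z, |t - t0| ≤ 1 → |z - z0| ≤ exp t0 →
        |V t θ z - a - b * (z - z0)| ≤ C * exp ((1 + δ) * t0) := by
  have pp := pi_pos
  set fb : ℝ → ℝ → ℝ := fun t z => π⁻¹ * ∫ x in (0:ℝ)..π, g t (θ₀ + x / μ) z with hfb
  set h : ℝ → ℝ → ℝ := fun t z => π⁻¹ * ∫ x in (0:ℝ)..π, g1 t (θ₀ + x / μ) z with hh
  have gc : ∀ t z, Continuous fun x : ℝ => g t (θ₀ + x / μ) z := fun t z =>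
    hg.comp (f := fun x : ℝ => (t, θ₀ + x / μ, z)) (by fun_prop)
  have gc1 : ∀ t z, Continuous fun x : ℝ => g1 t (θ₀ + x / μ) z := fun t z =>
    hg1.comp (f := fun x : ℝ => (t, θ₀ + x / μ, z)) (by fun_prop)
  have avg : ∀ (q : ℝ → ℝ) (B : ℝ), (∀ x, |q x| ≤ B) → |π⁻¹ * ∫ x in (0:ℝ)..π, q x| ≤ B := fun q B hq => by
    have := intervalIntegral.norm_integral_le_of_norm_le_const (a := 0) (b := π) (f := q) (C := B) (fun x _ => hq x)
    rw [norm_eq_abs, sub_zero, abs_of_pos pp] at this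
    rw [abs_mul, abs_of_pos (inv_pos.2 pp), inv_mul_le_iff₀ pp]; linarith
  have hfd : ∀ t z, HasDerivAt (fun t => fb t z) (h t z) t := fun t z => by
    refine HasDerivAt.const_mul _ ?_
    refine (intervalIntegral.hasDerivAt_integral_of_dominated_loc_of_deriv_le (μ := volume) (F := fun t x => g t (θ₀ + x / μ) z) (F' := fun t x => g1 t (θ₀ + x / μ) z)
      (bound := fun _ => K * exp (1 * (|t| + 1))) (ball_mem_nhds t one_pos) (Eventually.of_forall fun s => (gc s z).aestronglyMeasurable) ((gc t z).intervalIntegrable _ _)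
      ((gc1 t z).aestronglyMeasurable) (Eventually.of_forall fun x _ s hs => ?_) (continuous_const.intervalIntegrable _ _) (Eventually.of_forall fun x _ s hs => hd s _ z)).2
    refine (b3 s _ z).trans (mul_le_mul_of_nonneg_left (exp_le_exp.2 ?_) hK)
    rw [mem_ball, Real.dist_eq, abs_lt] at hs
    have := neg_abs_le t
    have := abs_nonneg t
    nlinarith [mul_nonneg hδ0.le (abs_nonneg t)]
  have hhc : Continuous fun p : ℝ × ℝ => h p.1 p.2 := by
    refine continuous_const.mul ?_
    refine intervalIntegral.continuous_parametric_intervalIntegral_of_continuous' ?_ _ _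
    exact hg1.comp (f := fun q : (ℝ × ℝ) × ℝ => (q.1.1, θ₀ + q.2 / μ, q.1.2)) (by fun_prop)
  have hfc : Continuous fun p : ℝ × ℝ => fb p.1 p.2 := by
    refine continuous_const.mul ?_
    refine intervalIntegral.continuous_parametric_intervalIntegral_of_continuous' ?_ _ _
    exact hg.comp (f := fun q : (ℝ × ℝ) × ℝ => (q.1.1, θ₀ + q.2 / μ, q.1.2)) (by fun_prop)
  obtain ⟨V0, hV0, C0, C00, v1, v2, v3⟩ := solve_zero (by linarith : 0 < μ) θ₀ hδ0 hδ1 hδ₀0 hδ₀1 hK hfd hhc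
    (fun t z => by simp only [hh, hper1]) (fun t z => avg _ _ fun x => b1 t _ z) (fun t z => avg _ _ fun x => b2 t _ z)
    (fun t z => avg _ _ fun x => b3 t _ z) (fun t z => avg _ _ fun x => b4 t _ z)
  obtain ⟨V1, hV1, C1, C10, u1⟩ := solve_ne hμ θ₀ (F := fun t θ z => exp (2 * t) * (g t θ z - fb t z)) (a1 := 1 + δ) (a2 := δ₀) (K := 2 * K)
    (by
      have : Continuous fun p : ℝ × ℝ × ℝ => fb p.1 p.2.2 := hfc.comp (f := fun p : ℝ × ℝ × ℝ => (p.1, p.2.2)) (by fun_prop)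
      fun_prop)
    (fun t θ z => by simp only [hfb, hper])
    (fun t θ z => by simp only [htri])
    (fun t z => by
      rw [intervalIntegral.integral_const_mul, intervalIntegral.integral_sub ((gc t z).intervalIntegrable _ _) (continuous_const.intervalIntegrable _ _), intervalIntegral.integral_const, hfb]
      simp only [smul_eq_mul, sub_zero]
      rw [← mul_assoc, mul_inv_cancel₀ pp.ne']; ring)
    (by linarith) (by linarith) hδ₀1 hδ₀0 (by positivity)
    (fun t θ z => by
      have key : ∀ B, |g t θ z| ≤ B → |fb t z| ≤ B → |g t θ z - fb t z| ≤ 2 * B := fun B h1 h2 => by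
        rw [abs_le] at *; constructor <;> linarith [h1.1, h1.2, h2.1, h2.2]
      have k1 := key _ (b1 t θ z) (avg _ _ fun x => b1 t _ z)
      have k2 := key _ (b2 t θ z) (avg _ _ fun x => b2 t _ z)
      have e1 : exp ((1 + δ) * t) = exp (2 * t) * exp ((δ - 1) * t) := by rw [← exp_add]; ring_nf
      have e2 : exp (δ₀ * t) = exp (2 * t) * exp ((δ₀ - 2) * t) := by rw [← exp_add]; ring_nf
      rw [abs_mul, abs_of_pos (exp_pos _), mul_min_of_nonneg _ _ (by positivity), le_min_iff, e1, e2]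
      constructor
      · linarith [mul_le_mul_of_nonneg_left k1 (exp_pos (2 * t)).le]
      · linarith [mul_le_mul_of_nonneg_left k2 (exp_pos (2 * t)).le])
  have ul : ∀ t θ z, |V1 t θ z| ≤ C1 * exp ((1 + δ) * t) := fun t θ z => (u1 t θ z).trans (mul_le_mul_of_nonneg_left (min_le_left _ _) C10)
  have ur : ∀ t θ z, |V1 t θ z| ≤ C1 * exp (δ₀ * t) := fun t θ z => (u1 t θ z).trans (mul_le_mul_of_nonneg_left (min_le_right _ _) C10)
  refine ⟨fun t θ z => V0 t z + V1 t θ z, ?_, C0 + C1 * exp 2, by positivity, ?_, ?_, ?_⟩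
  · have := hV0.add hV1
    convert this using 4
    ring
  · intro t θ z ht
    have a := v1 t z ht
    have b := ur t θ z
    have : 1 ≤ exp 2 := one_le_exp (by norm_num)
    have c : C1 * exp (δ₀ * t) ≤ C1 * exp 2 * exp (δ₀ * t) := mul_le_mul_of_nonneg_right (le_mul_of_one_le_right C10 this) (exp_pos _).le
    refine (abs_add_le _ _).trans ?_
    linarith
  · intro t θ z ht
    have a := v2 t z ht
    have b := ul t θ z
    have : exp ((1 + δ) * t) ≤ exp 2 := exp_le_exp.2 (by nlinarith)
    refine (abs_add_le _ _).trans ?_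
    linarith [mul_le_mul_of_nonneg_left this C10]
  · intro t0 z0 ht0
    obtain ⟨b, hb⟩ := v3 t0 z0 ht0
    refine ⟨V0 t0 z0, b, fun t θ z ht hz => ?_⟩
    have h1 := hb t z ht hz
    have h2 := ul t θ z
    have h3 : exp ((1 + δ) * t) ≤ exp 2 * exp ((1 + δ) * t0) := by
      rw [← exp_add]
      refine exp_le_exp.2 ?_
      rw [abs_le] at ht; nlinarith [ht.1, ht.2]
    have h4 := mul_le_mul_of_nonneg_left h3 C10
    rw [abs_le] at *; constructor <;> linarith [h1.1, h1.2, h2.1, h2.2]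

end

section
def Tt (y : V3) : ℝ := Real.log (y 0 ^ 2 + y 2 ^ 2) / 2
def An (y : V3) : ℝ := π / 4 + Real.arctan ((y 2 - y 0) / (y 2 + y 0))
def HP : Set V3 := {y : V3 | 0 < y 2 + y 0}

lemma hp_open : IsOpen HP := isOpen_lt continuous_const (by fun_prop)
lemma hp_pos {y : V3} (hy : y ∈ HP) : 0 < y 0 ^ 2 + y 2 ^ 2 := by
  have : 0 < y 2 + y 0 := hy
  nlinarith [sq_nonneg (y 2 - y 0), mul_pos this this]

lemma exp_tt {y : V3} (hy : y ∈ HP) : exp (Tt y) = rx y := by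
  unfold Tt rx
  rw [Real.sqrt_eq_rpow, Real.rpow_def_of_pos (hp_pos hy)]; congr 1; ring

lemma exp_2tt {y : V3} (hy : y ∈ HP) : exp (2 * Tt y) = y 0 ^ 2 + y 2 ^ 2 := by
  unfold Tt
  rw [mul_div_cancel₀ _ (by norm_num), Real.exp_log (hp_pos hy)]

lemma an_pol {y : V3} (hy : y ∈ HP) : y 0 = exp (Tt y) * cos (An y) ∧ y 2 = exp (Tt y) * sin (An y) := by
  have hs : 0 < y 2 + y 0 := hy
  have hr := hp_pos hy
  rw [exp_tt hy]
  unfold An rx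
  set r := √(y 0 ^ 2 + y 2 ^ 2) with hrr
  have r0 : 0 < r := Real.sqrt_pos.2 hr
  have r2 : r ^ 2 = y 0 ^ 2 + y 2 ^ 2 := Real.sq_sqrt hr.le
  have q2 : √2 ^ 2 = (2:ℝ) := Real.sq_sqrt (by norm_num)
  have q0 : 0 < √2 := by positivity
  have e : √(1 + ((y 2 - y 0) / (y 2 + y 0)) ^ 2) = √2 * r / (y 2 + y 0) := by
    rw [Real.sqrt_eq_iff_mul_self_eq (by positivity) (by positivity)]
    field_simp
    rw [q2, r2]; ring
  rw [cos_add, sin_add, cos_pi_div_four, sin_pi_div_four, cos_arctan, sin_arctan, e]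
  constructor
  · field_simp
    ring
  · field_simp
    ring

lemma tt_cd {n : WithTop ℕ∞} : ContDiffOn ℝ n Tt HP := fun y hy => by
  have h := hp_pos hy
  refine ContDiffAt.contDiffWithinAt ?_
  unfold Tt
  have c : ContDiffAt ℝ n (fun y : V3 => y 0 ^ 2 + y 2 ^ 2) y := by fun_prop
  exact (c.log h.ne').div_const _

lemma an_cd {n : WithTop ℕ∞} : ContDiffOn ℝ n An HP := fun y hy => by
  have h : 0 < y 2 + y 0 := hy
  refine ContDiffAt.contDiffWithinAt ?_
  unfold An
  refine contDiffAt_const.add (Real.contDiff_arctan.contDiffAt.comp _ (ContDiffAt.div ?_ ?_ h.ne')) <;> fun_prop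

def PX (y : V3) : ℝ := y 0 / (y 0 ^ 2 + y 2 ^ 2)
def PZ (y : V3) : ℝ := y 2 / (y 0 ^ 2 + y 2 ^ 2)

lemma line0 (y : V3) (s : ℝ) : (y + s • ee 0) 0 = y 0 + s ∧ (y + s • ee 0) 1 = y 1 ∧ (y + s • ee 0) 2 = y 2 := by simp [ee]
lemma line1 (y : V3) (s : ℝ) : (y + s • ee 1) 0 = y 0 ∧ (y + s • ee 1) 1 = y 1 + s ∧ (y + s • ee 1) 2 = y 2 := by simp [ee]
lemma line2 (y : V3) (s : ℝ) : (y + s • ee 2) 0 = y 0 ∧ (y + s • ee 2) 1 = y 1 ∧ (y + s • ee 2) 2 = y 2 + s := by simp [ee]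

lemma dT0 {y : V3} (hy : y ∈ HP) : HasDerivAt (fun s : ℝ => Tt (y + s • ee 0)) (PX y) 0 := by
  have h := hp_pos hy
  simp only [Tt, line0, PX]
  have : HasDerivAt (fun s : ℝ => (y 0 + s) ^ 2 + y 2 ^ 2) (2 * y 0) 0 :=
    ((((hasDerivAt_id (0:ℝ)).const_add (y 0)).pow 2).add_const _).congr_deriv (by simp)
  refine ((this.log (by simpa using h.ne')).div_const 2).congr_deriv ?_
  rw [add_zero]; field_simp
lemma dT2 {y : V3} (hy : y ∈ HP) : HasDerivAt (fun s : ℝ => Tt (y + s • ee 2)) (PZ y) 0 := by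
  have h := hp_pos hy
  simp only [Tt, line2, PZ]
  have : HasDerivAt (fun s : ℝ => y 0 ^ 2 + (y 2 + s) ^ 2) (2 * y 2) 0 :=
    ((((hasDerivAt_id (0:ℝ)).const_add (y 2)).pow 2).const_add _).congr_deriv (by simp)
  refine ((this.log (by simpa using h.ne')).div_const 2).congr_deriv ?_
  rw [add_zero]; field_simp
lemma dA0 {y : V3} (hy : y ∈ HP) : HasDerivAt (fun s : ℝ => An (y + s • ee 0)) (-PZ y) 0 := by
  have h := hp_pos hy
  have h' : 0 < y 2 + y 0 := hy
  simp only [An, line0, PZ]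
  have a : HasDerivAt (fun s : ℝ => y 2 - (y 0 + s)) (-1) 0 := ((hasDerivAt_id (0:ℝ)).const_add (y 0)).const_sub _
  have b : HasDerivAt (fun s : ℝ => y 2 + (y 0 + s)) (1) 0 := ((hasDerivAt_id (0:ℝ)).const_add (y 0)).const_add _
  refine (((a.fun_div b (by simpa using h'.ne')).arctan).const_add _).congr_deriv ?_
  simp only [add_zero]
  have : (y 2 + y 0) ^ 2 + (y 2 - y 0) ^ 2 ≠ 0 := by nlinarith
  field_simp
  ring
lemma dA2 {y : V3} (hy : y ∈ HP) : HasDerivAt (fun s : ℝ => An (y + s • ee 2)) (PX y) 0 := by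
  have h := hp_pos hy
  have h' : 0 < y 2 + y 0 := hy
  simp only [An, line2, PX]
  have a : HasDerivAt (fun s : ℝ => (y 2 + s) - y 0) (1) 0 := ((hasDerivAt_id (0:ℝ)).const_add (y 2)).sub_const _
  have b : HasDerivAt (fun s : ℝ => (y 2 + s) + y 0) (1) 0 := ((hasDerivAt_id (0:ℝ)).const_add (y 2)).add_const _
  refine (((a.fun_div b (by simpa using h'.ne')).arctan).const_add _).congr_deriv ?_
  simp only [add_zero]
  have : (y 2 + y 0) ^ 2 + (y 2 - y 0) ^ 2 ≠ 0 := by nlinarith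
  field_simp
  ring
lemma dPX0 {y : V3} (hy : y ∈ HP) : HasDerivAt (fun s : ℝ => PX (y + s • ee 0)) (PZ y ^ 2 - PX y ^ 2) 0 := by
  have h := hp_pos hy
  simp only [PX, line0, PZ]
  have : HasDerivAt (fun s : ℝ => (y 0 + s) ^ 2 + y 2 ^ 2) (2 * y 0) 0 :=
    ((((hasDerivAt_id (0:ℝ)).const_add (y 0)).pow 2).add_const _).congr_deriv (by simp)
  refine (((hasDerivAt_id (0:ℝ)).const_add (y 0)).fun_div this (by simpa using h.ne')).congr_deriv ?_
  simp only [id, add_zero]; field_simp; ring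
lemma dPZ0 {y : V3} (hy : y ∈ HP) : HasDerivAt (fun s : ℝ => PZ (y + s • ee 0)) (-2 * PX y * PZ y) 0 := by
  have h := hp_pos hy
  simp only [PX, line0, PZ]
  have : HasDerivAt (fun s : ℝ => (y 0 + s) ^ 2 + y 2 ^ 2) (2 * y 0) 0 :=
    ((((hasDerivAt_id (0:ℝ)).const_add (y 0)).pow 2).add_const _).congr_deriv (by simp)
  refine ((hasDerivAt_const (0:ℝ) (y 2)).fun_div this (by simpa using h.ne')).congr_deriv ?_
  simp only [id, add_zero]; field_simp; ring
lemma dPZ2 {y : V3} (hy : y ∈ HP) : HasDerivAt (fun s : ℝ => PZ (y + s • ee 2)) (PX y ^ 2 - PZ y ^ 2) 0 := by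
  have h := hp_pos hy
  simp only [PX, line2, PZ]
  have : HasDerivAt (fun s : ℝ => y 0 ^ 2 + (y 2 + s) ^ 2) (2 * y 2) 0 :=
    ((((hasDerivAt_id (0:ℝ)).const_add (y 2)).pow 2).const_add _).congr_deriv (by simp)
  refine (((hasDerivAt_id (0:ℝ)).const_add (y 2)).fun_div this (by simpa using h.ne')).congr_deriv ?_
  simp only [id, add_zero]; field_simp; ring
lemma dPX2 {y : V3} (hy : y ∈ HP) : HasDerivAt (fun s : ℝ => PX (y + s • ee 2)) (-2 * PX y * PZ y) 0 := by
  have h := hp_pos hy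
  simp only [PX, line2, PZ]
  have : HasDerivAt (fun s : ℝ => y 0 ^ 2 + (y 2 + s) ^ 2) (2 * y 2) 0 :=
    ((((hasDerivAt_id (0:ℝ)).const_add (y 2)).pow 2).const_add _).congr_deriv (by simp)
  refine ((hasDerivAt_const (0:ℝ) (y 0)).fun_div this (by simpa using h.ne')).congr_deriv ?_
  simp only [id, add_zero]; field_simp; ring

lemma fderiv_line {g : V3 → ℝ} {y e : V3} {g' : ℝ} (hg : DifferentiableAt ℝ g y) (h : HasDerivAt (fun s : ℝ => g (y + s • e)) g' 0) :
    fderiv ℝ g y e = g' := by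
  have l : HasDerivAt (fun s : ℝ => y + s • e) e 0 := by
    simpa using ((hasDerivAt_id (0:ℝ)).smul_const e).const_add y
  have hg' : HasFDerivAt g (fderiv ℝ g y) (y + (0:ℝ) • e) := by simpa using hg.hasFDerivAt
  have := hg'.comp_hasDerivAt (0:ℝ) l
  exact this.unique h

lemma lapl_lines {w : V3 → ℝ} {U : Set V3} (hU : IsOpen U) (hw : ContDiffOn ℝ 2 w U) {g : Fin 3 → V3 → ℝ} {h : Fin 3 → V3 → ℝ}
    (hg : ∀ i, ∀ y ∈ U, HasDerivAt (fun s : ℝ => w (y + s • ee i)) (g i y) 0)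
    (hh : ∀ i, ∀ y ∈ U, HasDerivAt (fun s : ℝ => g i (y + s • ee i)) (h i y) 0) : ∀ x ∈ U, lapl w x = ∑ i, h i x := by
  intro x hx
  unfold lapl
  refine Finset.sum_congr rfl fun i _ => ?_
  have e : ∀ y ∈ U, fderiv ℝ w y (ee i) = g i y := fun y hy =>
    fderiv_line ((hw.contDiffAt (hU.mem_nhds hy)).differentiableAt (by norm_num)) (hg i y hy)
  have d : DifferentiableAt ℝ (fun y => fderiv ℝ w y (ee i)) x :=
    (((hw.contDiffAt (hU.mem_nhds hx)).fderiv_right (m := 1) (by norm_num)).differentiableAt (by norm_num)).clm_apply (differentiableAt_const _)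
  refine fderiv_line d ?_
  refine (hh i x hx).congr_of_eventuallyEq ?_
  have : Tendsto (fun s : ℝ => x + s • ee i) (𝓝 0) (𝓝 x) := by
    have : Continuous fun s : ℝ => x + s • ee i := by fun_prop
    simpa using this.tendsto 0
  filter_upwards [this.eventually (hU.mem_nhds hx)] with s hs using e _ hs

lemma cd2_of {Y Y1 Y2 : ℝ → ℝ} (h1 : ∀ t, HasDerivAt Y (Y1 t) t) (h2 : ∀ t, HasDerivAt Y1 (Y2 t) t) (h3 : Continuous Y2) : ContDiff ℝ 2 Y := by
  have e1 : deriv Y = Y1 := funext fun t => (h1 t).deriv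
  have e2 : deriv Y1 = Y2 := funext fun t => (h2 t).deriv
  have c1 : ContDiff ℝ 1 Y1 := contDiff_one_iff_deriv.2 ⟨fun t => (h2 t).differentiableAt, by rw [e2]; exact h3⟩
  rw [show (2 : WithTop ℕ∞) = 1 + 1 by norm_num, contDiff_succ_iff_deriv]
  exact ⟨fun t => (h1 t).differentiableAt, by simp, by rw [e1]; exact c1⟩

def pol (W : ℝ → ℝ → ℝ → ℝ) (y : V3) : ℝ := W (Tt y) (An y) (y 1)

lemma SD.pol_cd (S : SD) (μ θ₀ : ℝ) : ContDiffOn ℝ 2 (pol (S.V μ θ₀)) HP := by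
  unfold pol SD.V
  refine ContDiffOn.sum fun i _ => ?_
  refine ((((cd2_of (S.h1 i) (S.h2 i) (S.h3 i)).comp_contDiffOn tt_cd)).mul (Real.contDiff_cos.comp_contDiffOn (contDiffOn_const.mul (an_cd.sub contDiffOn_const)))).mul (Real.contDiff_cos.comp_contDiffOn ?_)
  fun_prop

lemma mode_lapl {Y Y1 Y2 : ℝ → ℝ} (h1 : ∀ t, HasDerivAt Y (Y1 t) t) (h2 : ∀ t, HasDerivAt Y1 (Y2 t) t) (h3 : Continuous Y2) (k θ₀ m β : ℝ)
    {y : V3} (hy : y ∈ HP) :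
    lapl (fun y => Y (Tt y) * cos (k * (An y - θ₀)) * cos (m * y 1 + β)) y
      = exp (-(2 * Tt y)) * ((Y2 (Tt y) - (k ^ 2 + m ^ 2 * exp (2 * Tt y)) * Y (Tt y)) * cos (k * (An y - θ₀)) * cos (m * y 1 + β)) := by
  have cd : ContDiffOn ℝ 2 (fun y => Y (Tt y) * cos (k * (An y - θ₀)) * cos (m * y 1 + β)) HP := by
    refine ((((cd2_of h1 h2 h3).comp_contDiffOn tt_cd)).mul (Real.contDiff_cos.comp_contDiffOn (contDiffOn_const.mul (an_cd.sub contDiffOn_const)))).mul (Real.contDiff_cos.comp_contDiffOn ?_)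
    fun_prop
  have z0 : ∀ y e : V3, y + (0:ℝ) • e = y := fun y e => by simp
  have cT : ∀ {Z Z1 : ℝ → ℝ} (_ : ∀ t, HasDerivAt Z (Z1 t) t) (y e : V3) {d : ℝ} (_ : HasDerivAt (fun s : ℝ => Tt (y + s • e)) d 0),
      HasDerivAt (fun s : ℝ => Z (Tt (y + s • e))) (Z1 (Tt y) * d) 0 := fun {Z Z1} hZ y e {d} hd =>
    ((hZ _).comp (0:ℝ) hd).congr_deriv (by rw [z0])
  have cc : ∀ (y e : V3) {d : ℝ} (_ : HasDerivAt (fun s : ℝ => An (y + s • e)) d 0),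
      HasDerivAt (fun s : ℝ => cos (k * (An (y + s • e) - θ₀))) (-(k * sin (k * (An y - θ₀)) * d)) 0 := fun y e {d} hd =>
    ((hd.sub_const θ₀).const_mul k).cos.congr_deriv (by rw [z0]; ring)
  have cs : ∀ (y e : V3) {d : ℝ} (_ : HasDerivAt (fun s : ℝ => An (y + s • e)) d 0),
      HasDerivAt (fun s : ℝ => sin (k * (An (y + s • e) - θ₀))) (k * cos (k * (An y - θ₀)) * d) 0 := fun y e {d} hd =>
    ((hd.sub_const θ₀).const_mul k).sin.congr_deriv (by rw [z0]; ring)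
  have key := lapl_lines hp_open cd
    (g := ![fun y => (Y1 (Tt y) * cos (k * (An y - θ₀)) * PX y + Y (Tt y) * (k * sin (k * (An y - θ₀))) * PZ y) * cos (m * y 1 + β),
      fun y => Y (Tt y) * cos (k * (An y - θ₀)) * (-(m * sin (m * y 1 + β))),
      fun y => (Y1 (Tt y) * cos (k * (An y - θ₀)) * PZ y - Y (Tt y) * (k * sin (k * (An y - θ₀))) * PX y) * cos (m * y 1 + β)])
    (h := ![fun y => (Y2 (Tt y) * cos (k * (An y - θ₀)) * PX y ^ 2 + 2 * (Y1 (Tt y) * (k * sin (k * (An y - θ₀))) * PX y * PZ y) + Y1 (Tt y) * cos (k * (An y - θ₀)) * (PZ y ^ 2 - PX y ^ 2)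
          - Y (Tt y) * (k * k * cos (k * (An y - θ₀))) * PZ y ^ 2 - Y (Tt y) * (k * sin (k * (An y - θ₀))) * (2 * PX y * PZ y)) * cos (m * y 1 + β),
      fun y => Y (Tt y) * cos (k * (An y - θ₀)) * (-(m * m * cos (m * y 1 + β))),
      fun y => (Y2 (Tt y) * cos (k * (An y - θ₀)) * PZ y ^ 2 - 2 * (Y1 (Tt y) * (k * sin (k * (An y - θ₀))) * PX y * PZ y) + Y1 (Tt y) * cos (k * (An y - θ₀)) * (PX y ^ 2 - PZ y ^ 2)
          - Y (Tt y) * (k * k * cos (k * (An y - θ₀))) * PX y ^ 2 + Y (Tt y) * (k * sin (k * (An y - θ₀))) * (2 * PX y * PZ y)) * cos (m * y 1 + β)])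
    (by
      intro i y hy
      fin_cases i
      · have := (((cT h1 y _ (dT0 hy)).fun_mul (cc y _ (dA0 hy))).mul_const (cos (m * y 1 + β)))
        simp only [z0] at this
        simp only [Fin.zero_eta, Fin.isValue, Matrix.cons_val_zero, line0]
        exact this.congr_deriv (by ring)
      · simp only [Fin.mk_one, Fin.isValue, Matrix.cons_val_one, Matrix.cons_val_zero, Tt, An, line1]
        have := ((((hasDerivAt_id (0:ℝ)).const_add (y 1)).const_mul m).add_const β).cos
        exact (this.const_mul _).congr_deriv (by simp only [id, add_zero]; ring)
      · have := (((cT h1 y _ (dT2 hy)).fun_mul (cc y _ (dA2 hy))).mul_const (cos (m * y 1 + β)))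
        simp only [z0] at this
        simp only [Fin.reduceFinMk, Fin.isValue, Matrix.cons_val, line2]
        exact this.congr_deriv (by ring))
    (by
      intro i y hy
      fin_cases i
      · have := ((((cT h2 y _ (dT0 hy)).fun_mul (cc y _ (dA0 hy))).fun_mul (dPX0 hy)).fun_add (((cT h1 y _ (dT0 hy)).fun_mul ((cs y _ (dA0 hy)).const_mul k)).fun_mul (dPZ0 hy))).mul_const (cos (m * y 1 + β))
        simp only [z0] at this
        simp only [Fin.zero_eta, Fin.isValue, Matrix.cons_val_zero, line0]
        exact this.congr_deriv (by ring)
      · simp only [Fin.mk_one, Fin.isValue, Matrix.cons_val_one, Matrix.cons_val_zero, Tt, An, line1]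
        have := ((((hasDerivAt_id (0:ℝ)).const_add (y 1)).const_mul m).add_const β).sin
        exact (((this.const_mul m).fun_neg).const_mul _).congr_deriv (by simp only [id, add_zero]; ring)
      · have := ((((cT h2 y _ (dT2 hy)).fun_mul (cc y _ (dA2 hy))).fun_mul (dPZ2 hy)).fun_sub (((cT h1 y _ (dT2 hy)).fun_mul ((cs y _ (dA2 hy)).const_mul k)).fun_mul (dPX2 hy))).mul_const (cos (m * y 1 + β))
        simp only [z0] at this
        simp only [Fin.reduceFinMk, Fin.isValue, Matrix.cons_val, line2]
        exact this.congr_deriv (by ring)) y hy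
  rw [key, Fin.sum_univ_three]
  simp only [Fin.isValue, Matrix.cons_val_zero, Matrix.cons_val_one, Matrix.cons_val]
  have h := hp_pos hy
  have e1 : PX y ^ 2 + PZ y ^ 2 = exp (-(2 * Tt y)) := by
    rw [exp_neg, exp_2tt hy, PX, PZ]; field_simp
  have e2 : exp (-(2 * Tt y)) * exp (2 * Tt y) = 1 := by rw [← exp_add]; simp
  rw [← e1] at e2 ⊢
  linear_combination (m ^ 2 * Y (Tt y) * cos (k * (An y - θ₀)) * cos (m * y 1 + β)) * e2

lemma lapl_sum {ι : Type} [Fintype ι] {w : ι → V3 → ℝ} {U : Set V3} (hU : IsOpen U) (hw : ∀ i, ContDiffOn ℝ 2 (w i) U) {x : V3} (hx : x ∈ U) :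
    lapl (fun y => ∑ i, w i y) x = ∑ i, lapl (w i) x := by
  unfold lapl
  rw [Finset.sum_comm]
  refine Finset.sum_congr rfl fun j _ => ?_
  have e : (fun y => fderiv ℝ (fun y => ∑ i, w i y) y (ee j)) =ᶠ[𝓝 x] fun y => ∑ i, fderiv ℝ (w i) y (ee j) := by
    filter_upwards [hU.mem_nhds hx] with y hy
    rw [fderiv_fun_sum (fun i _ => ((hw i).contDiffAt (hU.mem_nhds hy)).differentiableAt (by norm_num))]
    simp
  rw [e.fderiv_eq, fderiv_fun_sum]
  · simp
  · intro i _
    exact ((((hw i).contDiffAt (hU.mem_nhds hx)).fderiv_right (m := 1) (by norm_num)).differentiableAt (by norm_num)).clm_apply (differentiableAt_const _)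

lemma SD.pol_lapl (S : SD) (μ θ₀ : ℝ) {y : V3} (hy : y ∈ HP) :
    lapl (pol (S.V μ θ₀)) y = exp (-(2 * Tt y)) * pol (S.G μ θ₀) y := by
  unfold pol SD.V
  rw [lapl_sum hp_open (fun i => ?_) hy]
  · unfold SD.G SD.c
    rw [Finset.mul_sum]
    refine Finset.sum_congr rfl fun i _ => ?_
    exact mode_lapl (S.h1 i) (S.h2 i) (S.h3 i) _ _ _ _ hy
  · refine ((((cd2_of (S.h1 i) (S.h2 i) (S.h3 i)).comp_contDiffOn tt_cd)).mul (Real.contDiff_cos.comp_contDiffOn (contDiffOn_const.mul (an_cd.sub contDiffOn_const)))).mul (Real.contDiff_cos.comp_contDiffOn ?_)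
    fun_prop

lemma pol_cont {W : ℝ → ℝ → ℝ → ℝ} (hW : Continuous fun p : ℝ × ℝ × ℝ => W p.1 p.2.1 p.2.2) : ContinuousOn (pol W) HP := by
  have : ContinuousOn (fun y : V3 => (Tt y, An y, y 1)) HP :=
    (tt_cd (n := 0)).continuousOn.prodMk ((an_cd (n := 0)).continuousOn.prodMk (by fun_prop))
  exact hW.comp_continuousOn this

theorem weak_polar {μ θ₀ : ℝ} {V F : ℝ → ℝ → ℝ → ℝ} (h : Approx μ θ₀ V F) {p : V3} {ρ ρ' : ℝ} (hρ : ρ < ρ') (h0 : 0 < ρ) (hP : ball p ρ' ⊆ HP) :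
    ∃ w f : V3 → ℝ, Weak p ρ w f ∧ (∀ y ∈ ball p ρ, w y = pol V y) ∧ ∀ y ∈ ball p ρ, f y = exp (-(2 * Tt y)) * pol F y := by
  have eT : ContinuousOn (fun y => exp (-(2 * Tt y))) HP := by
    have := (tt_cd (n := 0)).continuousOn
    fun_prop
  have ext : ∀ {g : V3 → ℝ}, ContinuousOn g HP → ∃ g' : V3 → ℝ, Continuous g' ∧ ∀ y, dist y p ≤ ρ → g' y = g y := fun hg =>
    exists_ext hρ (h0.trans hρ) (hg.mono hP)
  obtain ⟨w, hw, hw'⟩ := ext (pol_cont h.contV)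
  obtain ⟨f, hf, hf'⟩ := ext (eT.fun_mul (pol_cont h.contF))
  refine ⟨w, f, ⟨hw, hf, fun x s hs hxs => ?_⟩, fun y hy => hw' y (le_of_lt hy), fun y hy => hf' y (le_of_lt hy)⟩
  have hsub : closedBall p ρ ⊆ HP := (closedBall_subset_ball hρ).trans hP
  obtain ⟨L, hL⟩ := (isCompact_closedBall p ρ).exists_bound_of_continuousOn ((tt_cd (n := 0)).continuousOn.mono hsub)
  refine dfct_zero_of_limit hw hf hs.le fun ε hε => ?_
  obtain ⟨S, hS⟩ := h (ε / exp (2 * L)) (by positivity) L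
  obtain ⟨w', hw1, hw2⟩ := ext (pol_cont (S.V_cont μ θ₀))
  obtain ⟨f', hf1, hf2⟩ := ext (eT.fun_mul (pol_cont (S.G_cont μ θ₀)))
  have W : Weak p ρ w' f' := by
    have ball : ∀ y ∈ ball p ρ, y ∈ HP := fun y hy => hsub (ball_subset_closedBall hy)
    refine weak_of_C2 ?_ hw1 hf1 ?_
    · exact ((S.pol_cd μ θ₀).mono ball).congr fun y hy => hw2 y (le_of_lt hy)
    · intro y hy
      rw [hf2 y (le_of_lt hy)]
      refine Eq.trans (lapl_congr ?_) (S.pol_lapl μ θ₀ (ball y hy))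
      filter_upwards [isOpen_ball.mem_nhds hy] with z hz using hw2 z (le_of_lt hz)
  refine ⟨w', f', hw1, hf1, W.2.2 x s hs hxs, fun y hy => ?_⟩
  have hy' : dist y p ≤ ρ := by linarith [dist_triangle y x p]
  have hT := hL y hy'
  rw [norm_eq_abs] at hT
  obtain ⟨a, b⟩ := hS (Tt y) (An y) (y 1) hT
  have h1 : 1 ≤ exp (2 * L) := one_le_exp (by linarith [abs_nonneg (Tt y)])
  rw [hw' y hy', hw2 y hy', hf' y hy', hf2 y hy', ← mul_sub, abs_mul, abs_of_pos (exp_pos _)]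
  constructor
  · rw [abs_sub_comm]; exact a.trans (div_le_self hε.le h1)
  · rw [abs_sub_comm]
    have e : exp (-(2 * Tt y)) ≤ exp (2 * L) := exp_le_exp.2 (by linarith [neg_abs_le (Tt y)])
    calc _ ≤ exp (2 * L) * (ε / exp (2 * L)) := mul_le_mul e b (abs_nonneg _) (exp_pos _).le
      _ = ε := by field_simp

end

section
lemma wedge_open (b₀ : ℝ) : IsOpen (wedgeQ b₀) := by
  have : wedgeQ b₀ = {y : V3 | 0 < y 0} ∩ {y : V3 | b₀ * y 0 < y 2} := rfl
  rw [this]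
  exact (isOpen_lt continuous_const (by fun_prop)).inter (isOpen_lt (by fun_prop) (by fun_prop))

/-- inward path -/
def gam (b₀ : ℝ) (y : V3) (ε : ℝ) : V3 := y + ε • (ee 0 + (b₀ + 1) • ee 2)

lemma gam0 (b₀ : ℝ) (y : V3) (ε : ℝ) : gam b₀ y ε 0 = y 0 + ε := by simp [gam, ee]
lemma gam2 (b₀ : ℝ) (y : V3) (ε : ℝ) : gam b₀ y ε 2 = y 2 + ε * (b₀ + 1) := by simp [gam, ee]

lemma gam_mem {b₀ : ℝ} {y : V3} (h0 : 0 ≤ y 0) (h2 : b₀ * y 0 ≤ y 2) {ε : ℝ} (hε : 0 < ε) : gam b₀ y ε ∈ wedgeQ b₀ := by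
  refine ⟨?_, ?_⟩
  · rw [gam0]; linarith
  · rw [gam0, gam2]; nlinarith

lemma gam_cont (b₀ : ℝ) (y : V3) : Continuous (gam b₀ y) := by unfold gam; fun_prop

lemma gam_zero (b₀ : ℝ) (y : V3) : gam b₀ y 0 = y := by simp [gam]

lemma closure_wedge (b₀ : ℝ) : closure (wedgeQ b₀) = {y : V3 | 0 ≤ y 0 ∧ b₀ * y 0 ≤ y 2} := by
  apply Subset.antisymm
  · refine closure_minimal (fun y hy => ⟨hy.1.le, hy.2.le⟩) ?_
    have : {y : V3 | 0 ≤ y 0 ∧ b₀ * y 0 ≤ y 2} = {y : V3 | 0 ≤ y 0} ∩ {y : V3 | b₀ * y 0 ≤ y 2} := rfl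
    rw [this]
    exact (isClosed_le continuous_const (by fun_prop)).inter (isClosed_le (by fun_prop) (by fun_prop))
  · rintro y ⟨h0, h2⟩
    have h : Tendsto (gam b₀ y) (𝓝[>] 0) (𝓝 y) := by
      have := ((gam_cont b₀ y).tendsto 0).mono_left (nhdsWithin_le_nhds (s := Ioi 0))
      rwa [gam_zero] at this
    refine mem_closure_of_tendsto h ?_
    filter_upwards [self_mem_nhdsWithin] with ε hε using gam_mem h0 h2 hε

lemma mem_SQ {b₀ : ℝ} (hb : 0 < b₀) {y : V3} : y ∈ SQ b₀ ↔ 0 ≤ y 0 ∧ b₀ * y 0 ≤ y 2 ∧ 0 < y 2 := by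
  rw [SQ, mem_diff, closure_wedge, mem_setOf_eq, edge, mem_setOf_eq]
  constructor
  · rintro ⟨⟨h0, h2⟩, h⟩
    refine ⟨h0, h2, ?_⟩
    have : 0 ≤ b₀ * y 0 := by positivity
    rcases (this.trans h2).lt_or_eq with h' | h'
    · exact h'
    · exfalso; apply h
      refine ⟨?_, h'.symm⟩
      have : b₀ * y 0 = 0 := le_antisymm (by linarith) this
      rcases mul_eq_zero.1 this with h | h
      · linarith
      · exact h
  · rintro ⟨h0, h2, h⟩
    exact ⟨⟨h0, h2⟩, fun h' => by rw [h'.2] at h; exact lt_irrefl _ h⟩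

lemma wedge_sub {b₀ : ℝ} (hb : 0 < b₀) : wedgeQ b₀ ⊆ SQ b₀ := fun y hy => by
  have := hy.1; have := hy.2
  exact (mem_SQ hb).2 ⟨hy.1.le, hy.2.le, lt_trans (by positivity) hy.2⟩

lemma sq_nhds {b₀ : ℝ} (hb : 0 < b₀) {y : V3} (hy : y ∈ wedgeQ b₀) : SQ b₀ ∈ 𝓝 y :=
  mem_of_superset ((wedge_open b₀).mem_nhds hy) (wedge_sub hb)

lemma sq_convex {b₀ : ℝ} (hb : 0 < b₀) : Convex ℝ (SQ b₀) := by
  intro x hx y hy a b ha hbb hab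
  obtain ⟨x0, x2, x3⟩ := (mem_SQ hb).1 hx
  obtain ⟨y0, y2, y3⟩ := (mem_SQ hb).1 hy
  refine (mem_SQ hb).2 ?_
  simp only [PiLp.add_apply, PiLp.smul_apply, smul_eq_mul]
  refine ⟨by positivity, by nlinarith, ?_⟩
  rcases ha.lt_or_eq with h | h
  · have : 0 < a * x 2 := by positivity
    have : 0 ≤ b * y 2 := by positivity
    linarith
  · have : b = 1 := by linarith
    rw [← h, this]; linarith

lemma sq_unique {b₀ : ℝ} (hb : 0 < b₀) : UniqueDiffOn ℝ (SQ b₀) := by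
  refine uniqueDiffOn_convex (sq_convex hb) ⟨gam b₀ 0 1, ?_⟩
  exact mem_interior_iff_mem_nhds.2 (sq_nhds hb (gam_mem (by simp) (by simp) one_pos))

lemma sq_HP {b₀ : ℝ} (hb : 0 < b₀) : SQ b₀ ⊆ HP := fun y hy => by
  obtain ⟨x0, x2, x3⟩ := (mem_SQ hb).1 hy
  show 0 < y 2 + y 0
  linarith

lemma hp_rx {y : V3} (hy : y ∈ HP) : 0 < rx y := Real.sqrt_pos.2 (hp_pos hy)
lemma rx_sq (y : V3) : rx y ^ 2 = y 0 ^ 2 + y 2 ^ 2 := Real.sq_sqrt (by positivity)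
lemma rx_nonneg (y : V3) : 0 ≤ rx y := Real.sqrt_nonneg _
lemma rx_cont : Continuous rx := by unfold rx; fun_prop

lemma rx_lip (x y : V3) : rx x ≤ rx y + dist x y := by
  have h : ∀ a b c d : ℝ, √(a^2+b^2) ≤ √(c^2+d^2) + √((a-c)^2+(b-d)^2) := fun a b c d => by
    rw [Real.sqrt_le_left (by positivity), add_sq, Real.sq_sqrt (by positivity), Real.sq_sqrt (by positivity)]
    have : c * (a - c) + d * (b - d) ≤ √(c^2+d^2) * √((a-c)^2+(b-d)^2) := by
      rw [← Real.sqrt_mul (by positivity)]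
      apply Real.le_sqrt_of_sq_le
      nlinarith [sq_nonneg (c * (b - d) - d * (a - c))]
    nlinarith
  refine (h (x 0) (x 2) (y 0) (y 2)).trans ?_
  refine add_le_add le_rfl ?_
  rw [dist_eq_norm]
  apply Real.sqrt_le_iff.2 ⟨norm_nonneg _, ?_⟩
  rw [norm_sq3]; simp only [PiLp.sub_apply]
  nlinarith [sq_nonneg (x 1 - y 1)]

lemma gam_tendsto {b₀ : ℝ} (hb : 0 < b₀) {y : V3} (hy : y ∈ SQ b₀) : Tendsto (gam b₀ y) (𝓝[>] 0) (𝓝[SQ b₀] y) := by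
  obtain ⟨x0, x2, x3⟩ := (mem_SQ hb).1 hy
  refine tendsto_nhdsWithin_iff.2 ⟨?_, ?_⟩
  · have := ((gam_cont b₀ y).tendsto 0).mono_left (nhdsWithin_le_nhds (s := Ioi 0))
    rwa [gam_zero] at this
  · filter_upwards [self_mem_nhdsWithin] with ε hε using wedge_sub hb (gam_mem x0 x2 hε)

lemma gam_good {b₀ : ℝ} (hb : 0 < b₀) {y : V3} (hy : y ∈ SQ b₀) :
    ∀ᶠ ε in 𝓝[>] (0:ℝ), gam b₀ y ε ∈ wedgeQ b₀ ∧ rx (gam b₀ y ε) ≠ 1 := by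
  obtain ⟨x0, x2, x3⟩ := (mem_SQ hb).1 hy
  have h1 : ∀ᶠ ε in 𝓝[>] (0:ℝ), gam b₀ y ε ∈ wedgeQ b₀ := by
    filter_upwards [self_mem_nhdsWithin] with ε hε using gam_mem x0 x2 hε
  refine h1.and ?_
  rcases lt_or_ge (rx y) 1 with h | h
  · have := ((rx_cont.comp (gam_cont b₀ y)).tendsto 0).mono_left (nhdsWithin_le_nhds (s := Ioi 0))
    simp only [Function.comp, gam_zero] at this
    filter_upwards [this.eventually_lt_const h] with ε hε using hε.ne
  · filter_upwards [self_mem_nhdsWithin] with ε hε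
    have hε : 0 < ε := hε
    have e := rx_sq (gam b₀ y ε)
    have e' := rx_sq y
    rw [gam0, gam2] at e
    intro h'
    rw [h'] at e
    have : 0 < ε * (b₀ + 1) := by positivity
    nlinarith

/-- weight -/
def rho (δ δ₀ r : ℝ) : ℝ := min (r ^ (1 + δ)) (r ^ δ₀)

section rho
variable {δ δ₀ : ℝ} (hδ0 : 0 < δ) (hδ1 : δ < 1) (hδ₀0 : 0 < δ₀) (hδ₀1 : δ₀ < 1)
lemma rho_pos {r : ℝ} (hr : 0 < r) : 0 < rho δ δ₀ r := lt_min (by positivity) (by positivity)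
lemma rho_small (hδ0 : 0 < δ) (hδ₀1 : δ₀ < 1) {r : ℝ} (hr : 0 < r) (h1 : r ≤ 1) : rho δ δ₀ r = r ^ (1 + δ) :=
  min_eq_left (Real.rpow_le_rpow_of_exponent_ge hr h1 (by linarith))
lemma rho_large (hδ0 : 0 < δ) (hδ₀1 : δ₀ < 1) {r : ℝ} (h1 : 1 ≤ r) : rho δ δ₀ r = r ^ δ₀ :=
  min_eq_right (Real.rpow_le_rpow_of_exponent_le h1 (by linarith))
lemma rho_scale (hδ1 : δ < 1) (hδ₀1 : δ₀ < 1) {r r' : ℝ} (hr : 0 < r) (h : r ≤ r') : rho δ δ₀ r' ≤ (r' / r) ^ 2 * rho δ δ₀ r := by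
  have h1 : 1 ≤ r' / r := (one_le_div hr).2 h
  have hr' : 0 < r' := hr.trans_le h
  have key : ∀ a : ℝ, a ≤ 2 → r' ^ a ≤ (r' / r) ^ 2 * r ^ a := fun a ha => by
    have e : r' ^ a = (r' / r) ^ a * r ^ a := by
      rw [← Real.mul_rpow (by positivity) hr.le, div_mul_cancel₀ _ hr.ne']
    rw [e]
    gcongr
    have := Real.rpow_le_rpow_of_exponent_le h1 ha
    exact_mod_cast this
  unfold rho
  rw [mul_min_of_nonneg _ _ (by positivity)]
  exact min_le_min (key _ (by linarith)) (key _ (by linarith))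
lemma rho_mono (hδ0 : 0 < δ) (hδ₀0 : 0 < δ₀) {r r' : ℝ} (hr : 0 < r) (h : r ≤ r') : rho δ δ₀ r ≤ rho δ δ₀ r' :=
  min_le_min (Real.rpow_le_rpow hr.le h (by linarith)) (Real.rpow_le_rpow hr.le h (by linarith))
lemma rho_two (hδ0 : 0 < δ) (hδ1 : δ < 1) (hδ₀0 : 0 < δ₀) (hδ₀1 : δ₀ < 1) {r r' : ℝ} (hr : 0 < r) (hr' : 0 < r') (h : r' ≤ 2 * r) :
    rho δ δ₀ r' ≤ 4 * rho δ δ₀ r := by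
  have hp := rho_pos (δ := δ) (δ₀ := δ₀) hr
  rcases le_total r r' with h' | h'
  · refine (rho_scale hδ1 hδ₀1 hr h').trans ?_
    have h2 : r' / r ≤ 2 := (div_le_iff₀ hr).2 h
    have h0 : 0 ≤ r' / r := by positivity
    have : (r'/r)^2 ≤ 4 := by nlinarith
    nlinarith
  · have := rho_mono hδ0 hδ₀0 hr' h'
    linarith
lemma rho_cont : ContinuousOn (rho δ δ₀) (Ioi 0) := by
  unfold rho
  apply ContinuousOn.inf
  · exact ContinuousOn.rpow_const continuousOn_id fun x hx => Or.inl (ne_of_gt hx)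
  · exact ContinuousOn.rpow_const continuousOn_id fun x hx => Or.inl (ne_of_gt hx)
end rho

/-- Unified source bounds on the whole of `SQ`. -/
lemma source_bounds {b₀ α δ δ₀ : ℝ} (hb : 0 < b₀) (hα0 : 0 < α) (hδ0 : 0 < δ) (hδ1 : δ < 1) (hδ₀0 : 0 < δ₀) (hδ₀1 : δ₀ < 1)
    {f : V3 → ℝ} (hf : memH (SQ b₀) 4 α (1 - δ) (2 - δ₀) (wedgeQ b₀) f) :
    ∃ M, 0 ≤ M ∧ (∀ j ≤ 4, ∀ y ∈ SQ b₀, rx y ^ (j + 2) * ‖iteratedFDerivWithin ℝ j f (SQ b₀) y‖ ≤ M * rho δ δ₀ (rx y)) ∧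
      ∀ x ∈ SQ b₀, ∀ y ∈ SQ b₀, min (rx x) (rx y) ^ 6 * min (rx x) (rx y) ^ α *
        ‖iteratedFDerivWithin ℝ 4 f (SQ b₀) x - iteratedFDerivWithin ℝ 4 f (SQ b₀) y‖ ≤ M * rho δ δ₀ (min (rx x) (rx y)) * dist x y ^ α := by
  obtain ⟨hc, M, hM, ⟨h1, h2⟩, h3, h4⟩ := hf
  have hu := sq_unique hb
  have hcont : ∀ j ≤ 4, ContinuousOn (iteratedFDerivWithin ℝ j f (SQ b₀)) (SQ b₀) := fun j hj =>
    hc.continuousOn_iteratedFDerivWithin (by exact_mod_cast hj) hu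
  have rp : ∀ y ∈ SQ b₀, 0 < rx y := fun y hy => hp_rx (sq_HP hb hy)
  have a1 : ∀ r : ℝ, 0 < r → ∀ a : ℕ, ∀ b : ℝ, ∀ N : ℝ, ∀ K : ℝ, r ^ ((a:ℝ) - b) * N ≤ K → r ^ a * N ≤ K * r ^ b := by
    intro r hr a b N K h
    rw [rpow_sub hr, rpow_natCast, div_mul_eq_mul_div, div_le_iff₀ (by positivity)] at h
    exact h
  refine ⟨M, hM, fun j hj y hy => ?_, fun x hx y hy => ?_⟩
  · have g : ∀ y ∈ wedgeQ b₀, rx y ≠ 1 → rx y ^ (j + 2) * ‖iteratedFDerivWithin ℝ j f (SQ b₀) y‖ ≤ M * rho δ δ₀ (rx y) := by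
      intro y hy hy1
      have r0 := rp y (wedge_sub hb hy)
      rcases lt_or_gt_of_ne hy1 with h | h
      · rw [rho_small hδ0 hδ₀1 r0 h.le]
        refine a1 _ r0 _ _ _ _ ?_
        have := h1 j hj y hy r0 h
        rw [max_eq_left (by have : (0:ℝ) ≤ j := by positivity
                            linarith)] at this
        convert this using 3
        push_cast; ring
      · rw [rho_large hδ0 hδ₀1 h.le]
        refine a1 _ r0 _ _ _ _ ?_
        have := h2 j hj y hy h
        convert this using 3
        push_cast; ring
    have t := gam_tendsto hb hy
    have tr : Tendsto (fun ε => rx (gam b₀ y ε)) (𝓝[>] 0) (𝓝 (rx y)) := (rx_cont.tendsto y).comp (t.mono_right nhdsWithin_le_nhds)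
    refine le_of_tendsto_of_tendsto ((tr.pow _).mul (((hcont j hj y hy).tendsto.comp t).norm)) (tendsto_const_nhds.mul
      ((rho_cont.continuousAt (Ioi_mem_nhds (rp y hy))).tendsto.comp tr)) ?_
    filter_upwards [gam_good hb hy] with ε hε using g _ hε.1 hε.2
  · have g : ∀ x ∈ wedgeQ b₀, rx x ≠ 1 → ∀ y ∈ wedgeQ b₀, rx y ≠ 1 → min (rx x) (rx y) ^ 6 * min (rx x) (rx y) ^ α *
        ‖iteratedFDerivWithin ℝ 4 f (SQ b₀) x - iteratedFDerivWithin ℝ 4 f (SQ b₀) y‖ ≤ M * rho δ δ₀ (min (rx x) (rx y)) * dist x y ^ α := by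
      intro x hx hx1 y hy hy1
      have r0 : 0 < min (rx x) (rx y) := lt_min (rp x (wedge_sub hb hx)) (rp y (wedge_sub hb hy))
      have hne : min (rx x) (rx y) ≠ 1 := by
        rcases min_choice (rx x) (rx y) with h | h <;> rw [h] <;> assumption
      have h3' := h3 x hx y hy r0
      have h4' := h4 x hx y hy
      set r := min (rx x) (rx y)
      set N := ‖iteratedFDerivWithin ℝ 4 f (SQ b₀) x - iteratedFDerivWithin ℝ 4 f (SQ b₀) y‖
      rw [← dist_eq_norm] at h3' h4'
      rw [mul_assoc, mul_right_comm]
      rcases lt_or_gt_of_ne hne with h | h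
      · rw [rho_small hδ0 hδ₀1 r0 h.le]
        refine a1 _ r0 _ _ _ _ ?_
        have := h3' h
        rw [max_eq_left (by push_cast; linarith)] at this
        rw [← mul_assoc, ← rpow_add r0]
        convert this using 3
        push_cast; ring
      · rw [rho_large hδ0 hδ₀1 h.le]
        refine a1 _ r0 _ _ _ _ ?_
        have := h4' h
        rw [← mul_assoc, ← rpow_add r0]
        convert this using 3
        push_cast; ring
    have t := gam_tendsto hb hy
    have tx := gam_tendsto hb hx
    have tr : Tendsto (fun ε => rx (gam b₀ y ε)) (𝓝[>] 0) (𝓝 (rx y)) := (rx_cont.tendsto y).comp (t.mono_right nhdsWithin_le_nhds)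
    have trx : Tendsto (fun ε => rx (gam b₀ x ε)) (𝓝[>] 0) (𝓝 (rx x)) := (rx_cont.tendsto x).comp (tx.mono_right nhdsWithin_le_nhds)
    have tm := trx.min tr
    have r0 : 0 < min (rx x) (rx y) := lt_min (rp x hx) (rp y hy)
    refine le_of_tendsto_of_tendsto (((tm.pow _).mul (tm.rpow_const (Or.inl r0.ne'))).mul ((((hcont 4 le_rfl x hx).tendsto.comp tx).sub ((hcont 4 le_rfl y hy).tendsto.comp t)).norm)) ((tendsto_const_nhds.mul
      ((rho_cont.continuousAt (Ioi_mem_nhds r0)).tendsto.comp tm)).mul (((tx.mono_right nhdsWithin_le_nhds).dist (t.mono_right nhdsWithin_le_nhds)).rpow_const (Or.inr hα0.le))) ?_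
    filter_upwards [gam_good hb hy, gam_good hb hx] with ε hε hε' using g _ hε'.1 hε'.2 _ hε.1 hε.2
end

section
open scoped Pointwise

def muW (b₀ : ℝ) : ℝ := π / (π / 2 - arctan b₀)

lemma om_pos (b₀ : ℝ) : 0 < π / 2 - arctan b₀ := by have := arctan_lt_pi_div_two b₀; linarith
lemma muW_pos (b₀ : ℝ) : 0 < muW b₀ := div_pos pi_pos (om_pos b₀)
lemma th_pos {b₀ : ℝ} (hb : 0 < b₀) : 0 < arctan b₀ := by simpa using hb
lemma muW_gt {b₀ : ℝ} (hb : 0 < b₀) : 2 < muW b₀ := by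
  rw [muW, lt_div_iff₀ (om_pos b₀)]; have := th_pos hb; linarith
lemma muW_end (b₀ : ℝ) : arctan b₀ + π / muW b₀ = π / 2 := by
  have := (om_pos b₀).ne'
  have := pi_pos.ne'
  rw [muW, div_div_cancel₀ pi_pos.ne']; ring
lemma th_cos (b₀ : ℝ) : 0 < cos (arctan b₀) := cos_arctan_pos b₀
lemma th_sin (b₀ : ℝ) : sin (arctan b₀) = b₀ * cos (arctan b₀) := by
  have := tan_arctan b₀
  rw [tan_eq_sin_div_cos, div_eq_iff (th_cos b₀).ne'] at this
  exact this

def PP (t θ z : ℝ) : V3 := !₂[exp t * cos θ, z, exp t * sin θ]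
lemma PP0 (t θ z : ℝ) : PP t θ z 0 = exp t * cos θ := by simp [PP]
lemma PP1 (t θ z : ℝ) : PP t θ z 1 = z := by simp [PP]
lemma PP2 (t θ z : ℝ) : PP t θ z 2 = exp t * sin θ := by simp [PP]
lemma rx_PP (t θ z : ℝ) : rx (PP t θ z) = exp t := by
  rw [rx, PP0, PP2, mul_pow, mul_pow, ← mul_add, cos_sq_add_sin_sq, mul_one, Real.sqrt_sq (exp_pos t).le]

lemma sin_sub_th (b₀ θ : ℝ) : sin (θ - arctan b₀) = cos (arctan b₀) * (sin θ - b₀ * cos θ) := by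
  rw [sin_sub, th_sin]; ring

lemma PP_mem {b₀ : ℝ} (hb : 0 < b₀) {t θ z : ℝ} (h : θ ∈ Icc (arctan b₀) (π / 2)) : PP t θ z ∈ SQ b₀ := by
  have pp := pi_pos
  have h1 := th_pos hb
  have hc : 0 ≤ cos θ := cos_nonneg_of_mem_Icc ⟨by linarith [h.1], h.2⟩
  have hs : 0 < sin θ := sin_pos_of_pos_of_lt_pi (by linarith [h.1]) (by linarith [h.2])
  have hd : 0 ≤ sin (θ - arctan b₀) := sin_nonneg_of_nonneg_of_le_pi (by linarith [h.1]) (by linarith [h.2])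
  rw [sin_sub_th] at hd
  have hd' := nonneg_of_mul_nonneg_right hd (th_cos b₀)
  have := exp_pos t
  refine (mem_SQ hb).2 ⟨by rw [PP0]; positivity, ?_, by rw [PP2]; positivity⟩
  rw [PP0, PP2]; nlinarith

lemma an_range (y : V3) : An y ∈ Ioo (-(π / 4)) (3 * π / 4) := by
  have h1 := arctan_lt_pi_div_two ((y 2 - y 0) / (y 2 + y 0))
  have h2 := neg_pi_div_two_lt_arctan ((y 2 - y 0) / (y 2 + y 0))
  unfold An
  constructor <;> linarith

lemma an_mem {b₀ : ℝ} (hb : 0 < b₀) {y : V3} (hy : y ∈ SQ b₀) : An y ∈ Icc (arctan b₀) (π / 2) := by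
  have pp := pi_pos
  have h1 := th_pos hb
  obtain ⟨p0, p2⟩ := an_pol (sq_HP hb hy)
  obtain ⟨y0, y2, y3⟩ := (mem_SQ hb).1 hy
  obtain ⟨r1, r2⟩ := an_range y
  have e := exp_pos (Tt y)
  constructor
  · by_contra! h
    have hd : sin (An y - arctan b₀) < 0 := sin_neg_of_neg_of_neg_pi_lt (by linarith) (by have := arctan_lt_pi_div_two b₀; linarith)
    rw [sin_sub_th] at hd
    have : exp (Tt y) * (cos (arctan b₀) * (sin (An y) - b₀ * cos (An y))) < 0 := mul_neg_of_pos_of_neg e hd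
    have e2 : exp (Tt y) * (cos (arctan b₀) * (sin (An y) - b₀ * cos (An y))) = cos (arctan b₀) * (y 2 - b₀ * y 0) := by rw [p0, p2]; ring
    rw [e2] at this
    have h3 : 0 ≤ cos (arctan b₀) * (y 2 - b₀ * y 0) := mul_nonneg (th_cos b₀).le (by linarith)
    linarith
  · by_contra! h
    have hd : cos (An y) < 0 := cos_neg_of_pi_div_two_lt_of_lt h (by linarith)
    have := mul_neg_of_pos_of_neg e hd
    linarith

lemma ext3 {x y : V3} (h0 : x 0 = y 0) (h1 : x 1 = y 1) (h2 : x 2 = y 2) : x = y := by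
  ext i; fin_cases i
  · exact h0
  · exact h1
  · exact h2

lemma PP_pol {y : V3} (hy : y ∈ HP) : PP (Tt y) (An y) (y 1) = y := by
  obtain ⟨p0, p2⟩ := an_pol hy
  exact ext3 (by rw [PP0, ← p0]) (PP1 _ _ _) (by rw [PP2, ← p2])

lemma tri_W {b₀ : ℝ} (θ : ℝ) : tri (muW b₀) (arctan b₀) θ ∈ Icc (arctan b₀) (π / 2) := by
  have := tri_mem (θ₀ := arctan b₀) (muW_pos b₀) θ
  rwa [muW_end] at this

lemma tri_W_eq {b₀ θ : ℝ} (h : θ ∈ Icc (arctan b₀) (π / 2)) : tri (muW b₀) (arctan b₀) θ = θ :=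
  tri_eq (muW_pos b₀) (by rwa [muW_end])

/-- extended source in polar variables -/
def gsrc (b₀ : ℝ) (f : V3 → ℝ) (t θ z : ℝ) : ℝ := f (PP t (tri (muW b₀) (arctan b₀) θ) z)

lemma gsrc_pol {b₀ : ℝ} (hb : 0 < b₀) (f : V3 → ℝ) {y : V3} (hy : y ∈ SQ b₀) : pol (gsrc b₀ f) y = f y := by
  rw [pol, gsrc, tri_W_eq (an_mem hb hy), PP_pol (sq_HP hb hy)]

lemma PP_cont : Continuous fun p : ℝ × ℝ × ℝ => PP p.1 p.2.1 p.2.2 := by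
  unfold PP
  refine (PiLp.continuous_toLp 2 _).comp (continuous_pi fun i => ?_)
  fin_cases i <;> simp <;> fun_prop

lemma PP_deriv (t θ z : ℝ) : HasDerivAt (fun t => PP t θ z) (PP t θ 0) t := by
  have : ∀ t, PP t θ z = z • ee 1 + exp t • PP 0 θ 0 := fun t =>
    ext3 (by simp [PP0, ee]) (by simp [PP1, ee]) (by simp [PP2, ee])
  have e : PP t θ 0 = exp t • PP 0 θ 0 := ext3 (by simp [PP0]) (by simp [PP1]) (by simp [PP2])
  simp only [this]
  rw [e]
  exact ((Real.hasDerivAt_exp t).smul_const _).const_add _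

lemma PP_norm (t θ : ℝ) : ‖PP t θ 0‖ = exp t := by
  have := rx_PP t θ 0
  have h : ‖PP t θ 0‖ ^ 2 = rx (PP t θ 0) ^ 2 := by rw [norm_sq3, rx_sq, PP1]; ring
  rw [← this]
  exact (pow_left_inj₀ (norm_nonneg _) (rx_nonneg _) two_ne_zero).1 h

lemma per_fderiv {b₀ : ℝ} (hb : 0 < b₀) {f : V3 → ℝ} (hfper : Per2On (closure (wedgeQ b₀)) f) {y : V3} (hy : y ∈ SQ b₀) :
    fderivWithin ℝ f (SQ b₀) (y + (2 * π) • ee 1) = fderivWithin ℝ f (SQ b₀) y := by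
  have e := fderivWithin_comp_add_right (𝕜 := ℝ) (f := f) (s := SQ b₀) (x := y) ((2 * π) • ee 1)
  have hs : ((2 * π) • ee 1 : V3) +ᵥ SQ b₀ = SQ b₀ := by
    ext z
    rw [mem_vadd_set_iff_neg_vadd_mem, mem_SQ hb, mem_SQ hb]
    simp [ee]
  rw [hs] at e
  rw [← e]
  refine fderivWithin_congr (fun z hz => ?_) ?_
  · have := hfper z hz.1
    convert this using 2
    ext i; fin_cases i <;> simp [ee]
  · have := hfper y hy.1
    convert this using 2
    ext i; fin_cases i <;> simp [ee]

lemma wedge_V {b₀ α δ δ₀ : ℝ} (hb : 0 < b₀) (hα0 : 0 < α) (hδ0 : 0 < δ) (hδ1 : δ < 1) (hδ₀0 : 0 < δ₀) (hδ₀1 : δ₀ < 1)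
    {f : V3 → ℝ} (hf : ContDiffOn ℝ 4 f (SQ b₀)) (hfper : Per2On (closure (wedgeQ b₀)) f) {M : ℝ} (hM : 0 ≤ M)
    (hfb : ∀ j ≤ 4, ∀ y ∈ SQ b₀, rx y ^ (j + 2) * ‖iteratedFDerivWithin ℝ j f (SQ b₀) y‖ ≤ M * rho δ δ₀ (rx y)) :
    ∃ V : ℝ → ℝ → ℝ → ℝ, Approx (muW b₀) (arctan b₀) V (fun t θ z => exp (2 * t) * gsrc b₀ f t θ z) ∧ ∃ C ≥ 0,
      (∀ t θ z, 0 ≤ t → |V t θ z| ≤ C * exp (δ₀ * t)) ∧ (∀ t θ z, t ≤ 0 → |V t θ z| ≤ C) ∧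
      ∀ t0 z0, t0 ≤ 0 → ∃ a b, ∀ t θ z, |t - t0| ≤ 1 → |z - z0| ≤ exp t0 →
        |V t θ z - a - b * (z - z0)| ≤ C * exp ((1 + δ) * t0) := by
  have hu := sq_unique hb
  set S := SQ b₀ with hS
  set τ := tri (muW b₀) (arctan b₀) with hτ
  have mem : ∀ t θ z, PP t (τ θ) z ∈ S := fun t θ z => PP_mem hb (tri_W θ)
  have hdf : DifferentiableOn ℝ f S := hf.differentiableOn (by norm_num)
  have hfd : ContinuousOn (fderivWithin ℝ f S) S := hf.continuousOn_fderivWithin hu (by norm_num)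
  have cPP : Continuous fun p : ℝ × ℝ × ℝ => PP p.1 (τ p.2.1) p.2.2 :=
    PP_cont.comp (f := fun p : ℝ × ℝ × ℝ => (p.1, τ p.2.1, p.2.2)) (by
      have := tri_cont (muW b₀) (arctan b₀)
      fun_prop)
  have cPP0 : Continuous fun p : ℝ × ℝ × ℝ => PP p.1 (τ p.2.1) 0 :=
    PP_cont.comp (f := fun p : ℝ × ℝ × ℝ => (p.1, τ p.2.1, (0:ℝ))) (by
      have := tri_cont (muW b₀) (arctan b₀)
      fun_prop)
  have shift : ∀ t θ z, PP t θ (z + 2 * π) = PP t θ z + (2 * π) • ee 1 := fun t θ z =>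
    ext3 (by simp [PP0, ee]) (by simp [PP1, ee]) (by simp [PP2, ee])
  have shift' : ∀ y : V3, y + EuclideanSpace.single 1 (2 * Real.pi) = y + (2 * π) • ee 1 := fun y => by
    ext i; fin_cases i <;> simp [ee]
  have erp : ∀ a t : ℝ, exp t ^ a = exp (a * t) := fun a t => by rw [← Real.exp_mul, mul_comm]
  have bnd : ∀ t : ℝ, ∀ X : ℝ, exp t ^ 2 * X ≤ M * rho δ δ₀ (exp t) → X ≤ M * exp ((δ - 1) * t) ∧ X ≤ M * exp ((δ₀ - 2) * t) := by
    intro t X h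
    have e2 : exp t ^ 2 = exp (2 * t) := by rw [← Real.exp_nat_mul]; norm_num
    rw [e2] at h
    have h1 : X ≤ exp (-(2 * t)) * (M * rho δ δ₀ (exp t)) := by
      rw [Real.exp_neg, inv_mul_eq_div, le_div_iff₀ (exp_pos _), mul_comm]; exact h
    have i1 : rho δ δ₀ (exp t) ≤ exp ((1 + δ) * t) := (min_le_left _ _).trans (erp _ _).le
    have i2 : rho δ δ₀ (exp t) ≤ exp (δ₀ * t) := (min_le_right _ _).trans (erp _ _).le
    constructor
    · refine h1.trans ?_
      calc _ ≤ exp (-(2 * t)) * (M * exp ((1 + δ) * t)) := by gcongr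
        _ = M * (exp (-(2 * t)) * exp ((1 + δ) * t)) := by ring
        _ = _ := by rw [← Real.exp_add]; ring_nf
    · refine h1.trans ?_
      calc _ ≤ exp (-(2 * t)) * (M * exp (δ₀ * t)) := by gcongr
        _ = M * (exp (-(2 * t)) * exp (δ₀ * t)) := by ring
        _ = _ := by rw [← Real.exp_add]; ring_nf
  have g0 : ∀ t θ z, exp t ^ 2 * |gsrc b₀ f t θ z| ≤ M * rho δ δ₀ (exp t) := fun t θ z => by
    have := hfb 0 (by norm_num) _ (mem t θ z)
    rw [rx_PP, norm_iteratedFDerivWithin_zero] at this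
    exact this
  have g1 : ∀ t θ z, exp t ^ 2 * |fderivWithin ℝ f S (PP t (τ θ) z) (PP t (τ θ) 0)| ≤ M * rho δ δ₀ (exp t) := fun t θ z => by
    have := hfb 1 (by norm_num) _ (mem t θ z)
    rw [rx_PP, norm_iteratedFDerivWithin_one _ (hu _ (mem t θ z))] at this
    refine le_trans ?_ this
    have h := (fderivWithin ℝ f S (PP t (τ θ) z)).le_opNorm (PP t (τ θ) 0)
    rw [PP_norm, norm_eq_abs] at h
    calc _ ≤ exp t ^ 2 * (‖fderivWithin ℝ f S (PP t (τ θ) z)‖ * exp t) := by gcongr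
      _ = _ := by ring
  refine solve_all (muW_gt hb) (arctan b₀) (g1 := fun t θ z => fderivWithin ℝ f S (PP t (τ θ) z) (PP t (τ θ) 0)) hδ0 hδ1 hδ₀0 hδ₀1 hM
    (fun t θ z => ?_) ?_ ?_ (fun t θ z => ?_) (fun t θ z => ?_) (fun t θ z => ?_)
    (fun t θ z => (bnd t _ (g0 t θ z)).1) (fun t θ z => (bnd t _ (g0 t θ z)).2) (fun t θ z => (bnd t _ (g1 t θ z)).1) (fun t θ z => (bnd t _ (g1 t θ z)).2)
  · have h1 := (hdf _ (mem t θ z)).hasFDerivWithinAt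
    have h2 := (PP_deriv t (τ θ) z).hasDerivWithinAt (s := univ)
    have := h1.comp_hasDerivWithinAt t h2 (fun s _ => mem s θ z)
    exact hasDerivWithinAt_univ.1 this
  · exact hf.continuousOn.comp_continuous cPP fun p => mem _ _ _
  · have : Continuous fun p : ℝ × ℝ × ℝ => fderivWithin ℝ f S (PP p.1 (τ p.2.1) p.2.2) := hfd.comp_continuous cPP fun p => mem _ _ _
    exact this.clm_apply cPP0
  · show f (PP t (τ (τ θ)) z) = f (PP t (τ θ) z)
    have : τ (τ θ) = τ θ := tri_W_eq (tri_W θ)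
    rw [this]
  · show f (PP t (τ θ) (z + 2 * π)) = f (PP t (τ θ) z)
    rw [shift, ← shift', hfper _ (mem t θ z).1]
  · show fderivWithin ℝ f S (PP t (τ θ) (z + 2 * π)) _ = _
    rw [shift, per_fderiv hb hfper (mem t θ z)]
end

section
def rotL (φ : ℝ) : V3 →ₗ[ℝ] V3 where
  toFun x := !₂[cos φ * x 0 - sin φ * x 2, x 1, sin φ * x 0 + cos φ * x 2]
  map_add' x y := by apply ext3 <;> simp <;> ring
  map_smul' a x := by apply ext3 <;> simp <;> ring

lemma rotL0 (φ : ℝ) (x : V3) : rotL φ x 0 = cos φ * x 0 - sin φ * x 2 := by simp [rotL]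
lemma rotL1 (φ : ℝ) (x : V3) : rotL φ x 1 = x 1 := by simp [rotL]
lemma rotL2 (φ : ℝ) (x : V3) : rotL φ x 2 = sin φ * x 0 + cos φ * x 2 := by simp [rotL]

def Rot (φ : ℝ) : V3 ≃ₗᵢ[ℝ] V3 :=
  LinearIsometry.toLinearIsometryEquiv (LinearIsometry.mk (rotL φ) (fun x => by
    have h : ‖rotL φ x‖ ^ 2 = ‖x‖ ^ 2 := by
      rw [norm_sq3, norm_sq3, rotL0, rotL1, rotL2]
      linear_combination (x 0 ^ 2 + x 2 ^ 2) * (sin_sq_add_cos_sq φ)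
    exact (pow_left_inj₀ (norm_nonneg _) (norm_nonneg _) two_ne_zero).1 h)) rfl

lemma Rot_apply (φ : ℝ) (x : V3) : Rot φ x = rotL φ x := rfl

lemma sim_rot0 (p : V3) (R φ : ℝ) (x : V3) : sim p R (Rot φ) x 0 = p 0 + R * (cos φ * x 0 - sin φ * x 2) := by
  simp [sim, Rot_apply, rotL0]
lemma sim_rot1 (p : V3) (R φ : ℝ) (x : V3) : sim p R (Rot φ) x 1 = p 1 + R * x 1 := by
  simp [sim, Rot_apply, rotL1]
lemma sim_rot2 (p : V3) (R φ : ℝ) (x : V3) : sim p R (Rot φ) x 2 = p 2 + R * (sin φ * x 0 + cos φ * x 2) := by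
  simp [sim, Rot_apply, rotL2]

/-- signed distance to the face at angle φ -/
def dn (φ : ℝ) (y : V3) : ℝ := cos φ * y 2 - sin φ * y 0

lemma dn_sim (p : V3) (R φ : ℝ) (x : V3) : dn φ (sim p R (Rot φ) x) = dn φ p + R * x 2 := by
  rw [dn, dn, sim_rot0, sim_rot2]; linear_combination (R * x 2) * (sin_sq_add_cos_sq φ)

lemma dn_lip (φ : ℝ) (x y : V3) : |dn φ x - dn φ y| ≤ dist x y := by
  rw [dist_eq_norm]
  apply abs_le_of_sq_le_sq _ (norm_nonneg _)
  rw [norm_sq3]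
  simp only [PiLp.sub_apply, dn]
  have h := sin_sq_add_cos_sq φ
  have : (cos φ * x 2 - sin φ * x 0 - (cos φ * y 2 - sin φ * y 0)) ^ 2 + (cos φ * (x 0 - y 0) + sin φ * (x 2 - y 2)) ^ 2 =
    (x 0 - y 0) ^ 2 + (x 2 - y 2) ^ 2 := by linear_combination ((x 0 - y 0) ^ 2 + (x 2 - y 2) ^ 2) * h
  nlinarith [sq_nonneg (x 1 - y 1), sq_nonneg (cos φ * (x 0 - y 0) + sin φ * (x 2 - y 2))]

lemma dn_pol (φ : ℝ) {y : V3} (hy : y ∈ HP) : dn φ y = exp (Tt y) * sin (An y - φ) := by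
  obtain ⟨h0, h2⟩ := an_pol hy
  rw [dn, sin_sub]; rw [h0, h2]; ring

/-- angle uniqueness -/
lemma an_uniq {y : V3} (hy : y ∈ HP) {φ r : ℝ} (hr : 0 < r) (h0 : y 0 = r * cos φ) (h2 : y 2 = r * sin φ) (h : |An y - φ| < 2 * π) :
    An y = φ ∧ Tt y = log r := by
  obtain ⟨p0, p2⟩ := an_pol hy
  have hT : Tt y = log r := by
    have e := exp_2tt hy
    have : y 0 ^ 2 + y 2 ^ 2 = r ^ 2 := by rw [h0, h2]; linear_combination r ^ 2 * sin_sq_add_cos_sq φ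
    rw [Tt, this, log_pow]; push_cast; ring
  refine ⟨?_, hT⟩
  rw [hT, exp_log hr] at p0 p2
  have hc : cos (An y) = cos φ := mul_left_cancel₀ hr.ne' (p0.symm.trans h0)
  have hs : sin (An y) = sin φ := mul_left_cancel₀ hr.ne' (p2.symm.trans h2)
  have h1 : cos (An y - φ) = 1 := by rw [cos_sub, hc, hs]; linear_combination sin_sq_add_cos_sq φ
  rw [abs_lt] at h
  have := (cos_eq_one_iff_of_lt_of_lt h.1 h.2).1 h1
  linarith

def c1 (b₀ : ℝ) : ℝ := sin ((π / 2 - arctan b₀) / 2)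

lemma c1_pos (b₀ : ℝ) (hb : 0 < b₀) : 0 < c1 b₀ := by
  have := om_pos b₀; have := th_pos hb
  exact sin_pos_of_pos_of_lt_pi (by linarith) (by have := pi_pos; linarith)
lemma c1_le (b₀ : ℝ) : c1 b₀ ≤ 1 := sin_le_one _

def cR (b₀ : ℝ) : ℝ := c1 b₀ / 28
lemma cR_pos (b₀ : ℝ) (hb : 0 < b₀) : 0 < cR b₀ := by have := c1_pos b₀ hb; unfold cR; positivity

lemma ball_HP {b₀ : ℝ} (hb : 0 < b₀) {p : V3} (hp : p ∈ SQ b₀) : ball p (rx p * (2/3)) ⊆ HP := by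
  intro y hy
  obtain ⟨h0, h1, h2⟩ := (mem_SQ hb).1 hp
  rw [mem_ball, dist_eq_norm] at hy
  show 0 < y 2 + y 0
  have hr := rx_sq p
  have r0 := rx_nonneg p
  have hs : rx p ≤ p 2 + p 0 := by
    apply le_of_sq_le_sq _ (by linarith); nlinarith
  have hn := norm_sq3 (y - p)
  simp only [PiLp.sub_apply] at hn
  have hn0 := norm_nonneg (y - p)
  by_contra! hc
  have h3 : rx p ≤ (p 2 - y 2) + (p 0 - y 0) := by linarith
  have h4 : rx p ^ 2 ≤ ((p 2 - y 2) + (p 0 - y 0)) ^ 2 := by gcongr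
  have h5 : ‖y - p‖ ^ 2 < (rx p * (2/3)) ^ 2 := by gcongr
  nlinarith [sq_nonneg ((p 2 - y 2) - (p 0 - y 0)), sq_nonneg (y 1 - p 1), sq_nonneg (rx p)]

lemma sq_iff {b₀ : ℝ} (hb : 0 < b₀) {y : V3} (hy : y ∈ HP) : y ∈ SQ b₀ ↔ 0 ≤ dn (-(π/2)) y ∧ 0 ≤ dn (arctan b₀) y := by
  have hy : 0 < y 2 + y 0 := hy
  have e1 : dn (-(π/2)) y = y 0 := by simp [dn]
  have e2 : dn (arctan b₀) y = cos (arctan b₀) * (y 2 - b₀ * y 0) := by rw [dn, th_sin]; ring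
  rw [mem_SQ hb, e1, e2, mul_nonneg_iff_of_pos_left (th_cos b₀), sub_nonneg]
  constructor
  · rintro ⟨a, b, c⟩; exact ⟨a, b⟩
  · rintro ⟨a, b⟩
    refine ⟨a, b, ?_⟩
    have : 0 ≤ b₀ * y 0 := by positivity
    by_contra! hc
    have : b₀ * y 0 = 0 := by linarith
    rcases mul_eq_zero.1 this with h | h <;> linarith

/-- the local chart at a point of `SQ` -/
lemma chart {b₀ : ℝ} (hb : 0 < b₀) {p : V3} (hp : p ∈ SQ b₀) : ∃ φ κ : ℝ, κ ≤ 0 ∧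
    (∀ x ∈ ball (0:V3) 14, sim p (cR b₀ * rx p) (Rot φ) x ∈ SQ b₀ ↔ κ ≤ x 2) ∧
    (∀ W : ℝ → ℝ → ℝ → ℝ, (∀ t θ z, W t (tri (muW b₀) (arctan b₀) θ) z = W t θ z) → ∀ x ∈ ball (0:V3) 14,
      pol W (sim p (cR b₀ * rx p) (Rot φ) (fold κ x)) = pol W (sim p (cR b₀ * rx p) (Rot φ) x)) ∧
    (p 2 = b₀ * p 0 → κ = 0 ∧ φ = arctan b₀) ∧ (p 0 = 0 → κ = 0 ∧ φ = -(π/2)) := by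
  have pp := pi_pos
  have hHP := sq_HP hb hp
  have r0 := hp_rx hHP
  have hc := c1_pos b₀ hb
  have hc1 := c1_le b₀
  obtain ⟨R, hR⟩ : ∃ R, R = cR b₀ * rx p := ⟨_, rfl⟩
  have R0 : 0 < R := by rw [hR]; have := cR_pos b₀ hb; positivity
  have h14 : R * 14 = c1 b₀ * rx p / 2 := by rw [hR, cR]; ring
  have ax := an_mem hb hp
  have om := om_pos b₀
  have th := th_pos hb
  have er : exp (Tt p) = rx p := exp_tt hHP
  -- common
  have key : ∀ φ φ' : ℝ, ({φ, φ'} = ({-(π/2), arctan b₀} : Set ℝ)) → c1 b₀ * rx p ≤ dn φ' p →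
      (∃ ψ : ℝ, cos ψ = 1 ∧ sin ψ = 0 ∧ (∀ A : ℝ, tri (muW b₀) (arctan b₀) (2 * φ - A + ψ) = tri (muW b₀) (arctan b₀) A) ∧ -(π/4) ≤ 2 * φ + ψ ∧ 2 * φ + ψ ≤ 5 * π/4) →
      0 ≤ dn φ p →
      -(dn φ p) / R ≤ 0 ∧
    (∀ x ∈ ball (0:V3) 14, sim p R (Rot φ) x ∈ SQ b₀ ↔ -(dn φ p) / R ≤ x 2) ∧
    (∀ W : ℝ → ℝ → ℝ → ℝ, (∀ t θ z, W t (tri (muW b₀) (arctan b₀) θ) z = W t θ z) → ∀ x ∈ ball (0:V3) 14,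
      pol W (sim p R (Rot φ) (fold (-(dn φ p) / R) x)) = pol W (sim p R (Rot φ) x)) := by
    intro φ φ' hφ hd hψ hpos
    obtain ⟨ψ, cψ, sψ, tψ, lψ, uψ⟩ := hψ
    have hκ : -(dn φ p) / R ≤ 0 := div_nonpos_of_nonpos_of_nonneg (by linarith) R0.le
    have inHP : ∀ x ∈ ball (0:V3) 14, sim p R (Rot φ) x ∈ HP := fun x hx => by
      apply ball_HP hb hp
      rw [mem_ball, sim_dist0 R0]
      rw [mem_ball] at hx
      have : R * dist x 0 < R * 14 := by gcongr
      nlinarith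
    have hiff : ∀ y ∈ HP, (y ∈ SQ b₀ ↔ 0 ≤ dn φ y ∧ 0 ≤ dn φ' y) := fun y hy => by
      rw [sq_iff hb hy]
      have : (∀ a ∈ ({φ, φ'} : Set ℝ), 0 ≤ dn a y) ↔ ∀ a ∈ ({-(π/2), arctan b₀} : Set ℝ), 0 ≤ dn a y := by rw [hφ]
      simpa using this.symm
    have e1 : ∀ x : V3, 0 ≤ dn φ (sim p R (Rot φ) x) ↔ -(dn φ p) / R ≤ x 2 := fun x => by
      rw [dn_sim, div_le_iff₀ R0]; constructor <;> intro h <;> linarith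
    refine ⟨hκ, fun x hx => ?_, fun W hW x hx => ?_⟩
    · rw [hiff _ (inHP x hx), e1]
      refine and_iff_left ?_
      have := dn_lip φ' p (sim p R (Rot φ) x)
      rw [dist_comm, sim_dist0 R0] at this
      rw [mem_ball] at hx
      have h2 : R * dist x 0 < R * 14 := by gcongr
      have := (abs_le.1 this).2
      have : 0 < c1 b₀ * rx p := by positivity
      linarith
    · by_cases hx2 : -(dn φ p) / R ≤ x 2
      · rw [fold_eq hx2]
      · push Not at hx2
        set κ := -(dn φ p) / R with hκd
        have hx' : fold κ x ∈ ball (0:V3) 14 := by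
          simp only [mem_ball_zero_iff] at hx ⊢; exact (fold_norm hκ x).trans_lt hx
        have hy := inHP x hx
        have hy' := inHP _ hx'
        set y := sim p R (Rot φ) x with hyd
        set y' := sim p R (Rot φ) (fold κ x) with hyd'
        have f2 : fold κ x 2 = 2 * κ - x 2 := by rw [fold_two, abs_of_neg (by linarith)]; ring
        have hdn : dn φ y = R * (x 2 - κ) := by rw [hyd, dn_sim, hκd]; field_simp; ring
        obtain ⟨p0, p2⟩ := an_pol hy
        have y'1 : y' 1 = y 1 := by rw [hyd', hyd, sim_rot1, sim_rot1, fold_one]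
        have y'0 : y' 0 = y 0 + 2 * sin φ * dn φ y := by rw [hdn, hyd', hyd, sim_rot0, sim_rot0, fold_zero, f2]; ring
        have y'2 : y' 2 = y 2 - 2 * cos φ * dn φ y := by rw [hdn, hyd', hyd, sim_rot2, sim_rot2, fold_zero, f2]; ring
        have sc := sin_sq_add_cos_sq φ
        have z0 : y' 0 = exp (Tt y) * cos (2 * φ - An y + ψ) := by
          rw [y'0, dn, p0, p2, cos_add, cψ, sψ, cos_sub, cos_two_mul, sin_two_mul]
          linear_combination (2 * exp (Tt y) * cos (An y)) * (-sc)
        have z2 : y' 2 = exp (Tt y) * sin (2 * φ - An y + ψ) := by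
          rw [y'2, dn, p0, p2, sin_add, cψ, sψ, sin_sub, cos_two_mul, sin_two_mul]
          ring
        have ra := an_range y
        have ra' := an_range y'
        obtain ⟨A1, A2⟩ := an_uniq hy' (exp_pos _) z0 z2 (by rw [abs_lt]; constructor <;> linarith [ra.1, ra.2, ra'.1, ra'.2])
        rw [pol, pol, A2, log_exp, y'1, A1, ← hW, tψ, hW]
  have trieq : ∀ A B : ℝ, cos (muW b₀ * (A - arctan b₀)) = cos (muW b₀ * (B - arctan b₀)) → tri (muW b₀) (arctan b₀) A = tri (muW b₀) (arctan b₀) B :=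
    fun A B h => by rw [tri, tri, h]
  have muom : muW b₀ * (π / 2 - arctan b₀) = π := div_mul_cancel₀ _ om.ne'
  have dA0 : dn (-(π/2)) p = p 0 := by simp [dn]
  have dB0 : dn (arctan b₀) p = cos (arctan b₀) * (p 2 - b₀ * p 0) := by rw [dn, th_sin]; ring
  have hnn := (sq_iff hb hHP).1 hp
  have dA := dn_pol (-(π/2)) hHP
  have dB := dn_pol (arctan b₀) hHP
  have triB : ∀ A : ℝ, tri (muW b₀) (arctan b₀) (2 * arctan b₀ - A) = tri (muW b₀) (arctan b₀) A := fun A => by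
    apply trieq; rw [← cos_neg]; ring_nf
  have triA : ∀ A : ℝ, tri (muW b₀) (arctan b₀) (2 * (-(π/2)) - A + 2 * π) = tri (muW b₀) (arctan b₀) A := fun A => by
    apply trieq
    have : muW b₀ * (2 * (-(π/2)) - A + 2 * π - arctan b₀) = 2 * π - muW b₀ * (A - arctan b₀) := by linear_combination 2 * muom
    rw [this, cos_two_pi_sub]
  rw [← hR]
  rcases le_total ((π / 2 - arctan b₀) / 2) (An p - arctan b₀) with h | h
  · -- dB large, face A
    have big : c1 b₀ * rx p ≤ dn (arctan b₀) p := by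
      rw [dB, er, mul_comm, c1]
      gcongr
      exact sin_le_sin_of_le_of_le_pi_div_two (by linarith) (by linarith [ax.2]) h
    obtain ⟨k1, k2, k3⟩ := key (-(π/2)) (arctan b₀) rfl big ⟨2 * π, cos_two_pi, sin_two_pi, triA, by linarith, by linarith⟩ hnn.1
    refine ⟨_, _, k1, k2, k3, fun h' => ?_, fun h' => ?_⟩
    · exfalso
      rw [dB0, h', sub_self, mul_zero] at big
      have : 0 < c1 b₀ * rx p := by positivity
      linarith
    · exact ⟨by rw [dA0, h']; simp, rfl⟩
  · have big : c1 b₀ * rx p ≤ dn (-(π/2)) p := by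
      have : sin (An p - -(π/2)) = sin (π/2 - An p) := by rw [sub_neg_eq_add, sin_add_pi_div_two, sin_pi_div_two_sub]
      rw [dA, er, mul_comm, c1, this]
      gcongr
      exact sin_le_sin_of_le_of_le_pi_div_two (by linarith) (by linarith [ax.1]) (by linarith)
    obtain ⟨k1, k2, k3⟩ := key (arctan b₀) (-(π/2)) (Set.pair_comm _ _) big ⟨0, cos_zero, sin_zero, fun A => by rw [add_zero]; exact triB A, by linarith, by linarith [arctan_lt_pi_div_two b₀]⟩ hnn.2
    refine ⟨_, _, k1, k2, k3, fun h' => ?_, fun h' => ?_⟩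
    · exact ⟨by rw [dB0, h']; simp, rfl⟩
    · exfalso
      rw [dA0, h'] at big
      have : 0 < c1 b₀ * rx p := by positivity
      linarith
end

section
lemma cR_le (b₀ : ℝ) : cR b₀ ≤ 1/28 := by have := c1_le b₀; unfold cR; linarith

def aff (a b z : ℝ) (y : V3) : ℝ := a + b * (y 1 - z)

lemma aff_cd (a b z : ℝ) {n : WithTop ℕ∞} : ContDiff ℝ n (aff a b z) := by
  unfold aff; fun_prop

lemma aff_fd (a b z : ℝ) (y : V3) : HasFDerivAt (aff a b z) (b • (EuclideanSpace.proj 1 : V3 →L[ℝ] ℝ)) y := by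
  have h : HasFDerivAt (fun y : V3 => y 1) (EuclideanSpace.proj 1 : V3 →L[ℝ] ℝ) y := (EuclideanSpace.proj 1 : V3 →L[ℝ] ℝ).hasFDerivAt
  exact ((h.sub_const z).const_mul b).const_add a

lemma aff_fderiv (a b z : ℝ) : fderiv ℝ (aff a b z) = fun _ => b • (EuclideanSpace.proj 1 : V3 →L[ℝ] ℝ) :=
  funext fun y => (aff_fd a b z y).fderiv

lemma aff_lapl (a b z : ℝ) (y : V3) : lapl (aff a b z) y = 0 := by
  unfold lapl; rw [aff_fderiv]; simp

lemma aff_iter (a b z : ℝ) {j : ℕ} (hj : 2 ≤ j) {S : Set V3} (hS : UniqueDiffOn ℝ S) {y : V3} (hy : y ∈ S) : iteratedFDerivWithin ℝ j (aff a b z) S y = 0 := by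
  obtain ⟨k, rfl⟩ : ∃ k, j = (k + 1) + 1 := ⟨j - 2, by omega⟩
  rw [iteratedFDerivWithin_eq_iteratedFDeriv hS (aff_cd a b z).contDiffAt hy, ← norm_eq_zero, ← norm_iteratedFDeriv_fderiv, aff_fderiv,
    iteratedFDeriv_const_of_ne (by omega)]
  simp

lemma tt_near {p y : V3} (hp : p ∈ HP) (hy : y ∈ HP) (h : dist y p ≤ rx p * (1/2)) : |Tt y - Tt p| ≤ 1 := by
  have h1 := rx_lip y p
  have h2 := rx_lip p y
  rw [dist_comm p y] at h2
  have e1 := exp_tt hy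
  have e2 := exp_tt hp
  have r0 := hp_rx hp
  have k1 : 2 < exp 1 := by have := exp_one_gt_d9; linarith
  rw [abs_le]; constructor
  · have : exp (Tt p - 1) ≤ exp (Tt y) := by
      rw [exp_sub, e1, e2, div_le_iff₀ (exp_pos _)]; nlinarith
    have := exp_le_exp.1 this; linarith
  · have : exp (Tt y) ≤ exp (Tt p + 1) := by
      rw [exp_add, e1, e2]; nlinarith
    have := exp_le_exp.1 this; linarith

lemma iter_congr {S B : Set V3} (hB : IsOpen B) {u v : V3 → ℝ} (h : ∀ y ∈ S ∩ B, u y = v y) {y : V3} (hy : y ∈ S ∩ B) (j : ℕ) :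
    iteratedFDerivWithin ℝ j u S y = iteratedFDerivWithin ℝ j v S y := by
  refine Filter.EventuallyEq.iteratedFDerivWithin_eq ?_ (h y hy) j
  filter_upwards [self_mem_nhdsWithin, mem_nhdsWithin_of_mem_nhds (hB.mem_nhds hy.2)] with x h1 h2 using h x ⟨h1, h2⟩

lemma core1 {b₀ α δ δ₀ : ℝ} (hb : 0 < b₀) (hα0 : 0 < α) (hα1 : α < 1) (hδ0 : 0 < δ) (hδ1 : δ < 1) (hδ₀0 : 0 < δ₀) (hδ₀1 : δ₀ < 1) : ∃ C1 : ℝ, 1 ≤ C1 ∧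
    ∀ (f : V3 → ℝ) (hf : ContDiffOn ℝ 4 f (SQ b₀)) (M : ℝ) (hM : 0 ≤ M)
    (hfb : ∀ j ≤ 4, ∀ y ∈ SQ b₀, rx y ^ (j + 2) * ‖iteratedFDerivWithin ℝ j f (SQ b₀) y‖ ≤ M * rho δ δ₀ (rx y))
    (hfh : ∀ x ∈ SQ b₀, ∀ y ∈ SQ b₀, min (rx x) (rx y) ^ 6 * min (rx x) (rx y) ^ α *
        ‖iteratedFDerivWithin ℝ 4 f (SQ b₀) x - iteratedFDerivWithin ℝ 4 f (SQ b₀) y‖ ≤ M * rho δ δ₀ (min (rx x) (rx y)) * dist x y ^ α)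
    (V : ℝ → ℝ → ℝ → ℝ) (hV : Approx (muW b₀) (arctan b₀) V (fun t θ z => exp (2 * t) * gsrc b₀ f t θ z))
    (p : V3) (hp : p ∈ SQ b₀) (a b K : ℝ) (hK : 4 * M * rho δ δ₀ (rx p) ≤ K)
    (hVb : ∀ y ∈ ball p (rx p * (1/2)), |pol V y - aff a b (p 1) y| ≤ K),
    ContDiffOn ℝ 6 (pol V) (SQ b₀ ∩ ball p (cR b₀ * rx p)) ∧
    (∀ j ≤ 6, ∀ y ∈ SQ b₀ ∩ ball p (cR b₀ * rx p), (cR b₀ * rx p) ^ j * ‖iteratedFDerivWithin ℝ j (fun y => pol V y - aff a b (p 1) y) (SQ b₀) y‖ ≤ C1 * K) ∧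
    (∀ y ∈ SQ b₀ ∩ ball p (cR b₀ * rx p), ∀ z ∈ SQ b₀ ∩ ball p (cR b₀ * rx p),
      (cR b₀ * rx p) ^ 6 * (cR b₀ * rx p) ^ α * ‖iteratedFDerivWithin ℝ 6 (fun y => pol V y - aff a b (p 1) y) (SQ b₀) y
        - iteratedFDerivWithin ℝ 6 (fun y => pol V y - aff a b (p 1) y) (SQ b₀) z‖ ≤ C1 * K * dist y z ^ α) ∧
    ContDiffOn ℝ 2 (pol V) (ball p (cR b₀ * rx p)) ∧ (lapl (pol V) p = f p) := by
  obtain ⟨C1, hC1, L⟩ := local_est hα0 hα1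
  refine ⟨C1, hC1, ?_⟩
  intro f hf M hM hfb hfh V hV p hp a b K hK hVb
  have hu := sq_unique hb
  have hHP := sq_HP hb hp
  have r0 := hp_rx hHP
  have hc := c1_pos b₀ hb
  have hc1 := c1_le b₀
  obtain ⟨φ, κ, hκ, ch1, ch2, -, -⟩ := chart hb hp
  obtain ⟨R, hR⟩ : ∃ R, R = cR b₀ * rx p := ⟨_, rfl⟩
  rw [← hR] at ch1 ch2 ⊢
  have R0 : 0 < R := by rw [hR]; have := cR_pos b₀ hb; positivity
  have h14 : R * 14 ≤ rx p * (1/2) := by rw [hR]; have := cR_le b₀; nlinarith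
  obtain ⟨w, g, hW, hw, hg⟩ := weak_polar hV (p := p) (ρ := R * 14) (ρ' := rx p * (2/3)) (by linarith) (by positivity) (ball_HP hb hp)
  have b14 : ball p (R * 14) ⊆ HP := (ball_subset_ball (by linarith)).trans (ball_HP hb hp)
  have bR : ball p R ⊆ ball p (R * 14) := ball_subset_ball (by linarith)
  have hg' : ∀ y ∈ ball p (R * 14), g y = pol (gsrc b₀ f) y := fun y hy => by
    rw [hg y hy]; unfold pol; rw [← mul_assoc, ← exp_add]; simp
  have hgf : ∀ y ∈ SQ b₀ ∩ ball p (R * 14), g y = f y := fun y hy => by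
    rw [hg' y hy.2, gsrc_pol hb f hy.1]
  have hA : Weak p (R * 14) (aff a b (p 1)) (fun _ => 0) :=
    weak_of_C2 (aff_cd a b _).contDiffOn (aff_cd a b _ (n := 0)).continuous continuous_const (fun y _ => aff_lapl _ _ _ _)
  have hWA : Weak p (R * 14) (fun y => 1 * w y + (-1) * aff a b (p 1) y) g := by
    refine ⟨by have := hW.1; have := hA.1; fun_prop, hW.2.1, fun x s hs hxs => ?_⟩
    have := dfct_lin hW.1 hA.1 hW.2.1 hA.2.1 1 (-1) s x
    rw [hW.2.2 x s hs hxs, hA.2.2 x s hs hxs] at this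
    simpa using this
  have rxy : ∀ y ∈ ball p (R * 14), R ≤ rx y ∧ rx y ≤ 2 * rx p ∧ 0 < rx y := fun y hy => by
    have h1 := rx_lip y p
    have h2 := rx_lip p y
    rw [dist_comm p y] at h2
    have h3 : dist y p < R * 14 := hy
    refine ⟨by linarith, by linarith, by linarith⟩
  have rb : ∀ r, 0 < r → r ≤ 2 * rx p → M * rho δ δ₀ r ≤ K := fun r hr h => by
    have := rho_two hδ0 hδ1 hδ₀0 hδ₀1 r0 hr h
    nlinarith
  obtain ⟨l1, l2, l3, l4⟩ := L p R R0 (Rot φ) κ hκ (SQ b₀) hu ch1 _ g K hWA (fun y hy => by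
      rw [hw y hy]; have := hVb y (ball_subset_ball h14 hy); rw [one_mul, neg_one_mul]; exact this)
    (fun x hx => by
      have m : ∀ x ∈ ball (0:V3) 14, sim p R (Rot φ) x ∈ ball p (R * 14) := fun x hx => by
        rw [mem_ball, sim_dist0 R0]; exact mul_lt_mul_of_pos_left hx R0
      have hfx : fold κ x ∈ ball (0:V3) 14 := by
        rw [mem_ball_zero_iff] at hx ⊢; exact (fold_norm hκ x).trans_lt hx
      rw [hg' _ (m _ hx), hg' _ (m _ hfx)]
      refine ch2 _ (fun t θ z => ?_) x hx
      unfold gsrc; rw [tri_W_eq (tri_W θ)])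
    ((hf.mono inter_subset_left).congr hgf)
    (fun j hj y hy => by
      rw [iter_congr isOpen_ball hgf hy]
      obtain ⟨q1, q2, q3⟩ := rxy y hy.2
      refine le_trans ?_ ((hfb j hj y hy.1).trans (rb _ q3 q2))
      gcongr)
    (fun y hy z hz => by
      rw [iter_congr isOpen_ball hgf hy, iter_congr isOpen_ball hgf hz]
      obtain ⟨q1, q2, q3⟩ := rxy y hy.2
      obtain ⟨q1', q2', q3'⟩ := rxy z hz.2
      have m1 : R ≤ min (rx y) (rx z) := le_min q1 q1'
      have m2 : min (rx y) (rx z) ≤ 2 * rx p := (min_le_left _ _).trans q2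
      refine le_trans ?_ ((hfh y hy.1 z hz.1).trans (mul_le_mul_of_nonneg_right (rb _ (R0.trans_le m1) m2) (by positivity)))
      gcongr)
  have ew : ∀ y ∈ ball p R, 1 * w y + (-1) * aff a b (p 1) y = pol V y - aff a b (p 1) y := fun y hy => by rw [hw y (bR hy)]; ring
  have ei : ∀ y ∈ SQ b₀ ∩ ball p R, ∀ j, iteratedFDerivWithin ℝ j (fun y => 1 * w y + (-1) * aff a b (p 1) y) (SQ b₀) y =
      iteratedFDerivWithin ℝ j (fun y => pol V y - aff a b (p 1) y) (SQ b₀) y := fun y hy j => iter_congr isOpen_ball (fun y hy => ew y hy.2) hy j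
  have e2 : ContDiffOn ℝ 2 w (ball p R) := (l4.add (aff_cd a b (p 1)).contDiffOn).congr fun y hy => by simp
  have pR : p ∈ ball p R := by simp [R0]
  refine ⟨?_, ?_, ?_, ?_, ?_⟩
  · exact (l1.add (aff_cd a b (p 1)).contDiffOn).congr fun y hy => by simp [hw y (bR hy.2)]
  · intro j hj y hy; rw [← ei y hy]; exact l2 j hj y hy
  · intro y hy z hz; rw [← ei y hy, ← ei z hz]; exact l3 y hy z hz
  · exact e2.congr fun y hy => (hw y (bR hy)).symm
  · have hWR : Weak p R w g := ⟨hW.1, hW.2.1, fun x s hs hxs => hW.2.2 x s hs (by linarith)⟩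
    have := lapl_of_weak hWR e2 p pR
    rw [← hgf p ⟨hp, bR pR⟩, ← this]
    exact (lapl_congr (Filter.eventually_of_mem (isOpen_ball.mem_nhds pR) fun y hy => hw y (bR hy))).symm

end

section
structure Good (b₀ α δ δ₀ C : ℝ) (f v : V3 → ℝ) : Prop where
  C0 : 0 ≤ C
  cd : ContDiffOn ℝ 6 v (SQ b₀)
  lap : ∀ p ∈ wedgeQ b₀, lapl v p = f p
  neu1 : ∀ y ∈ SQ b₀, y 2 = b₀ * y 0 → b₀ * pdW (SQ b₀) 0 v y - pdW (SQ b₀) 2 v y = 0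
  neu2 : ∀ y ∈ SQ b₀, y 0 = 0 → pdW (SQ b₀) 0 v y = 0
  val : ∀ p ∈ SQ b₀, 1 ≤ rx p → |v p| ≤ C * rho δ δ₀ (rx p)
  val' : ∀ p ∈ SQ b₀, rx p ≤ 1 → |v p| ≤ C
  grad : ∀ p ∈ SQ b₀, ∃ b : ℝ, (1 ≤ rx p → b = 0) ∧ rx p * ‖fderivWithin ℝ v (SQ b₀) p - b • (EuclideanSpace.proj 1 : V3 →L[ℝ] ℝ)‖ ≤ C * rho δ δ₀ (rx p)
  iter : ∀ j, 2 ≤ j → j ≤ 6 → ∀ p ∈ SQ b₀, rx p ^ j * ‖iteratedFDerivWithin ℝ j v (SQ b₀) p‖ ≤ C * rho δ δ₀ (rx p)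
  hold : ∀ p ∈ SQ b₀, ∀ y ∈ SQ b₀, dist y p < cR b₀ * rx p → rx p ^ 6 * rx p ^ α * ‖iteratedFDerivWithin ℝ 6 v (SQ b₀) y - iteratedFDerivWithin ℝ 6 v (SQ b₀) p‖
    ≤ C * rho δ δ₀ (rx p) * dist y p ^ α

lemma fold_smul (s : ℝ) : fold 0 (s • ee 2) = |s| • ee 2 := by
  unfold fold; rw [← add_smul]; congr 1; simp [ee]

lemma neu_gen {p : V3} {R φ : ℝ} (hR : 0 < R) {v : V3 → ℝ} (hv : DifferentiableAt ℝ v p)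
    (he : ∀ x ∈ ball (0:V3) 14, v (sim p R (Rot φ) (fold 0 x)) = v (sim p R (Rot φ) x)) : fderiv ℝ v p (Rot φ (ee 2)) = 0 := by
  have h1 : HasDerivAt (fun s : ℝ => p + s • (R • Rot φ (ee 2))) (R • Rot φ (ee 2)) 0 := by
    simpa using ((hasDerivAt_id (0:ℝ)).smul_const (R • Rot φ (ee 2))).const_add p
  have h2 : HasDerivAt (fun s : ℝ => v (p + s • (R • Rot φ (ee 2)))) (fderiv ℝ v p (R • Rot φ (ee 2))) 0 := by
    have h3 : HasFDerivAt v (fderiv ℝ v p) (p + (0:ℝ) • (R • Rot φ (ee 2))) := by simpa using hv.hasFDerivAt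
    exact h3.comp_hasDerivAt 0 h1
  have ev : (fun s : ℝ => v (p + (-s) • (R • Rot φ (ee 2)))) =ᶠ[𝓝 0] (fun s : ℝ => v (p + s • (R • Rot φ (ee 2)))) := by
    filter_upwards [ball_mem_nhds (0:ℝ) (by norm_num : (0:ℝ) < 14)] with s hs
    have m : ∀ s : ℝ, |s| < 14 → v (p + s • (R • Rot φ (ee 2))) = v (p + |s| • (R • Rot φ (ee 2))) := fun s hs => by
      have := he (s • ee 2) (by rw [mem_ball_zero_iff, norm_smul, ee_norm]; simpa using hs)
      rw [fold_smul] at this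
      simp only [sim, map_smul] at this
      rw [smul_comm R, smul_comm R] at this
      exact this.symm
    have hs' : |s| < 14 := by simpa using hs
    rw [m s hs', m (-s) (by rwa [abs_neg]), abs_neg]
  have h4 : HasDerivAt (fun s : ℝ => v (p + (-s) • (R • Rot φ (ee 2)))) (-(fderiv ℝ v p (R • Rot φ (ee 2)))) 0 := by
    have h2' : HasDerivAt (fun s : ℝ => v (p + s • (R • Rot φ (ee 2)))) (fderiv ℝ v p (R • Rot φ (ee 2))) (-0) := by simpa using h2
    have := h2'.scomp (0:ℝ) (hasDerivAt_neg (0:ℝ))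
    simpa [Function.comp_def] using this
  have := (h4.congr_of_eventuallyEq ev.symm).unique h2
  rw [map_smul, smul_eq_mul] at this
  have : R * fderiv ℝ v p (Rot φ (ee 2)) = 0 := by linarith
  exact (mul_eq_zero.1 this).resolve_left hR.ne'

lemma good_of {b₀ α δ δ₀ : ℝ} (hb : 0 < b₀) (hα0 : 0 < α) (hα1 : α < 1) (hδ0 : 0 < δ) (hδ1 : δ < 1) (hδ₀0 : 0 < δ₀) (hδ₀1 : δ₀ < 1)
    {f : V3 → ℝ} (hf : ContDiffOn ℝ 4 f (SQ b₀)) {M : ℝ} (hM : 0 ≤ M)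
    (hfb : ∀ j ≤ 4, ∀ y ∈ SQ b₀, rx y ^ (j + 2) * ‖iteratedFDerivWithin ℝ j f (SQ b₀) y‖ ≤ M * rho δ δ₀ (rx y))
    (hfh : ∀ x ∈ SQ b₀, ∀ y ∈ SQ b₀, min (rx x) (rx y) ^ 6 * min (rx x) (rx y) ^ α *
        ‖iteratedFDerivWithin ℝ 4 f (SQ b₀) x - iteratedFDerivWithin ℝ 4 f (SQ b₀) y‖ ≤ M * rho δ δ₀ (min (rx x) (rx y)) * dist x y ^ α)
    {V : ℝ → ℝ → ℝ → ℝ} (hV : Approx (muW b₀) (arctan b₀) V (fun t θ z => exp (2 * t) * gsrc b₀ f t θ z)) {C : ℝ} (hC : 0 ≤ C)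
    (hV1 : ∀ t θ z, 0 ≤ t → |V t θ z| ≤ C * exp (δ₀ * t)) (hV2 : ∀ t θ z, t ≤ 0 → |V t θ z| ≤ C)
    (hV3 : ∀ t0 z0, t0 ≤ 0 → ∃ a b, ∀ t θ z, |t - t0| ≤ 1 → |z - z0| ≤ exp t0 →
        |V t θ z - a - b * (z - z0)| ≤ C * exp ((1 + δ) * t0)) : ∃ C', Good b₀ α δ δ₀ C' f (pol V) := by
  obtain ⟨C1, hC1, core⟩ := core1 (δ := δ) (δ₀ := δ₀) hb hα0 hα1 hδ0 hδ1 hδ₀0 hδ₀1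
  have hu := sq_unique hb
  have hcR := cR_pos b₀ hb
  have hcR' := cR_le b₀
  have key : ∀ p ∈ SQ b₀, ∃ a b, (1 ≤ rx p → b = 0) ∧ ∀ y ∈ ball p (rx p * (1/2)), |pol V y - aff a b (p 1) y| ≤ 4 * (C + M) * rho δ δ₀ (rx p) := by
    intro p hp
    have hHP := sq_HP hb hp
    have r0 := hp_rx hHP
    have eT := exp_tt hHP
    have rp := rho_pos (δ := δ) (δ₀ := δ₀) r0
    have near : ∀ y ∈ ball p (rx p * (1/2)), y ∈ HP ∧ |Tt y - Tt p| ≤ 1 ∧ |y 1 - p 1| ≤ exp (Tt p) ∧ rx y ≤ 2 * rx p := fun y hy => by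
      have hy' : y ∈ HP := ball_HP hb hp (ball_subset_ball (by linarith) hy)
      have hd : dist y p < rx p * (1/2) := hy
      refine ⟨hy', tt_near hHP hy' hd.le, ?_, ?_⟩
      · rw [eT]
        have : |(y - p) 1| ≤ ‖y - p‖ := by
          have := PiLp.norm_apply_le (y - p) (1 : Fin 3)
          rwa [norm_eq_abs] at this
        rw [← dist_eq_norm] at this
        simp only [PiLp.sub_apply] at this
        linarith
      · have := rx_lip y p; linarith
    rcases le_or_gt 1 (rx p) with h1 | h1
    · refine ⟨0, 0, fun _ => rfl, fun y hy => ?_⟩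
      obtain ⟨n1, n2, n3, n4⟩ := near y hy
      have e : pol V y - aff 0 0 (p 1) y = V (Tt y) (An y) (y 1) := by simp [aff, pol]
      rw [e]
      rcases le_or_gt 0 (Tt y) with ht | ht
      · refine (hV1 _ _ _ ht).trans ?_
        have ey := exp_tt n1
        have h1y : 1 ≤ rx y := by rw [← ey]; exact one_le_exp ht
        have : exp (δ₀ * Tt y) = rho δ δ₀ (rx y) := by
          rw [rho_large hδ0 hδ₀1 h1y, ← ey, ← exp_mul, mul_comm]
        rw [this]
        have := rho_two hδ0 hδ1 hδ₀0 hδ₀1 r0 (hp_rx n1) n4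
        nlinarith [mul_nonneg hM rp.le, mul_le_mul_of_nonneg_left this hC]
      · refine (hV2 _ _ _ ht.le).trans ?_
        have : 1 ≤ rho δ δ₀ (rx p) := by rw [rho_large hδ0 hδ₀1 h1]; exact one_le_rpow h1 hδ₀0.le
        nlinarith [mul_nonneg hM rp.le]
    · have ht : Tt p ≤ 0 := by
        by_contra h; push Not at h
        have := one_lt_exp_iff.2 h; linarith
      obtain ⟨a, b, hab⟩ := hV3 (Tt p) (p 1) ht
      refine ⟨a, b, fun h => by linarith, fun y hy => ?_⟩
      obtain ⟨n1, n2, n3, n4⟩ := near y hy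
      have e : pol V y - aff a b (p 1) y = V (Tt y) (An y) (y 1) - a - b * (y 1 - p 1) := by simp only [aff, pol]; ring
      rw [e]
      refine (hab _ _ _ n2 n3).trans ?_
      have : exp ((1 + δ) * Tt p) = rho δ δ₀ (rx p) := by
        rw [rho_small hδ0 hδ₀1 r0 h1.le, ← eT, ← exp_mul, mul_comm]
      rw [this]
      nlinarith [mul_nonneg hM rp.le, mul_nonneg hC rp.le]
  choose! a b hk1 hk2 using key
  have con := fun p (hp : p ∈ SQ b₀) => And.intro (hk1 p hp) (core f hf M hM hfb hfh V hV p hp (a p) (b p) _ (by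
    have rp := rho_pos (δ := δ) (δ₀ := δ₀) (hp_rx (sq_HP hb hp))
    nlinarith [mul_nonneg hC rp.le]) (hk2 p hp))
  have pb : ∀ p ∈ SQ b₀, p ∈ SQ b₀ ∩ ball p (cR b₀ * rx p) := fun p hp => ⟨hp, by
    have := hp_rx (sq_HP hb hp); simp; positivity⟩
  have hcd : ContDiffOn ℝ 6 (pol V) (SQ b₀) := by
    intro p hp
    obtain ⟨h1, c1, -⟩ := con p hp
    exact (c1 p (pb p hp)).mono_of_mem_nhdsWithin (inter_mem_nhdsWithin _ (isOpen_ball.mem_nhds (pb p hp).2))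
  have hdiff : ∀ p ∈ SQ b₀, DifferentiableAt ℝ (pol V) p := fun p hp => by
    obtain ⟨h1, -, -, -, c4, -⟩ := con p hp
    exact (c4.differentiableOn (by norm_num)).differentiableAt (isOpen_ball.mem_nhds (pb p hp).2)
  have hfw : ∀ p ∈ SQ b₀, fderivWithin ℝ (pol V) (SQ b₀) p = fderiv ℝ (pol V) p := fun p hp =>
    (hdiff p hp).fderivWithin (hu p hp)
  have htri : ∀ t θ z, V t (tri (muW b₀) (arctan b₀) θ) z = V t θ z := hV.tri (muW_pos b₀)
  set D := C1 * (4 * (C + M)) / cR b₀ ^ 7 with hD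
  have D0 : 0 ≤ D := by positivity
  have cv : ∀ (q r X ρ B : ℝ), cR b₀ ^ 7 ≤ q → 0 ≤ r → 0 ≤ X → 0 ≤ ρ → 0 ≤ B → q * r * X ≤ C1 * (4 * (C + M) * ρ) * B → r * X ≤ D * ρ * B := by
    intro q r X ρ B hq hr hX hρ hB h
    have : D * ρ * B = (C1 * (4 * (C + M) * ρ) * B) / cR b₀ ^ 7 := by rw [hD]; ring
    rw [this, le_div_iff₀ (by positivity)]
    refine le_trans ?_ h
    have := mul_le_mul_of_nonneg_right hq (mul_nonneg hr hX)
    linarith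
  have h28 : cR b₀ ≤ 1 := by linarith
  have ai : ∀ a b z (p : V3), p ∈ SQ b₀ → ∀ j, 2 ≤ j → j ≤ 6 → iteratedFDerivWithin ℝ j (fun y => pol V y - aff a b z y) (SQ b₀) p = iteratedFDerivWithin ℝ j (pol V) (SQ b₀) p := by
    intro a b z p hp j hj hj6
    have := iteratedFDerivWithin_sub_apply (i := j) (f := pol V) (g := aff a b z) ((hcd p hp).of_le (by exact_mod_cast hj6)) ((aff_cd a b z).contDiffOn p hp) hu hp
    have e : (fun y => pol V y - aff a b z y) = pol V - aff a b z := rfl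
    rw [e, this, aff_iter a b z hj hu hp, sub_zero]
  have v1 : ∀ p ∈ SQ b₀, 1 ≤ rx p → |pol V p| ≤ C * rho δ δ₀ (rx p) := fun p hp h => by
    have e := exp_tt (sq_HP hb hp)
    have ht : 0 ≤ Tt p := by rw [← one_le_exp_iff]; linarith
    have := hV1 (Tt p) (An p) (p 1) ht
    rw [rho_large hδ0 hδ₀1 h, ← e, ← exp_mul, mul_comm]; rw [mul_comm C] at this
    rwa [mul_comm δ₀] at this
  have v2 : ∀ p ∈ SQ b₀, rx p ≤ 1 → |pol V p| ≤ C := fun p hp h => by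
    have e := exp_tt (sq_HP hb hp)
    have ht : Tt p ≤ 0 := by rw [← exp_le_one_iff]; linarith
    exact hV2 (Tt p) (An p) (p 1) ht
  have CD : C ≤ D := by
    rw [hD, le_div_iff₀ (by positivity)]
    have : cR b₀ ^ 7 ≤ 1 := pow_le_one₀ hcR.le h28
    nlinarith [mul_nonneg (sub_nonneg.2 hC1) (add_nonneg hC hM), mul_nonneg hC (sub_nonneg.2 this)]
  refine ⟨D, ⟨D0, hcd, ?_, ?_, ?_, ?_, ?_, ?_, ?_, ?_⟩⟩
  · intro p hp
    obtain ⟨h1, -, -, -, -, c5⟩ := con p (wedge_sub hb hp)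
    exact c5
  · intro p hp h
    obtain ⟨φ, κ, hκ, ch1, ch2, ch3, -⟩ := chart hb hp
    obtain ⟨rfl, rfl⟩ := ch3 h
    have r0 := hp_rx (sq_HP hb hp)
    have := neu_gen (R := cR b₀ * rx p) (by positivity) (hdiff p hp) (ch2 V htri)
    have e : Rot (arctan b₀) (ee 2) = cos (arctan b₀) • (ee 2 - b₀ • ee 0) := by
      rw [Rot_apply]; apply ext3
      · rw [rotL0, th_sin]; simp [ee]; ring
      · rw [rotL1]; simp [ee]
      · rw [rotL2]; simp [ee]
    rw [e, map_smul, map_sub, map_smul] at this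
    have := (mul_eq_zero.1 this).resolve_left (th_cos b₀).ne'
    unfold pdW; rw [hfw p hp]
    simp only [smul_eq_mul] at this
    change b₀ * fderiv ℝ (pol V) p (ee 0) - fderiv ℝ (pol V) p (ee 2) = 0
    linarith
  · intro p hp h
    obtain ⟨φ, κ, hκ, ch1, ch2, -, ch3⟩ := chart hb hp
    obtain ⟨rfl, rfl⟩ := ch3 h
    have r0 := hp_rx (sq_HP hb hp)
    have := neu_gen (R := cR b₀ * rx p) (by positivity) (hdiff p hp) (ch2 V htri)
    have e : Rot (-(π/2)) (ee 2) = ee 0 := by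
      rw [Rot_apply]; apply ext3
      · rw [rotL0]; simp [ee]
      · rw [rotL1]; simp [ee]
      · rw [rotL2]; simp [ee]
    rw [e] at this
    unfold pdW; rw [hfw p hp]; exact this
  · intro p hp h
    have rp := rho_pos (δ := δ) (δ₀ := δ₀) (hp_rx (sq_HP hb hp))
    exact (v1 p hp h).trans (mul_le_mul_of_nonneg_right CD rp.le)
  · intro p hp h; exact (v2 p hp h).trans CD
  · intro p hp
    obtain ⟨h1, -, c2, -⟩ := con p hp
    refine ⟨b p, h1, ?_⟩
    have r0 := hp_rx (sq_HP hb hp)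
    have rp := rho_pos (δ := δ) (δ₀ := δ₀) r0
    have q := c2 1 (by norm_num) p (pb p hp)
    have q' : cR b₀ * rx p * ‖fderivWithin ℝ (pol V) (SQ b₀) p - b p • (EuclideanSpace.proj 1 : V3 →L[ℝ] ℝ)‖ ≤ C1 * (4 * (C + M) * rho δ δ₀ (rx p)) * 1 := by
      have q := c2 1 (by norm_num) p (pb p hp)
      have e1 : ‖iteratedFDerivWithin ℝ 1 (fun y => pol V y - aff (a p) (b p) (p 1) y) (SQ b₀) p‖ = ‖fderivWithin ℝ (fun y => pol V y - aff (a p) (b p) (p 1) y) (SQ b₀) p‖ :=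
        norm_iteratedFDerivWithin_one _ (hu p hp)
      have e2 : fderivWithin ℝ (fun y => pol V y - aff (a p) (b p) (p 1) y) (SQ b₀) p = fderivWithin ℝ (pol V) (SQ b₀) p - b p • (EuclideanSpace.proj 1 : V3 →L[ℝ] ℝ) := by
        rw [fderivWithin_fun_sub (hu p hp) (hdiff p hp).differentiableWithinAt (aff_fd (a p) (b p) _ p).differentiableAt.differentiableWithinAt,
          (aff_fd (a p) (b p) _ p).hasFDerivWithinAt.fderivWithin (hu p hp)]
      rw [e1, e2, pow_one] at q
      simpa using q
    have := cv (cR b₀) _ _ _ 1 (by simpa using pow_le_pow_of_le_one hcR.le h28 (show 1 ≤ 7 by norm_num)) r0.le (norm_nonneg _) rp.le zero_le_one q'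
    simpa using this
  · intro j hj hj6 p hp
    obtain ⟨h1, -, c2, -⟩ := con p hp
    have r0 := hp_rx (sq_HP hb hp)
    have rp := rho_pos (δ := δ) (δ₀ := δ₀) r0
    have q := c2 j hj6 p (pb p hp)
    rw [ai (a p) (b p) _ p hp j hj hj6, mul_pow, ← mul_one (C1 * _)] at q
    simpa using cv _ _ _ _ 1 (pow_le_pow_of_le_one hcR.le h28 (show j ≤ 7 by omega)) (by positivity) (norm_nonneg _) rp.le zero_le_one q
  · intro p hp y hy hd
    obtain ⟨h1, -, -, c3, -⟩ := con p hp
    have r0 := hp_rx (sq_HP hb hp)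
    have rp := rho_pos (δ := δ) (δ₀ := δ₀) r0
    have q := c3 y ⟨hy, hd⟩ p (pb p hp)
    rw [ai (a p) (b p) _ p hp 6 (by norm_num) le_rfl, ai (a p) (b p) _ y hy 6 (by norm_num) le_rfl, mul_pow, mul_rpow hcR.le r0.le] at q
    have e : cR b₀ ^ 6 * rx p ^ 6 * (cR b₀ ^ α * rx p ^ α) = (cR b₀ ^ 6 * cR b₀ ^ α) * (rx p ^ 6 * rx p ^ α) := by ring
    rw [e] at q
    refine cv _ _ _ _ _ ?_ (by positivity) (norm_nonneg _) rp.le (by positivity) q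
    have : cR b₀ ≤ cR b₀ ^ α := by
      have := rpow_le_rpow_of_exponent_ge hcR h28 hα1.le
      simpa using this
    rw [pow_succ]; gcongr

end

section
section
variable {b₀ α δ δ₀ C : ℝ} {f v : V3 → ℝ}

lemma Good.gb (hb : 0 < b₀) (hδ0 : 0 < δ) (hδ₀1 : δ₀ < 1) (G : Good b₀ α δ δ₀ C f v) {p : V3} (hp : p ∈ SQ b₀) (h1 : rx p ≤ 1) :
    ‖fderivWithin ℝ v (SQ b₀) p‖ ≤ C + C / δ := by
  have hu := sq_unique hb
  have C0 := G.C0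
  refine ContinuousLinearMap.opNorm_le_bound _ (by positivity) fun e => ?_
  have hHP := sq_HP hb hp
  have ma := an_mem hb hp
  have mem : ∀ t, PP t (An p) (p 1) ∈ SQ b₀ := fun t => PP_mem hb ma
  have hd : ContDiffOn ℝ 1 (fderivWithin ℝ v (SQ b₀)) (SQ b₀) := G.cd.fderivWithin hu (by norm_num)
  have hdd := hd.differentiableOn (by norm_num)
  have d1 : ∀ t, HasDerivAt (fun t => fderivWithin ℝ v (SQ b₀) (PP t (An p) (p 1)) e)
      ((fderivWithin ℝ (fderivWithin ℝ v (SQ b₀)) (SQ b₀) (PP t (An p) (p 1)) (PP t (An p) 0)) e) t := fun t => by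
    have h := (hdd _ (mem t)).hasFDerivWithinAt
    have h2 := h.comp_hasDerivWithinAt (s := univ) t (PP_deriv t (An p) (p 1)).hasDerivWithinAt (fun s _ => mem s)
    have h3 := h2.hasDerivAt univ_mem
    exact (h3.clm_apply (hasDerivAt_const t e)).congr_deriv (by simp)
  have d2 : ∀ t, HasDerivAt (fun t => C / δ * ‖e‖ * exp (δ * t)) (C * ‖e‖ * exp (δ * t)) t := fun t =>
    ((exp_hd δ t).const_mul (C / δ * ‖e‖)).congr_deriv (by field_simp)
  have bd : ∀ t, |(fderivWithin ℝ (fderivWithin ℝ v (SQ b₀)) (SQ b₀) (PP t (An p) (p 1)) (PP t (An p) 0)) e| ≤ C * ‖e‖ * exp (δ * t) := fun t => by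
    rw [← norm_eq_abs]
    refine (ContinuousLinearMap.le_opNorm _ _).trans ?_
    have q := G.iter 2 le_rfl (by norm_num) _ (mem t)
    rw [← norm_iteratedFDerivWithin_fderivWithin hu (mem t), norm_iteratedFDerivWithin_one _ (hu _ (mem t)), rx_PP] at q
    have r1 : rho δ δ₀ (exp t) ≤ exp t * exp (δ * t) := by
      refine (min_le_left _ _).trans ?_
      rw [← exp_mul, ← exp_add]; apply le_of_eq; congr 1; ring
    have q2 : exp t * ‖fderivWithin ℝ (fderivWithin ℝ v (SQ b₀)) (SQ b₀) (PP t (An p) (p 1))‖ ≤ C * exp (δ * t) := by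
      have h0 := exp_pos t
      refine le_of_mul_le_mul_left ?_ h0
      have := mul_le_mul_of_nonneg_left r1 C0
      nlinarith
    have q3 := (fderivWithin ℝ (fderivWithin ℝ v (SQ b₀)) (SQ b₀) (PP t (An p) (p 1))).le_opNorm (PP t (An p) 0)
    rw [PP_norm, mul_comm] at q3
    have := mul_le_mul_of_nonneg_right (q3.trans q2) (norm_nonneg e)
    linarith
  have ht : Tt p ≤ 0 := by rw [← exp_le_one_iff, exp_tt hHP]; exact h1
  have k := cmp_le d1 d2 bd ht
  rw [PP_pol hHP] at k
  simp only [mul_zero, exp_zero, mul_one] at k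
  have e1 : rx (PP 0 (An p) (p 1)) = 1 := by rw [rx_PP, exp_zero]
  obtain ⟨b, hb0, hb1⟩ := G.grad _ (mem 0)
  rw [hb0 e1.ge, e1, rho_large hδ0 hδ₀1 le_rfl] at hb1
  simp at hb1
  have k2 := (fderivWithin ℝ v (SQ b₀) (PP 0 (An p) (p 1))).le_opNorm e
  rw [norm_eq_abs] at k2 ⊢
  have k3 := mul_le_mul_of_nonneg_right hb1 (norm_nonneg e)
  have k4 : 0 ≤ C / δ * ‖e‖ * exp (δ * Tt p) := by positivity
  obtain ⟨a1, a2⟩ := abs_le.1 k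
  obtain ⟨a3, a4⟩ := abs_le.1 k2
  rw [abs_le]; constructor <;> nlinarith

lemma Good.lim (hb : 0 < b₀) (hδ0 : 0 < δ) (hδ₀1 : δ₀ < 1) (G : Good b₀ α δ δ₀ C f v) : ∃ c, Tendsto v (𝓝[SQ b₀] (0 : V3)) (𝓝 c) := by
  have C0 := G.C0
  have r1 : ∀ y ∈ ball (0:V3) 1, rx y ≤ 1 := fun y hy => by
    have := rx_lip y 0
    have h0 : rx (0:V3) = 0 := by simp [rx]
    have hy' : dist y 0 < 1 := hy
    linarith
  have hl : LipschitzOnWith (C + C / δ).toNNReal v (SQ b₀ ∩ ball 0 1) := by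
    refine ((sq_convex hb).inter (convex_ball _ _)).lipschitzOnWith_of_nnnorm_hasFDerivWithin_le (f' := fderivWithin ℝ v (SQ b₀)) (fun x hx => ?_) (fun x hx => ?_)
    · exact ((G.cd.differentiableOn (by norm_num) x hx.1).hasFDerivWithinAt).mono inter_subset_left
    · rw [← NNReal.coe_le_coe, Real.coe_toNNReal _ (by positivity)]
      exact G.gb hb hδ0 hδ₀1 hx.1 (r1 x hx.2)
  obtain ⟨g, hg, he⟩ := hl.extend_real
  refine ⟨g 0, ?_⟩
  have h1 : Tendsto g (𝓝[SQ b₀] (0 : V3)) (𝓝 (g 0)) := hg.continuous.continuousAt.mono_left inf_le_left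
  refine h1.congr' ?_
  filter_upwards [self_mem_nhdsWithin, mem_nhdsWithin_of_mem_nhds (ball_mem_nhds (0:V3) one_pos)] with y h1 h2 using (he ⟨h1, h2⟩).symm

lemma wt {r X C e : ℝ} {s : ℝ} (q : ℝ) (hr : 0 < r) (h : r ^ q * X ≤ C * r ^ e) (hs : s = q - e) : r ^ s * X ≤ C := by
  rw [hs, rpow_sub hr, div_mul_eq_mul_div, div_le_iff₀ (by positivity)]; exact h

lemma Good.hold1 (hb : 0 < b₀) (hα0 : 0 < α) (hα1 : α < 1) (hδ1 : δ < 1) (hδ₀1 : δ₀ < 1) (G : Good b₀ α δ δ₀ C f v) {p y : V3} (hp : p ∈ SQ b₀) (hy : y ∈ SQ b₀)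
    (h : rx p ≤ rx y) : rx p ^ 6 * rx p ^ α * ‖iteratedFDerivWithin ℝ 6 v (SQ b₀) y - iteratedFDerivWithin ℝ 6 v (SQ b₀) p‖ ≤ 2 * C / cR b₀ * rho δ δ₀ (rx p) * dist y p ^ α := by
  have C0 := G.C0
  have hcR := cR_pos b₀ hb
  have hcR' : cR b₀ ≤ 1 := by have := cR_le b₀; linarith
  have r0 := hp_rx (sq_HP hb hp)
  have ry := hp_rx (sq_HP hb hy)
  have rp := rho_pos (δ := δ) (δ₀ := δ₀) r0
  have CC : 2 * C ≤ 2 * C / cR b₀ := by rw [le_div_iff₀ hcR]; nlinarith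
  rcases lt_or_ge (dist y p) (cR b₀ * rx p) with hd | hd
  · refine (G.hold p hp y hy hd).trans ?_
    gcongr; linarith
  · have k1 := G.iter 6 (by norm_num) le_rfl p hp
    have k2 := G.iter 6 (by norm_num) le_rfl y hy
    have k3 := rho_scale (δ := δ) (δ₀ := δ₀) hδ1 hδ₀1 r0 h
    have k4 : rx p ^ 6 * ‖iteratedFDerivWithin ℝ 6 v (SQ b₀) y‖ ≤ C * rho δ δ₀ (rx p) := by
      have h1 : 1 ≤ rx y / rx p := by rw [le_div_iff₀ r0]; linarith
      have h2 : (rx y / rx p) ^ 2 ≤ (rx y / rx p) ^ 6 := pow_le_pow_right₀ h1 (by norm_num)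
      have h3 : rho δ δ₀ (rx y) ≤ (rx y / rx p) ^ 6 * rho δ δ₀ (rx p) := k3.trans (mul_le_mul_of_nonneg_right h2 rp.le)
      have h4 := k2.trans (mul_le_mul_of_nonneg_left h3 C0)
      rw [div_pow] at h4
      have h5 : C * (rx y ^ 6 / rx p ^ 6 * rho δ δ₀ (rx p)) = rx y ^ 6 * (C * rho δ δ₀ (rx p) / rx p ^ 6) := by ring
      rw [h5] at h4
      have h6 := le_of_mul_le_mul_left h4 (by positivity)
      rw [le_div_iff₀ (by positivity)] at h6
      linarith
    have k5 : rx p ^ 6 * ‖iteratedFDerivWithin ℝ 6 v (SQ b₀) y - iteratedFDerivWithin ℝ 6 v (SQ b₀) p‖ ≤ 2 * (C * rho δ δ₀ (rx p)) := by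
      have := mul_le_mul_of_nonneg_left (norm_sub_le (iteratedFDerivWithin ℝ 6 v (SQ b₀) y) (iteratedFDerivWithin ℝ 6 v (SQ b₀) p)) (show 0 ≤ rx p ^ 6 by positivity)
      linarith
    have k6 : cR b₀ * rx p ^ α ≤ dist y p ^ α := by
      refine le_trans ?_ (rpow_le_rpow (by positivity) hd hα0.le)
      rw [mul_rpow hcR.le r0.le]
      gcongr
      simpa using rpow_le_rpow_of_exponent_ge hcR hcR' hα1.le
    calc _ = (rx p ^ 6 * ‖iteratedFDerivWithin ℝ 6 v (SQ b₀) y - iteratedFDerivWithin ℝ 6 v (SQ b₀) p‖) * rx p ^ α := by ring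
      _ ≤ 2 * (C * rho δ δ₀ (rx p)) * rx p ^ α := by gcongr
      _ = 2 * C / cR b₀ * rho δ δ₀ (rx p) * (cR b₀ * rx p ^ α) := by field_simp
      _ ≤ _ := by gcongr

lemma Good.hold2 (hb : 0 < b₀) (hα0 : 0 < α) (hα1 : α < 1) (hδ1 : δ < 1) (hδ₀1 : δ₀ < 1) (G : Good b₀ α δ δ₀ C f v) {x y : V3} (hx : x ∈ SQ b₀) (hy : y ∈ SQ b₀) :
    min (rx x) (rx y) ^ 6 * min (rx x) (rx y) ^ α * ‖iteratedFDerivWithin ℝ 6 v (SQ b₀) x - iteratedFDerivWithin ℝ 6 v (SQ b₀) y‖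
      ≤ 2 * C / cR b₀ * rho δ δ₀ (min (rx x) (rx y)) * ‖x - y‖ ^ α := by
  rcases le_total (rx x) (rx y) with h | h
  · have e1 : ‖iteratedFDerivWithin ℝ 6 v (SQ b₀) x - iteratedFDerivWithin ℝ 6 v (SQ b₀) y‖ = ‖iteratedFDerivWithin ℝ 6 v (SQ b₀) y - iteratedFDerivWithin ℝ 6 v (SQ b₀) x‖ := norm_sub_rev _ _
    have e2 : ‖x - y‖ = dist y x := by rw [dist_comm, dist_eq_norm]
    rw [min_eq_left h, e1, e2]
    exact G.hold1 hb hα0 hα1 hδ1 hδ₀1 hx hy h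
  · have e2 : ‖x - y‖ = dist x y := (dist_eq_norm _ _).symm
    rw [min_eq_right h, e2]
    exact G.hold1 hb hα0 hα1 hδ1 hδ₀1 hy hx h

lemma Good.gb2 (hb : 0 < b₀) (G : Good b₀ α δ δ₀ C f v) {p : V3} (hp : p ∈ SQ b₀) (h1 : 1 ≤ rx p) :
    rx p * ‖fderivWithin ℝ v (SQ b₀) p‖ ≤ C * rho δ δ₀ (rx p) := by
  obtain ⟨b, h, h'⟩ := G.grad p hp
  rw [h h1] at h'
  simpa using h'

lemma Good.memH (hb : 0 < b₀) (hα0 : 0 < α) (hα1 : α < 1) (hδ0 : 0 < δ) (hδ1 : δ < 1) (hδ₀0 : 0 < δ₀) (hδ₀1 : δ₀ < 1) (G : Good b₀ α δ δ₀ C f v) :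
    memH (SQ b₀) 6 α (-1 - δ) (-δ₀) (wedgeQ b₀) v := by
  have C0 := G.C0
  have hcR := cR_pos b₀ hb
  have hcR' : cR b₀ ≤ 1 := by have := cR_le b₀; linarith
  have hu := sq_unique hb
  have CC : 2 * C ≤ 2 * C / cR b₀ := by rw [le_div_iff₀ hcR]; nlinarith
  have CD : 0 ≤ C / δ := by positivity
  have up : C + C / δ ≤ 2 * C / cR b₀ + C / δ := by linarith
  have up' : C ≤ 2 * C / cR b₀ + C / δ := by linarith
  have ws := wedge_sub hb
  refine ⟨G.cd, 2 * C / cR b₀ + C / δ, by positivity, ⟨?_, ?_⟩, ?_, ?_⟩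
  · intro j hj x hx h0 h1
    rcases Nat.lt_or_ge j 2 with hj2 | hj2
    · interval_cases j
      · rw [max_eq_right (by norm_num; linarith)]
        simp only [rpow_zero, one_mul, norm_iteratedFDerivWithin_zero]
        exact (G.val' x (ws hx) h1.le).trans up'
      · rw [max_eq_right (by norm_num; linarith)]
        simp only [rpow_zero, one_mul]
        rw [norm_iteratedFDerivWithin_one _ (hu x (ws hx))]
        exact (G.gb hb hδ0 hδ₀1 (ws hx) h1.le).trans up
    · have hj2' : (2:ℝ) ≤ j := by exact_mod_cast hj2
      rw [max_eq_left (by linarith)]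
      have := G.iter j hj2 hj x (ws hx)
      rw [rho_small hδ0 hδ₀1 h0 h1.le, ← rpow_natCast] at this
      exact (wt j h0 this (by ring)).trans up'
  · intro j hj x hx h1
    have h0 : 0 < rx x := by linarith
    have : rx x ^ (j:ℝ) * ‖iteratedFDerivWithin ℝ j v (SQ b₀) x‖ ≤ C * rx x ^ δ₀ := by
      rw [← rho_large hδ0 hδ₀1 h1.le, rpow_natCast]
      rcases Nat.lt_or_ge j 2 with hj2 | hj2
      · interval_cases j
        · rw [norm_iteratedFDerivWithin_zero, pow_zero, one_mul]; exact G.val x (ws hx) h1.le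
        · rw [norm_iteratedFDerivWithin_one _ (hu x (ws hx)), pow_one]
          exact G.gb2 hb (ws hx) h1.le
      · exact G.iter j hj2 hj x (ws hx)
    exact (wt j h0 this (by ring)).trans up'
  · intro x hx y hy h0 h1
    have := G.hold2 hb hα0 hα1 hδ1 hδ₀1 (ws hx) (ws hy)
    rw [max_eq_left (by push_cast; linarith)]
    have up2 : 2 * C / cR b₀ * ‖x - y‖ ^ α ≤ (2 * C / cR b₀ + C / δ) * ‖x - y‖ ^ α := by gcongr; linarith
    refine le_trans ?_ up2
    rw [rho_small hδ0 hδ₀1 h0 h1.le, ← rpow_natCast, ← rpow_add h0] at this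
    refine wt (6 + α) h0 (e := 1 + δ) ?_ (by push_cast; ring)
    push_cast at this
    linarith
  · intro x hx y hy h1
    have h0 : 0 < min (rx x) (rx y) := by linarith
    have := G.hold2 hb hα0 hα1 hδ1 hδ₀1 (ws hx) (ws hy)
    have up2 : 2 * C / cR b₀ * ‖x - y‖ ^ α ≤ (2 * C / cR b₀ + C / δ) * ‖x - y‖ ^ α := by gcongr; linarith
    refine le_trans ?_ up2
    rw [rho_large hδ0 hδ₀1 h1.le, ← rpow_natCast, ← rpow_add h0] at this
    refine wt (6 + α) h0 (e := δ₀) ?_ (by push_cast; ring)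
    push_cast at this
    linarith

lemma lapW_lapl (hb : 0 < b₀) {y : V3} (hy : y ∈ wedgeQ b₀) (u : V3 → ℝ) : lapW (SQ b₀) u y = lapl u y := by
  unfold lapW lapl
  refine Finset.sum_congr rfl fun i _ => ?_
  unfold pdW
  rw [fderivWithin_of_mem_nhds (sq_nhds hb hy)]
  have : (fun x => fderivWithin ℝ u (SQ b₀) x (EuclideanSpace.single i 1)) =ᶠ[𝓝 y] fun x => fderiv ℝ u x (ee i) := by
    filter_upwards [(wedge_open b₀).mem_nhds hy] with x hx
    rw [fderivWithin_of_mem_nhds (sq_nhds hb hx)]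
  rw [this.fderiv_eq]

lemma Good.grad0 (hb : 0 < b₀) (hδ0 : 0 < δ) (hδ₀1 : δ₀ < 1) (G : Good b₀ α δ δ₀ C f v) (ε : ℝ) (hε : 0 < ε) :
    ∃ R : ℝ, ∀ y ∈ wedgeQ b₀, R < rx y → ‖fderivWithin ℝ v (SQ b₀) y‖ < ε := by
  have C0 := G.C0
  have : Tendsto (fun r : ℝ => C * r ^ (-(1 - δ₀))) atTop (𝓝 (C * 0)) := (tendsto_rpow_neg_atTop (by linarith)).const_mul C
  rw [mul_zero] at this
  obtain ⟨R, hR⟩ := (this.eventually (gt_mem_nhds hε)).exists_forall_of_atTop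
  refine ⟨max R 1, fun y hy h => ?_⟩
  have h1 : 1 < rx y := (le_max_right _ _).trans_lt h
  have h0 : 0 < rx y := by linarith
  have k := G.gb2 hb (wedge_sub hb hy) h1.le
  rw [rho_large hδ0 hδ₀1 h1.le] at k
  have k2 := hR (rx y) ((le_max_left _ _).trans h.le)
  refine lt_of_le_of_lt ?_ k2
  have e : -(1 - δ₀) = δ₀ - 1 := by ring
  rw [e, rpow_sub h0, rpow_one, mul_div_assoc', le_div_iff₀ h0]
  linarith

end

theorem existence {b₀ α δ δ₀ : ℝ} (hb : 0 < b₀) (hα0 : 0 < α) (hα1 : α < 1) (hδ0 : 0 < δ) (hδ1 : δ < 1) (hδ₀0 : 0 < δ₀) (hδ₀1 : δ₀ < 1)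
    {f : V3 → ℝ} (hf : memH (SQ b₀) 4 α (1 - δ) (2 - δ₀) (wedgeQ b₀) f) (hfper : Per2On (closure (wedgeQ b₀)) f) :
    ∃ v : V3 → ℝ, memH (SQ b₀) 6 α (-1 - δ) (-δ₀) (wedgeQ b₀) v ∧ IsWedgeSolution b₀ f v := by
  obtain ⟨M, hM, hfb, hfh⟩ := source_bounds hb hα0 hδ0 hδ1 hδ₀0 hδ₀1 hf
  have hf4 : ContDiffOn ℝ 4 f (SQ b₀) := hf.1
  obtain ⟨V, hV, C, hC, hV1, hV2, hV3⟩ := wedge_V hb hα0 hδ0 hδ1 hδ₀0 hδ₀1 hf4 hfper hM hfb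
  obtain ⟨C', G⟩ := good_of hb hα0 hα1 hδ0 hδ1 hδ₀0 hδ₀1 hf4 hM hfb hfh hV hC hV1 hV2 hV3
  obtain ⟨c, hc⟩ := G.lim hb hδ0 hδ₀1
  have hA : Approx (muW b₀) (arctan b₀) (fun t θ z => -c) (fun t θ z => 0) := fun ε hε L => ⟨SD.const (-c), fun t θ z _ => by
    rw [SD.const_V, SD.const_G]; simp [hε.le]⟩
  have hV' := hV.add hA
  simp only [add_zero] at hV'
  obtain ⟨C'', G'⟩ := good_of hb hα0 hα1 hδ0 hδ1 hδ₀0 hδ₀1 hf4 hM hfb hfh hV' (C := C + |c|) (by positivity) (fun t θ z ht => by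
      have h1 := hV1 t θ z ht
      have h2 : 1 ≤ exp (δ₀ * t) := one_le_exp (by positivity)
      have h3 := abs_add_le (V t θ z) (-c)
      rw [abs_neg] at h3
      nlinarith [abs_nonneg c]) (fun t θ z ht => by
      have h1 := hV2 t θ z ht
      have h3 := abs_add_le (V t θ z) (-c)
      rw [abs_neg] at h3
      linarith) (fun t0 z0 ht0 => by
      obtain ⟨a, b, hab⟩ := hV3 t0 z0 ht0
      refine ⟨a - c, b, fun t θ z h1 h2 => ?_⟩
      have h := hab t θ z h1 h2
      have e : V t θ z + -c - (a - c) - b * (z - z0) = V t θ z - a - b * (z - z0) := by ring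
      rw [e]
      have := mul_nonneg (abs_nonneg c) (exp_pos ((1 + δ) * t0)).le
      linarith)
  refine ⟨_, G'.memH hb hα0 hα1 hδ0 hδ1 hδ₀0 hδ₀1, fun y hy => ?_, G'.neu1, G'.neu2, fun y hy => ?_, ?_, G'.grad0 hb hδ0 hδ₀1⟩
  · rw [lapW_lapl hb hy]; exact G'.lap y hy
  · have e1 : Tt (y + EuclideanSpace.single 1 (2 * π)) = Tt y := by simp [Tt]
    have e2 : An (y + EuclideanSpace.single 1 (2 * π)) = An y := by simp [An]
    have e3 : (y + EuclideanSpace.single 1 (2 * π) : V3) 1 = y 1 + 2 * π := by simp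
    unfold pol; rw [e1, e2, e3]; exact hV'.per _ _ _
  · have h : Tendsto (fun y => pol V y + -c) (𝓝[SQ b₀] (0 : V3)) (𝓝 (c + -c)) := hc.add_const (-c)
    rw [add_neg_cancel] at h
    exact h

end

section
lemma ev_diff {u : V3 → ℝ} {p : V3} (h : ContDiffAt ℝ 2 u p) : ∀ᶠ y in 𝓝 p, DifferentiableAt ℝ u y := by
  have := h.eventually (by norm_num)
  filter_upwards [this] with y hy using hy.differentiableAt (by norm_num)

lemma dir_diff {u : V3 → ℝ} {p : V3} (h : ContDiffAt ℝ 2 u p) (e : V3) : DifferentiableAt ℝ (fun y => fderiv ℝ u y e) p := by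
  have hd : DifferentiableAt ℝ (fderiv ℝ u) p := (h.fderiv_right (m := 1) (by norm_num)).differentiableAt (by norm_num)
  exact hd.clm_apply (differentiableAt_const _)

lemma lapl_comb {u v : V3 → ℝ} {p : V3} (hu : ContDiffAt ℝ 2 u p) (hv : ContDiffAt ℝ 2 v p) (a c : ℝ) :
    lapl (fun y => u y + a * v y + c) p = lapl u p + a * lapl v p := by
  unfold lapl
  rw [Finset.mul_sum, ← Finset.sum_add_distrib]
  refine Finset.sum_congr rfl fun i _ => ?_
  have e : (fun y => fderiv ℝ (fun y => u y + a * v y + c) y (ee i)) =ᶠ[𝓝 p] fun y => fderiv ℝ u y (ee i) + a * fderiv ℝ v y (ee i) := by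
    filter_upwards [ev_diff hu, ev_diff hv] with y h1 h2
    have := ((h1.hasFDerivAt.add (h2.hasFDerivAt.const_mul a)).add_const c).fderiv
    have e2 : (fun y => u y + a * v y + c) = fun y => (u + fun y => a * v y) y + c := rfl
    rw [e2, this]; simp
  rw [e.fderiv_eq]
  have := ((dir_diff hu (ee i)).hasFDerivAt.add ((dir_diff hv (ee i)).hasFDerivAt.const_mul a)).fderiv
  have e2 : (fun y => fderiv ℝ u y (ee i) + a * fderiv ℝ v y (ee i)) = (fun y => fderiv ℝ u y (ee i)) + fun y => a * fderiv ℝ v y (ee i) := rfl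
  rw [e2, this]; simp

lemma lapl_nonpos {u : V3 → ℝ} {p : V3} (hu : ContDiffAt ℝ 2 u p) (hm : IsLocalMax u p) : lapl u p ≤ 0 := by
  unfold lapl
  refine Finset.sum_nonpos fun i _ => ?_
  set e := ee i
  have hl : ∀ s : ℝ, HasDerivAt (fun s : ℝ => p + s • e) e s := fun s => by
    simpa using ((hasDerivAt_id s).smul_const e).const_add p
  have tl : Tendsto (fun s : ℝ => p + s • e) (𝓝 0) (𝓝 p) := by
    have := (hl 0).continuousAt.tendsto
    simpa using this
  have d1 : ∀ᶠ s in 𝓝 (0:ℝ), deriv (fun s : ℝ => u (p + s • e)) s = fderiv ℝ u (p + s • e) e := by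
    filter_upwards [tl.eventually (ev_diff hu)] with s hs
    exact (hs.hasFDerivAt.comp_hasDerivAt s (hl s)).deriv
  have d2 : HasDerivAt (fun s : ℝ => fderiv ℝ u (p + s • e) e) (fderiv ℝ (fun y => fderiv ℝ u y e) p e) 0 := by
    have h : HasFDerivAt (fun y => fderiv ℝ u y e) (fderiv ℝ (fun y => fderiv ℝ u y e) p) (p + (0:ℝ) • e) := by
      simpa using (dir_diff hu e).hasFDerivAt
    exact h.comp_hasDerivAt 0 (hl 0)
  have dd : deriv (deriv (fun s : ℝ => u (p + s • e))) 0 = fderiv ℝ (fun y => fderiv ℝ u y e) p e := by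
    rw [Filter.EventuallyEq.deriv_eq d1]; exact d2.deriv
  have lm : IsLocalMax (fun s : ℝ => u (p + s • e)) 0 := by
    have := tl.eventually hm
    filter_upwards [this] with s hs; simpa using hs
  by_contra hc
  push Not at hc
  have hcont : ContinuousAt (fun s : ℝ => u (p + s • e)) 0 := by
    have : ContinuousAt u (p + (0:ℝ) • e) := by simpa using hu.continuousAt
    exact ContinuousAt.comp (f := fun s : ℝ => p + s • e) this (hl 0).continuousAt
  have mn : IsLocalMin (fun s : ℝ => u (p + s • e)) 0 := isLocalMin_of_deriv_deriv_pos (by rw [dd]; exact hc) lm.deriv_eq_zero hcont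
  have cst : (fun s : ℝ => u (p + s • e)) =ᶠ[𝓝 0] fun _ => u (p + (0:ℝ) • e) := by
    filter_upwards [lm, mn] with s h1 h2 using le_antisymm h1 h2
  have z : deriv (deriv (fun s : ℝ => u (p + s • e))) 0 = 0 := by
    rw [cst.deriv.deriv_eq]; simp
  linarith

lemma face_nonpos {b₀ : ℝ} (hb : 0 < b₀) {u : V3 → ℝ} {p d : V3} {D : V3 →L[ℝ] ℝ} (hu : HasFDerivWithinAt u D (SQ b₀) p) (hp : p ∈ SQ b₀)
    (hd : p + d ∈ SQ b₀) (hm : IsLocalMaxOn u (SQ b₀) p) : D d ≤ 0 :=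
  hm.hasFDerivWithinAt_nonpos hu (mem_posTangentConeAt_of_segment_subset ((sq_convex hb).segment_subset hp hd))

lemma per_shift {b₀ : ℝ} (hb : 0 < b₀) {y : V3} (h : ℝ) : y + h • ee 1 ∈ SQ b₀ ↔ y ∈ SQ b₀ := by
  rw [mem_SQ hb, mem_SQ hb]; simp [line1]

/-- attaining a positive maximum -/
lemma attain {b₀ : ℝ} (hb : 0 < b₀) {Φ : V3 → ℝ} (hc : ContinuousOn Φ (SQ b₀)) (hper : ∀ y ∈ SQ b₀, Φ (y + (2 * π) • ee 1) = Φ y)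
    {r1 R : ℝ} (h1 : 0 < r1) (hs : ∀ y ∈ SQ b₀, rx y < r1 → Φ y ≤ 0) (hR : ∀ y ∈ SQ b₀, rx y = R → Φ y ≤ 0)
    {x : V3} (hx : x ∈ SQ b₀) (hxR : rx x ≤ R) (hpos : 0 < Φ x) :
    ∃ p ∈ SQ b₀, 0 < Φ p ∧ IsLocalMaxOn Φ (SQ b₀) p := by
  have r0 := hp_rx (sq_HP hb hx)
  have R0 : 0 < R := by linarith
  set K : Set (ℝ × ℝ × ℝ) := Icc (log r1) (log R) ×ˢ (Icc (arctan b₀) (π/2) ×ˢ Icc 0 (2 * π)) with hK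
  have cK : IsCompact K := isCompact_Icc.prod (isCompact_Icc.prod isCompact_Icc)
  have mK : ∀ q ∈ K, PP q.1 q.2.1 q.2.2 ∈ SQ b₀ := fun q hq => PP_mem hb hq.2.1
  have cc : ContinuousOn (fun q : ℝ × ℝ × ℝ => Φ (PP q.1 q.2.1 q.2.2)) K := hc.comp PP_cont.continuousOn mK
  -- every point of SQ with r1 ≤ r ≤ R has a representative
  have rep : ∀ y ∈ SQ b₀, r1 ≤ rx y → rx y ≤ R → ∃ q ∈ K, Φ (PP q.1 q.2.1 q.2.2) = Φ y := fun y hy h1y hyR => by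
    have hy' := sq_HP hb hy
    have ey := exp_tt hy'
    have pf : Function.Periodic (fun z => Φ (PP (Tt y) (An y) z)) (2 * π) := fun z => by
      have := hper (PP (Tt y) (An y) z) (PP_mem hb (an_mem hb hy))
      have e : PP (Tt y) (An y) (z + 2 * π) = PP (Tt y) (An y) z + (2 * π) • ee 1 := by
        apply ext3 <;> simp [PP0, PP1, PP2, line1]
      beta_reduce
      rw [e, this]
    obtain ⟨z, hz, hz2⟩ := pf.exists_mem_Ico₀ (by positivity) (y 1)
    refine ⟨(Tt y, An y, z), ⟨⟨?_, ?_⟩, an_mem hb hy, hz.1, hz.2.le⟩, ?_⟩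
    · rw [log_le_iff_le_exp h1]; simpa [ey] using h1y
    · rw [le_log_iff_exp_le R0]; simpa [ey] using hyR
    · beta_reduce at hz2; rw [← hz2, PP_pol hy']
  have hx1 : r1 ≤ rx x := by by_contra h; push Not at h; linarith [hs x hx h]
  obtain ⟨q0, hq0, eq0⟩ := rep x hx hx1 hxR
  obtain ⟨q, hq, hmax⟩ := cK.exists_isMaxOn ⟨q0, hq0⟩ cc
  have hpq : 0 < Φ (PP q.1 q.2.1 q.2.2) := by
    have := hmax hq0
    simp only [mem_setOf_eq] at this
    rw [eq0] at this; linarith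
  refine ⟨_, mK q hq, hpq, ?_⟩
  have rq : rx (PP q.1 q.2.1 q.2.2) < R := by
    refine lt_of_le_of_ne ?_ fun h => ?_
    · rw [rx_PP, ← le_log_iff_exp_le R0]; exact hq.1.2
    · linarith [hR _ (mK q hq) h]
  have : ∀ᶠ y in 𝓝[SQ b₀] (PP q.1 q.2.1 q.2.2), rx y < R := mem_nhdsWithin_of_mem_nhds (rx_cont.continuousAt.eventually (gt_mem_nhds rq))
  filter_upwards [this, self_mem_nhdsWithin] with y hy1 hy
  rcases lt_or_ge (rx y) r1 with h | h
  · exact (hs y hy h).trans hpq.le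
  · obtain ⟨q', hq', eq'⟩ := rep y hy h hy1.le
    rw [← eq']; exact hmax hq'

end

section
variable {b₀ δ₀ C : ℝ} {w : V3 → ℝ}

lemma no_max (hb : 0 < b₀) {Φ : V3 → ℝ} (hc : ContDiffOn ℝ 2 Φ (SQ b₀)) (hper : ∀ y ∈ SQ b₀, Φ (y + (2 * π) • ee 1) = Φ y)
    (hl : ∀ y ∈ wedgeQ b₀, 0 < lapl Φ y) (hf : ∀ y ∈ SQ b₀, y ∉ wedgeQ b₀ → Φ y ≤ 0 ∨ ∃ d, y + d ∈ SQ b₀ ∧ 0 < fderivWithin ℝ Φ (SQ b₀) y d)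
    {r1 R : ℝ} (h1 : 0 < r1) (hs : ∀ y ∈ SQ b₀, rx y < r1 → Φ y ≤ 0) (hR : ∀ y ∈ SQ b₀, rx y = R → Φ y ≤ 0)
    {x : V3} (hx : x ∈ SQ b₀) (hxR : rx x ≤ R) : Φ x ≤ 0 := by
  by_contra hpos
  push Not at hpos
  obtain ⟨p, hp, hp0, hm⟩ := attain hb hc.continuousOn hper h1 hs hR hx hxR hpos
  by_cases hw : p ∈ wedgeQ b₀
  · have := lapl_nonpos (hc.contDiffAt (sq_nhds hb hw)) (hm.isLocalMax (sq_nhds hb hw))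
    linarith [hl p hw]
  · rcases hf p hp hw with h | ⟨d, hd, hd'⟩
    · linarith
    · have := face_nonpos hb ((hc.differentiableOn (by norm_num)) p hp).hasFDerivWithinAt hp hd hm
      linarith

/-- the homogeneous problem -/
structure HW (b₀ δ₀ C : ℝ) (w : V3 → ℝ) : Prop where
  cd : ContDiffOn ℝ 6 w (SQ b₀)
  lap : ∀ y ∈ wedgeQ b₀, lapl w y = 0
  n1 : ∀ y ∈ SQ b₀, y 2 = b₀ * y 0 → b₀ * fderivWithin ℝ w (SQ b₀) y (ee 0) - fderivWithin ℝ w (SQ b₀) y (ee 2) = 0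
  n2 : ∀ y ∈ SQ b₀, y 0 = 0 → fderivWithin ℝ w (SQ b₀) y (ee 0) = 0
  per : Per2On (closure (wedgeQ b₀)) w
  grad : ∀ y ∈ SQ b₀, ‖fderivWithin ℝ w (SQ b₀) y‖ ≤ C * min 1 (rx y ^ (δ₀ - 1))

lemma memH_grad {α δ : ℝ} (hb : 0 < b₀) (hδ0 : 0 < δ) {v : V3 → ℝ} (hv : memH (SQ b₀) 6 α (-1 - δ) (-δ₀) (wedgeQ b₀) v) (hδ₀1 : δ₀ < 1) :
    ∃ M, 0 ≤ M ∧ ∀ y ∈ SQ b₀, ‖fderivWithin ℝ v (SQ b₀) y‖ ≤ M * min 1 (rx y ^ (δ₀ - 1)) := by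
  obtain ⟨hc, M, hM, ⟨h1, h2⟩, -, -⟩ := hv
  refine ⟨M, hM, fun y hy => ?_⟩
  have hu := sq_unique hb
  have g : ∀ y ∈ wedgeQ b₀, rx y ≠ 1 → ‖fderivWithin ℝ v (SQ b₀) y‖ ≤ M * min 1 (rx y ^ (δ₀ - 1)) := by
    intro y hy hy1
    have hyS := wedge_sub hb hy
    have r0 := hp_rx (sq_HP hb hyS)
    rcases lt_or_gt_of_ne hy1 with h | h
    · have := h1 1 (by norm_num) y hy r0 h
      rw [max_eq_right (by push_cast; linarith), rpow_zero, one_mul, norm_iteratedFDerivWithin_one v (hu y hyS)] at this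
      rw [min_eq_left]
      · linarith
      · exact one_le_rpow_of_pos_of_le_one_of_nonpos r0 h.le (by linarith)
    · have := h2 1 (by norm_num) y hy h
      rw [norm_iteratedFDerivWithin_one v (hu y hyS)] at this
      rw [min_eq_right (rpow_le_one_of_one_le_of_nonpos h.le (by linarith))]
      have e : δ₀ - 1 = -(-δ₀ + (1:ℕ)) := by push_cast; ring
      rw [e, rpow_neg r0.le, ← div_eq_mul_inv, le_div_iff₀ (by positivity), mul_comm]
      exact this
  have t := gam_tendsto hb hy
  have tr : Tendsto (fun ε => rx (gam b₀ y ε)) (𝓝[>] 0) (𝓝 (rx y)) := (rx_cont.tendsto y).comp (t.mono_right nhdsWithin_le_nhds)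
  have r0 := hp_rx (sq_HP hb hy)
  have cD : ContinuousOn (fderivWithin ℝ v (SQ b₀)) (SQ b₀) := hc.continuousOn_fderivWithin hu (by norm_num)
  refine le_of_tendsto_of_tendsto (((cD y hy).tendsto.comp t).norm) (tendsto_const_nhds.mul (tendsto_const_nhds.min (tr.rpow_const (Or.inl r0.ne')))) ?_
  filter_upwards [gam_good hb hy] with ε hε using g _ hε.1 hε.2

lemma per_ee {f : V3 → ℝ} (hper : Per2On (closure (wedgeQ b₀)) f) {y : V3} (hy : y ∈ SQ b₀) : f (y + (2 * π) • ee 1) = f y := by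
  have := hper y hy.1
  convert this using 2
  ext i; fin_cases i <;> simp [ee]

lemma HW_of {α δ : ℝ} (hb : 0 < b₀) (hδ0 : 0 < δ) (hδ₀1 : δ₀ < 1) {f v₁ v₂ : V3 → ℝ} (h1 : memH (SQ b₀) 6 α (-1 - δ) (-δ₀) (wedgeQ b₀) v₁)
    (s1 : IsWedgeSolution b₀ f v₁) (h2 : memH (SQ b₀) 6 α (-1 - δ) (-δ₀) (wedgeQ b₀) v₂) (s2 : IsWedgeSolution b₀ f v₂) :
    ∃ C, 0 ≤ C ∧ HW b₀ δ₀ C (fun y => v₁ y + -1 * v₂ y + 0) := by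
  obtain ⟨M1, hM1, g1⟩ := memH_grad hb hδ0 h1 hδ₀1
  obtain ⟨M2, hM2, g2⟩ := memH_grad hb hδ0 h2 hδ₀1
  have d1 : ∀ y ∈ SQ b₀, DifferentiableWithinAt ℝ v₁ (SQ b₀) y := h1.1.differentiableOn (by norm_num)
  have d2 : ∀ y ∈ SQ b₀, DifferentiableWithinAt ℝ v₂ (SQ b₀) y := h2.1.differentiableOn (by norm_num)
  have fd : ∀ y ∈ SQ b₀, fderivWithin ℝ (fun y => v₁ y + -1 * v₂ y + 0) (SQ b₀) y = fderivWithin ℝ v₁ (SQ b₀) y - fderivWithin ℝ v₂ (SQ b₀) y := by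
    intro y hy
    have e : (fun y => v₁ y + -1 * v₂ y + 0) = fun y => v₁ y - v₂ y := by ext y; ring
    rw [e, fderivWithin_fun_sub (sq_unique hb y hy) (d1 y hy) (d2 y hy)]
  have hee : ∀ i, (ee i : V3) = EuclideanSpace.single i 1 := fun i => rfl
  obtain ⟨l1, a1, c1, p1, -, -⟩ := s1
  obtain ⟨l2, a2, c2, p2, -, -⟩ := s2
  refine ⟨M1 + M2, by positivity, ⟨?_, fun y hy => ?_, fun y hy h => ?_, fun y hy h => ?_, fun y hy => ?_, fun y hy => ?_⟩⟩
  · have a := h1.1; have b := h2.1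
    exact (a.add (contDiffOn_const.mul b)).add contDiffOn_const
  · rw [lapl_comb ((h1.1.contDiffAt (sq_nhds hb hy)).of_le (by norm_num)) ((h2.1.contDiffAt (sq_nhds hb hy)).of_le (by norm_num)),
      ← lapW_lapl hb hy, ← lapW_lapl hb hy, l1 y hy, l2 y hy]; ring
  · have x1 := a1 y hy h; have x2 := a2 y hy h
    unfold pdW at x1 x2
    rw [fd y hy, sub_apply, sub_apply, hee, hee]; linarith
  · have x1 := c1 y hy h; have x2 := c2 y hy h
    unfold pdW at x1 x2
    rw [fd y hy, sub_apply, hee]; linarith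
  · beta_reduce; rw [p1 y hy, p2 y hy]
  · rw [fd y hy]
    have := norm_sub_le (fderivWithin ℝ v₁ (SQ b₀) y) (fderivWithin ℝ v₂ (SQ b₀) y)
    linarith [g1 y hy, g2 y hy]

end

section
variable {b₀ δ₀ C : ℝ} {w : V3 → ℝ}

def BZ (b₀ : ℝ) (y : V3) : ℝ := -Tt y - (y 0 + 1) ^ 2 - (y 2 + b₀ + 1) ^ 2

lemma BZ_cd : ContDiffOn ℝ 2 (BZ b₀) HP := by
  have h := tt_cd (n := 2)
  unfold BZ
  refine (h.neg.sub ?_).sub ?_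
  · exact ContDiff.contDiffOn (by fun_prop)
  · exact ContDiff.contDiffOn (by fun_prop)

def gZ (b₀ : ℝ) (i : Fin 3) (y : V3) : ℝ := ![-PX y - 2 * (y 0 + 1), 0, -PZ y - 2 * (y 2 + b₀ + 1)] i

lemma dsq (a c : ℝ) : HasDerivAt (fun s : ℝ => (a + s + c) ^ 2) (2 * (a + c)) 0 := by
  have := (((hasDerivAt_id (0:ℝ)).const_add a).add_const c).fun_pow 2
  simpa using this
lemma dln (a c : ℝ) : HasDerivAt (fun s : ℝ => 2 * (a + s + c)) 2 0 := by
  have := (((hasDerivAt_id (0:ℝ)).const_add a).add_const c).const_mul 2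
  simpa using this

lemma dBZ (i : Fin 3) {y : V3} (hy : y ∈ HP) : HasDerivAt (fun s : ℝ => BZ b₀ (y + s • ee i)) (gZ b₀ i y) 0 := by
  fin_cases i
  · have := ((dT0 hy).fun_neg.fun_sub (dsq (y 0) 1)).fun_sub (hasDerivAt_const (0:ℝ) ((y 2 + b₀ + 1) ^ 2))
    simpa [BZ, gZ, line0] using this
  · have e : (fun s : ℝ => BZ b₀ (y + s • ee 1)) = fun _ => BZ b₀ y := by
      ext s; simp [BZ, Tt, line1]
    simp only [Fin.mk_one]
    rw [e]; simpa [gZ] using hasDerivAt_const (0:ℝ) (BZ b₀ y)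
  · have := ((dT2 hy).fun_neg.fun_sub (hasDerivAt_const (0:ℝ) ((y 0 + 1) ^ 2))).fun_sub (dsq (y 2) (b₀ + 1))
    simpa [BZ, gZ, line2, add_assoc] using this

lemma BZ_lapl {y : V3} (hy : y ∈ HP) : lapl (BZ b₀) y = -4 := by
  rw [lapl_lines hp_open BZ_cd (g := gZ b₀) (h := fun i y => ![-(PZ y ^ 2 - PX y ^ 2) - 2, 0, -(PX y ^ 2 - PZ y ^ 2) - 2] i) (fun i y hy => dBZ i hy) ?_ y hy]
  · simp [Fin.sum_univ_three]; ring
  · intro i y hy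
    fin_cases i
    · simpa [gZ, line0] using (dPX0 hy).fun_neg.fun_sub (dln (y 0) 1)
    · simpa [gZ] using hasDerivAt_const (0:ℝ) (0:ℝ)
    · simpa [gZ, line2, add_assoc] using (dPZ2 hy).fun_neg.fun_sub (dln (y 2) (b₀ + 1))

lemma BZ_fd (i : Fin 3) {y : V3} (hy : y ∈ HP) : fderiv ℝ (BZ b₀) y (ee i) = gZ b₀ i y :=
  fderiv_line ((BZ_cd.contDiffAt (hp_open.mem_nhds hy)).differentiableAt (by norm_num)) (dBZ i hy)

lemma lapl_shift (u : V3 → ℝ) (c y : V3) : lapl (fun y => u (y + c)) y = lapl u (y + c) := by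
  unfold lapl
  refine Finset.sum_congr rfl fun i _ => ?_
  have : (fun y => fderiv ℝ (fun y => u (y + c)) y (ee i)) = fun y => (fun z => fderiv ℝ u z (ee i)) (y + c) := by
    ext y; rw [fderiv_comp_add_right]
  rw [this, fderiv_comp_add_right (f := fun z => fderiv ℝ u z (ee i))]

lemma shift_wedge (y : V3) (h : ℝ) : y + h • ee 1 ∈ wedgeQ b₀ ↔ y ∈ wedgeQ b₀ := by
  unfold wedgeQ; simp [line1]
lemma shift_rx (y : V3) (h : ℝ) : rx (y + h • ee 1) = rx y := by unfold rx; simp [line1]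

lemma HW.fdS (H : HW b₀ δ₀ C w) (hb : 0 < b₀) {y : V3} (hy : y ∈ SQ b₀) (h : ℝ) :
    HasFDerivWithinAt (fun y => w (y + h • ee 1)) (fderivWithin ℝ w (SQ b₀) (y + h • ee 1)) (SQ b₀) y := by
  have h1 := ((H.cd.differentiableOn (by norm_num)) _ ((per_shift hb h).2 hy)).hasFDerivWithinAt
  have := h1.comp y ((hasFDerivWithinAt_id y (SQ b₀)).add_const (h • ee 1)) (fun z hz => (per_shift hb h).2 hz)
  exact this

lemma HW.zdiff (H : HW b₀ δ₀ C w) (hb : 0 < b₀) (hC : 0 ≤ C) {y : V3} (hy : y ∈ SQ b₀) (h : ℝ) :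
    |w y - w (y + h • ee 1)| ≤ C * min 1 (rx y ^ (δ₀ - 1)) * |h| := by
  have hd : ∀ s ∈ (univ : Set ℝ), HasDerivWithinAt (fun s : ℝ => w (y + s • ee 1)) (fderivWithin ℝ w (SQ b₀) (y + s • ee 1) (ee 1)) univ s := fun s _ => by
    have h1 := ((H.cd.differentiableOn (by norm_num)) _ ((per_shift hb s).2 hy)).hasFDerivWithinAt
    have l : HasDerivWithinAt (fun s : ℝ => y + s • ee 1) (ee 1) univ s := by
      simpa using ((hasDerivWithinAt_id s univ).smul_const (ee 1)).const_add y
    exact h1.comp_hasDerivWithinAt s l (fun z _ => (per_shift hb z).2 hy)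
  have := convex_univ.norm_image_sub_le_of_norm_hasDerivWithin_le (C := C * min 1 (rx y ^ (δ₀ - 1))) hd (fun s _ => ?_) (mem_univ h) (mem_univ 0)
  · simpa using this
  · have g := H.grad _ ((per_shift hb s).2 hy)
    rw [shift_rx] at g
    refine (ContinuousLinearMap.le_opNorm _ _).trans ?_
    have : ‖(ee 1 : V3)‖ = 1 := by simp [ee]
    rw [this, mul_one]; exact g

lemma HW.zle (H : HW b₀ δ₀ C w) (hb : 0 < b₀) (hC : 0 ≤ C) (hδ₀1 : δ₀ < 1) {x : V3} (hx : x ∈ SQ b₀) (h : ℝ) :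
    w x ≤ w (x + h • ee 1) := by
  by_contra hcon
  push Not at hcon
  obtain ⟨p, hp⟩ : ∃ p : V3 → ℝ, p = fun y => w y + -1 * w (y + h • ee 1) + 0 := ⟨_, rfl⟩
  have px : 0 < p x := by rw [hp]; beta_reduce; linarith
  obtain ⟨η, hη⟩ : ∃ η, η = p x / 2 := ⟨_, rfl⟩
  have η0 : 0 < η := by rw [hη]; linarith
  have pb : ∀ y ∈ SQ b₀, p y ≤ C * min 1 (rx y ^ (δ₀ - 1)) * |h| := fun y hy => by
    have := (le_abs_self _).trans (H.zdiff hb hC hy h)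
    rw [hp]; beta_reduce; linarith
  have tz : Tendsto (fun r : ℝ => C * r ^ (δ₀ - 1) * |h|) atTop (𝓝 0) := by
    have := tendsto_rpow_neg_atTop (y := 1 - δ₀) (by linarith)
    have := (this.const_mul C).mul_const |h|
    simpa using this
  obtain ⟨R, hR1, hR2, hR3⟩ : ∃ R : ℝ, 1 ≤ R ∧ rx x ≤ R ∧ C * R ^ (δ₀ - 1) * |h| < η :=
    ((eventually_ge_atTop (1:ℝ)).and ((eventually_ge_atTop (rx x)).and (tz.eventually_lt_const η0))).exists
  obtain ⟨K, hK⟩ : ∃ K, K = log R + (R + 1) ^ 2 + (R + b₀ + 1) ^ 2 := ⟨_, rfl⟩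
  have tR : ∀ y ∈ SQ b₀, Tt y = log (rx y) := fun y hy => by rw [← exp_tt (sq_HP hb hy), log_exp]
  have BK : ∀ y ∈ SQ b₀, rx y ≤ R → log R - log (rx y) ≤ BZ b₀ y + K := fun y hy hyR => by
    obtain ⟨y0, y1, y2⟩ := (mem_SQ hb).1 hy
    have e := rx_sq y
    have rn := rx_nonneg y
    have a0 : y 0 ≤ R := by nlinarith
    have a2 : y 2 ≤ R := by nlinarith
    have b0 : (y 0 + 1) ^ 2 ≤ (R + 1) ^ 2 := by gcongr
    have b2 : (y 2 + b₀ + 1) ^ 2 ≤ (R + b₀ + 1) ^ 2 := by gcongr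
    rw [hK, BZ, tR y hy]; linarith
  have BK0 : ∀ y ∈ SQ b₀, rx y ≤ R → 0 ≤ BZ b₀ y + K := fun y hy hyR => by
    have := log_le_log (hp_rx (sq_HP hb hy)) hyR
    linarith [BK y hy hyR]
  obtain ⟨ε, hε⟩ : ∃ ε, ε = η / (2 * (BZ b₀ x + K + 1)) := ⟨_, rfl⟩
  have x0 := BK0 x hx hR2
  have ε0 : 0 < ε := by rw [hε]; positivity
  have εx : ε * (BZ b₀ x + K) < η := by
    rw [hε, div_mul_eq_mul_div, div_lt_iff₀ (by positivity)]
    nlinarith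
  have dp : ∀ y ∈ SQ b₀, HasFDerivWithinAt p (fderivWithin ℝ w (SQ b₀) y - fderivWithin ℝ w (SQ b₀) (y + h • ee 1)) (SQ b₀) y := fun y hy => by
    have e : p = fun y => w y - w (y + h • ee 1) := by rw [hp]; ext y; ring
    rw [e]
    exact ((H.cd.differentiableOn (by norm_num)) y hy).hasFDerivWithinAt.fun_sub (H.fdS hb hy h)
  have cds : ContDiffOn ℝ 2 (fun y => w (y + h • ee 1)) (SQ b₀) :=
    (H.cd.of_le (by norm_num)).comp (contDiff_id.add contDiff_const).contDiffOn (fun z hz => (per_shift hb h).2 hz)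
  have cdw : ContDiffOn ℝ 2 w (SQ b₀) := H.cd.of_le (by norm_num)
  have cdp : ContDiffOn ℝ 2 p (SQ b₀) := by
    rw [hp]; exact (cdw.add (contDiffOn_const.mul cds)).add contDiffOn_const
  have cdB := (BZ_cd (b₀ := b₀)).mono (sq_HP hb)
  have cdΦ : ContDiffOn ℝ 2 (fun y => p y + (-ε) * BZ b₀ y + (-η - ε * K)) (SQ b₀) :=
    (cdp.add (contDiffOn_const.mul cdB)).add contDiffOn_const
  have fdΦ : ∀ y ∈ SQ b₀, ∀ d, fderivWithin ℝ (fun y => p y + (-ε) * BZ b₀ y + (-η - ε * K)) (SQ b₀) y d =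
      fderivWithin ℝ w (SQ b₀) y d - fderivWithin ℝ w (SQ b₀) (y + h • ee 1) d + (-ε) * fderiv ℝ (BZ b₀) y d := fun y hy d => by
    have hB := ((BZ_cd (b₀ := b₀)).contDiffAt (hp_open.mem_nhds (sq_HP hb hy))).differentiableAt (by norm_num) |>.hasFDerivAt.hasFDerivWithinAt (s := SQ b₀)
    have := (((dp y hy).fun_add (hB.const_mul (-ε))).add_const (-η - ε * K)).fderivWithin (sq_unique hb y hy)
    rw [this]; simp
  have key := no_max hb cdΦ (r1 := min 1 (exp (-(C * |h| / ε)))) (R := R) ?_ ?_ ?_ (by positivity) ?_ ?_ hx hR2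
  · have : p x = 2 * η := by rw [hη]; ring
    linarith
  · intro y hy
    have e1 : BZ b₀ (y + (2 * π) • ee 1) = BZ b₀ y := by simp [BZ, Tt, line1]
    have e2 : y + (2 * π) • ee 1 + h • ee 1 = (y + h • ee 1) + (2 * π) • ee 1 := by abel
    rw [e1, hp]; beta_reduce
    rw [e2, per_ee H.per hy, per_ee H.per ((per_shift hb h).2 hy)]
  · intro y hy
    have nb := sq_nhds hb hy
    rw [lapl_comb (cdp.contDiffAt nb) (cdB.contDiffAt nb), BZ_lapl (sq_HP hb (wedge_sub hb hy)), hp,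
      lapl_comb (cdw.contDiffAt nb) (cds.contDiffAt nb), lapl_shift, H.lap y hy, H.lap _ ((shift_wedge y h).2 hy)]
    linarith
  · intro y hy hyw
    right
    obtain ⟨y0, y1, y2⟩ := (mem_SQ hb).1 hy
    have hyP := sq_HP hb hy
    have hy' := (per_shift hb h).2 hy
    have l1 := line1 y h
    rcases y0.eq_or_lt with h0 | h0
    · refine ⟨(y 2 / b₀) • ee 0, ?_, ?_⟩
      · rw [mem_SQ hb]; simp only [line0]
        refine ⟨by positivity, ?_, y2⟩
        rw [← h0, zero_add, mul_div_cancel₀ _ hb.ne']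
      · rw [fdΦ y hy, map_smul, map_smul, map_smul, H.n2 y hy h0.symm, H.n2 _ hy' (by rw [l1.1, ← h0]), BZ_fd 0 hyP]
        simp only [gZ, PX, ← h0, smul_eq_mul]
        have : 0 < y 2 / b₀ * ε := by positivity
        simp; linarith
    · have hf : y 2 = b₀ * y 0 := by
        by_contra hne
        exact hyw ⟨h0, lt_of_le_of_ne y1 (Ne.symm hne)⟩
      have n1 := H.n1 y hy hf
      have n1' := H.n1 _ hy' (by rw [l1.1, l1.2.2, hf])
      refine ⟨(y 0 / b₀) • (ee 2 - b₀ • ee 0), ?_, ?_⟩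
      · rw [mem_SQ hb]; simp [ee]
        have e : y 0 / b₀ * b₀ = y 0 := div_mul_cancel₀ _ hb.ne'
        have : 0 < y 0 / b₀ := by positivity
        rw [e]
        refine ⟨le_rfl, by nlinarith, by linarith⟩
      · rw [fdΦ y hy]
        simp only [map_smul, map_sub, BZ_fd _ hyP]
        have : 0 < y 0 / b₀ * ε := by positivity
        have hz : PZ y = b₀ * PX y := by unfold PZ PX; rw [hf]; ring
        simp only [gZ, hz, smul_eq_mul]
        generalize fderivWithin ℝ w (SQ b₀) y = D1 at n1 ⊢
        generalize fderivWithin ℝ w (SQ b₀) (y + h • ee 1) = D2 at n1' ⊢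
        generalize y 0 / b₀ = t at this ⊢
        simp only [Matrix.cons_val_zero, Matrix.cons_val]
        rw [hf]
        refine lt_of_lt_of_eq (show 0 < 2 * (t * ε) by linarith) ?_
        linear_combination t * n1 - t * n1'
  · intro y hy hy1
    have r0 := hp_rx (sq_HP hb hy)
    have a1 : rx y < 1 := hy1.trans_le (min_le_left _ _)
    have a2 := log_lt_log r0 (hy1.trans_le (min_le_right _ _))
    rw [log_exp] at a2
    have b1 := BK y hy (by linarith)
    have b2 := log_nonneg hR1
    have b3 : C * |h| / ε ≤ BZ b₀ y + K := by linarith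
    rw [div_le_iff₀ ε0] at b3
    have b4 : C * min 1 (rx y ^ (δ₀ - 1)) * |h| ≤ C * 1 * |h| := by gcongr; exact min_le_left _ _
    linarith [pb y hy]
  · intro y hy hyR
    have b1 := mul_nonneg ε0.le (BK0 y hy hyR.le)
    have b4 : C * min 1 (rx y ^ (δ₀ - 1)) * |h| ≤ C * rx y ^ (δ₀ - 1) * |h| := by gcongr; exact min_le_right _ _
    rw [hyR] at b4
    have := pb y hy
    rw [hyR] at this
    linarith

lemma HW.zconst (H : HW b₀ δ₀ C w) (hb : 0 < b₀) (hC : 0 ≤ C) (hδ₀1 : δ₀ < 1) {y : V3} (hy : y ∈ wedgeQ b₀) : fderiv ℝ w y (ee 1) = 0 := by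
  have nb := sq_nhds hb hy
  refine fderiv_line ((H.cd.contDiffAt nb).differentiableAt (by norm_num)) ?_
  have hyS := wedge_sub hb hy
  have e : (fun s : ℝ => w (y + s • ee 1)) = fun _ => w y := by
    ext s
    have h1 := H.zle hb hC hδ₀1 hyS s
    have h2 := H.zle hb hC hδ₀1 ((per_shift hb s).2 hyS) (-s)
    have : y + s • ee 1 + (-s) • ee 1 = y := by simp
    rw [this] at h2
    exact le_antisymm h2 h1
  rw [e]; exact hasDerivAt_const _ _

end

section
variable {b₀ δ₀ C : ℝ} {w : V3 → ℝ}

lemma pd_cd {U : Set V3} (hU : IsOpen U) {n m : ℕ∞} (hw : ContDiffOn ℝ n w U) (h : m + 1 ≤ n) (i : Fin 3) : ContDiffOn ℝ m (fun y => fderiv ℝ w y (ee i)) U :=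
  (hw.fderiv_of_isOpen hU (m := m) (by exact_mod_cast h)).clm_apply contDiffOn_const

lemma harm_pd {U : Set V3} (hU : IsOpen U) (hw : ContDiffOn ℝ 3 w U) (h : ∀ y ∈ U, lapl w y = 0) {x : V3} (hx : x ∈ U) (i : Fin 3) :
    lapl (fun y => fderiv ℝ w y (ee i)) x = 0 := by
  have c2 : ∀ j, ContDiffOn ℝ 2 (fun y => fderiv ℝ w y (ee j)) U := fun j => pd_cd hU (n := 3) (m := 2) hw (by norm_num) j
  have c1 : ∀ j, ContDiffOn ℝ 1 (fun z => fderiv ℝ (fun y => fderiv ℝ w y (ee j)) z (ee j)) U := fun j => pd_cd hU (n := 2) (m := 1) (c2 j) (by norm_num) j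
  have hw2 : ContDiffOn ℝ 2 w U := hw.of_le (by norm_num)
  have e : lapl (fun y => fderiv ℝ w y (ee i)) x = ∑ j, fderiv ℝ (fun z => fderiv ℝ (fun y => fderiv ℝ w y (ee j)) z (ee j)) x (ee i) := by
    refine Finset.sum_congr rfl fun j _ => ?_
    rw [← pd_lapl_comm hU (c2 j) hx i j]
    have : (fun z => fderiv ℝ (fun y => fderiv ℝ w y (ee i)) z (ee j)) =ᶠ[𝓝 x] fun z => fderiv ℝ (fun y => fderiv ℝ w y (ee j)) z (ee i) := by
      filter_upwards [hU.mem_nhds hx] with z hz using pd_lapl_comm hU hw2 hz i j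
    rw [this.fderiv_eq]
  rw [e]
  have z : fderiv ℝ (lapl w) x = 0 := by
    have : lapl w =ᶠ[𝓝 x] fun _ => 0 := by filter_upwards [hU.mem_nhds hx] with z hz using h z hz
    rw [this.fderiv_eq]; simp
  have s : fderiv ℝ (lapl w) x = ∑ j, fderiv ℝ (fun z => fderiv ℝ (fun y => fderiv ℝ w y (ee j)) z (ee j)) x :=
    fderiv_fun_sum fun j _ => ((c1 j).contDiffAt (hU.mem_nhds hx)).differentiableAt (by norm_num)
  rw [z] at s
  have := congrArg (fun L => L (ee i)) s
  simpa using this.symm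

lemma coord_fd {g : V3 → ℝ} {x : V3} (hg : DifferentiableAt ℝ g x) (k i : Fin 3) :
    fderiv ℝ (fun y : V3 => y k * g y) x (ee i) = x k * fderiv ℝ g x (ee i) + (if k = i then g x else 0) := by
  have h1 : HasFDerivAt (fun y : V3 => y k) (EuclideanSpace.proj k : V3 →L[ℝ] ℝ) x := (EuclideanSpace.proj k : V3 →L[ℝ] ℝ).hasFDerivAt
  rw [(h1.fun_mul hg.hasFDerivAt).fderiv]
  by_cases h : k = i <;> simp [ee, h]

lemma lapl_coord {g : V3 → ℝ} {x : V3} (hg : ContDiffAt ℝ 2 g x) (k : Fin 3) :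
    lapl (fun y : V3 => y k * g y) x = x k * lapl g x + 2 * fderiv ℝ g x (ee k) := by
  have t : ∀ i, fderiv ℝ (fun z => fderiv ℝ (fun y : V3 => y k * g y) z (ee i)) x (ee i) =
      x k * fderiv ℝ (fun z => fderiv ℝ g z (ee i)) x (ee i) + (if k = i then 2 * fderiv ℝ g x (ee i) else 0) := fun i => by
    have e : (fun z => fderiv ℝ (fun y : V3 => y k * g y) z (ee i)) =ᶠ[𝓝 x] fun z => z k * fderiv ℝ g z (ee i) + (if k = i then g z else 0) := by
      filter_upwards [ev_diff hg] with z hz using coord_fd hz k i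
    have hd := dir_diff hg (ee i)
    rw [e.fderiv_eq]
    have hp : DifferentiableAt ℝ (fun z : V3 => z k * fderiv ℝ g z (ee i)) x :=
      (EuclideanSpace.proj k : V3 →L[ℝ] ℝ).differentiableAt.mul hd
    by_cases h : k = i
    · simp only [h, if_true] at hp ⊢
      rw [fderiv_fun_add hp (hg.differentiableAt (by norm_num)), add_apply, coord_fd hd]
      simp; ring
    · simp only [h, if_false, add_zero]
      rw [coord_fd hd]; simp [h]
  unfold lapl
  rw [Finset.sum_congr rfl fun i _ => t i, Finset.sum_add_distrib, ← Finset.mul_sum]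
  simp

/-- barrier -/
def BU (a : ℝ) (y : V3) : ℝ := (y 0 + y 2) ^ a

lemma hp_sum {y : V3} (hy : y ∈ HP) : 0 < y 0 + y 2 := by have : 0 < y 2 + y 0 := hy; linarith

lemma BU_cd (a : ℝ) : ContDiffOn ℝ 2 (BU a) HP := by
  unfold BU
  refine ContDiffOn.rpow_const_of_ne (ContDiff.contDiffOn (by fun_prop)) fun y hy => (hp_sum hy).ne'

lemma dpw {c : ℝ} (hc : 0 < c) (a : ℝ) {g : ℝ → ℝ} (hg : ∀ s, g s = c + s) : HasDerivAt (fun s : ℝ => g s ^ a) (a * c ^ (a - 1)) 0 := by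
  have hgd : HasDerivAt g 1 0 := by
    have : g = fun s => c + s := funext hg
    rw [this]; simpa using (hasDerivAt_id (0:ℝ)).const_add c
  have := hgd.rpow_const (p := a) (Or.inl (by rw [hg]; linarith))
  simpa [hg] using this

lemma BU_lapl (a : ℝ) {y : V3} (hy : y ∈ HP) : lapl (BU a) y = 2 * (a * (a - 1) * (y 0 + y 2) ^ (a - 1 - 1)) := by
  rw [lapl_lines hp_open (BU_cd a) (g := fun i y => ![a * (y 0 + y 2) ^ (a - 1), 0, a * (y 0 + y 2) ^ (a - 1)] i)
    (h := fun i y => ![a * (a - 1) * (y 0 + y 2) ^ (a - 1 - 1), 0, a * (a - 1) * (y 0 + y 2) ^ (a - 1 - 1)] i) ?_ ?_ y hy]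
  · simp [Fin.sum_univ_three]; ring
  · intro i y hy
    fin_cases i
    · simpa [BU] using dpw (hp_sum hy) a (g := fun s => (y + s • ee 0) 0 + (y + s • ee 0) 2) (fun s => by simp [line0]; ring)
    · simpa [BU, line1] using hasDerivAt_const (0:ℝ) ((y 0 + y 2) ^ a)
    · simpa [BU] using dpw (hp_sum hy) a (g := fun s => (y + s • ee 2) 0 + (y + s • ee 2) 2) (fun s => by simp [line2]; ring)
  · intro i y hy
    fin_cases i
    · simpa [mul_assoc] using (dpw (hp_sum hy) (a-1) (g := fun s => (y + s • ee 0) 0 + (y + s • ee 0) 2) (fun s => by simp [line0]; ring)).const_mul a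
    · simpa using hasDerivAt_const (0:ℝ) (0:ℝ)
    · simpa [mul_assoc] using (dpw (hp_sum hy) (a-1) (g := fun s => (y + s • ee 2) 0 + (y + s • ee 2) 2) (fun s => by simp [line2]; ring)).const_mul a

/-- rotation derivative -/
def uU (b₀ : ℝ) (w : V3 → ℝ) (y : V3) : ℝ := y 0 * fderivWithin ℝ w (SQ b₀) y (ee 2) + (-1) * (y 2 * fderivWithin ℝ w (SQ b₀) y (ee 0)) + 0

lemma fdw_eq (hb : 0 < b₀) {y : V3} (hy : y ∈ wedgeQ b₀) : fderivWithin ℝ w (SQ b₀) y = fderiv ℝ w y := fderivWithin_of_mem_nhds (sq_nhds hb hy)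

lemma rx_coord (hb : 0 < b₀) {y : V3} (hy : y ∈ SQ b₀) : 0 ≤ y 0 ∧ y 0 ≤ rx y ∧ 0 ≤ y 2 ∧ y 2 ≤ rx y ∧ rx y ≤ y 0 + y 2 := by
  obtain ⟨y0, y1, y2⟩ := (mem_SQ hb).1 hy
  have e := rx_sq y
  have rn := rx_nonneg y
  refine ⟨y0, by nlinarith, y2.le, by nlinarith, by nlinarith [mul_nonneg y0 y2.le]⟩

lemma HW.fd_le (H : HW b₀ δ₀ C w) {y : V3} (hy : y ∈ SQ b₀) (i : Fin 3) : |fderivWithin ℝ w (SQ b₀) y (ee i)| ≤ C * min 1 (rx y ^ (δ₀ - 1)) := by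
  rw [← norm_eq_abs]
  refine (ContinuousLinearMap.le_opNorm _ _).trans ?_
  have : ‖(ee i : V3)‖ = 1 := by simp [ee]
  rw [this, mul_one]; exact H.grad y hy

lemma HW.lin_le (H : HW b₀ δ₀ C w) (hb : 0 < b₀) (hC : 0 ≤ C) {y : V3} (hy : y ∈ SQ b₀) (i j : Fin 3) {s : ℝ} (hs : |s| ≤ 1) :
    |y 0 * fderivWithin ℝ w (SQ b₀) y (ee i) + s * (y 2 * fderivWithin ℝ w (SQ b₀) y (ee j))| ≤ 2 * C * (rx y * min 1 (rx y ^ (δ₀ - 1))) := by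
  obtain ⟨a0, a1, a2, a3, -⟩ := rx_coord hb hy
  have h1 := H.fd_le hy i
  have h2 := H.fd_le hy j
  have rn := rx_nonneg y
  have m0 : 0 ≤ min 1 (rx y ^ (δ₀ - 1)) := by positivity
  refine (abs_add_le _ _).trans ?_
  rw [abs_mul, abs_mul, abs_mul, abs_of_nonneg a0, abs_of_nonneg a2]
  have t1 : y 0 * |fderivWithin ℝ w (SQ b₀) y (ee i)| ≤ rx y * (C * min 1 (rx y ^ (δ₀ - 1))) := by gcongr
  have t2 : |s| * (y 2 * |fderivWithin ℝ w (SQ b₀) y (ee j)|) ≤ 1 * (rx y * (C * min 1 (rx y ^ (δ₀ - 1)))) := by gcongr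
  linarith

lemma HW.u_cd (H : HW b₀ δ₀ C w) (hb : 0 < b₀) : ContDiffOn ℝ 2 (uU b₀ w) (SQ b₀) := by
  have h : ∀ i, ContDiffOn ℝ 2 (fun y => fderivWithin ℝ w (SQ b₀) y (ee i)) (SQ b₀) := fun i =>
    (H.cd.fderivWithin (sq_unique hb) (m := 2) (by norm_num)).clm_apply contDiffOn_const
  have hc : ∀ i : Fin 3, ContDiffOn ℝ 2 (fun y : V3 => y i) (SQ b₀) := fun i => ContDiff.contDiffOn (by fun_prop)
  exact (((hc 0).mul (h 2)).add (contDiffOn_const.mul ((hc 2).mul (h 0)))).add contDiffOn_const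

lemma HW.u_lapl (H : HW b₀ δ₀ C w) (hb : 0 < b₀) {y : V3} (hy : y ∈ wedgeQ b₀) : lapl (uU b₀ w) y = 0 := by
  have hU := wedge_open b₀
  have cw := H.cd.mono (wedge_sub hb)
  have c3 : ContDiffOn ℝ 3 w (wedgeQ b₀) := cw.of_le (by norm_num)
  have c2 : ∀ j, ContDiffAt ℝ 2 (fun y => fderiv ℝ w y (ee j)) y := fun j => (pd_cd hU (n := 3) (m := 2) c3 (by norm_num) j).contDiffAt (hU.mem_nhds hy)
  have hc : ∀ i : Fin 3, ContDiffAt ℝ 2 (fun y : V3 => y i) y := fun i => ContDiff.contDiffAt (by fun_prop)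
  have e : uU b₀ w =ᶠ[𝓝 y] fun y => (fun y : V3 => y 0 * fderiv ℝ w y (ee 2)) y + (-1) * (fun y : V3 => y 2 * fderiv ℝ w y (ee 0)) y + 0 := by
    filter_upwards [hU.mem_nhds hy] with z hz
    unfold uU; rw [fdw_eq hb hz]
  rw [lapl_congr e, lapl_comb ((hc 0).mul (c2 2)) ((hc 2).mul (c2 0)), lapl_coord (c2 2), lapl_coord (c2 0), harm_pd hU c3 H.lap hy, harm_pd hU c3 H.lap hy,
    pd_lapl_comm hU (cw.of_le (by norm_num)) hy 2 0]
  ring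

lemma HW.u_le (H : HW b₀ δ₀ C w) (hb : 0 < b₀) (hC : 0 ≤ C) (hδ₀0 : 0 < δ₀) (hδ₀1 : δ₀ < 1) {σ : ℝ} (hσ : |σ| ≤ 1) {x : V3} (hx : x ∈ SQ b₀) : σ * uU b₀ w x ≤ 0 := by
  by_contra hcon
  push Not at hcon
  obtain ⟨a, ha⟩ : ∃ a, a = (1 + δ₀) / 2 := ⟨_, rfl⟩
  have a0 : 0 < a := by linarith
  have a1 : a < 1 := by linarith
  have aδ : δ₀ < a := by linarith
  obtain ⟨p, hp⟩ : ∃ p : V3 → ℝ, p = fun y => (fun _ : V3 => (0:ℝ)) y + σ * uU b₀ w y + 0 := ⟨_, rfl⟩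
  have pv : ∀ y, p y = σ * uU b₀ w y := fun y => by rw [hp]; ring
  have Bx : 0 < BU a x := rpow_pos_of_pos (hp_sum (sq_HP hb hx)) _
  obtain ⟨ε, hε⟩ : ∃ ε, ε = p x / (2 * BU a x) := ⟨_, rfl⟩
  have px : 0 < p x := by rw [pv]; exact hcon
  have ε0 : 0 < ε := by rw [hε]; positivity
  have εx : ε * BU a x = p x / 2 := by rw [hε]; field_simp
  have pb : ∀ y ∈ SQ b₀, p y ≤ 2 * C * (rx y * min 1 (rx y ^ (δ₀ - 1))) := fun y hy => by
    have := H.lin_le hb hC hy 2 0 (s := -1) (by simp)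
    rw [pv]
    refine (le_abs_self _).trans ?_
    rw [abs_mul]
    have h2 : |uU b₀ w y| ≤ 2 * C * (rx y * min 1 (rx y ^ (δ₀ - 1))) := by unfold uU; rw [add_zero]; exact this
    nlinarith [abs_nonneg (uU b₀ w y), abs_nonneg σ]
  have Bl : ∀ y ∈ SQ b₀, rx y ^ a ≤ BU a y := fun y hy => rpow_le_rpow (rx_nonneg y) (rx_coord hb hy).2.2.2.2 a0.le
  obtain ⟨R, hR1, hR2, hR3⟩ : ∃ R : ℝ, 0 < R ∧ rx x ≤ R ∧ 2 * C * R ^ (-(a - δ₀)) < ε := by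
    have := (tendsto_rpow_neg_atTop (y := a - δ₀) (by linarith)).const_mul (2 * C)
    rw [mul_zero] at this
    exact ((eventually_gt_atTop (0:ℝ)).and ((eventually_ge_atTop (rx x)).and (this.eventually_lt_const ε0))).exists
  obtain ⟨r1, hr1, hr⟩ : ∃ r1 > 0, ∀ r : ℝ, 0 < r → r < r1 → 2 * C * r ^ (1 - a) < ε := by
    have : Tendsto (fun r : ℝ => 2 * C * r ^ (1 - a)) (𝓝 0) (𝓝 (2 * C * (0:ℝ) ^ (1 - a))) :=
      ((continuousAt_rpow_const 0 (1 - a) (Or.inr (by linarith))).tendsto).const_mul _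
    rw [zero_rpow (by linarith), mul_zero] at this
    obtain ⟨d, hd, h⟩ := Metric.eventually_nhds_iff.1 (this.eventually_lt_const ε0)
    exact ⟨d, hd, fun r h0 h1 => h (by rwa [Real.dist_eq, sub_zero, abs_of_pos h0])⟩
  have cdu := H.u_cd hb
  have cdp : ContDiffOn ℝ 2 p (SQ b₀) := by
    rw [hp]; exact (contDiffOn_const.add (contDiffOn_const.mul cdu)).add contDiffOn_const
  have cdB := (BU_cd a).mono (sq_HP hb)
  have cdΦ : ContDiffOn ℝ 2 (fun y => p y + (-ε) * BU a y + 0) (SQ b₀) :=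
    (cdp.add (contDiffOn_const.mul cdB)).add contDiffOn_const
  have key := no_max hb cdΦ (r1 := r1) (R := R) ?_ ?_ ?_ hr1 ?_ ?_ hx hR2
  · linarith
  · intro y hy
    have e1 : BU a (y + (2 * π) • ee 1) = BU a y := by simp [BU, line1]
    rw [e1, pv, pv]
    have : uU b₀ w (y + (2 * π) • ee 1) = uU b₀ w y := by
      unfold uU; rw [per_fderiv hb H.per hy]; simp [line1]
    rw [this]
  · intro y hy
    have nb := sq_nhds hb hy
    have hyP := sq_HP hb (wedge_sub hb hy)
    have l0 : lapl (fun _ : V3 => (0:ℝ)) y = 0 := by simp [lapl]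
    rw [lapl_comb (cdp.contDiffAt nb) (cdB.contDiffAt nb), BU_lapl a hyP, hp, lapl_comb contDiffAt_const (cdu.contDiffAt nb), H.u_lapl hb hy, l0]
    have s : 0 < (y 0 + y 2) ^ (a - 1 - 1) := rpow_pos_of_pos (hp_sum hyP) _
    have : 0 < ε * (a * (1 - a)) * (y 0 + y 2) ^ (a - 1 - 1) := mul_pos (mul_pos ε0 (mul_pos a0 (by linarith))) s
    linarith
  · intro y hy hyw
    left
    have B0 : 0 ≤ ε * BU a y := mul_nonneg ε0.le (rpow_pos_of_pos (hp_sum (sq_HP hb hy)) _).le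
    obtain ⟨y0, y1, y2⟩ := (mem_SQ hb).1 hy
    have : uU b₀ w y = 0 := by
      unfold uU
      rcases y0.eq_or_lt with h0 | h0
      · rw [H.n2 y hy h0.symm, ← h0]; ring
      · have hf : y 2 = b₀ * y 0 := by
          by_contra hne
          exact hyw ⟨h0, lt_of_le_of_ne y1 (Ne.symm hne)⟩
        have n1 := H.n1 y hy hf
        rw [hf]; linear_combination (-(y 0)) * n1
    rw [pv, this]; linarith
  · intro y hy hy1
    have r0 := hp_rx (sq_HP hb hy)
    have h1 := hr _ r0 hy1
    have h2 := pb y hy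
    have h3 := Bl y hy
    have e : rx y = rx y ^ (1 - a) * rx y ^ a := by rw [← rpow_add r0]; simp
    have h4 : 2 * C * (rx y * min 1 (rx y ^ (δ₀ - 1))) ≤ 2 * C * (rx y * 1) := by gcongr; exact min_le_left _ _
    have h5 : 2 * C * (rx y * 1) ≤ ε * rx y ^ a := by
      rw [mul_one]; conv_lhs => rw [e]
      rw [← mul_assoc]; gcongr
    have h6 : ε * rx y ^ a ≤ ε * BU a y := by gcongr
    linarith
  · intro y hy hy1
    have r0 := hp_rx (sq_HP hb hy)
    have h2 := pb y hy
    have h3 := Bl y hy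
    rw [← hy1] at hR3
    have e : rx y * rx y ^ (δ₀ - 1) = rx y ^ (-(a - δ₀)) * rx y ^ a := by
      rw [← rpow_add r0, ← rpow_one_add' r0.le (by linarith)]; ring_nf
    have h4 : 2 * C * (rx y * min 1 (rx y ^ (δ₀ - 1))) ≤ 2 * C * (rx y * rx y ^ (δ₀ - 1)) := by gcongr; exact min_le_right _ _
    have h5 : 2 * C * (rx y * rx y ^ (δ₀ - 1)) ≤ ε * rx y ^ a := by
      rw [e, ← mul_assoc]; gcongr
    have h6 : ε * rx y ^ a ≤ ε * BU a y := by gcongr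
    linarith

lemma HW.u_zero (H : HW b₀ δ₀ C w) (hb : 0 < b₀) (hC : 0 ≤ C) (hδ₀0 : 0 < δ₀) (hδ₀1 : δ₀ < 1) {x : V3} (hx : x ∈ SQ b₀) : uU b₀ w x = 0 := by
  have h1 := H.u_le hb hC hδ₀0 hδ₀1 (σ := 1) (by simp) hx
  have h2 := H.u_le hb hC hδ₀0 hδ₀1 (σ := -1) (by simp) hx
  linarith

end

section
variable {b₀ δ₀ C : ℝ} {w : V3 → ℝ}

lemma wedge_convex (b₀ : ℝ) : Convex ℝ (wedgeQ b₀) := by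
  intro x hx y hy s t hs ht hst
  have h1 : 0 < x 0 ∧ b₀ * x 0 < x 2 := hx
  have h2 : 0 < y 0 ∧ b₀ * y 0 < y 2 := hy
  have key : ∀ a b : ℝ, 0 < a → 0 < b → 0 < s * a + t * b := fun a b ha hb => by
    rcases hs.eq_or_lt with h | h
    · have : t = 1 := by linarith
      rw [← h, this]; linarith
    · have := mul_pos h ha
      have := mul_nonneg ht hb.le
      linarith
  have e0 : (s • x + t • y) 0 = s * x 0 + t * y 0 := by simp
  have e2 : (s • x + t • y) 2 = s * x 2 + t * y 2 := by simp
  refine ⟨?_, ?_⟩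
  · rw [e0]; exact key _ _ h1.1 h2.1
  · rw [e0, e2]
    have := key (x 2 - b₀ * x 0) (y 2 - b₀ * y 0) (by linarith [h1.2]) (by linarith [h2.2])
    linarith

lemma wedge_const {g : V3 → ℝ} (hg : ∀ y ∈ wedgeQ b₀, DifferentiableAt ℝ g y) (h : ∀ y ∈ wedgeQ b₀, ∀ i, fderiv ℝ g y (ee i) = 0)
    {c : ℝ} (hlim : Tendsto (fun s : ℝ => g (gam b₀ 0 s)) (𝓝[>] 0) (𝓝 c)) {y : V3} (hy : y ∈ wedgeQ b₀) : g y = c := by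
  have z : ∀ s : ℝ, 0 < s → g (gam b₀ 0 s) = g y := fun s hs =>
    (wedge_open b₀).is_const_of_fderiv_eq_zero (wedge_convex b₀).isPreconnected (fun y hy => (hg y hy).differentiableWithinAt) (fun y hy => by
      rw [clm_eq_sum (fderiv ℝ g y)]; simp [h y hy]) (gam_mem (by simp) (by simp) hs) hy
  have : Tendsto (fun s : ℝ => g (gam b₀ 0 s)) (𝓝[>] 0) (𝓝 (g y)) := by
    refine tendsto_const_nhds.congr' ?_
    filter_upwards [self_mem_nhdsWithin] with s hs using (z s hs).symm
  exact tendsto_nhds_unique this hlim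

lemma gam_zero_tendsto (b₀ : ℝ) : Tendsto (gam b₀ 0) (𝓝[>] 0) (𝓝 0) := by
  have := ((gam_cont b₀ 0).tendsto 0).mono_left (nhdsWithin_le_nhds (s := Ioi 0))
  rwa [gam_zero] at this

lemma HW.zero (H : HW b₀ δ₀ C w) (hb : 0 < b₀) (hC : 0 ≤ C) (hδ₀0 : 0 < δ₀) (hδ₀1 : δ₀ < 1) (hlim : Tendsto w (𝓝[SQ b₀] (0 : V3)) (𝓝 0))
    {x : V3} (hx : x ∈ SQ b₀) : w x = 0 := by
  have hU := wedge_open b₀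
  have cw := H.cd.mono (wedge_sub hb)
  have c3 : ContDiffOn ℝ 3 w (wedgeQ b₀) := cw.of_le (by norm_num)
  have c2w : ContDiffOn ℝ 2 w (wedgeQ b₀) := cw.of_le (by norm_num)
  have d : ∀ j, ∀ y ∈ wedgeQ b₀, DifferentiableAt ℝ (fun y => fderiv ℝ w y (ee j)) y := fun j y hy =>
    ((pd_cd hU (n := 3) (m := 2) c3 (by norm_num) j).contDiffAt (hU.mem_nhds hy)).differentiableAt (by norm_num)
  have dc : ∀ k j, ∀ y ∈ wedgeQ b₀, DifferentiableAt ℝ (fun y : V3 => y k * fderiv ℝ w y (ee j)) y := fun k j y hy =>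
    (EuclideanSpace.proj k : V3 →L[ℝ] ℝ).differentiableAt.mul (d j y hy)
  have u0 : ∀ y ∈ wedgeQ b₀, y 0 * fderiv ℝ w y (ee 2) = y 2 * fderiv ℝ w y (ee 0) := fun y hy => by
    have := H.u_zero hb hC hδ₀0 hδ₀1 (wedge_sub hb hy)
    unfold uU at this
    rw [fdw_eq hb hy] at this; linarith
  have tg := gam_zero_tendsto b₀
  have tgS : Tendsto (gam b₀ 0) (𝓝[>] 0) (𝓝[SQ b₀] 0) := tendsto_nhdsWithin_iff.2 ⟨tg, by
    filter_upwards [self_mem_nhdsWithin] with s hs using wedge_sub hb (gam_mem (by simp) (by simp) hs)⟩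
  have W1 : ∀ y ∈ wedgeQ b₀, fderiv ℝ w y (ee 1) = 0 := fun y hy => H.zconst hb hC hδ₀1 hy
  have W1d : ∀ y ∈ wedgeQ b₀, ∀ i, fderiv ℝ (fun z => fderiv ℝ w z (ee 1)) y (ee i) = 0 := fun y hy i => by
    have : (fun z => fderiv ℝ w z (ee 1)) =ᶠ[𝓝 y] fun _ => 0 := by filter_upwards [hU.mem_nhds hy] with z hz using W1 z hz
    rw [this.fderiv_eq]; simp
  have q0 : ∀ y ∈ wedgeQ b₀, y 0 * fderiv ℝ w y (ee 0) + y 2 * fderiv ℝ w y (ee 2) = 0 := fun y hy => by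
    refine wedge_const (g := fun y => y 0 * fderiv ℝ w y (ee 0) + y 2 * fderiv ℝ w y (ee 2)) (fun y hy => (dc 0 0 y hy).add (dc 2 2 y hy)) (fun y hy i => ?_) ?_ hy
    · have ud : ∀ i, fderiv ℝ (fun y : V3 => y 0 * fderiv ℝ w y (ee 2)) y (ee i) = fderiv ℝ (fun y : V3 => y 2 * fderiv ℝ w y (ee 0)) y (ee i) := fun i => by
        have : (fun y : V3 => y 0 * fderiv ℝ w y (ee 2)) =ᶠ[𝓝 y] fun y : V3 => y 2 * fderiv ℝ w y (ee 0) := by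
          filter_upwards [hU.mem_nhds hy] with z hz using u0 z hz
        rw [this.fderiv_eq]
      have ud0 := ud 0
      have ud2 := ud 2
      rw [coord_fd (d 2 y hy), coord_fd (d 0 y hy)] at ud0 ud2
      have L := H.lap y hy
      unfold lapl at L
      rw [Fin.sum_univ_three, W1d y hy 1] at L
      have s02 := pd_lapl_comm hU c2w hy 0 2
      have s01 := pd_lapl_comm hU c2w hy 0 1
      have s21 := pd_lapl_comm hU c2w hy 2 1
      rw [W1d y hy] at s01 s21
      rw [fderiv_fun_add (dc 0 0 y hy) (dc 2 2 y hy), add_apply, coord_fd (d 0 y hy), coord_fd (d 2 y hy)]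
      fin_cases i
      · simp at ud2 ⊢
        linear_combination y 0 * L - ud2 - y 2 * s02
      · simp
        rw [s01, s21]; simp
      · simp at ud0 ⊢
        linear_combination y 2 * L + ud0 + y 0 * s02
    · have tr : Tendsto (fun s => 2 * C * (rx (gam b₀ 0 s))) (𝓝[>] 0) (𝓝 0) := by
        have := ((rx_cont.tendsto 0).comp tg).const_mul (2 * C)
        simpa [rx] using this
      refine squeeze_zero_norm' ?_ tr
      filter_upwards [self_mem_nhdsWithin] with s hs
      have hm : gam b₀ 0 s ∈ wedgeQ b₀ := gam_mem (by simp) (by simp) hs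
      have := H.lin_le hb hC (wedge_sub hb hm) 0 2 (s := 1) (by simp)
      rw [fdw_eq hb hm, one_mul] at this
      refine this.trans ?_
      have r0 := rx_nonneg (gam b₀ 0 s)
      have : rx (gam b₀ 0 s) * min 1 (rx (gam b₀ 0 s) ^ (δ₀ - 1)) ≤ rx (gam b₀ 0 s) * 1 := by gcongr; exact min_le_left _ _
      rw [mul_one] at this
      gcongr
  have wz : ∀ y ∈ wedgeQ b₀, w y = 0 := fun y hy => by
    refine wedge_const (fun y hy => (c3.contDiffAt (hU.mem_nhds hy)).differentiableAt (by norm_num)) (fun y hy i => ?_) (hlim.comp tgS) hy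
    have a := q0 y hy
    have b := u0 y hy
    have r := hp_pos (sq_HP hb (wedge_sub hb hy))
    fin_cases i
    · have : (y 0 ^ 2 + y 2 ^ 2) * fderiv ℝ w y (ee 0) = 0 := by linear_combination y 0 * a - y 2 * b
      exact (mul_eq_zero.1 this).resolve_left r.ne'
    · exact W1 y hy
    · have : (y 0 ^ 2 + y 2 ^ 2) * fderiv ℝ w y (ee 2) = 0 := by linear_combination y 2 * a + y 0 * b
      exact (mul_eq_zero.1 this).resolve_left r.ne'
  obtain ⟨x0, x2, x3⟩ := (mem_SQ hb).1 hx
  have t := (H.cd.continuousOn x hx).tendsto.comp (gam_tendsto hb hx)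
  refine tendsto_nhds_unique t (tendsto_const_nhds.congr' ?_)
  filter_upwards [self_mem_nhdsWithin] with s hs using (wz _ (gam_mem x0 x2 hs)).symm

theorem uniqueness {α δ : ℝ} (hb : 0 < b₀) (hδ0 : 0 < δ) (hδ₀0 : 0 < δ₀) (hδ₀1 : δ₀ < 1) {f v₁ v₂ : V3 → ℝ} (h1 : memH (SQ b₀) 6 α (-1 - δ) (-δ₀) (wedgeQ b₀) v₁)
    (s1 : IsWedgeSolution b₀ f v₁) (h2 : memH (SQ b₀) 6 α (-1 - δ) (-δ₀) (wedgeQ b₀) v₂) (s2 : IsWedgeSolution b₀ f v₂) : EqOn v₁ v₂ (SQ b₀) := by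
  obtain ⟨C, hC, H⟩ := HW_of hb hδ0 hδ₀1 h1 s1 h2 s2
  have t : Tendsto (fun y => v₁ y + -1 * v₂ y + 0) (𝓝[SQ b₀] (0 : V3)) (𝓝 0) := by
    have := (s1.2.2.2.2.1.add (s2.2.2.2.2.1.const_mul (-1))).add_const 0
    simpa using this
  intro x hx
  have := H.zero hb hC hδ₀0 hδ₀1 t hx
  linarith

end

end

/-- Lemma 6.1 together with §5: the boundary value problem (4.3) in the unbounded wedge `Q`
has exactly one solution in the weighted Hölder space `H^{(−1−δ,−δ₀)}_{6,α}(Q)`. -/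
theorem stmt15 (b₀ α δ δ₀ : ℝ) (hb₀ : 0 < b₀) (hα0 : 0 < α) (hα1 : α < 1)
    (hδ0 : 0 < δ) (hδ1 : δ < 1) (hδ₀0 : 0 < δ₀) (hδ₀1 : δ₀ < 1)
    (f : V3 → ℝ)
    (hf : memH (SQ b₀) 4 α (1 - δ) (2 - δ₀) (wedgeQ b₀) f)
    (hfper : Per2On (closure (wedgeQ b₀)) f) :
    (∃ v : V3 → ℝ, memH (SQ b₀) 6 α (-1 - δ) (-δ₀) (wedgeQ b₀) v ∧
        IsWedgeSolution b₀ f v) ∧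
    (∀ v₁ v₂ : V3 → ℝ,
        memH (SQ b₀) 6 α (-1 - δ) (-δ₀) (wedgeQ b₀) v₁ → IsWedgeSolution b₀ f v₁ →
        memH (SQ b₀) 6 α (-1 - δ) (-δ₀) (wedgeQ b₀) v₂ → IsWedgeSolution b₀ f v₂ →
        Set.EqOn v₁ v₂ (SQ b₀)) := by
  exact ⟨existence hb₀ hα0 hα1 hδ0 hδ1 hδ₀0 hδ₀1 hf hfper,
    fun _ _ h1 s1 h2 s2 => uniqueness hb₀ hδ0 hδ₀0 hδ₀1 h1 s1 h2 s2⟩
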